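/- Suppose conditions (★) hold, and in addition x_1 = x_2 = ⋯ = x_n = x (so X is regular of degree x, which forces x = O(n^{2ε})). Then, as n → ∞: num(d,X) = exp( 1/4 + λx²/(4(1−λ)) − K/(2An²) − R²/(16A²n⁴) + O(n^{−b}) ); miss(d,X) = exp( −λx(x−2)/(4(1−λ)) − xR/(2(1−λ)²n²) − K/(2An²) + O(n^{−b}) ); and hit(d,X) = exp( −(1−λ)x(x−2)/(4λ) − xR/(2λ²n²) − K/(2An²) + O(n^{−b}) ). -/

import Mathlib

open Filter Finset Asymptotics MeasureTheory
open scoped Classical Topology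

noncomputable section

/-- The number of simple graphs on `Fin n` with degree sequence `d` having
no edge in common with the graph `X`. -/
def gCount {n : ℕ} (d : Fin n → ℕ) (X : SimpleGraph (Fin n)) : ℕ :=
  Nat.card {H : SimpleGraph (Fin n) //
    (∀ v, Nat.card (H.neighborSet v) = d v) ∧ Disjoint H.edgeSet X.edgeSet}

/-- The degree `x_j` of vertex `j` in the graph `X`. -/
def xDeg {n : ℕ} (X : SimpleGraph (Fin n)) (j : Fin n) : ℕ :=
  Nat.card (X.neighborSet j)

/-- The number of edges of `X`. -/
def xEdges {n : ℕ} (X : SimpleGraph (Fin n)) : ℕ := Nat.card X.edgeSet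

/-- The average degree `d̄ = 2E/n`. -/
def dBar {n : ℕ} (d : Fin n → ℕ) : ℝ := (∑ j, (d j : ℝ)) / n

/-- The density `λ = d̄/(n-1)`. -/
def lamb {n : ℕ} (d : Fin n → ℕ) : ℝ := dBar d / ((n : ℝ) - 1)

/-- `A = λ(1-λ)/2`. -/
def aPar {n : ℕ} (d : Fin n → ℕ) : ℝ := lamb d * (1 - lamb d) / 2

/-- `δ_j = d_j - d̄ + λ x_j`. -/
def deltaPar {n : ℕ} (d : Fin n → ℕ) (X : SimpleGraph (Fin n)) (j : Fin n) : ℝ :=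
  (d j : ℝ) - dBar d + lamb d * (xDeg X j : ℝ)

/-- The sum over unordered pairs `{j,k}` with `X.Adj j k` of `f j * f k`. -/
def pairSum {n : ℕ} (X : SimpleGraph (Fin n)) (f : Fin n → ℝ) : ℝ :=
  (∑ j, ∑ k, if X.Adj j k then f j * f k else 0) / 2

/-- `R = Σ_j (d_j - d̄)²`. -/
def rPar {n : ℕ} (d : Fin n → ℕ) : ℝ := ∑ j, ((d j : ℝ) - dBar d)^2

/-- The naive estimate `Ĝ(d,X)`. -/
def gHat {n : ℕ} (d : Fin n → ℕ) (X : SimpleGraph (Fin n)) : ℝ :=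
  (1 - lamb d) ^ (-(xEdges X : ℝ)) *
  (lamb d ^ lamb d * (1 - lamb d) ^ (1 - lamb d)) ^ n.choose 2 *
  ∏ j, ((n - 1 - xDeg X j).choose (d j) : ℝ)

/-- `X_ℓ = Σ_j x_j^ℓ`. -/
def xPow {n : ℕ} (X : SimpleGraph (Fin n)) (ℓ : ℕ) : ℝ := ∑ j, (xDeg X j : ℝ)^ℓ

/-- `C_{ℓ,m} = Σ_j δ_j^ℓ x_j^m`. -/
def cPar {n : ℕ} (d : Fin n → ℕ) (X : SimpleGraph (Fin n)) (ℓ m : ℕ) : ℝ :=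
  ∑ j, (deltaPar d X j)^ℓ * (xDeg X j : ℝ)^m

/-- `miss(d,X) = G(d,X) / ((1-λ)^X G(d))`. -/
def missPar {n : ℕ} (d : Fin n → ℕ) (X : SimpleGraph (Fin n)) : ℝ :=
  (gCount d X : ℝ) / ((1 - lamb d) ^ xEdges X * (gCount d ⊥ : ℝ))

/-- `hit(d,X) = G(d-x,X) / (λ^X G(d))`. -/
def hitPar {n : ℕ} (d : Fin n → ℕ) (X : SimpleGraph (Fin n)) : ℝ :=
  (gCount (fun j => d j - xDeg X j) X : ℝ) / (lamb d ^ xEdges X * (gCount d ⊥ : ℝ))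

/-- `num(d,X) = G(d,X) / (√2 Ĝ(d,X))`, the exponential factor in the main theorem. -/
def numPar {n : ℕ} (d : Fin n → ℕ) (X : SimpleGraph (Fin n)) : ℝ :=
  (gCount d X : ℝ) / (Real.sqrt 2 * gHat d X)

/-- Indicator that the edge `e` belongs to the edge set `F`. -/
def ind {n : ℕ} (F : Finset (Sym2 (Fin n))) (e : Sym2 (Fin n)) : ℝ := if e ∈ F then 1 else 0

/-- The degree of `v` in the edge set `F`, as a real number. -/
def dg {n : ℕ} (F : Finset (Sym2 (Fin n))) (v : Fin n) : ℝ := ∑ u, ind F s(v, u)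

/-- The edge sets inside `Y` whose degree sequence is `d`. -/
def gr {n : ℕ} (d : Fin n → ℝ) (Y : Finset (Sym2 (Fin n))) : Finset (Finset (Sym2 (Fin n))) :=
  Y.powerset.filter (fun F => dg F = d)

/-- The number of edge sets inside `Y` whose degree sequence is `d`. -/
def nn {n : ℕ} (d : Fin n → ℝ) (Y : Finset (Sym2 (Fin n))) : ℝ := (gr d Y).card

/-- The unit vector at `a`. -/
def ev {n : ℕ} (a : Fin n) : Fin n → ℝ := fun v => if v = a then 1 else 0

/-- `Y` contains no loop. -/
def loopless {n : ℕ} (Y : Finset (Sym2 (Fin n))) : Prop := ∀ v, s(v, v) ∉ Y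

section graphs

variable {n : ℕ} {F G Y Z : Finset (Sym2 (Fin n))} {d : Fin n → ℝ} {a b u v w : Fin n}
  {e f : Sym2 (Fin n)}

lemma ind_of_mem (h : e ∈ F) : ind F e = 1 := if_pos h

lemma ind_of_notMem (h : e ∉ F) : ind F e = 0 := if_neg h

lemma ind_nonneg : 0 ≤ ind F e := by unfold ind; split_ifs <;> norm_num

lemma ind_le_one : ind F e ≤ 1 := by unfold ind; split_ifs <;> norm_num

lemma ind_eq_zero_or_one : ind F e = 0 ∨ ind F e = 1 := by unfold ind; split_ifs <;> simp

lemma ind_comm : ind F s(u, v) = ind F s(v, u) := by rw [Sym2.eq_swap]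

lemma ind_insert_self : ind (insert e F) e = 1 := ind_of_mem (by simp)

lemma ind_insert_of_ne (h : f ≠ e) : ind (insert e F) f = ind F f := by simp [ind, h]

lemma ind_le_of_subset (h : F ⊆ G) : ind F e ≤ ind G e := by
  unfold ind
  by_cases h1 : e ∈ F
  · simp [h1, h h1]
  · simp only [h1, if_false]; split_ifs <;> norm_num

lemma ind_union (h : Disjoint F G) : ind (F ∪ G) e = ind F e + ind G e := by
  unfold ind
  by_cases h1 : e ∈ F
  · have h2 : e ∉ G := Finset.disjoint_left.1 h h1
    simp [h1, h2]
  · simp [h1]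

lemma ind_sdiff (h : F ⊆ Y) : ind (Y \ F) e = ind Y e - ind F e := by
  unfold ind
  by_cases h1 : e ∈ F
  · simp [h1, h h1]
  · simp [h1]

lemma dg_union (h : Disjoint F G) : dg (F ∪ G) = dg F + dg G := by
  funext v; simp [dg, ind_union h, Finset.sum_add_distrib]

lemma dg_sdiff (h : F ⊆ Y) : dg (Y \ F) = dg Y - dg F := by
  funext v; simp [dg, ind_sdiff h, Finset.sum_sub_distrib]

lemma dg_singleton (h : a ≠ b) : dg {s(a, b)} = ev a + ev b := by
  funext v
  have : ∀ u, ind {s(a, b)} s(v, u)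
      = (if v = a then (if u = b then (1:ℝ) else 0) else 0)
        + (if v = b then (if u = a then (1:ℝ) else 0) else 0) := by
    intro u
    simp only [ind, Finset.mem_singleton, Sym2.eq_iff]
    by_cases h1 : v = a
    · have h2 : v ≠ b := fun h2 => h (h1.symm.trans h2)
      simp [h1, h]
    · simp [h1, ← ite_and]
  simp only [dg, this, Finset.sum_add_distrib, ev, Pi.add_apply]
  by_cases h1 : v = a <;> by_cases h2 : v = b <;> simp [h1, h2]

lemma dg_insert (h : a ≠ b) (hF : s(a, b) ∉ F) : dg (insert s(a, b) F) = dg F + ev a + ev b := by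
  rw [Finset.insert_eq, dg_union (by simpa using hF), dg_singleton h]
  funext v; simp; ring

lemma mem_gr : F ∈ gr d Y ↔ F ⊆ Y ∧ dg F = d := by simp [gr]

lemma dg_of_mem_gr (h : F ∈ gr d Y) (v : Fin n) : ∑ u, ind F s(v, u) = d v := by
  rw [← (mem_gr.1 h).2]; rfl

lemma ind_eq_zero_of_mem_gr (h : F ∈ gr d Y) (he : e ∉ Y) : ind F e = 0 :=
  ind_of_notMem fun h1 => he ((mem_gr.1 h).1 h1)

lemma nn_nonneg : 0 ≤ nn d Y := Nat.cast_nonneg _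

lemma nn_eq_sum : nn d Y = ∑ F ∈ gr d Y, (1 : ℝ) := by simp [nn]

lemma loopless.ne (h : loopless Y) (hab : s(a, b) ∈ Y) : a ≠ b := by
  rintro rfl; exact h a hab

lemma loopless.mono (h : loopless Y) (hZ : Z ⊆ Y) : loopless Z := fun v hv => h v (hZ hv)

/-- Conditioning on the part of the graph inside `Z`. -/
lemma sum_filter_inter (hZ : Z ⊆ Y) {Z₁ : Finset (Sym2 (Fin n))} (hZ₁ : Z₁ ⊆ Z)
    (φ : Finset (Sym2 (Fin n)) → ℝ) :
    ∑ F ∈ gr d Y with F ∩ Z = Z₁, φ F = ∑ F ∈ gr (d - dg Z₁) (Y \ Z), φ (F ∪ Z₁) := by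
  refine Finset.sum_bij' (fun F _ => F \ Z) (fun F _ => F ∪ Z₁) ?_ ?_ ?_ ?_ ?_
  · intro F hF
    rw [Finset.mem_filter, mem_gr] at hF
    obtain ⟨⟨h1, h2⟩, h3⟩ := hF
    rw [mem_gr]
    refine ⟨Finset.sdiff_subset_sdiff h1 le_rfl, ?_⟩
    rw [← h2, ← h3, ← dg_sdiff Finset.inter_subset_left, Finset.sdiff_inter_self_left]
  · intro F hF
    rw [mem_gr] at hF
    obtain ⟨h1, h2⟩ := hF
    have hd : Disjoint F Z := Finset.disjoint_of_subset_left h1 Finset.sdiff_disjoint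
    rw [Finset.mem_filter, mem_gr]
    refine ⟨⟨Finset.union_subset (h1.trans Finset.sdiff_subset) (hZ₁.trans hZ), ?_⟩, ?_⟩
    · rw [dg_union (Finset.disjoint_of_subset_right hZ₁ hd), h2]; simp
    · rw [Finset.union_inter_distrib_right, Finset.disjoint_iff_inter_eq_empty.1 hd,
        Finset.inter_eq_left.2 hZ₁, Finset.empty_union]
  · intro F hF
    rw [Finset.mem_filter] at hF
    simp only [← hF.2]
    rw [Finset.sdiff_union_inter]
  · intro F hF
    rw [mem_gr] at hF
    have hd : Disjoint F Z := Finset.disjoint_of_subset_left hF.1 Finset.sdiff_disjoint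
    rw [Finset.union_sdiff_distrib, Finset.sdiff_eq_self_of_disjoint hd,
      Finset.sdiff_eq_empty_iff_subset.2 hZ₁, Finset.union_empty]
  · intro F hF
    rw [Finset.mem_filter] at hF
    simp only [← hF.2]
    rw [Finset.sdiff_union_inter]

/-- Conditioning on the presence of an edge. -/
lemma sum_ind_mul (hab : a ≠ b) (he : s(a, b) ∈ Y) (φ : Finset (Sym2 (Fin n)) → ℝ) :
    ∑ F ∈ gr d Y, ind F s(a, b) * φ F
      = ∑ F ∈ gr (d - ev a - ev b) (Y.erase s(a, b)), φ (insert s(a, b) F) := by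
  have h := sum_filter_inter (d := d) (Y := Y) (Z := {s(a, b)}) (by simpa using he)
    (Finset.Subset.refl {s(a, b)}) φ
  rw [dg_singleton hab, ← sub_sub] at h
  rw [Finset.sdiff_singleton_eq_erase] at h
  simp only [Finset.union_singleton] at h
  rw [← h, Finset.sum_filter]
  refine Finset.sum_congr rfl fun F _ => ?_
  by_cases h1 : s(a, b) ∈ F
  · simp [ind, h1]
  · simp [ind, h1]

/-- Conditioning on the absence of an edge. -/
lemma sum_one_sub_ind_mul (he : e ∈ Y) (φ : Finset (Sym2 (Fin n)) → ℝ) :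
    ∑ F ∈ gr d Y, (1 - ind F e) * φ F = ∑ F ∈ gr d (Y.erase e), φ F := by
  have h := sum_filter_inter (d := d) (Y := Y) (Z := {e}) (by simpa using he)
    (Finset.empty_subset _) φ
  have h0 : dg (∅ : Finset (Sym2 (Fin n))) = 0 := by funext v; simp [dg, ind]
  rw [Finset.sdiff_singleton_eq_erase, h0, sub_zero] at h
  simp only [Finset.union_empty] at h
  rw [← h, Finset.sum_filter]
  refine Finset.sum_congr rfl fun F _ => ?_
  by_cases h1 : e ∈ F
  · simp [ind, h1]
  · simp [ind, h1]

lemma sum_ind (hab : a ≠ b) (he : s(a, b) ∈ Y) :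
    ∑ F ∈ gr d Y, ind F s(a, b) = nn (d - ev a - ev b) (Y.erase s(a, b)) := by
  have := sum_ind_mul (d := d) hab he (fun _ => 1)
  simpa [nn] using this

lemma sum_one_sub_ind (he : e ∈ Y) :
    ∑ F ∈ gr d Y, (1 - ind F e) = nn d (Y.erase e) := by
  have := sum_one_sub_ind_mul (d := d) he (fun _ => 1)
  simpa [nn] using this

/-- Complementation inside `Y`. -/
lemma sum_gr_compl (φ : Finset (Sym2 (Fin n)) → ℝ) :
    ∑ F ∈ gr d Y, φ F = ∑ F ∈ gr (dg Y - d) Y, φ (Y \ F) := by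
  refine Finset.sum_bij' (fun F _ => Y \ F) (fun F _ => Y \ F) ?_ ?_ ?_ ?_ ?_
  · intro F hF
    rw [mem_gr] at hF ⊢
    exact ⟨Finset.sdiff_subset, by rw [dg_sdiff hF.1, hF.2]⟩
  · intro F hF
    rw [mem_gr] at hF ⊢
    exact ⟨Finset.sdiff_subset, by rw [dg_sdiff hF.1, hF.2]; simp⟩
  · intro F hF; exact Finset.sdiff_sdiff_eq_self (mem_gr.1 hF).1
  · intro F hF; exact Finset.sdiff_sdiff_eq_self (mem_gr.1 hF).1
  · intro F hF; rw [Finset.sdiff_sdiff_eq_self (mem_gr.1 hF).1]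

lemma nn_compl : nn d Y = nn (dg Y - d) Y := by
  have := sum_gr_compl (d := d) (Y := Y) (fun _ => 1)
  simpa [nn] using this

end graphs

section crude

variable {n : ℕ} {F G Y Z : Finset (Sym2 (Fin n))} {d : Fin n → ℝ} {a b u v w : Fin n}
  {e f : Sym2 (Fin n)}

/-- Switching the edges `R` into the edges `S ∋ e` injects graphs into graphs containing `e`. -/
lemma switch_le {R S : Finset (Sym2 (Fin n))} (φ : Finset (Sym2 (Fin n)) → ℝ)
    (h1 : ∀ F, φ F ≤ 1) (h2 : ∀ F ∈ gr d Y, φ F ≠ 0 → R ⊆ F ∧ S ⊆ Y \ F ∧ dg R = dg S ∧ e ∈ S) :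
    ∑ F ∈ gr d Y, φ F ≤ ∑ F ∈ gr d Y, ind F e := by
  have hl : ∑ F ∈ gr d Y, φ F ≤ ((gr d Y).filter (fun F => φ F ≠ 0)).card := by
    rw [← Finset.sum_filter_ne_zero]
    calc _ ≤ ∑ F ∈ gr d Y with φ F ≠ 0, (1:ℝ) := Finset.sum_le_sum fun F _ => h1 F
      _ = _ := by simp
  have hr : ∑ F ∈ gr d Y, ind F e = ((gr d Y).filter (fun F => e ∈ F)).card := by
    simp [ind]
  rw [hr]
  refine hl.trans ?_
  norm_cast
  refine Finset.card_le_card_of_injOn (fun F => (F \ R) ∪ S) ?_ ?_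
  · intro F hF
    simp only [Finset.coe_filter, Set.mem_ofPred_eq] at hF
    obtain ⟨hF, h0⟩ := hF
    obtain ⟨hR, hS, hdg, heS⟩ := h2 F hF h0
    rw [mem_gr] at hF
    simp only [Finset.coe_filter, Set.mem_ofPred_eq, mem_gr]
    have hd : Disjoint (F \ R) S := by
      refine Finset.disjoint_of_subset_left Finset.sdiff_subset ?_
      exact (Finset.disjoint_of_subset_left hS Finset.sdiff_disjoint).symm
    refine ⟨⟨Finset.union_subset (Finset.sdiff_subset.trans hF.1) (hS.trans Finset.sdiff_subset),
      ?_⟩, Finset.mem_union_right _ heS⟩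
    rw [dg_union hd, dg_sdiff hR, hdg, hF.2]; simp
  · intro F hF F' hF' h
    simp only [Finset.coe_filter, Set.mem_ofPred_eq] at hF hF'
    obtain ⟨hR, hS, -⟩ := h2 F hF.1 hF.2
    obtain ⟨hR', hS', -⟩ := h2 F' hF'.1 hF'.2
    have key : ∀ F : Finset (Sym2 (Fin n)), R ⊆ F → S ⊆ Y \ F → (F \ R ∪ S) \ S ∪ R = F := by
      intro F hR hS
      ext x
      have h3 := @hR x
      have h4 := @hS x
      simp only [Finset.mem_union, Finset.mem_sdiff] at h4 ⊢
      tauto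
    rw [← key F hR hS, ← key F' hR' hS']
    simp only at h
    rw [h]

lemma path_count_aux (A : Fin n → Fin n → ℝ) (hs : ∀ u v, A u v = A v u)
    (v a : Fin n) :
    ∑ e, ∑ w, (1 - A v e) * A e w * A w a
      = ∑ w, A w a * (∑ u, A w u) - (∑ u, A v u) * (∑ u, A a u)
        + ∑ b, ∑ w, A v b * (1 - A b w) * A w a := by
  have h1 : ∑ w, A w a * (∑ u, A w u) = ∑ e, ∑ w, A e w * A w a := by
    rw [Finset.sum_comm]
    refine Finset.sum_congr rfl fun w _ => ?_
    rw [Finset.mul_sum]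
    exact Finset.sum_congr rfl fun u _ => by rw [hs w u]; ring
  have h2 : (∑ u, A v u) * (∑ u, A a u) = ∑ e, ∑ w, A v e * A w a := by
    rw [Finset.sum_mul_sum]
    exact Finset.sum_congr rfl fun e _ => Finset.sum_congr rfl fun w _ => by rw [hs a w]
  rw [h1, h2, ← Finset.sum_sub_distrib, ← Finset.sum_add_distrib]
  refine Finset.sum_congr rfl fun e _ => ?_
  rw [← Finset.sum_sub_distrib, ← Finset.sum_add_distrib]
  exact Finset.sum_congr rfl fun e _ => by ring

/-- Lower bound for the number of alternating paths of length five. -/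
lemma path_count (A : Fin n → Fin n → ℝ) (hs : ∀ u v, A u v = A v u)
    (h0 : ∀ u v, 0 ≤ A u v) (h1 : ∀ u v, A u v ≤ 1) (v a : Fin n) (D : Fin n → ℝ)
    (hD : ∀ u, ∑ w, A u w = D u) (c4 β β' : ℝ)
    (hc4 : ∑ b, ∑ w, A v b * (1 - A b w) * A w a = c4)
    (hβ : ∑ w, A w a * D w - D v * D a + c4 = β)
    (hβ' : ∑ w, A w v * D w - D v * D a + c4 = β') :
    D v * D a * (∑ e, (1 - A v e) * D e - β) - n ^ 2 * β - n ^ 2 * β' ≤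
    ∑ b, ∑ c, ∑ e, ∑ w, A v b * (1 - A b c) * A c e * (1 - A e w) * A w a := by
  have e1 : ∑ e, ∑ w, (1 - A v e) * A e w * A w a = β := by
    rw [path_count_aux A hs v a, hc4, hD, hD, ← hβ]; simp only [hD]
  have e2 : ∑ c, ∑ b, (1 - A a c) * A c b * A b v = β' := by
    rw [path_count_aux A hs a v, hD, hD, ← hβ', ← hc4]; simp only [hD]
    rw [mul_comm (D v)]
    congr 1
    rw [Finset.sum_comm]
    exact Finset.sum_congr rfl fun e _ => Finset.sum_congr rfl fun w _ => by
      rw [hs a w, hs w e, hs e v]; ring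
  set k : Fin n → ℝ := fun c => ∑ b, A c b * A b v with hk
  set m : Fin n → ℝ := fun e => ∑ w, A e w * A w a with hm
  have hDn : ∀ u, D u ≤ n := fun u => by
    rw [← hD u]
    calc _ ≤ ∑ w : Fin n, (1:ℝ) := Finset.sum_le_sum fun w _ => h1 u w
      _ = n := by simp
  have hD0 : ∀ u, 0 ≤ D u := fun u => by
    rw [← hD u]; exact Finset.sum_nonneg fun w _ => h0 u w
  have hk0 : ∀ c, 0 ≤ k c := fun c => Finset.sum_nonneg fun b _ => mul_nonneg (h0 _ _) (h0 _ _)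
  have hm0 : ∀ c, 0 ≤ m c := fun c => Finset.sum_nonneg fun b _ => mul_nonneg (h0 _ _) (h0 _ _)
  have hkD : ∀ c, k c ≤ D v := fun c => by
    rw [← hD v]
    exact Finset.sum_le_sum fun b _ => by
      rw [hs v b]; exact mul_le_of_le_one_left (h0 _ _) (h1 _ _)
  have hmD : ∀ c, m c ≤ D a := fun c => by
    rw [← hD a]
    exact Finset.sum_le_sum fun b _ => by
      rw [hs a b]; exact mul_le_of_le_one_left (h0 _ _) (h1 _ _)
  have e3 : ∑ b, ∑ c, ∑ e, ∑ w, A v b * (1 - A b c) * A c e * (1 - A e w) * A w a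
      = ∑ c, ∑ e, (D v - k c) * A c e * (D a - m e) := by
    rw [Finset.sum_comm]
    refine Finset.sum_congr rfl fun c _ => ?_
    rw [Finset.sum_comm]
    refine Finset.sum_congr rfl fun e _ => ?_
    have p1 : D v - k c = ∑ b, A v b * (1 - A b c) := by
      rw [hk, ← hD v, ← Finset.sum_sub_distrib]
      exact Finset.sum_congr rfl fun b _ => by rw [hs c b, hs v b]; ring
    have p2 : D a - m e = ∑ w, (1 - A e w) * A w a := by
      rw [hm, ← hD a, ← Finset.sum_sub_distrib]
      exact Finset.sum_congr rfl fun b _ => by rw [hs a b]; ring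
    rw [p1, p2, mul_assoc, Finset.mul_sum, Finset.sum_mul_sum]
    exact Finset.sum_congr rfl fun b _ => Finset.sum_congr rfl fun w _ => by ring
  have e4 : ∑ c, ∑ e, A c e * (1 - A v e) * (1 - A a c) = ∑ e, (1 - A v e) * D e - β := by
    rw [← e1, ← Finset.sum_sub_distrib, Finset.sum_comm]
    refine Finset.sum_congr rfl fun e _ => ?_
    rw [← hD e, Finset.mul_sum, ← Finset.sum_sub_distrib]
    exact Finset.sum_congr rfl fun c _ => by rw [hs a c, hs e c]; ring
  rw [e3, ← e4]
  have e5 : (n:ℝ) ^ 2 * β = ∑ c : Fin n, ∑ e, n * ((1 - A v e) * m e) := by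
    rw [← e1, Finset.sum_const]
    simp only [Finset.card_univ, Fintype.card_fin, nsmul_eq_mul, hm]
    rw [← Finset.mul_sum, ← mul_assoc, ← sq]
    congr 1
    refine Finset.sum_congr rfl fun e _ => ?_
    rw [Finset.mul_sum]
    exact Finset.sum_congr rfl fun c _ => by ring
  have e6 : (n:ℝ) ^ 2 * β' = ∑ c : Fin n, ∑ e : Fin n, n * ((1 - A a c) * k c) := by
    rw [← e2]
    simp only [Finset.sum_const, Finset.card_univ, Fintype.card_fin, nsmul_eq_mul, hk]
    rw [Finset.mul_sum]
    refine Finset.sum_congr rfl fun e _ => ?_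
    rw [Finset.mul_sum, Finset.mul_sum, Finset.mul_sum, Finset.mul_sum]
    exact Finset.sum_congr rfl fun c _ => by ring
  rw [e5, e6, Finset.mul_sum, ← Finset.sum_sub_distrib, ← Finset.sum_sub_distrib]
  refine Finset.sum_le_sum fun c _ => ?_
  rw [Finset.mul_sum, ← Finset.sum_sub_distrib, ← Finset.sum_sub_distrib]
  refine Finset.sum_le_sum fun e _ => ?_
  have a1 := h0 c e
  have a2 := h1 c e
  have b0 := sub_nonneg.2 (h1 v e)
  have b1 : 1 - A v e ≤ 1 := by linarith [h0 v e]
  have c0 := sub_nonneg.2 (h1 a c)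
  have c1 : 1 - A a c ≤ 1 := by linarith [h0 a c]
  set p := 1 - A v e
  set q := 1 - A a c
  have hP : 0 ≤ D v - k c := sub_nonneg.2 (hkD c)
  have hQ : 0 ≤ D a - m e := sub_nonneg.2 (hmD e)
  have hpq : p * q ≤ 1 := by nlinarith
  have hpq0 : 0 ≤ p * q := by positivity
  have s1 : A c e * p * q * ((D v - k c) * (D a - m e)) ≤ A c e * ((D v - k c) * (D a - m e)) := by
    have : A c e * p * q ≤ A c e := by nlinarith
    exact mul_le_mul_of_nonneg_right this (by positivity)
  have s2 : A c e * p * q * (D a * k c) ≤ n * (q * k c) := by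
    have t1 : A c e * p ≤ 1 := by nlinarith
    have t2 : A c e * p * D a ≤ n := by
      calc A c e * p * D a ≤ 1 * D a := mul_le_mul_of_nonneg_right t1 (hD0 a)
        _ ≤ n := by rw [one_mul]; exact hDn a
    have := mul_le_mul_of_nonneg_right t2 (mul_nonneg c0 (hk0 c))
    calc _ = A c e * p * D a * (q * k c) := by ring
      _ ≤ _ := this
  have s3 : A c e * p * q * (D v * m e) ≤ n * (p * m e) := by
    have t1 : A c e * q ≤ 1 := by nlinarith
    have t2 : A c e * q * D v ≤ n := by
      calc A c e * q * D v ≤ 1 * D v := mul_le_mul_of_nonneg_right t1 (hD0 v)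
        _ ≤ n := by rw [one_mul]; exact hDn v
    have := mul_le_mul_of_nonneg_right t2 (mul_nonneg b0 (hm0 e))
    calc _ = A c e * q * D v * (p * m e) := by ring
      _ ≤ _ := this
  have s4 : 0 ≤ A c e * p * q * (k c * m e) := by
    have := hk0 c; have := hm0 e; positivity
  nlinarith

end crude

/-- Nearly regular degrees `d` and nearly complete set `Y` of allowed edges, away from at most two
exceptional vertices. -/
structure C0 {n : ℕ} (T lam B : ℝ) (U : Finset (Fin n)) (d : Fin n → ℝ)
    (Y : Finset (Sym2 (Fin n))) : Prop where
  loop : loopless Y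
  hU : ((Uᶜ).card : ℝ) ≤ 2
  hT : 100 ≤ T
  hB : 10 ≤ B
  lo : 1 ≤ lam * T
  hi : 1 ≤ (1 - lam) * T
  deg : ∀ v ∈ U, |d v - lam * n| ≤ B
  xd : ∀ v ∈ U, n - dg Y v ≤ B

section crude

variable {n : ℕ} {F G Y Z U : Finset (Sym2 (Fin n))} {d : Fin n → ℝ} {a b u v w : Fin n}
  {e f : Sym2 (Fin n)} {T lam B : ℝ} {U : Finset (Fin n)}

lemma mem_of_ind_ne_zero (h : ind F e ≠ 0) : e ∈ F := by
  by_contra h1; exact h (ind_of_notMem h1)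

lemma mem_sdiff_of_ind_sub_ne_zero (hF : F ⊆ Y) (h : ind Y e - ind F e ≠ 0) : e ∈ Y \ F := by
  rw [← ind_sdiff hF] at h; exact mem_of_ind_ne_zero h

lemma ind_sub_nonneg (hF : F ⊆ Y) : 0 ≤ ind Y e - ind F e := by
  rw [← ind_sdiff hF]; exact ind_nonneg

lemma dg_nonneg : 0 ≤ dg F v := Finset.sum_nonneg fun _ _ => ind_nonneg

lemma dg_le : dg F v ≤ n := by
  calc dg F v ≤ ∑ u : Fin n, (1:ℝ) := Finset.sum_le_sum fun _ _ => ind_le_one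
    _ = n := by simp

lemma C0.lam_pos (h : C0 T lam B U d Y) : 0 < lam := by
  have h1 := h.lo; have h2 := h.hT
  by_contra h3; push Not at h3; nlinarith

lemma C0.lam_lt_one (h : C0 T lam B U d Y) : lam < 1 := by
  have h1 := h.hi; have h2 := h.hT
  by_contra h3; push Not at h3; nlinarith

lemma C0.compl (h : C0 T lam B U d Y) : C0 T (1 - lam) (2 * B) U (dg Y - d) Y where
  loop := h.loop
  hU := h.hU
  hT := h.hT
  hB := by linarith [h.hB]
  lo := h.hi
  hi := by simpa using h.lo
  deg := fun v hv => by
    have h1 := h.deg v hv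
    have h2 := h.xd v hv
    have h3 : dg Y v ≤ n := dg_le
    rw [abs_le] at h1 ⊢
    simp only [Pi.sub_apply]
    constructor <;> linarith
  xd := fun v hv => by linarith [h.xd v hv, h.hB]

lemma C0.mono (h : C0 T lam B U d Y) {T' B' : ℝ} (hT : T ≤ T') (hB : B ≤ B') :
    C0 T' lam B' U d Y where
  loop := h.loop
  hU := h.hU
  hT := h.hT.trans hT
  hB := h.hB.trans hB
  lo := h.lo.trans (mul_le_mul_of_nonneg_left hT h.lam_pos.le)
  hi := h.hi.trans (mul_le_mul_of_nonneg_left hT (by linarith [h.lam_lt_one]))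
  deg := fun v hv => (h.deg v hv).trans hB
  xd := fun v hv => (h.xd v hv).trans hB

lemma C0.sum_le (h : C0 T lam B U d Y) (f : Fin n → ℝ) (c K : ℝ)
    (h1 : ∀ v ∈ U, f v ≤ c) (h2 : ∀ v, f v ≤ K) (hK : 0 ≤ K) (hc : 0 ≤ c) :
    ∑ v, f v ≤ n * c + 2 * K := by
  rw [← Finset.sum_add_sum_compl U]
  have e1 : ∑ v ∈ U, f v ≤ n * c := by
    calc _ ≤ ∑ v ∈ U, c := Finset.sum_le_sum h1
      _ = U.card * c := by simp
      _ ≤ n * c := by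
        have : U.card ≤ n := by simpa using Finset.card_le_univ U
        have : (U.card : ℝ) ≤ n := by exact_mod_cast this
        gcongr
  have e2 : ∑ v ∈ Uᶜ, f v ≤ 2 * K := by
    calc _ ≤ ∑ v ∈ Uᶜ, K := Finset.sum_le_sum fun v _ => h2 v
      _ = (Uᶜ.card : ℝ) * K := by simp
      _ ≤ 2 * K := by have := h.hU; gcongr
  linarith

lemma C0.sum_notMem (h : C0 T lam B U d Y) :
    ∑ b, ∑ w, (1 - ind Y s(b, w)) ≤ n * (B + 2) := by
  have e : ∀ b, ∑ w, (1 - ind Y s(b, w)) = n - dg Y b := by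
    intro b; simp [dg, Finset.sum_sub_distrib]
  simp only [e]
  have := h.sum_le (fun b => n - dg Y b) B n h.xd
    (fun v => by linarith [dg_nonneg (F := Y) (v := v)]) (by positivity) (by linarith [h.hB])
  linarith

lemma switch_four (hY : loopless Y) (hav : s(v, a) ∈ Y) :
    ∑ F ∈ gr d Y, ind F s(v, b) * (ind Y s(b, w) - ind F s(b, w)) * ind F s(w, a)
      * (1 - ind F s(v, a)) ≤ ∑ F ∈ gr d Y, ind F s(v, a) := by
  refine switch_le (R := {s(v, b), s(w, a)}) (S := {s(b, w), s(v, a)}) _ ?_ ?_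
  · intro F
    unfold ind; split_ifs <;> norm_num
  · intro F hF h0
    obtain ⟨hF, -⟩ := mem_gr.1 hF
    have h1 := mem_of_ind_ne_zero (left_ne_zero_of_mul (left_ne_zero_of_mul (left_ne_zero_of_mul h0)))
    have h2 := mem_sdiff_of_ind_sub_ne_zero hF
      (right_ne_zero_of_mul (left_ne_zero_of_mul (left_ne_zero_of_mul h0)))
    have h3 := mem_of_ind_ne_zero (right_ne_zero_of_mul (left_ne_zero_of_mul h0))
    have h4 : s(v, a) ∉ F := fun h => right_ne_zero_of_mul h0 (by rw [ind_of_mem h, sub_self])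
    have n1 := hY.ne (hF h1)
    have n2 := hY.ne (Finset.mem_sdiff.1 h2).1
    have n3 := hY.ne (hF h3)
    have n4 := hY.ne hav
    have m1 : s(v, b) ≠ s(w, a) := by
      intro h
      rcases Sym2.eq_iff.1 h with ⟨rfl, rfl⟩ | ⟨rfl, rfl⟩
      · exact h4 h1
      · exact n2 rfl
    have m2 : s(b, w) ≠ s(v, a) := by
      intro h
      rcases Sym2.eq_iff.1 h with ⟨rfl, rfl⟩ | ⟨rfl, rfl⟩
      · exact n1 rfl
      · exact h4 h1
    refine ⟨?_, ?_, ?_, by simp⟩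
    · intro x hx
      simp only [Finset.mem_insert, Finset.mem_singleton] at hx
      rcases hx with rfl | rfl
      exacts [h1, h3]
    · intro x hx
      simp only [Finset.mem_insert, Finset.mem_singleton] at hx
      rcases hx with rfl | rfl
      exacts [h2, Finset.mem_sdiff.2 ⟨hav, h4⟩]
    · rw [dg_insert n1 (by simpa using m1), dg_insert n2 (by simpa using m2), dg_singleton n3,
        dg_singleton n4]
      funext x; simp only [Pi.add_apply]; ring

lemma switch_six (hY : loopless Y) (hav : s(v, a) ∈ Y) {b c e w : Fin n} :
    ∑ F ∈ gr d Y, ind F s(v, b) * (ind Y s(b, c) - ind F s(b, c)) * ind F s(c, e)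
      * (ind Y s(e, w) - ind F s(e, w)) * ind F s(w, a) * (1 - ind F s(v, a)) *
      (if (c = v ∧ e = b) ∨ (c = w ∧ e = a) ∨ (b = e ∧ c = w) then 0 else 1)
      ≤ ∑ F ∈ gr d Y, ind F s(v, a) := by
  refine switch_le (R := {s(v, b), s(c, e), s(w, a)}) (S := {s(b, c), s(e, w), s(v, a)}) _ ?_ ?_
  · intro F
    have p : ∀ x y : ℝ, 0 ≤ x → x ≤ 1 → 0 ≤ y → y ≤ 1 → 0 ≤ x * y ∧ x * y ≤ 1 := by
      intro x y a1 a2 a3 a4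
      exact ⟨mul_nonneg a1 a3, by nlinarith⟩
    have q : ∀ e, |ind Y e - ind F e| ≤ 1 := by
      intro e; unfold ind; split_ifs <;> norm_num
    have r : ∀ e, |ind F e| ≤ 1 := by
      intro e; unfold ind; split_ifs <;> norm_num
    have r' : ∀ e, |1 - ind F e| ≤ 1 := by
      intro e; unfold ind; split_ifs <;> norm_num
    refine (le_abs_self _).trans ?_
    simp only [abs_mul]
    refine mul_le_one₀ ?_ (abs_nonneg _) (by split_ifs <;> simp)
    refine mul_le_one₀ ?_ (abs_nonneg _) (r' _)
    refine mul_le_one₀ ?_ (abs_nonneg _) (r _)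
    refine mul_le_one₀ ?_ (abs_nonneg _) (q _)
    refine mul_le_one₀ ?_ (abs_nonneg _) (r _)
    exact mul_le_one₀ (r _) (abs_nonneg _) (q _)
  · intro F hF h0
    obtain ⟨hF, -⟩ := mem_gr.1 hF
    have h7 := right_ne_zero_of_mul h0
    have h0 := left_ne_zero_of_mul h0
    have h6 : s(v, a) ∉ F := fun h => right_ne_zero_of_mul h0 (by rw [ind_of_mem h, sub_self])
    have h0 := left_ne_zero_of_mul h0
    have h5 := mem_of_ind_ne_zero (right_ne_zero_of_mul h0)
    have h0 := left_ne_zero_of_mul h0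
    have h4 := mem_sdiff_of_ind_sub_ne_zero hF (right_ne_zero_of_mul h0)
    have h0 := left_ne_zero_of_mul h0
    have h3 := mem_of_ind_ne_zero (right_ne_zero_of_mul h0)
    have h0 := left_ne_zero_of_mul h0
    have h2 := mem_sdiff_of_ind_sub_ne_zero hF (right_ne_zero_of_mul h0)
    have h1 := mem_of_ind_ne_zero (left_ne_zero_of_mul h0)
    have h7 : ¬ ((c = v ∧ e = b) ∨ (c = w ∧ e = a) ∨ (b = e ∧ c = w)) := by
      intro h; rw [if_pos h] at h7; exact h7 rfl
    push Not at h7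
    have n1 := hY.ne (hF h1)
    have n2 := hY.ne (Finset.mem_sdiff.1 h2).1
    have n3 := hY.ne (hF h3)
    have n4 := hY.ne (Finset.mem_sdiff.1 h4).1
    have n5 := hY.ne (hF h5)
    have n6 := hY.ne hav
    have m1 : s(v, b) ∉ ({s(c, e), s(w, a)} : Finset (Sym2 (Fin n))) := by
      simp only [Finset.mem_insert, Finset.mem_singleton, Sym2.eq_iff]
      rintro ((⟨rfl, rfl⟩ | ⟨rfl, rfl⟩) | (⟨rfl, rfl⟩ | ⟨rfl, rfl⟩))
      · exact h7.1 rfl rfl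
      · exact n2 rfl
      · exact h6 h1
      · exact n6 rfl
    have m2 : s(c, e) ∉ ({s(w, a)} : Finset (Sym2 (Fin n))) := by
      simp only [Finset.mem_singleton, Sym2.eq_iff]
      rintro (⟨rfl, rfl⟩ | ⟨rfl, rfl⟩)
      · exact h7.2.1 rfl rfl
      · exact n4 rfl
    have m3 : s(b, c) ∉ ({s(e, w), s(v, a)} : Finset (Sym2 (Fin n))) := by
      simp only [Finset.mem_insert, Finset.mem_singleton, Sym2.eq_iff]
      rintro ((⟨rfl, rfl⟩ | ⟨rfl, rfl⟩) | (⟨rfl, rfl⟩ | ⟨rfl, rfl⟩))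
      · exact h7.2.2 rfl rfl
      · exact n3 rfl
      · exact n1 rfl
      · exact h6 h1
    have m4 : s(e, w) ∉ ({s(v, a)} : Finset (Sym2 (Fin n))) := by
      simp only [Finset.mem_singleton, Sym2.eq_iff]
      rintro (⟨rfl, rfl⟩ | ⟨rfl, rfl⟩)
      · exact n5 rfl
      · exact h6 h5
    refine ⟨?_, ?_, ?_, by simp⟩
    · intro x hx
      simp only [Finset.mem_insert, Finset.mem_singleton] at hx
      rcases hx with rfl | rfl | rfl
      exacts [h1, h3, h5]
    · intro x hx
      simp only [Finset.mem_insert, Finset.mem_singleton] at hx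
      rcases hx with rfl | rfl | rfl
      exacts [h2, h4, Finset.mem_sdiff.2 ⟨hav, h6⟩]
    · rw [dg_insert n1 m1, dg_insert n3 m2, dg_singleton n5, dg_insert n2 m3, dg_insert n4 m4,
        dg_singleton n6]
      funext x; simp only [Pi.add_apply]; ring

end crude

section crude

variable {n : ℕ} {F G Y Z : Finset (Sym2 (Fin n))} {d : Fin n → ℝ} {a b u v w : Fin n}
  {e f : Sym2 (Fin n)} {T lam B : ℝ} {U : Finset (Fin n)}

lemma four_sum_le (h : C0 T lam B U d Y) (hva : s(v, a) ∉ F) :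
    ∑ b, ∑ w, ind F s(v, b) * (1 - ind F s(b, w)) * ind F s(w, a) ≤
    ∑ b, ∑ w, ind F s(v, b) * (ind Y s(b, w) - ind F s(b, w)) * ind F s(w, a)
      * (1 - ind F s(v, a)) + n * (B + 2) := by
  refine le_trans ?_ (add_le_add_right h.sum_notMem _)
  rw [← Finset.sum_add_distrib]
  refine Finset.sum_le_sum fun b _ => ?_
  rw [← Finset.sum_add_distrib]
  refine Finset.sum_le_sum fun w _ => ?_
  rw [ind_of_notMem hva]
  have h1 : 0 ≤ 1 - ind Y s(b, w) := sub_nonneg.2 ind_le_one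
  have h2 : ind F s(v, b) * ind F s(w, a) ≤ 1 := mul_le_one₀ ind_le_one ind_nonneg ind_le_one
  nlinarith

lemma six_sum_le (h : C0 T lam B U d Y) (hF : F ⊆ Y) (hva : s(v, a) ∉ F) :
    ∑ b, ∑ c, ∑ e, ∑ w, ind F s(v, b) * (1 - ind F s(b, c)) * ind F s(c, e)
      * (1 - ind F s(e, w)) * ind F s(w, a) ≤
    ∑ b, ∑ c, ∑ e, ∑ w, ind F s(v, b) * (ind Y s(b, c) - ind F s(b, c)) * ind F s(c, e)
      * (ind Y s(e, w) - ind F s(e, w)) * ind F s(w, a) * (1 - ind F s(v, a)) *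
      (if (c = v ∧ e = b) ∨ (c = w ∧ e = a) ∨ (b = e ∧ c = w) then 0 else 1)
      + (2 * n ^ 3 * (B + 2) + 3 * n ^ 2) := by
  have key : ∀ b c e w : Fin n, ind F s(v, b) * (1 - ind F s(b, c)) * ind F s(c, e)
      * (1 - ind F s(e, w)) * ind F s(w, a) ≤
      ind F s(v, b) * (ind Y s(b, c) - ind F s(b, c)) * ind F s(c, e)
      * (ind Y s(e, w) - ind F s(e, w)) * ind F s(w, a) * (1 - ind F s(v, a)) *
      (if (c = v ∧ e = b) ∨ (c = w ∧ e = a) ∨ (b = e ∧ c = w) then 0 else 1)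
      + (((1 - ind Y s(b, c)) + (1 - ind Y s(e, w))) + ((if c = v then if e = b then (1:ℝ) else 0
        else 0) + (if c = w then if e = a then (1:ℝ) else 0 else 0)
        + (if b = e then if c = w then (1:ℝ) else 0 else 0))) := by
    intro b c e w
    rw [ind_of_notMem hva]
    have y1 : 0 ≤ 1 - ind Y s(b, c) := sub_nonneg.2 ind_le_one
    have y2 : 0 ≤ 1 - ind Y s(e, w) := sub_nonneg.2 ind_le_one
    have i1 : (0:ℝ) ≤ if c = v then if e = b then (1:ℝ) else 0 else 0 := by
      split_ifs <;> norm_num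
    have i2 : (0:ℝ) ≤ if c = w then if e = a then (1:ℝ) else 0 else 0 := by
      split_ifs <;> norm_num
    have i3 : (0:ℝ) ≤ if b = e then if c = w then (1:ℝ) else 0 else 0 := by
      split_ifs <;> norm_num
    have f1 : 0 ≤ 1 - ind F s(b, c) := sub_nonneg.2 ind_le_one
    have f1' : 1 - ind F s(b, c) ≤ 1 := by linarith [ind_nonneg (F := F) (e := s(b, c))]
    have f2 : 0 ≤ 1 - ind F s(e, w) := sub_nonneg.2 ind_le_one
    have f2' : 1 - ind F s(e, w) ≤ 1 := by linarith [ind_nonneg (F := F) (e := s(e, w))]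
    have g1 : 0 ≤ ind Y s(b, c) - ind F s(b, c) := ind_sub_nonneg hF
    have g2 : 0 ≤ ind Y s(e, w) - ind F s(e, w) := ind_sub_nonneg hF
    have L : ind F s(v, b) * (1 - ind F s(b, c)) * ind F s(c, e)
      * (1 - ind F s(e, w)) * ind F s(w, a) ≤ 1 := by
      refine mul_le_one₀ ?_ ind_nonneg ind_le_one
      refine mul_le_one₀ ?_ f2 f2'
      refine mul_le_one₀ ?_ ind_nonneg ind_le_one
      exact mul_le_one₀ ind_le_one f1 f1'
    have e1 := ind_nonneg (F := F) (e := s(v, b))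
    have e2 := ind_nonneg (F := F) (e := s(c, e))
    have e3 := ind_nonneg (F := F) (e := s(w, a))
    have V : 0 ≤ ind F s(v, b) * (ind Y s(b, c) - ind F s(b, c)) * ind F s(c, e)
      * (ind Y s(e, w) - ind F s(e, w)) * ind F s(w, a) * (1 - 0) *
      (if (c = v ∧ e = b) ∨ (c = w ∧ e = a) ∨ (b = e ∧ c = w) then 0 else 1) := by
      refine mul_nonneg (by positivity) (by split_ifs <;> norm_num)
    by_cases p : (c = v ∧ e = b) ∨ (c = w ∧ e = a) ∨ (b = e ∧ c = w)
    · rcases p with ⟨p, q⟩ | ⟨p, q⟩ | ⟨p, q⟩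
      · linarith [show (if c = v then if e = b then (1:ℝ) else 0 else 0) = 1 from
          (if_pos p).trans (if_pos q)]
      · linarith [show (if c = w then if e = a then (1:ℝ) else 0 else 0) = 1 from
          (if_pos p).trans (if_pos q)]
      · linarith [show (if b = e then if c = w then (1:ℝ) else 0 else 0) = 1 from
          (if_pos p).trans (if_pos q)]
    · rcases ind_eq_zero_or_one (F := Y) (e := s(b, c)) with q1 | q1
      · rw [q1] at V ⊢; linarith
      rcases ind_eq_zero_or_one (F := Y) (e := s(e, w)) with q2 | q2
      · rw [q2] at V ⊢; linarith
      rw [if_neg p, q1, q2]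
      linarith
  refine (Finset.sum_le_sum fun b _ => Finset.sum_le_sum fun c _ => Finset.sum_le_sum fun e _ =>
    Finset.sum_le_sum fun w _ => key b c e w).trans ?_
  simp only [Finset.sum_add_distrib]
  have s1 : ∑ b : Fin n, ∑ c : Fin n, ∑ e : Fin n, ∑ w : Fin n, (1 - ind Y s(b, c))
      ≤ n ^ 2 * (n * (B + 2)) := by
    simp only [Finset.sum_const, Finset.card_univ, Fintype.card_fin, nsmul_eq_mul,
      ← Finset.mul_sum]
    rw [← mul_assoc, ← sq]
    exact mul_le_mul_of_nonneg_left h.sum_notMem (by positivity)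
  have s2 : ∑ b : Fin n, ∑ c : Fin n, ∑ e : Fin n, ∑ w : Fin n, (1 - ind Y s(e, w))
      ≤ n ^ 2 * (n * (B + 2)) := by
    simp only [Finset.sum_const, Finset.card_univ, Fintype.card_fin, nsmul_eq_mul]
    rw [← mul_assoc, ← sq]
    exact mul_le_mul_of_nonneg_left h.sum_notMem (by positivity)
  have s3 : ∑ b : Fin n, ∑ c : Fin n, ∑ e : Fin n, ∑ w : Fin n,
      (if c = v then if e = b then (1:ℝ) else 0 else 0) = n ^ 2 := by
    simp [sq]
  have s4 : ∑ b : Fin n, ∑ c : Fin n, ∑ e : Fin n, ∑ w : Fin n,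
      (if c = w then if e = a then (1:ℝ) else 0 else 0) = n ^ 2 := by
    simp [sq]
  have s5 : ∑ b : Fin n, ∑ c : Fin n, ∑ e : Fin n, ∑ w : Fin n,
      (if b = e then if c = w then (1:ℝ) else 0 else 0) = n ^ 2 := by
    simp [sq]
  rw [s3, s4, s5]
  linarith

lemma crude_numeric {N T lam B c4 β β' Dv Da s v4 v6 : ℝ} (hT : 100 ≤ T) (hB : 10 ≤ B)
    (hlo : 1 ≤ lam * T) (hhi : 1 ≤ (1 - lam) * T) (hn : B * T ^ 10 ≤ N) (hDv : |Dv - lam * N| ≤ B)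
    (hDa : |Da - lam * N| ≤ B)
    (hβ : β ≤ (2 * B + 2) * N + c4) (hβ' : β' ≤ (2 * B + 2) * N + c4)
    (hs : (lam * N - B) * (N - Dv) - 2 * N ≤ s) (h4 : c4 ≤ v4 + N * (B + 2)) (h40 : 0 ≤ v4)
    (h60 : 0 ≤ v6)
    (h6 : Dv * Da * (s - β) - N ^ 2 * β - N ^ 2 * β' ≤ v6 + (2 * N ^ 3 * (B + 2) + 3 * N ^ 2)) :
    1 ≤ T ^ 6 * (v4 / N ^ 2 + v6 / N ^ 4) := by
  have hT0 : 0 < T := by linarith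
  obtain ⟨x, rfl⟩ : ∃ x, N = x * T := ⟨N / T, by field_simp⟩
  have hx : B * T ^ 9 ≤ x := by
    have : B * T ^ 9 * T ≤ x * T := by linarith [hn, show B * T ^ 10 = B * T ^ 9 * T by ring]
    exact le_of_mul_le_mul_right this hT0
  have hx0 : 0 < x := lt_of_lt_of_le (by positivity) hx
  have hN0 : 0 < x * T := by positivity
  have key : ∀ k : ℕ, k ≤ 9 → B * T ^ k * 100 ^ (9 - k) ≤ x := by
    intro k hk
    refine le_trans ?_ hx
    have : T ^ 9 = T ^ k * T ^ (9 - k) := by rw [← pow_add]; congr 1; omega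
    rw [this, ← mul_assoc]
    gcongr
  rcases le_or_gt (x ^ 2 / T ^ 3) c4 with hc | hc
  · have k1 := key 5 (by norm_num)
    norm_num at k1
    have hv4 : x ^ 2 / T ^ 3 / 2 ≤ v4 := by
      have : x * T * (B + 2) ≤ x ^ 2 / T ^ 3 / 2 := by
        rw [div_div, le_div_iff₀ (by positivity)]
        have : T ^ 4 ≤ T ^ 5 := by gcongr <;> linarith
        have hBT : B * T ^ 4 ≤ B * T ^ 5 := by gcongr
        have : 2 * (B + 2) * T ^ 4 ≤ x := by nlinarith only [pow_pos hT0 4, hBT, k1, hB]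
        nlinarith only [this, hx0]
      linarith
    have e : 1 ≤ T ^ 6 * (v4 / (x * T) ^ 2) := by
      rw [← mul_div_assoc, le_div_iff₀ (by positivity), one_mul]
      have : T ^ 6 * (x ^ 2 / T ^ 3 / 2) ≤ T ^ 6 * v4 := by gcongr
      refine le_trans ?_ this
      have e2 : T ^ 6 * (x ^ 2 / T ^ 3 / 2) = x ^ 2 * T ^ 3 / 2 := by field_simp
      rw [e2, mul_pow]
      nlinarith only [mul_pos (pow_pos hx0 2) (pow_pos hT0 2), hT]
    have : 0 ≤ v6 / (x * T) ^ 4 := by positivity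
    rw [mul_add]; linarith [mul_nonneg (pow_pos hT0 6).le this]
  · have k0 := key 0 (by norm_num)
    have k1 := key 4 (by norm_num)
    have k3 := key 3 (by norm_num)
    norm_num at k0 k1 k3
    have hlx : x ≤ lam * (x * T) := by nlinarith only [hlo, hx0]
    have hhx : x ≤ (1 - lam) * (x * T) := by nlinarith only [hhi, hx0]
    rw [abs_le] at hDv hDa
    have d1 : 0.99 * x ≤ Dv := by linarith
    have d2 : 0.99 * x ≤ Da := by linarith
    have d3 : 0.99 * x ≤ x * T - Dv := by linarith
    have d4 : 0.99 * x ≤ lam * (x * T) - B := by linarith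
    have c2 : c4 ≤ x ^ 2 / 1000000 := by
      have : x ^ 2 / T ^ 3 ≤ x ^ 2 / 100 ^ 3 := by gcongr
      linarith
    have hc4' : c4 ≤ x ^ 2 / T ^ 3 := hc.le
    have b0 : (2 * B + 2) * (x * T) ≤ x ^ 2 / T ^ 3 := by
      rw [le_div_iff₀ (by positivity)]
      have : (2 * B + 2) * T ^ 4 ≤ x := by nlinarith only [pow_pos hT0 4, k1, hB]
      nlinarith only [this, hx0]
    have b1 : β ≤ 2 * (x ^ 2 / T ^ 3) := by linarith
    have b2 : β' ≤ 2 * (x ^ 2 / T ^ 3) := by linarith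
    have b3 : x ^ 2 / T ^ 3 ≤ x ^ 2 / 1000000 := by
      have : x ^ 2 / T ^ 3 ≤ x ^ 2 / 100 ^ 3 := by gcongr
      linarith
    have s1 : 0.98 * x ^ 2 ≤ (lam * (x * T) - B) * (x * T - Dv) := by
      have := mul_le_mul d4 d3 (by positivity) (by linarith)
      nlinarith only [this, hx0]
    have s2 : x * T ≤ x ^ 2 / 1000 := by
      have k2 := key 1 (by norm_num)
      norm_num at k2
      have : T * 1000 ≤ x := by nlinarith only [k2, hB, hT]
      nlinarith only [this, hx0]
    have s3 : 0.9 * x ^ 2 ≤ s - β := by linarith [sq_nonneg x]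
    have s4 : 0.85 * x ^ 4 ≤ Dv * Da * (s - β) := by
      have m1 := mul_le_mul d1 d2 (by positivity) (by linarith)
      have m2 := mul_le_mul m1 s3 (by positivity) (le_trans (by positivity) m1)
      have q1 : 0 < x ^ 4 := by positivity
      have q2 : 0.99 * x * (0.99 * x) * (0.9 * x ^ 2) = 0.88209 * x ^ 4 := by ring
      rw [q2] at m2
      linarith
    have t1 : (x * T) ^ 2 * (x ^ 2 / T ^ 3) = x ^ 4 / T := by field_simp
    have t2 : x ^ 4 / T ≤ x ^ 4 / 100 := by gcongr
    have t3 : (x * T) ^ 2 * β ≤ 2 * (x ^ 4 / 100) := by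
      calc _ ≤ (x * T) ^ 2 * (2 * (x ^ 2 / T ^ 3)) := by gcongr
        _ = 2 * (x ^ 4 / T) := by rw [← t1]; ring
        _ ≤ _ := by gcongr
    have t4 : (x * T) ^ 2 * β' ≤ 2 * (x ^ 4 / 100) := by
      calc _ ≤ (x * T) ^ 2 * (2 * (x ^ 2 / T ^ 3)) := by gcongr
        _ = 2 * (x ^ 4 / T) := by rw [← t1]; ring
        _ ≤ _ := by gcongr
    have t5 : 2 * (x * T) ^ 3 * (B + 2) + 3 * (x * T) ^ 2 ≤ x ^ 4 / 100 := by
      have w1 : T ^ 3 * (B + 2) ≤ x / 1000 := by nlinarith only [pow_pos hT0 3, k3, hB]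
      have w2 : T ^ 2 ≤ x / 1000 := by nlinarith only [pow_pos hT0 2, pow_pos hT0 3, k3, hB, hT]
      have w3 : (x * T) ^ 3 * (B + 2) ≤ x ^ 4 / 1000 := by
        have := mul_le_mul_of_nonneg_left w1 (pow_pos hx0 3).le
        rw [show x ^ 3 * (x / 1000) = x ^ 4 / 1000 by ring] at this
        linarith [show (x * T) ^ 3 * (B + 2) = x ^ 3 * (T ^ 3 * (B + 2)) by ring]
      have w4 : (x * T) ^ 2 ≤ x ^ 3 / 1000 := by
        have := mul_le_mul_of_nonneg_left w2 (pow_pos hx0 2).le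
        rw [show x ^ 2 * (x / 1000) = x ^ 3 / 1000 by ring] at this
        linarith [show (x * T) ^ 2 = x ^ 2 * T ^ 2 by ring]
      have w5 : x ^ 3 ≤ x ^ 4 := by
        have : 1 ≤ x := by linarith
        exact pow_le_pow_right₀ this (by norm_num)
      linarith [show 2 * (x * T) ^ 3 * (B + 2) = 2 * ((x * T) ^ 3 * (B + 2)) by ring,
        pow_pos hx0 4]
    have hv6 : 0.7 * x ^ 4 ≤ v6 := by
      have : 0 < x ^ 4 := by positivity
      linarith
    have e : 1 ≤ T ^ 6 * (v6 / (x * T) ^ 4) := by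
      rw [← mul_div_assoc, le_div_iff₀ (by positivity), one_mul]
      have : T ^ 6 * (0.7 * x ^ 4) ≤ T ^ 6 * v6 := by gcongr
      refine le_trans ?_ this
      have q1 : (0:ℝ) < x ^ 4 * T ^ 4 := by positivity
      have q2 : T ^ 6 * (0.7 * x ^ 4) = x ^ 4 * T ^ 4 * (0.7 * T ^ 2) := by ring
      have q3 : 1 ≤ 0.7 * T ^ 2 := by nlinarith only [hT]
      rw [q2, mul_pow]
      exact le_mul_of_one_le_right q1.le q3
    have : 0 ≤ v4 / (x * T) ^ 2 := by positivity
    rw [mul_add]; linarith [mul_nonneg (pow_pos hT0 6).le this]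

lemma crude_pointwise (h : C0 T lam B U d Y) (hn : B * T ^ 10 ≤ n) (hF : F ∈ gr d Y) (hv : v ∈ U)
    (ha : a ∈ U) (hva : s(v, a) ∉ F) :
    1 ≤ T ^ 6 * ((∑ b, ∑ w, ind F s(v, b) * (ind Y s(b, w) - ind F s(b, w)) * ind F s(w, a)
      * (1 - ind F s(v, a))) / (n : ℝ) ^ 2 +
      (∑ b, ∑ c, ∑ e, ∑ w, ind F s(v, b) * (ind Y s(b, c) - ind F s(b, c)) * ind F s(c, e)
      * (ind Y s(e, w) - ind F s(e, w)) * ind F s(w, a) * (1 - ind F s(v, a)) *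
      (if (c = v ∧ e = b) ∨ (c = w ∧ e = a) ∨ (b = e ∧ c = w) then 0 else 1)) / (n : ℝ) ^ 4) := by
  have hFY := (mem_gr.1 hF).1
  have hD := dg_of_mem_gr hF
  have hd0 : ∀ u, 0 ≤ d u := fun u => by rw [← hD u]; exact dg_nonneg
  have hdn : ∀ u, d u ≤ n := fun u => by rw [← hD u]; exact dg_le
  have hB := h.hB
  have g : ∀ e, 0 ≤ ind Y e - ind F e := fun e => ind_sub_nonneg hFY
  have g' : ∀ e, 0 ≤ 1 - ind F e := fun e => sub_nonneg.2 ind_le_one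
  have i0 : ∀ e, 0 ≤ ind F e := fun e => ind_nonneg
  have hx : ∀ u ∈ U, d u ≤ lam * n + B := fun u hu => by
    have := abs_le.1 (h.deg u hu); linarith
  have hx' : ∀ u ∈ U, lam * n - B ≤ d u := fun u hu => by
    have := abs_le.1 (h.deg u hu); linarith
  have hn0 : (0:ℝ) ≤ n := by positivity
  have hlam : 0 ≤ lam := h.lam_pos.le
  have hlam1 : lam ≤ 1 := h.lam_lt_one.le
  have aux : ∀ a v : Fin n, a ∈ U → v ∈ U →
      ∑ w, ind F s(w, a) * d w - d v * d a ≤ (2 * B + 2) * n := by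
    intro a v ha hv
    have h1 := h.sum_le (fun w => ind F s(w, a) * (d w - (lam * n + B))) 0 n
      (fun w hw => mul_nonpos_of_nonneg_of_nonpos ind_nonneg (by linarith [hx w hw]))
      (fun w => by
        have := hdn w
        have : d w - (lam * n + B) ≤ n := by nlinarith
        calc _ ≤ ind F s(w, a) * n := mul_le_mul_of_nonneg_left this ind_nonneg
          _ ≤ 1 * n := mul_le_mul_of_nonneg_right ind_le_one hn0
          _ = n := one_mul _) hn0 le_rfl
    have h2 : ∑ w, ind F s(w, a) * (d w - (lam * n + B))
        = ∑ w, ind F s(w, a) * d w - d a * (lam * n + B) := by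
      rw [← hD a, Finset.sum_mul, ← Finset.sum_sub_distrib]
      exact Finset.sum_congr rfl fun w _ => by rw [ind_comm (u := a)]; ring
    have h3 := hx' v hv
    have h4 := hdn a
    have h5 := hd0 a
    nlinarith
  refine crude_numeric h.hT hB h.lo h.hi hn (h.deg v hv) (h.deg a ha)
    (c4 := ∑ b, ∑ w, ind F s(v, b) * (1 - ind F s(b, w)) * ind F s(w, a))
    (β := ∑ w, ind F s(w, a) * d w - d v * d a
      + ∑ b, ∑ w, ind F s(v, b) * (1 - ind F s(b, w)) * ind F s(w, a))
    (β' := ∑ w, ind F s(w, v) * d w - d v * d a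
      + ∑ b, ∑ w, ind F s(v, b) * (1 - ind F s(b, w)) * ind F s(w, a))
    (s := ∑ e, (1 - ind F s(v, e)) * d e)
    ?_ ?_ ?_ (four_sum_le h hva) ?_ ?_ ?_
  · have := aux a v ha hv; linarith
  · have := aux v a hv ha; linarith
  · have h1 := h.sum_le (fun e => (1 - ind F s(v, e)) * (lam * n - B - d e)) 0 n
      (fun w hw => mul_nonpos_of_nonneg_of_nonpos (g' _) (by linarith [hx' w hw]))
      (fun w => by
        have := hd0 w
        have : lam * n - B - d w ≤ n := by nlinarith
        calc _ ≤ (1 - ind F s(v, w)) * n := mul_le_mul_of_nonneg_left this (g' _)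
          _ ≤ 1 * n := mul_le_mul_of_nonneg_right (by linarith [i0 s(v, w)]) hn0
          _ = n := one_mul _) hn0 le_rfl
    have h2 : ∑ e, (1 - ind F s(v, e)) * (lam * n - B - d e)
        = (lam * n - B) * (n - d v) - ∑ e, (1 - ind F s(v, e)) * d e := by
      have h3 : (n - d v : ℝ) = ∑ e, (1 - ind F s(v, e)) := by
        rw [Finset.sum_sub_distrib, hD v]; simp
      rw [h3, Finset.mul_sum, ← Finset.sum_sub_distrib]
      exact Finset.sum_congr rfl fun w _ => by ring
    linarith
  · exact Finset.sum_nonneg fun b _ => Finset.sum_nonneg fun w _ =>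
      mul_nonneg (mul_nonneg (mul_nonneg (i0 _) (g _)) (i0 _)) (g' _)
  · refine Finset.sum_nonneg fun b _ => Finset.sum_nonneg fun c _ => Finset.sum_nonneg fun e _ =>
      Finset.sum_nonneg fun w _ => mul_nonneg (mul_nonneg (mul_nonneg (mul_nonneg (mul_nonneg
      (mul_nonneg (i0 _) (g _)) (i0 _)) (g _)) (i0 _)) (g' _)) (by split_ifs <;> norm_num)
  · refine le_trans ?_ (six_sum_le h hFY hva)
    exact path_count (fun u w => ind F s(u, w)) (fun u w => ind_comm) (fun u w => ind_nonneg)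
      (fun u w => ind_le_one) v a d hD _ _ _ rfl rfl rfl

/-- Every allowed edge has probability at least `T ^ (-7)`. -/
lemma crude_lower (h : C0 T lam B U d Y) (hn : B * T ^ 10 ≤ n) (hv : v ∈ U)
    (ha : a ∈ U) (hva : s(v, a) ∈ Y) : nn d Y ≤ T ^ 7 * ∑ F ∈ gr d Y, ind F s(v, a) := by
  have hT := h.hT
  have hB := h.hB
  have hn0 : (0:ℝ) < n := lt_of_lt_of_le (by positivity) hn
  set N := ∑ F ∈ gr d Y, ind F s(v, a) with hN
  have hN0 : 0 ≤ N := Finset.sum_nonneg fun _ _ => ind_nonneg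
  have h1 : ∑ F ∈ gr d Y, (1 - ind F s(v, a)) ≤ ∑ F ∈ gr d Y,
    T ^ 6 * ((∑ b, ∑ w, ind F s(v, b) * (ind Y s(b, w) - ind F s(b, w)) * ind F s(w, a)
      * (1 - ind F s(v, a))) / (n : ℝ) ^ 2 +
      (∑ b, ∑ c, ∑ e, ∑ w, ind F s(v, b) * (ind Y s(b, c) - ind F s(b, c)) * ind F s(c, e)
      * (ind Y s(e, w) - ind F s(e, w)) * ind F s(w, a) * (1 - ind F s(v, a)) *
      (if (c = v ∧ e = b) ∨ (c = w ∧ e = a) ∨ (b = e ∧ c = w) then 0 else 1)) / (n : ℝ) ^ 4) := by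
    refine Finset.sum_le_sum fun F hF => ?_
    by_cases hm : s(v, a) ∈ F
    · simp [ind_of_mem hm]
    · refine le_trans ?_ (crude_pointwise h hn hF hv ha hm)
      linarith [ind_nonneg (F := F) (e := s(v, a))]
  rw [← Finset.mul_sum, Finset.sum_add_distrib, ← Finset.sum_div, ← Finset.sum_div] at h1
  have h2 : (∑ F ∈ gr d Y, ∑ b, ∑ w, ind F s(v, b) * (ind Y s(b, w) - ind F s(b, w))
      * ind F s(w, a) * (1 - ind F s(v, a))) ≤ n ^ 2 * N := by
    rw [Finset.sum_comm]
    calc _ ≤ ∑ b : Fin n, ∑ w : Fin n, N := by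
          refine Finset.sum_le_sum fun b _ => ?_
          rw [Finset.sum_comm]
          exact Finset.sum_le_sum fun w _ => switch_four h.loop hva
      _ = _ := by simp; ring
  have h3 : (∑ F ∈ gr d Y, ∑ b, ∑ c, ∑ e, ∑ w, ind F s(v, b) * (ind Y s(b, c) - ind F s(b, c))
      * ind F s(c, e) * (ind Y s(e, w) - ind F s(e, w)) * ind F s(w, a) * (1 - ind F s(v, a)) *
      (if (c = v ∧ e = b) ∨ (c = w ∧ e = a) ∨ (b = e ∧ c = w) then 0 else 1)) ≤ n ^ 4 * N := by
    rw [Finset.sum_comm]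
    calc _ ≤ ∑ b : Fin n, ∑ c : Fin n, ∑ e : Fin n, ∑ w : Fin n, N := by
          refine Finset.sum_le_sum fun b _ => ?_
          rw [Finset.sum_comm]
          refine Finset.sum_le_sum fun c _ => ?_
          rw [Finset.sum_comm]
          refine Finset.sum_le_sum fun e _ => ?_
          rw [Finset.sum_comm]
          exact Finset.sum_le_sum fun w _ => switch_six h.loop hva
      _ = _ := by simp; ring
  have h4 : nn d Y - N ≤ T ^ 6 * (N + N) := by
    have : ∑ F ∈ gr d Y, (1 - ind F s(v, a)) = nn d Y - N := by
      rw [Finset.sum_sub_distrib, ← nn_eq_sum]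
    rw [← this]
    refine h1.trans ?_
    gcongr
    · rw [div_le_iff₀ (by positivity)]; linarith
    · rw [div_le_iff₀ (by positivity)]; linarith
  have : 3 * T ^ 6 ≤ T ^ 7 := by nlinarith [pow_pos (show (0:ℝ) < T by linarith) 6]
  have : 1 ≤ T ^ 6 := one_le_pow₀ (by linarith)
  nlinarith

/-- Every allowed edge has probability at most `1 - T ^ (-7)`. -/
lemma crude_upper (h : C0 T lam B U d Y) (hn : 2 * B * T ^ 10 ≤ n) (hv : v ∈ U)
    (ha : a ∈ U) (hva : s(v, a) ∈ Y) : nn d Y ≤ T ^ 7 * ∑ F ∈ gr d Y, (1 - ind F s(v, a)) := by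
  have h1 := crude_lower h.compl hn hv ha hva
  rw [← nn_compl] at h1
  rw [sum_gr_compl]
  refine h1.trans (mul_le_mul_of_nonneg_left (Finset.sum_le_sum fun F hF => ?_)
    (pow_nonneg (by linarith [h.hT]) _))
  rw [ind_sdiff (mem_gr.1 hF).1, ind_of_mem hva]
  linarith

end crude

/-- The number of vertices `v` with `bv` an edge and `av` an allowed non-edge. -/
def lfun {n : ℕ} (a b : Fin n) (Y F : Finset (Sym2 (Fin n))) : ℝ :=
  ∑ v, ind F s(b, v) * (ind Y s(a, v) - ind F s(a, v))

section tail

variable {n : ℕ} {F G Y Z : Finset (Sym2 (Fin n))} {d : Fin n → ℝ} {a b u v w : Fin n}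
  {e f : Sym2 (Fin n)} {T lam B : ℝ} {U : Finset (Fin n)}

lemma ev_nonneg : 0 ≤ ev a v := by unfold ev; split_ifs <;> norm_num

lemma ev_le_one : ev a v ≤ 1 := by unfold ev; split_ifs <;> norm_num

lemma ev_self : ev a a = 1 := if_pos rfl

lemma ev_of_ne (h : v ≠ a) : ev a v = 0 := if_neg h

lemma ev_add_le (h : a ≠ b) : ev a v + ev b v ≤ 1 := by
  unfold ev; split_ifs with h1 h2 <;> simp_all

lemma dg_erase (hab : a ≠ b) (he : s(a, b) ∈ Y) : dg (Y.erase s(a, b)) = dg Y - ev a - ev b := by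
  rw [Finset.erase_eq, dg_sdiff (by simpa using he), dg_singleton hab, sub_sub]

lemma C0.shift (h : C0 T lam B U d Y) {d' : Fin n → ℝ} {Y' : Finset (Sym2 (Fin n))} {c : ℝ}
    (hc : 0 ≤ c) (hY : Y' ⊆ Y) (h1 : ∀ v, |d' v - d v| ≤ c) (h2 : ∀ v, dg Y v - dg Y' v ≤ c) :
    C0 T lam (B + c) U d' Y' where
  loop := h.loop.mono hY
  hU := h.hU
  hT := h.hT
  hB := by linarith [h.hB]
  lo := h.lo
  hi := h.hi
  deg := fun v hv => by
    have := h.deg v hv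
    have := h1 v
    calc |d' v - lam * n| = |(d' v - d v) + (d v - lam * n)| := by ring_nf
      _ ≤ _ := abs_add_le _ _
      _ ≤ _ := by linarith
  xd := fun v hv => by linarith [h.xd v hv, h2 v]

lemma C0.erase (h : C0 T lam B U d Y) (hab : s(a, b) ∈ Y) :
    C0 T lam (B + 1) U d (Y.erase s(a, b)) := by
  refine h.shift zero_le_one (Finset.erase_subset _ _) (by simp) fun v => ?_
  have hne := h.loop.ne hab
  rw [dg_erase hne hab]
  have := ev_add_le hne (v := v)
  simp only [Pi.sub_apply]; linarith

lemma C0.take (h : C0 T lam B U d Y) (hab : s(a, b) ∈ Y) :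
    C0 T lam (B + 1) U (d - ev a - ev b) (Y.erase s(a, b)) := by
  have hne := h.loop.ne hab
  refine h.shift zero_le_one (Finset.erase_subset _ _) (fun v => ?_) fun v => ?_
  · have := ev_add_le hne (v := v)
    have := ev_nonneg (a := a) (v := v)
    have := ev_nonneg (a := b) (v := v)
    simp only [Pi.sub_apply]; rw [abs_le]; constructor <;> linarith
  rw [dg_erase hne hab]
  have := ev_add_le hne (v := v)
  simp only [Pi.sub_apply]; linarith

/-- Exponential moment of the number of vertices joined to `b` but not to `a`. -/
lemma hit_product (hab : a ≠ b) (ha : a ∈ U) (hb : b ∈ U) (W : Finset (Fin n)) :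
    ∀ (B : ℝ) (d : Fin n → ℝ) (Y : Finset (Sym2 (Fin n))), C0 T lam B U d Y →
    2 * (B + 2 * W.card) * T ^ 10 ≤ n →
    (∀ v ∈ W, v ∈ U ∧ v ≠ a ∧ v ≠ b ∧ s(a, v) ∈ Y ∧ s(b, v) ∈ Y) →
    ∑ F ∈ gr d Y, ∏ v ∈ W, (1 - ind F s(b, v) * (1 - ind F s(a, v)) / 2)
      ≤ (1 - 1 / (2 * T ^ 14)) ^ W.card * nn d Y := by
  induction W using Finset.induction_on with
  | empty => intro B d Y _ _ _; simp [nn]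
  | insert v W hv ih =>
    intro B d Y h hn hW
    have hT := h.hT
    have hT0 : 0 < T := by linarith
    rw [Finset.card_insert_of_notMem hv] at hn ⊢
    push_cast at hn
    obtain ⟨vU, va, vb, hav, hbv⟩ := hW v (Finset.mem_insert_self _ _)
    set P : Finset (Sym2 (Fin n)) → ℝ :=
      fun F => ∏ v ∈ W, (1 - ind F s(b, v) * (1 - ind F s(a, v)) / 2) with hP
    have hne : ∀ v' ∈ W, v' ≠ v := fun v' h1 h2 => hv (h2 ▸ h1)
    have n1 : ∀ v' ∈ W, s(b, v') ≠ s(b, v) ∧ s(a, v') ≠ s(b, v) ∧ s(b, v') ≠ s(a, v) ∧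
        s(a, v') ≠ s(a, v) := by
      intro v' h1
      have h2 := hne v' h1
      obtain ⟨-, h3, h4, -⟩ := hW v' (Finset.mem_insert_of_mem h1)
      simp only [ne_eq, Sym2.eq_iff]
      refine ⟨?_, ?_, ?_, ?_⟩ <;> rintro (⟨h5, h6⟩ | ⟨h5, h6⟩)
      exacts [h2 h6, h4 h6, hab h5, h4 h6, hab h5.symm, h3 h6, h2 h6, h3 h6]
    have n2 : s(a, v) ≠ s(b, v) := by
      simp only [ne_eq, Sym2.eq_iff]
      rintro (⟨h5, h6⟩ | ⟨h5, h6⟩)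
      exacts [hab h5, va h5.symm]
    have P1 : ∀ F, P (insert s(b, v) F) = P F := by
      intro F
      refine Finset.prod_congr rfl fun v' h1 => ?_
      obtain ⟨q1, q2, -, -⟩ := n1 v' h1
      rw [ind_insert_of_ne q1, ind_insert_of_ne q2]
    have P2 : ∀ F, P (insert s(a, v) F) = P F := by
      intro F
      refine Finset.prod_congr rfl fun v' h1 => ?_
      obtain ⟨-, -, q1, q2⟩ := n1 v' h1
      rw [ind_insert_of_ne q1, ind_insert_of_ne q2]
    set r := (1 - 1 / (2 * T ^ 14)) with hr
    have hav' : s(a, v) ∈ Y.erase s(b, v) := Finset.mem_erase.2 ⟨n2, hav⟩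
    have hB := h.hB
    have hc0 : (0:ℝ) ≤ W.card := by positivity
    have hn' : 2 * (B + 2 + 2 * W.card) * T ^ 10 ≤ n := by
      refine le_trans (le_of_eq ?_) hn; ring
    have hT10 : 0 < T ^ 10 := by positivity
    have C1 := h.erase hbv
    have C2 := h.take hbv
    have C3 := C2.erase hav'
    have C4 := C2.take hav'
    have W1 : ∀ v' ∈ W, v' ∈ U ∧ v' ≠ a ∧ v' ≠ b ∧ s(a, v') ∈ Y.erase s(b, v)
        ∧ s(b, v') ∈ Y.erase s(b, v) := by
      intro v' h1
      obtain ⟨q1, q2, q3, q4⟩ := n1 v' h1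
      obtain ⟨p0, p1, p2, p3, p4⟩ := hW v' (Finset.mem_insert_of_mem h1)
      exact ⟨p0, p1, p2, Finset.mem_erase.2 ⟨q2, p3⟩, Finset.mem_erase.2 ⟨q1, p4⟩⟩
    have W2 : ∀ v' ∈ W, v' ∈ U ∧ v' ≠ a ∧ v' ≠ b ∧ s(a, v') ∈ (Y.erase s(b, v)).erase s(a, v)
        ∧ s(b, v') ∈ (Y.erase s(b, v)).erase s(a, v) := by
      intro v' h1
      obtain ⟨q1, q2, q3, q4⟩ := n1 v' h1
      obtain ⟨p0, p1, p2, p3, p4⟩ := W1 v' h1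
      exact ⟨p0, p1, p2, Finset.mem_erase.2 ⟨q4, p3⟩, Finset.mem_erase.2 ⟨q3, p4⟩⟩
    have I1 := ih _ _ _ C1 (le_trans (mul_le_mul_of_nonneg_right (by linarith) hT10.le) hn') W1
    have I3 := ih _ _ _ C3 (le_trans (mul_le_mul_of_nonneg_right (by linarith) hT10.le) hn') W2
    have I4 := ih _ _ _ C4 (le_trans (mul_le_mul_of_nonneg_right (by linarith) hT10.le) hn') W2
    have D1 : ∑ F ∈ gr d Y, (1 - ind F s(b, v)) * P F ≤ r ^ W.card *
        ∑ F ∈ gr d Y, (1 - ind F s(b, v)) := by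
      rw [sum_one_sub_ind_mul hbv, sum_one_sub_ind hbv]; exact I1
    have D3 : ∑ F ∈ gr d Y, ind F s(b, v) * ((1 - ind F s(a, v)) * P F) ≤ r ^ W.card *
        ∑ F ∈ gr d Y, ind F s(b, v) * (1 - ind F s(a, v)) := by
      rw [sum_ind_mul vb.symm hbv, sum_ind_mul vb.symm hbv]
      simp only [P1, ind_insert_of_ne n2]
      rw [sum_one_sub_ind_mul hav', sum_one_sub_ind hav']; exact I3
    have D4 : ∑ F ∈ gr d Y, ind F s(b, v) * (ind F s(a, v) * P F) ≤ r ^ W.card *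
        ∑ F ∈ gr d Y, ind F s(b, v) * ind F s(a, v) := by
      rw [sum_ind_mul vb.symm hbv, sum_ind_mul vb.symm hbv]
      simp only [P1, ind_insert_of_ne n2]
      rw [sum_ind_mul va.symm hav', sum_ind va.symm hav']
      simp only [P2]; exact I4
    have H1 := crude_lower h (le_trans (mul_le_mul_of_nonneg_right (by linarith) hT10.le) hn') hb vU
      hbv
    have H2 := crude_upper C2 (le_trans (mul_le_mul_of_nonneg_right (by linarith) hT10.le) hn')
      ha vU hav'
    have H3 : nn d Y ≤ T ^ 14 * ∑ F ∈ gr d Y, ind F s(b, v) * (1 - ind F s(a, v)) := by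
      rw [sum_ind vb.symm hbv] at H1
      rw [sum_ind_mul vb.symm hbv]
      simp only [ind_insert_of_ne n2]
      calc _ ≤ _ := H1
        _ ≤ _ := mul_le_mul_of_nonneg_left H2 (by positivity)
        _ = _ := by ring
    set H := ∑ F ∈ gr d Y, ind F s(b, v) * (1 - ind F s(a, v))
    have E1 : ∑ F ∈ gr d Y, ∏ v ∈ insert v W, (1 - ind F s(b, v) * (1 - ind F s(a, v)) / 2)
        = ∑ F ∈ gr d Y, (1 - ind F s(b, v)) * P F
        + (∑ F ∈ gr d Y, ind F s(b, v) * ((1 - ind F s(a, v)) * P F)) / 2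
        + ∑ F ∈ gr d Y, ind F s(b, v) * (ind F s(a, v) * P F) := by
      rw [Finset.sum_div, ← Finset.sum_add_distrib, ← Finset.sum_add_distrib]
      refine Finset.sum_congr rfl fun F _ => ?_
      rw [Finset.prod_insert hv]; ring
    have E2 : nn d Y = ∑ F ∈ gr d Y, (1 - ind F s(b, v)) + H
        + ∑ F ∈ gr d Y, ind F s(b, v) * ind F s(a, v) := by
      rw [nn_eq_sum, ← Finset.sum_add_distrib, ← Finset.sum_add_distrib]
      exact Finset.sum_congr rfl fun F _ => by ring
    have hr0 : 0 ≤ r := by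
      have : 1 ≤ T ^ 14 := one_le_pow₀ (by linarith)
      rw [hr, sub_nonneg, div_le_one (by positivity)]; linarith
    have hH : nn d Y / (2 * T ^ 14) ≤ H / 2 := by
      rw [div_le_iff₀ (by positivity)]; linarith
    rw [E1, pow_succ, mul_assoc]
    have : r ^ W.card * (nn d Y - H / 2) ≤ r ^ W.card * (r * nn d Y) := by
      refine mul_le_mul_of_nonneg_left ?_ (pow_nonneg hr0 _)
      rw [hr]
      have : (1 - 1 / (2 * T ^ 14)) * nn d Y = nn d Y - nn d Y / (2 * T ^ 14) := by ring
      linarith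
    refine le_trans ?_ this
    have : r ^ W.card * (nn d Y - H / 2) = r ^ W.card * ∑ F ∈ gr d Y, (1 - ind F s(b, v))
        + (r ^ W.card * H) / 2 + r ^ W.card * ∑ F ∈ gr d Y, ind F s(b, v) * ind F s(a, v) := by
      rw [E2]; ring
    linarith

end tail

section tail

variable {n : ℕ} {F G Y Z : Finset (Sym2 (Fin n))} {d : Fin n → ℝ} {a b u v w : Fin n}
  {e f : Sym2 (Fin n)} {T lam B : ℝ} {U : Finset (Fin n)}

lemma C0.exists_subset (h : C0 T lam B U d Y) (ha : a ∈ U) (hb : b ∈ U) (K : ℕ)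
    (hK : K + (2 * B + 4) ≤ n) : ∃ W : Finset (Fin n), W.card = K ∧
    ∀ v ∈ W, v ∈ U ∧ v ≠ a ∧ v ≠ b ∧ s(a, v) ∈ Y ∧ s(b, v) ∈ Y := by
  set V := Finset.univ.filter (fun v => v ∈ U ∧ v ≠ a ∧ v ≠ b ∧ s(a, v) ∈ Y ∧ s(b, v) ∈ Y) with hV
  have h1 : (n:ℝ) ≤ V.card + (2 * B + 4) := by
    have e1 : ∑ v : Fin n, (1:ℝ) ≤ ∑ v : Fin n, ((if v ∈ V then 1 else 0) +
        ((if v ∈ Uᶜ then 1 else 0) + ev a v + ev b v + (1 - ind Y s(a, v))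
        + (1 - ind Y s(b, v)))) := by
      refine Finset.sum_le_sum fun v _ => ?_
      have y1 : 0 ≤ 1 - ind Y s(a, v) := sub_nonneg.2 ind_le_one
      have y2 : 0 ≤ 1 - ind Y s(b, v) := sub_nonneg.2 ind_le_one
      have y3 := ev_nonneg (a := a) (v := v)
      have y4 := ev_nonneg (a := b) (v := v)
      have y5 : (0:ℝ) ≤ if v ∈ Uᶜ then (1:ℝ) else 0 := by split_ifs <;> norm_num
      have y6 : (0:ℝ) ≤ if v ∈ V then (1:ℝ) else 0 := by split_ifs <;> norm_num
      by_cases p1 : v ∈ U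
      swap
      · rw [if_pos (Finset.mem_compl.2 p1)] at *; linarith
      by_cases p2 : v = a
      · have : ev a v = 1 := by rw [p2, ev_self]
        linarith
      by_cases p3 : v = b
      · have : ev b v = 1 := by rw [p3, ev_self]
        linarith
      by_cases p4 : s(a, v) ∈ Y
      swap
      · rw [ind_of_notMem p4] at *; linarith
      by_cases p5 : s(b, v) ∈ Y
      swap
      · rw [ind_of_notMem p5] at *; linarith
      have : v ∈ V := by simp [hV, p1, p2, p3, p4, p5]
      rw [if_pos this]; linarith
    have e2 : ∑ v : Fin n, (1 - ind Y s(a, v)) = n - dg Y a := by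
      simp [dg, Finset.sum_sub_distrib]
    have e3 : ∑ v : Fin n, (1 - ind Y s(b, v)) = n - dg Y b := by
      simp [dg, Finset.sum_sub_distrib]
    have e4 : ∑ v : Fin n, ev a v = 1 := by simp [ev]
    have e5 : ∑ v : Fin n, ev b v = 1 := by simp [ev]
    have e6 : ∑ v : Fin n, (if v ∈ Uᶜ then (1:ℝ) else 0) = Uᶜ.card := by
      rw [Finset.sum_ite_mem]; simp
    have e7 : ∑ v : Fin n, (if v ∈ V then (1:ℝ) else 0) = V.card := by
      rw [Finset.sum_ite_mem]; simp
    simp only [Finset.sum_add_distrib] at e1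
    rw [e2, e3, e4, e5, e6, e7] at e1
    have := h.hU
    have := h.xd a ha
    have := h.xd b hb
    simp at e1
    simp at this
    have hU := h.hU
    simp only [Finset.card_compl, Fintype.card_fin] at hU
    linarith
  have h2 : K ≤ V.card := by
    have : (K:ℝ) ≤ V.card := by linarith
    exact_mod_cast this
  obtain ⟨W, hW, hc⟩ := Finset.exists_subset_card_eq h2
  refine ⟨W, hc, fun v hv => ?_⟩
  have := hW hv
  simpa [hV] using this

lemma exp_neg_lfun_le (hF : F ⊆ Y) (W : Finset (Fin n)) (hW : ∀ v ∈ W, s(a, v) ∈ Y) :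
    Real.exp (-lfun a b Y F) ≤ ∏ v ∈ W, (1 - ind F s(b, v) * (1 - ind F s(a, v)) / 2) := by
  have h1 : ∑ v ∈ W, ind F s(b, v) * (1 - ind F s(a, v)) ≤ lfun a b Y F := by
    unfold lfun
    calc _ = ∑ v ∈ W, ind F s(b, v) * (ind Y s(a, v) - ind F s(a, v)) :=
          Finset.sum_congr rfl fun v hv => by rw [ind_of_mem (hW v hv)]
      _ ≤ _ := Finset.sum_le_sum_of_subset_of_nonneg (Finset.subset_univ _)
          fun v _ _ => mul_nonneg ind_nonneg (ind_sub_nonneg hF)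
  calc _ ≤ Real.exp (∑ v ∈ W, -(ind F s(b, v) * (1 - ind F s(a, v)))) := by
        rw [Real.exp_le_exp, Finset.sum_neg_distrib]; linarith
    _ = ∏ v ∈ W, Real.exp (-(ind F s(b, v) * (1 - ind F s(a, v)))) := Real.exp_sum _ _
    _ ≤ _ := by
        refine Finset.prod_le_prod (fun _ _ => (Real.exp_pos _).le) fun v _ => ?_
        have : Real.exp (-1) ≤ 1 / 2 := by
          rw [Real.exp_neg, inv_le_comm₀ (Real.exp_pos _) (by norm_num)]
          have := Real.add_one_le_exp (1:ℝ)
          norm_num at this ⊢; exact this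
        rcases ind_eq_zero_or_one (F := F) (e := s(b, v)) with h | h <;>
          rcases ind_eq_zero_or_one (F := F) (e := s(a, v)) with h' | h' <;> rw [h, h'] <;>
          norm_num
        norm_num at this; exact this

/-- It is very unlikely that few vertices are joined to `b` but not to `a`. -/
lemma lower_tail (h : C0 T lam B U d Y) (hab : a ≠ b) (ha : a ∈ U) (hb : b ∈ U)
    (hn : B * T ^ 12 ≤ n) (hn' : T ^ 30 ≤ n) (hlog : Real.log n ≤ T) :
    ∑ F ∈ gr d Y, (if lfun a b Y F < n / T ^ 27 then (1:ℝ) else 0) ≤ nn d Y / (n:ℝ) ^ 10 := by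
  have hT := h.hT
  have hB := h.hB
  have hT0 : 0 < T := by linarith
  have hn0 : (0:ℝ) < n := lt_of_lt_of_le (by positivity) hn'
  set K := ⌊(n:ℝ) / T ^ 12⌋₊ with hK
  have k0 : B ≤ n / T ^ 12 := by rw [le_div_iff₀ (by positivity)]; exact hn
  have k1 : (K:ℝ) ≤ n / T ^ 12 := Nat.floor_le (by positivity)
  have k2 : n / T ^ 12 ≤ 2 * K := by
    have := Nat.lt_floor_add_one ((n:ℝ) / T ^ 12)
    have h3 : (1:ℝ) ≤ K := by
      have : 1 ≤ K := Nat.le_floor (by push_cast; linarith)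
      exact_mod_cast this
    linarith
  have k3 : (n:ℝ) / T ^ 12 * T ^ 12 = n := by field_simp
  have k4 : (n:ℝ) / T ^ 12 * (T ^ 10 * 10000) ≤ n := by
    calc _ ≤ (n:ℝ) / T ^ 12 * T ^ 12 := by
          refine mul_le_mul_of_nonneg_left ?_ (by positivity)
          rw [show T ^ 12 = T ^ 10 * T ^ 2 by ring]
          exact mul_le_mul_of_nonneg_left (by nlinarith) (by positivity)
      _ = n := k3
  have k5 : (1:ℝ) ≤ T ^ 10 := one_le_pow₀ (by linarith)
  obtain ⟨W, hWc, hW⟩ := h.exists_subset ha hb K (by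
    have : (n:ℝ) / T ^ 12 * 1 ≤ n / T ^ 12 * T ^ 10 := by gcongr
    nlinarith only [this, k4, k0, k1, hB])
  have key := hit_product hab ha hb W B d Y h (by
    rw [hWc]
    nlinarith only [k4, k0, k1, pow_pos hT0 10]) hW
  set J := (n:ℝ) / T ^ 27 with hJ
  have e1 : ∑ F ∈ gr d Y, (if lfun a b Y F < J then (1:ℝ) else 0) ≤
      Real.exp J * ∑ F ∈ gr d Y, ∏ v ∈ W, (1 - ind F s(b, v) * (1 - ind F s(a, v)) / 2) := by
    rw [Finset.mul_sum]
    refine Finset.sum_le_sum fun F hF => ?_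
    have h1 := exp_neg_lfun_le (a := a) (b := b) (mem_gr.1 hF).1 W fun v hv => (hW v hv).2.2.2.1
    have h2 : Real.exp J * Real.exp (-lfun a b Y F) ≤ _ :=
      mul_le_mul_of_nonneg_left h1 (Real.exp_pos J).le
    rw [← Real.exp_add] at h2
    refine le_trans ?_ h2
    split_ifs with h3
    · rw [Real.one_le_exp_iff]; linarith
    · exact (Real.exp_pos _).le
  have e2 : (1 - 1 / (2 * T ^ 14)) ^ W.card ≤ Real.exp (- (n / (4 * T ^ 26))) := by
    have q0 : 1 / (2 * T ^ 14) ≤ 1 := by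
      have : 1 ≤ T ^ 14 := one_le_pow₀ (by linarith)
      rw [div_le_one (by positivity)]; linarith
    have q1 : 1 - 1 / (2 * T ^ 14) ≤ Real.exp (-(1 / (2 * T ^ 14))) := by
      have := Real.add_one_le_exp (-(1 / (2 * T ^ 14))); linarith
    calc _ ≤ Real.exp (-(1 / (2 * T ^ 14))) ^ W.card := pow_le_pow_left₀ (by linarith) q1 _
      _ = Real.exp (K * (-(1 / (2 * T ^ 14)))) := by rw [hWc, Real.exp_nat_mul]
      _ ≤ _ := by
        rw [Real.exp_le_exp]
        have : n / (4 * T ^ 26) = n / T ^ 12 / 2 * (1 / (2 * T ^ 14)) := by field_simp; norm_num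
        rw [this]
        have : 0 ≤ 1 / (2 * T ^ 14) := by positivity
        nlinarith only [this, k2]
  have e3 : Real.exp J * Real.exp (- (n / (4 * T ^ 26))) ≤ 1 / (n:ℝ) ^ 10 := by
    rw [← Real.exp_add, one_div, ← Real.exp_log (show (0:ℝ) < ((n:ℝ)^10)⁻¹ by positivity),
      Real.exp_le_exp, Real.log_inv, Real.log_pow]
    have q1 : J ≤ n / (100 * T ^ 26) := by
      rw [hJ]
      refine div_le_div_of_nonneg_left hn0.le (by positivity) ?_
      rw [show T ^ 27 = T * T ^ 26 by ring]; gcongr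
    have q2 : (n:ℝ) / (100 * T ^ 26) = n / T ^ 26 / 100 := by field_simp
    have q3 : (n:ℝ) / (4 * T ^ 26) = n / T ^ 26 / 4 := by field_simp
    have q4 : T ^ 4 ≤ n / T ^ 26 := by
      rw [le_div_iff₀ (by positivity), ← pow_add]; exact hn'
    have q5 : 100 * T ≤ T ^ 4 := by
      have : (100:ℝ) ^ 3 ≤ T ^ 3 := by gcongr
      rw [show T ^ 4 = T ^ 3 * T by ring]; nlinarith
    push_cast
    linarith
  have := nn_nonneg (d := d) (Y := Y)
  calc _ ≤ _ := e1
    _ ≤ Real.exp J * (Real.exp (- (n / (4 * T ^ 26))) * nn d Y) := by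
        refine mul_le_mul_of_nonneg_left (key.trans ?_) (Real.exp_pos _).le
        gcongr
    _ = Real.exp J * Real.exp (- (n / (4 * T ^ 26))) * nn d Y := by ring
    _ ≤ 1 / (n:ℝ) ^ 10 * nn d Y := by gcongr
    _ = _ := by ring

end tail

/-- The correction to the degree difference coming from the forbidden pairs at `a` and `b`. -/
def xi {n : ℕ} (a b : Fin n) (Y F : Finset (Sym2 (Fin n))) : ℝ :=
  ∑ v, (ind F s(a, v) * (1 - ind Y s(b, v)) - ind F s(b, v) * (1 - ind Y s(a, v)))

section switching

variable {n : ℕ} {F G Y Z : Finset (Sym2 (Fin n))} {d : Fin n → ℝ} {a b u v w : Fin n}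
  {e f : Sym2 (Fin n)} {T lam B : ℝ} {U : Finset (Fin n)}

lemma lfun_insert_right (hab : a ≠ b) (hva : v ≠ a) (hav : s(a, v) ∈ Y) (hbF : s(b, v) ∉ F)
    (haF : s(a, v) ∉ F) : lfun a b Y (insert s(b, v) F) = lfun a b Y F + 1 := by
  rw [← sub_eq_iff_eq_add']
  unfold lfun
  rw [← Finset.sum_sub_distrib, Finset.sum_eq_single v]
  · have : s(a, v) ≠ s(b, v) := by
      simp only [ne_eq, Sym2.eq_iff]; rintro (⟨h, -⟩ | ⟨h, -⟩)
      exacts [hab h, hva h.symm]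
    rw [ind_insert_self, ind_insert_of_ne this, ind_of_mem hav, ind_of_notMem hbF,
      ind_of_notMem haF]; ring
  · intro w _ hw
    have h1 : s(b, w) ≠ s(b, v) := fun h => hw (Sym2.congr_right.1 h)
    have h2 : s(a, w) ≠ s(b, v) := by
      simp only [ne_eq, Sym2.eq_iff]; rintro (⟨h, -⟩ | ⟨h, -⟩)
      exacts [hab h, hva h.symm]
    rw [ind_insert_of_ne h1, ind_insert_of_ne h2]; ring
  · simp

lemma lfun_insert_left (hab : a ≠ b) (hvb : v ≠ b) (hbF : s(b, v) ∉ F) :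
    lfun a b Y (insert s(a, v) F) = lfun a b Y F := by
  unfold lfun
  refine Finset.sum_congr rfl fun w _ => ?_
  have h2 : s(b, w) ≠ s(a, v) := by
    simp only [ne_eq, Sym2.eq_iff]; rintro (⟨h, -⟩ | ⟨h, -⟩)
    exacts [hab h.symm, hvb h.symm]
  rw [ind_insert_of_ne h2]
  by_cases hw : w = v
  · rw [hw, ind_of_notMem hbF]; ring
  · have h1 : s(a, w) ≠ s(a, v) := fun h => hw (Sym2.congr_right.1 h)
    rw [ind_insert_of_ne h1]

lemma lfun_nonneg (hF : F ⊆ Y) : 0 ≤ lfun a b Y F :=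
  Finset.sum_nonneg fun _ _ => mul_nonneg ind_nonneg (ind_sub_nonneg hF)

lemma lfun_le : lfun a b Y F ≤ n := by
  unfold lfun
  calc _ ≤ ∑ v : Fin n, (1:ℝ) := Finset.sum_le_sum fun v _ => by
        have := ind_nonneg (F := F) (e := s(b, v))
        have := ind_le_one (F := F) (e := s(b, v))
        have := ind_nonneg (F := F) (e := s(a, v))
        have := ind_le_one (F := Y) (e := s(a, v))
        nlinarith
    _ = n := by simp

/-- Moving an edge end from `a` to `b`. -/
lemma lfun_switch (hY : loopless Y) (hab : a ≠ b) (φ : ℝ → ℝ) :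
    ∑ F ∈ gr (d - ev b) Y, lfun b a Y F * φ (lfun a b Y F)
      = ∑ F ∈ gr (d - ev a) Y, lfun a b Y F * φ (lfun a b Y F - 1) := by
  have e1 : ∀ (a b : Fin n) (F : Finset (Sym2 (Fin n))) (x : ℝ), lfun b a Y F * x =
      ∑ v, ind F s(a, v) * (ind Y s(b, v) - ind F s(b, v)) * x := fun a b F x => by
    rw [lfun, Finset.sum_mul]
  simp only [e1 a b, e1 b a]
  rw [Finset.sum_comm, Finset.sum_comm (s := gr (d - ev a) Y)]
  refine Finset.sum_congr rfl fun v _ => ?_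
  by_cases hav : s(a, v) ∈ Y
  swap
  · rw [Finset.sum_eq_zero, Finset.sum_eq_zero]
    · intro F hF; rw [ind_eq_zero_of_mem_gr hF hav, ind_of_notMem hav]; ring
    · intro F hF; rw [ind_eq_zero_of_mem_gr hF hav]; ring
  by_cases hbv : s(b, v) ∈ Y
  swap
  · rw [Finset.sum_eq_zero, Finset.sum_eq_zero]
    · intro F hF; rw [ind_eq_zero_of_mem_gr hF hbv]; ring
    · intro F hF; rw [ind_eq_zero_of_mem_gr hF hbv, ind_of_notMem hbv]; ring
  have hva := hY.ne hav
  have hvb := hY.ne hbv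
  have hne : s(a, v) ≠ s(b, v) := by
    simp only [ne_eq, Sym2.eq_iff]; rintro (⟨h, -⟩ | ⟨h, -⟩)
    exacts [hab h, hva h]
  rw [ind_of_mem hav, ind_of_mem hbv]
  simp only [mul_assoc]
  rw [sum_ind_mul hva hav, sum_ind_mul hvb hbv]
  simp only [ind_insert_of_ne hne, ind_insert_of_ne hne.symm]
  rw [sum_one_sub_ind_mul (Finset.mem_erase.2 ⟨hne.symm, hbv⟩),
    sum_one_sub_ind_mul (Finset.mem_erase.2 ⟨hne, hav⟩), Finset.erase_right_comm,
    sub_right_comm d (ev b)]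
  refine Finset.sum_congr rfl fun F hF => ?_
  have h1 : s(a, v) ∉ F := fun h => by
    simpa using (mem_gr.1 hF).1 h
  have h2 : s(b, v) ∉ F := fun h => by
    simpa using (mem_gr.1 hF).1 h
  rw [lfun_insert_left hab hvb.symm h2, lfun_insert_right hab hva.symm hav h2 h1]
  ring_nf

lemma lfun_sub : lfun b a Y F - lfun a b Y F = dg F a - dg F b - xi a b Y F := by
  unfold lfun dg xi
  simp only [← Finset.sum_sub_distrib]
  exact Finset.sum_congr rfl fun v _ => by ring

lemma abs_xi_le (h : C0 T lam B U d Y) (ha : a ∈ U) (hb : b ∈ U) : |xi a b Y F| ≤ B := by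
  have key : ∀ {a b : Fin n}, b ∈ U → 0 ≤ ∑ v, ind F s(a, v) * (1 - ind Y s(b, v)) ∧
      ∑ v, ind F s(a, v) * (1 - ind Y s(b, v)) ≤ B := fun {a b} hb => by
    refine ⟨Finset.sum_nonneg fun v _ => mul_nonneg ind_nonneg (sub_nonneg.2 ind_le_one), ?_⟩
    calc _ ≤ ∑ v, (1 - ind Y s(b, v)) := Finset.sum_le_sum fun v _ =>
          mul_le_of_le_one_left (sub_nonneg.2 ind_le_one) ind_le_one
      _ = n - dg Y b := by simp [dg, Finset.sum_sub_distrib]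
      _ ≤ B := h.xd b hb
  have h1 := key (a := a) hb
  have h2 := key (a := b) ha
  rw [xi, Finset.sum_sub_distrib, abs_le]
  constructor <;> linarith

/-- The ratio of the numbers of graphs for two neighbouring degree sequences. -/
lemma switch_identity (h : C0 T lam B U (d - ev a) Y) (hab : a ≠ b) (ha : a ∈ U) (hb : b ∈ U)
    (hn : B * T ^ 12 ≤ n) (hn' : T ^ 30 ≤ n) (hlog : Real.log n ≤ T) :
    |nn (d - ev a) Y - nn (d - ev b) Y - ∑ F ∈ gr (d - ev b) Y,
      (d a - d b - xi a b Y F) / (lfun a b Y F + 1)| ≤ nn (d - ev a) Y / (n:ℝ) ^ 10 := by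
  have hT0 : 0 < T := by linarith [h.hT]
  have hn0 : (0:ℝ) < n := lt_of_lt_of_le (by positivity) hn'
  have key := lfun_switch (d := d) h.loop hab (fun t => 1 / (t + 1))
  have e1 : ∑ F ∈ gr (d - ev b) Y, lfun b a Y F * (1 / (lfun a b Y F + 1)) =
      nn (d - ev b) Y + ∑ F ∈ gr (d - ev b) Y, (d a - d b - xi a b Y F) / (lfun a b Y F + 1) := by
    rw [nn_eq_sum, ← Finset.sum_add_distrib]
    refine Finset.sum_congr rfl fun F hF => ?_
    have h1 := lfun_sub (a := a) (b := b) (Y := Y) (F := F)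
    rw [(mem_gr.1 hF).2] at h1
    simp only [Pi.sub_apply, ev_self, ev_of_ne hab] at h1
    have h2 := lfun_nonneg (a := a) (b := b) (mem_gr.1 hF).1
    have h3 : lfun b a Y F = lfun a b Y F + 1 + (d a - d b - xi a b Y F) := by linarith
    rw [h3]; field_simp
  have e2 : ∑ F ∈ gr (d - ev a) Y, lfun a b Y F * (1 / (lfun a b Y F - 1 + 1)) =
      nn (d - ev a) Y - ∑ F ∈ gr (d - ev a) Y, (if lfun a b Y F = 0 then (1:ℝ) else 0) := by
    rw [nn_eq_sum, ← Finset.sum_sub_distrib]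
    refine Finset.sum_congr rfl fun F hF => ?_
    rw [sub_add_cancel]
    split_ifs with h1
    · rw [h1]; simp
    · field_simp; simp
  rw [e1, e2] at key
  have e3 : ∑ F ∈ gr (d - ev a) Y, (if lfun a b Y F = 0 then (1:ℝ) else 0) ≤
      nn (d - ev a) Y / (n:ℝ) ^ 10 := by
    refine le_trans (Finset.sum_le_sum fun F _ => ?_) (lower_tail h hab ha hb hn hn' hlog)
    split_ifs with h1 h2 h2 <;> norm_num
    exact h2 (by rw [h1]; positivity)
  have e4 : 0 ≤ ∑ F ∈ gr (d - ev a) Y, (if lfun a b Y F = 0 then (1:ℝ) else 0) :=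
    Finset.sum_nonneg fun _ _ => by split_ifs <;> norm_num
  rw [abs_le]
  constructor <;> linarith

/-- Sums of `1 / (l + 1)`. -/
lemma sum_inv_lfun_le (h : C0 T lam B U d Y) (hab : a ≠ b) (ha : a ∈ U) (hb : b ∈ U)
    (hn : B * T ^ 12 ≤ n) (hn' : T ^ 30 ≤ n) (hlog : Real.log n ≤ T) :
    ∑ F ∈ gr d Y, 1 / (lfun a b Y F + 1) ≤ 2 * T ^ 27 / n * nn d Y := by
  have hT := h.hT
  have hT0 : 0 < T := by linarith
  have hn0 : (0:ℝ) < n := lt_of_lt_of_le (by positivity) hn'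
  have hT1 : 1 ≤ T ^ 27 := one_le_pow₀ (by linarith)
  have hn1 : (1:ℝ) ≤ n := le_trans (one_le_pow₀ (by linarith)) hn'
  have h1 := lower_tail h hab ha hb hn hn' hlog
  have h2 : ∑ F ∈ gr d Y, 1 / (lfun a b Y F + 1) ≤ ∑ F ∈ gr d Y,
      ((if lfun a b Y F < n / T ^ 27 then (1:ℝ) else 0) + T ^ 27 / n) := by
    refine Finset.sum_le_sum fun F hF => ?_
    have h3 := lfun_nonneg (a := a) (b := b) (mem_gr.1 hF).1
    split_ifs with h4
    · have : 1 / (lfun a b Y F + 1) ≤ 1 := by rw [div_le_one (by linarith)]; linarith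
      have : 0 ≤ T ^ 27 / (n:ℝ) := by positivity
      linarith
    · have h5 : (n:ℝ) / T ^ 27 ≤ lfun a b Y F + 1 := by linarith
      have := one_div_le_one_div_of_le (by positivity) h5
      rw [one_div_div] at this; linarith
  rw [Finset.sum_add_distrib, Finset.sum_const, nsmul_eq_mul] at h2
  change _ ≤ _ + nn d Y * _ at h2
  have h3 := nn_nonneg (d := d) (Y := Y)
  have h4 : nn d Y / (n:ℝ) ^ 10 ≤ T ^ 27 / n * nn d Y := by
    have : 1 / (n:ℝ) ^ 10 ≤ T ^ 27 / n := by
      rw [div_le_div_iff₀ (by positivity) hn0]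
      have : (n:ℝ) ^ 1 ≤ n ^ 10 := pow_le_pow_right₀ hn1 (by norm_num)
      nlinarith [pow_pos hn0 10]
    calc nn d Y / (n:ℝ) ^ 10 = 1 / (n:ℝ) ^ 10 * nn d Y := by ring
      _ ≤ _ := by gcongr
  calc _ ≤ _ := h2
    _ ≤ T ^ 27 / n * nn d Y + nn d Y * (T ^ 27 / n) := by linarith
    _ = _ := by ring

lemma C0.swap (h : C0 T lam B U (d - ev a) Y) : C0 T lam (B + 1) U (d - ev b) Y := by
  refine h.shift zero_le_one subset_rfl (fun v => ?_) (by simp)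
  have h1 := ev_nonneg (a := a) (v := v)
  have h2 := ev_nonneg (a := b) (v := v)
  have h3 := ev_le_one (a := a) (v := v)
  have h4 := ev_le_one (a := b) (v := v)
  simp only [Pi.sub_apply]
  rw [abs_le]; constructor <;> linarith

lemma abs_sub_le_of_C0 (h : C0 T lam B U (d - ev a) Y) (hab : a ≠ b) (ha : a ∈ U) (hb : b ∈ U) :
    |d a - d b| ≤ 2 * B + 1 := by
  have h1 := h.deg a ha
  have h2 := h.deg b hb
  simp only [Pi.sub_apply, ev_self, ev_of_ne hab.symm] at h1 h2
  rw [abs_le] at h1 h2 ⊢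
  constructor <;> linarith

/-- The crude ratio bound. -/
lemma ratio_crude (h : C0 T lam B U (d - ev a) Y) (hab : a ≠ b) (ha : a ∈ U) (hb : b ∈ U)
    (hn : B * T ^ 29 ≤ n) (hn' : T ^ 30 ≤ n) (hlog : Real.log n ≤ T) :
    |nn (d - ev a) Y - nn (d - ev b) Y| ≤ T ^ 28 * B / n * nn (d - ev b) Y := by
  have hT := h.hT
  have hB := h.hB
  have hT0 : 0 < T := by linarith
  have hB0 : 0 < B := by linarith
  have hn0 : (0:ℝ) < n := lt_of_lt_of_le (by positivity) hn'
  have p1 : T ^ 12 ≤ T ^ 29 := pow_le_pow_right₀ (by linarith) (by norm_num)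
  have p2 : T * T ^ 28 = T ^ 29 := by ring
  have p3 : T ^ 12 ≤ T ^ 28 := pow_le_pow_right₀ (by linarith) (by norm_num)
  have hTT : 100 * T ^ 28 ≤ T ^ 29 := by
    rw [← p2]; exact mul_le_mul_of_nonneg_right hT (by positivity)
  have hn1 : B * T ^ 12 ≤ n := le_trans (by gcongr) hn
  have hn2 : (B + 1) * T ^ 12 ≤ n := le_trans (by nlinarith only [p3, hTT, hB, pow_pos hT0 28]) hn
  have h1 := switch_identity h hab ha hb hn1 hn' hlog
  have h2 := sum_inv_lfun_le (h.swap (b := b)) hab ha hb hn2 hn' hlog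
  have hΔ := abs_sub_le_of_C0 h hab ha hb
  set Na := nn (d - ev a) Y
  set Nb := nn (d - ev b) Y
  have hNa : 0 ≤ Na := nn_nonneg
  have hNb : 0 ≤ Nb := nn_nonneg
  have h3 : |∑ F ∈ gr (d - ev b) Y, (d a - d b - xi a b Y F) / (lfun a b Y F + 1)| ≤
      (3 * B + 1) * (2 * T ^ 27 / n * Nb) := by
    refine le_trans (Finset.abs_sum_le_sum_abs _ _) (le_trans ?_
      (mul_le_mul_of_nonneg_left h2 (by linarith)))
    rw [Finset.mul_sum]
    refine Finset.sum_le_sum fun F hF => ?_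
    have h4 := lfun_nonneg (a := a) (b := b) (mem_gr.1 hF).1
    have h5 := abs_xi_le (F := F) h ha hb
    rw [abs_div, abs_of_pos (by linarith : 0 < lfun a b Y F + 1), mul_one_div]
    gcongr
    calc _ ≤ |d a - d b| + |xi a b Y F| := abs_sub _ _
      _ ≤ _ := by linarith
  have h6 : (3 * B + 1) * (2 * T ^ 27 / n * Nb) ≤ T ^ 28 * B / n * Nb / 10 := by
    have : (3 * B + 1) * (2 * T ^ 27) ≤ T ^ 28 * B / 10 := by
      rw [show T ^ 28 = T * T ^ 27 by ring]
      nlinarith only [hB, hT, pow_pos hT0 27, mul_nonneg (sub_nonneg.2 hT) (mul_pos (pow_pos hT0 27) hB0).le]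
    calc _ = (3 * B + 1) * (2 * T ^ 27) / n * Nb := by ring
      _ ≤ (T ^ 28 * B / 10) / n * Nb := by gcongr
      _ = _ := by ring
  have h7 : T ^ 28 * B / n ≤ 1 := by
    rw [div_le_one hn0]; nlinarith only [hTT, hn, hB0, pow_pos hT0 28]
  have hn1' : (100:ℝ) ≤ n := by
    calc (100:ℝ) ≤ T := hT
      _ = T ^ 1 := by ring
      _ ≤ T ^ 30 := pow_le_pow_right₀ (by linarith) (by norm_num)
      _ ≤ n := hn'
  have h8 : Na / (n:ℝ) ^ 10 ≤ Na / n / 100 := by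
    rw [div_div]
    refine div_le_div_of_nonneg_left hNa (by positivity) ?_
    calc (n:ℝ) * 100 ≤ n * n := by gcongr
      _ = n ^ 2 := by ring
      _ ≤ n ^ 10 := pow_le_pow_right₀ (by linarith) (by norm_num)
  have h9 : Na / n ≤ Na / 100 := by gcongr
  have h10 := abs_le.1 (le_trans h3 h6)
  have h11 := abs_le.1 (le_trans h1 h8)
  have h12 : T ^ 28 * B / n * Nb ≤ 1 * Nb := by gcongr
  have h13 : Na ≤ 2 * Nb := by linarith
  have h14 : Na / n ≤ 2 * (T ^ 28 * B / n * Nb) := by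
    calc Na / n ≤ 2 * Nb / n := by gcongr
      _ = 2 * (1 / n * Nb) := by ring
      _ ≤ 2 * (T ^ 28 * B / n * Nb) := by
        gcongr
        have : 1 ≤ T ^ 28 := one_le_pow₀ (by linarith)
        nlinarith
  rw [abs_le]
  constructor <;> linarith

end switching

section fourcycle

variable {n : ℕ} {F G Y Z : Finset (Sym2 (Fin n))} {d : Fin n → ℝ} {a b u v w : Fin n}
  {e f : Sym2 (Fin n)} {T lam B : ℝ} {U : Finset (Fin n)}

/-- The edges of `Y` meeting `a` or `b`. -/
def starE (a b : Fin n) (Y : Finset (Sym2 (Fin n))) : Finset (Sym2 (Fin n)) :=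
  Y.filter fun e => a ∈ e ∨ b ∈ e

lemma star_subset : starE a b Y ⊆ Y := Finset.filter_subset _ _

lemma sum_inter_eq (hZ : Z ⊆ Y) (g : Finset (Sym2 (Fin n)) → ℝ) :
    ∑ F ∈ gr d Y, g (F ∩ Z) = ∑ W ∈ Z.powerset, g W * nn (d - dg W) (Y \ Z) := by
  rw [← Finset.sum_fiberwise_of_maps_to (s := gr d Y) (t := Z.powerset) (g := fun F => F ∩ Z)
    fun F _ => Finset.mem_powerset.2 Finset.inter_subset_right]
  refine Finset.sum_congr rfl fun W hW => ?_
  rw [Finset.mem_powerset] at hW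
  rw [sum_filter_inter hZ hW (fun F => g (F ∩ Z)), nn_eq_sum, Finset.mul_sum]
  refine Finset.sum_congr rfl fun F hF => ?_
  have hd : Disjoint F Z :=
    Finset.disjoint_of_subset_left (mem_gr.1 hF).1 Finset.sdiff_disjoint
  rw [mul_one, Finset.union_inter_distrib_right, Finset.disjoint_iff_inter_eq_empty.1 hd,
    Finset.inter_eq_left.2 hW, Finset.empty_union]

lemma ind_inter_star (hF : F ⊆ Y) (h : a ∈ e ∨ b ∈ e) : ind (F ∩ starE a b Y) e = ind F e := by
  unfold ind
  congr 1
  simp only [Finset.mem_inter, starE, Finset.mem_filter, eq_iff_iff]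
  exact ⟨fun h => h.1, fun h1 => ⟨h1, hF h1, h⟩⟩

lemma lfun_inter_star (hF : F ⊆ Y) : lfun a b Y (F ∩ starE a b Y) = lfun a b Y F := by
  unfold lfun
  refine Finset.sum_congr rfl fun v _ => ?_
  rw [ind_inter_star hF (by simp), ind_inter_star hF (by simp)]

lemma lfun_insert_left_of_mem (hab : a ≠ b) (hvb : v ≠ b) (hav : s(a, v) ∈ Y) (hbF : s(b, v) ∈ F)
    (haF : s(a, v) ∉ F) : lfun a b Y (insert s(a, v) F) = lfun a b Y F - 1 := by
  rw [eq_sub_iff_add_eq', ← eq_sub_iff_add_eq]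
  unfold lfun
  rw [← Finset.sum_sub_distrib, Finset.sum_eq_single v]
  · have : s(b, v) ≠ s(a, v) := by
      simp only [ne_eq, Sym2.eq_iff]; rintro (⟨h, -⟩ | ⟨h, -⟩)
      exacts [hab h.symm, hvb h.symm]
    rw [ind_insert_self, ind_insert_of_ne this, ind_of_mem hav, ind_of_mem hbF,
      ind_of_notMem haF]; ring
  · intro w _ hw
    have h1 : s(a, w) ≠ s(a, v) := fun h => hw (Sym2.congr_right.1 h)
    have h2 : s(b, w) ≠ s(a, v) := by
      simp only [ne_eq, Sym2.eq_iff]; rintro (⟨h, -⟩ | ⟨h, -⟩)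
      exacts [hab h.symm, hvb h.symm]
    rw [ind_insert_of_ne h1, ind_insert_of_ne h2]; ring
  · simp

/-- The configuration in which `u` is joined to both `a` and `b`, and `v` to neither. -/
def pairIn {n : ℕ} (a b u v : Fin n) (Y F : Finset (Sym2 (Fin n))) : ℝ :=
  ind F s(a, u) * ind F s(b, u) * ((ind Y s(a, v) - ind F s(a, v)) *
    (ind Y s(b, v) - ind F s(b, v)))

/-- The configuration in which `u` is joined to `b` only, and `v` to `a` only. -/
def pairOut {n : ℕ} (a b u v : Fin n) (Y F : Finset (Sym2 (Fin n))) : ℝ :=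
  ind F s(b, u) * (ind Y s(a, u) - ind F s(a, u)) * (ind F s(a, v) *
    (ind Y s(b, v) - ind F s(b, v)))

lemma pairIn_inter_star (hF : F ⊆ Y) :
    pairIn a b u v Y (F ∩ starE a b Y) = pairIn a b u v Y F := by
  unfold pairIn
  simp only [ind_inter_star hF (show a ∈ s(a, u) ∨ b ∈ s(a, u) by simp),
    ind_inter_star hF (show a ∈ s(a, v) ∨ b ∈ s(a, v) by simp),
    ind_inter_star hF (show a ∈ s(b, u) ∨ b ∈ s(b, u) by simp),
    ind_inter_star hF (show a ∈ s(b, v) ∨ b ∈ s(b, v) by simp)]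

lemma pairOut_inter_star (hF : F ⊆ Y) :
    pairOut a b u v Y (F ∩ starE a b Y) = pairOut a b u v Y F := by
  unfold pairOut
  simp only [ind_inter_star hF (show a ∈ s(a, u) ∨ b ∈ s(a, u) by simp),
    ind_inter_star hF (show a ∈ s(a, v) ∨ b ∈ s(a, v) by simp),
    ind_inter_star hF (show a ∈ s(b, u) ∨ b ∈ s(b, u) by simp),
    ind_inter_star hF (show a ∈ s(b, v) ∨ b ∈ s(b, v) by simp)]

lemma pairIn_nonneg (hF : F ⊆ Y) : 0 ≤ pairIn a b u v Y F :=
  mul_nonneg (mul_nonneg ind_nonneg ind_nonneg)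
    (mul_nonneg (ind_sub_nonneg hF) (ind_sub_nonneg hF))

lemma mul_ind_sub (hF : F ⊆ Y) : ind F e * (ind Y e - ind F e) = 0 := by
  by_cases h : e ∈ F
  · rw [ind_of_mem h, ind_of_mem (hF h)]; ring
  · rw [ind_of_notMem h]; ring

lemma dg_star_le {W : Finset (Sym2 (Fin n))} (hW : W ⊆ starE a b Y) (hva : v ≠ a) (hvb : v ≠ b) :
    dg W v ≤ 2 := by
  calc dg W v ≤ ∑ u, (ev a u + ev b u) := by
        refine Finset.sum_le_sum fun u _ => ?_
        by_cases h : s(v, u) ∈ W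
        · rw [ind_of_mem h]
          have h1 := (Finset.mem_filter.1 (hW h)).2
          simp only [Sym2.mem_iff, hva.symm, hvb.symm, false_or] at h1
          rcases h1 with h1 | h1
          · rw [h1, ev_self]; linarith [ev_nonneg (a := b) (v := u)]
          · rw [h1, ev_self]; linarith [ev_nonneg (a := a) (v := u)]
        · rw [ind_of_notMem h]
          exact add_nonneg ev_nonneg ev_nonneg
    _ = 2 := by rw [Finset.sum_add_distrib]; simp [ev]; norm_num

lemma dg_sub_star_le (hva : v ≠ a) (hvb : v ≠ b) : dg Y v - dg (Y \ starE a b Y) v ≤ 2 := by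
  rw [dg_sdiff star_subset]
  have := dg_star_le (Y := Y) (v := v) subset_rfl hva hvb
  simp only [Pi.sub_apply]; linarith

lemma C0.star (h : C0 T lam B Finset.univ d Y) {W : Finset (Sym2 (Fin n))}
    (hW : W ⊆ starE a b Y) :
    C0 T lam (B + 2) ({a, b}ᶜ) (d - dg W) (Y \ starE a b Y) where
  loop := h.loop.mono Finset.sdiff_subset
  hU := by
    rw [compl_compl]
    exact_mod_cast Finset.card_le_two
  hT := h.hT
  hB := by linarith [h.hB]
  lo := h.lo
  hi := h.hi
  deg := fun v hv => by
    simp only [Finset.mem_compl, Finset.mem_insert, Finset.mem_singleton, not_or] at hv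
    have h1 := h.deg v (Finset.mem_univ _)
    have h2 := dg_star_le hW hv.1 hv.2
    have h3 := dg_nonneg (F := W) (v := v)
    simp only [Pi.sub_apply]
    rw [abs_le] at h1 ⊢
    constructor <;> linarith
  xd := fun v hv => by
    simp only [Finset.mem_compl, Finset.mem_insert, Finset.mem_singleton, not_or] at hv
    have h1 := h.xd v (Finset.mem_univ _)
    have h2 := dg_sub_star_le (Y := Y) hv.1 hv.2
    linarith

lemma pair_switch (h : C0 T lam B Finset.univ d Y) (hab : a ≠ b) (hn : (B + 3) * T ^ 29 ≤ n)
    (hn' : T ^ 30 ≤ n) (hlog : Real.log n ≤ T) (φ : ℝ → ℝ) :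
    |∑ F ∈ gr d Y, pairIn a b u v Y F * φ (lfun a b Y F)
      - ∑ F ∈ gr d Y, pairOut a b u v Y F * φ (lfun a b Y F - 1)| ≤
      T ^ 28 * (B + 3) / n * ∑ F ∈ gr d Y, pairIn a b u v Y F * |φ (lfun a b Y F)| := by
  have hT := h.hT
  have hB := h.hB
  have hT0 : 0 < T := by linarith
  by_cases hg : u ≠ v ∧ s(a, u) ∈ Y ∧ s(b, u) ∈ Y ∧ s(a, v) ∈ Y ∧ s(b, v) ∈ Y
  swap
  · have z1 : ∀ F ∈ gr d Y, pairIn a b u v Y F = 0 ∧ pairOut a b u v Y F = 0 := by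
      intro F hF
      have hFY := (mem_gr.1 hF).1
      unfold pairIn pairOut
      by_cases h1 : u = v
      · subst h1
        have q1 := mul_ind_sub (e := s(a, u)) hFY
        have q2 := mul_ind_sub (e := s(b, u)) hFY
        constructor
        · linear_combination ind F s(b, u) * (ind Y s(b, u) - ind F s(b, u)) * q1
        · linear_combination ind F s(b, u) * (ind Y s(b, u) - ind F s(b, u)) * q1
      have : ∀ {e}, e ∉ Y → ind Y e = 0 ∧ ind F e = 0 := fun {e} he =>
        ⟨ind_of_notMem he, ind_eq_zero_of_mem_gr hF he⟩
      by_cases h2 : s(a, u) ∈ Y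
      swap
      · obtain ⟨q1, q2⟩ := this h2; rw [q1, q2]; constructor <;> ring
      by_cases h3 : s(b, u) ∈ Y
      swap
      · obtain ⟨q1, q2⟩ := this h3; rw [q2]; constructor <;> ring
      by_cases h4 : s(a, v) ∈ Y
      swap
      · obtain ⟨q1, q2⟩ := this h4; rw [q1, q2]; constructor <;> ring
      by_cases h5 : s(b, v) ∈ Y
      swap
      · obtain ⟨q1, q2⟩ := this h5; rw [q1, q2]; constructor <;> ring
      exact absurd ⟨h1, h2, h3, h4, h5⟩ hg
    rw [Finset.sum_eq_zero (fun F hF => by rw [(z1 F hF).1, zero_mul]),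
      Finset.sum_eq_zero (fun F hF => by rw [(z1 F hF).2, zero_mul]),
      Finset.sum_eq_zero (fun F hF => by rw [(z1 F hF).1, zero_mul])]
    simp
  obtain ⟨huv, hau, hbu, hav, hbv⟩ := hg
  have na := h.loop.ne hau
  have nb := h.loop.ne hbu
  have ma := h.loop.ne hav
  have mb := h.loop.ne hbv
  set Z := starE a b Y with hZ
  have c1 : ∀ ψ : ℝ → ℝ, ∑ F ∈ gr d Y, pairIn a b u v Y F * ψ (lfun a b Y F) =
      ∑ W ∈ Z.powerset, pairIn a b u v Y W * ψ (lfun a b Y W) * nn (d - dg W) (Y \ Z) := by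
    intro ψ
    rw [← sum_inter_eq star_subset fun W => pairIn a b u v Y W * ψ (lfun a b Y W)]
    refine Finset.sum_congr rfl fun F hF => ?_
    rw [pairIn_inter_star (mem_gr.1 hF).1, lfun_inter_star (mem_gr.1 hF).1]
  have c2 : ∑ F ∈ gr d Y, pairOut a b u v Y F * φ (lfun a b Y F - 1) =
      ∑ W ∈ Z.powerset, pairOut a b u v Y W * φ (lfun a b Y W - 1) * nn (d - dg W) (Y \ Z) := by
    rw [← sum_inter_eq star_subset fun W => pairOut a b u v Y W * φ (lfun a b Y W - 1)]
    refine Finset.sum_congr rfl fun F hF => ?_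
    rw [pairOut_inter_star (mem_gr.1 hF).1, lfun_inter_star (mem_gr.1 hF).1]
  have n1 : s(a, u) ≠ s(a, v) := fun h => huv (Sym2.congr_right.1 h)
  have n2 : s(b, u) ≠ s(b, v) := fun h => huv (Sym2.congr_right.1 h)
  have n3 : ∀ {x y : Fin n}, a ≠ y → s(a, x) ≠ s(b, y) := by
    intro x y hy
    simp only [ne_eq, Sym2.eq_iff]; rintro (⟨h, -⟩ | ⟨h, -⟩)
    exacts [hab h, hy h]
  have hZau : s(a, u) ∈ Z := Finset.mem_filter.2 ⟨hau, by simp⟩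
  have hZav : s(a, v) ∈ Z := Finset.mem_filter.2 ⟨hav, by simp⟩
  -- the bijection
  have c3 : ∑ W ∈ Z.powerset, pairOut a b u v Y W * φ (lfun a b Y W - 1) * nn (d - dg W) (Y \ Z)
      = ∑ W ∈ Z.powerset, pairIn a b u v Y W * φ (lfun a b Y W) *
        nn (d - dg W + ev u - ev v) (Y \ Z) := by
    have f1 : ∀ W, pairIn a b u v Y W ≠ 0 →
        s(a, u) ∈ W ∧ s(b, u) ∈ W ∧ s(a, v) ∉ W ∧ s(b, v) ∉ W := by
      intro W hW
      unfold pairIn at hW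
      rw [ind_of_mem hav, ind_of_mem hbv] at hW
      refine ⟨mem_of_ind_ne_zero (left_ne_zero_of_mul (left_ne_zero_of_mul hW)),
        mem_of_ind_ne_zero (right_ne_zero_of_mul (left_ne_zero_of_mul hW)), fun hc => ?_,
        fun hc => ?_⟩
      · rw [ind_of_mem hc] at hW; simp at hW
      · rw [ind_of_mem hc] at hW; simp at hW
    have f2 : ∀ W, pairOut a b u v Y W ≠ 0 →
        s(a, u) ∉ W ∧ s(b, u) ∈ W ∧ s(a, v) ∈ W ∧ s(b, v) ∉ W := by
      intro W hW
      unfold pairOut at hW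
      rw [ind_of_mem hau, ind_of_mem hbv] at hW
      refine ⟨fun hc => ?_, mem_of_ind_ne_zero (left_ne_zero_of_mul (left_ne_zero_of_mul hW)),
        mem_of_ind_ne_zero (left_ne_zero_of_mul (right_ne_zero_of_mul hW)), fun hc => ?_⟩
      · rw [ind_of_mem hc] at hW; simp at hW
      · rw [ind_of_mem hc] at hW; simp at hW
    have g1 : ∀ W, s(a, u) ∈ W → s(b, u) ∈ W → s(a, v) ∉ W → s(b, v) ∉ W →
        pairIn a b u v Y W = 1 := by
      intro W h1 h2 h3 h4
      unfold pairIn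
      rw [ind_of_mem h1, ind_of_mem h2, ind_of_notMem h3, ind_of_notMem h4, ind_of_mem hav,
        ind_of_mem hbv]; ring
    have g2 : ∀ W, s(a, u) ∉ W → s(b, u) ∈ W → s(a, v) ∈ W → s(b, v) ∉ W →
        pairOut a b u v Y W = 1 := by
      intro W h1 h2 h3 h4
      unfold pairOut
      rw [ind_of_notMem h1, ind_of_mem h2, ind_of_mem h3, ind_of_notMem h4, ind_of_mem hau,
        ind_of_mem hbv]; ring
    set σ := Equiv.swap s(a, u) s(a, v) with hσ
    have hmap : ∀ W : Finset (Sym2 (Fin n)), W ∈ Z.powerset → W.map σ.toEmbedding ∈ Z.powerset := by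
      intro W hW
      rw [Finset.mem_powerset] at hW ⊢
      intro e he
      obtain ⟨e', h1, rfl⟩ := Finset.mem_map.1 he
      change σ e' ∈ Z
      rcases eq_or_ne e' s(a, u) with h2 | h2
      · rw [h2, hσ, Equiv.swap_apply_left]; exact hZav
      rcases eq_or_ne e' s(a, v) with h3 | h3
      · rw [h3, hσ, Equiv.swap_apply_right]; exact hZau
      · rw [hσ, Equiv.swap_apply_of_ne_of_ne h2 h3]; exact hW h1
    have hinv : ∀ W : Finset (Sym2 (Fin n)), (W.map σ.toEmbedding).map σ.toEmbedding = W := by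
      intro W
      rw [Finset.map_map]
      convert Finset.map_refl
      ext e; simp [hσ]
    have hind : ∀ (W : Finset (Sym2 (Fin n))) e, ind (W.map σ.toEmbedding) e = ind W (σ e) := by
      intro W e
      unfold ind
      congr 1
      rw [Finset.mem_map_equiv, hσ, Equiv.symm_swap]
    refine Finset.sum_nbij' (fun W => W.map σ.toEmbedding) (fun W => W.map σ.toEmbedding) hmap hmap
      (fun W _ => hinv W) (fun W _ => hinv W) fun W hW => ?_
    have k1 : pairIn a b u v Y (W.map σ.toEmbedding) = pairOut a b u v Y W := by
      unfold pairIn pairOut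
      simp only [hind]
      rw [hσ, Equiv.swap_apply_left, Equiv.swap_apply_right,
        Equiv.swap_apply_of_ne_of_ne (n3 (x := u) na).symm (n3 (x := v) na).symm,
        Equiv.swap_apply_of_ne_of_ne (n3 (x := u) ma).symm (n3 (x := v) ma).symm, ind_of_mem hau, ind_of_mem hav]
      ring
    by_cases h0 : pairOut a b u v Y W = 0
    · rw [k1, h0]; ring
    obtain ⟨p1, p2, p3, p4⟩ := f2 W h0
    have k2 : W = insert s(a, v) (W.erase s(a, v)) := (Finset.insert_erase p3).symm
    have k3 : W.map σ.toEmbedding = insert s(a, u) (W.erase s(a, v)) := by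
      ext e
      rw [Finset.mem_map_equiv, hσ, Equiv.symm_swap, Finset.mem_insert, Finset.mem_erase]
      rcases eq_or_ne e s(a, u) with h2 | h2
      · subst h2; simp [p3]
      rcases eq_or_ne e s(a, v) with h3 | h3
      · subst h3; simp [p1, h2]
      · rw [Equiv.swap_apply_of_ne_of_ne h2 h3]; simp [h2, h3]
    have k4 : lfun a b Y W - 1 = lfun a b Y (W.map σ.toEmbedding) := by
      rw [k3, lfun_insert_left_of_mem hab nb.symm hau (Finset.mem_erase.2 ⟨(n3 na).symm, p2⟩)
        (fun hc => p1 (Finset.mem_of_mem_erase hc))]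
      nth_rewrite 1 [k2]
      rw [lfun_insert_left hab mb.symm (fun hc => p4 (Finset.mem_of_mem_erase hc))]
    have k5 : d - dg W = d - dg (W.map σ.toEmbedding) + ev u - ev v := by
      rw [k3, dg_insert na (fun hc => p1 (Finset.mem_of_mem_erase hc))]
      nth_rewrite 1 [k2]
      rw [dg_insert ma (by simp)]
      funext x; simp only [Pi.sub_apply, Pi.add_apply]; ring
    rw [k1, k4, k5]
  rw [c1 φ, c1 fun t => |φ t|, c2, c3, ← Finset.sum_sub_distrib, Finset.mul_sum]
  refine le_trans (Finset.abs_sum_le_sum_abs _ _) (Finset.sum_le_sum fun W hW => ?_)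
  rw [Finset.mem_powerset] at hW
  by_cases h0 : pairIn a b u v Y W = 0
  · rw [h0]; simp
  have hWY := hW.trans star_subset
  have p0 := pairIn_nonneg (a := a) (b := b) (u := u) (v := v) hWY
  have c4 := h.star hW
  have c5 : d - dg W = d - dg W + ev u - ev u := by simp
  rw [c5] at c4
  have c6 := ratio_crude (c4.swap (b := v)) huv.symm (by simp [ma.symm, mb.symm])
    (by simp [na.symm, nb.symm]) (by rw [add_assoc]; norm_num; exact hn) hn' hlog
  rw [← c5, add_assoc, show (2:ℝ) + 1 = 3 by norm_num] at c6
  rw [mul_assoc, mul_assoc, ← mul_sub, abs_mul, abs_of_nonneg p0, ← mul_sub, abs_mul, abs_sub_comm]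
  calc _ ≤ pairIn a b u v Y W * (|φ (lfun a b Y W)| *
        (T ^ 28 * (B + 3) / n * nn (d - dg W) (Y \ Z))) := by gcongr
    _ = _ := by ring

end fourcycle

section moment

variable {n : ℕ} {F G Y Z : Finset (Sym2 (Fin n))} {d : Fin n → ℝ} {a b u v w : Fin n}
  {e f : Sym2 (Fin n)} {T lam B : ℝ} {U : Finset (Fin n)}

/-- The number of common neighbours of `a` and `b`. -/
def both {n : ℕ} (a b : Fin n) (F : Finset (Sym2 (Fin n))) : ℝ := ∑ v, ind F s(a, v) * ind F s(b, v)

lemma cycle_switch (h : C0 T lam B Finset.univ d Y) (hab : a ≠ b) (hn : (B + 3) * T ^ 29 ≤ n)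
    (hn' : T ^ 30 ≤ n) (hlog : Real.log n ≤ T) (φ : ℝ → ℝ) :
    |∑ F ∈ gr d Y, (both a b F * both a b (Y \ F) * φ (lfun a b Y F)
      - lfun a b Y F * lfun b a Y F * φ (lfun a b Y F - 1))| ≤
      T ^ 28 * (B + 3) / n * ∑ F ∈ gr d Y,
        both a b F * both a b (Y \ F) * |φ (lfun a b Y F)| := by
  have e1 : ∀ F ∈ gr d Y, ∀ x, both a b F * both a b (Y \ F) * x =
      ∑ u, ∑ v, pairIn a b u v Y F * x := by
    intro F hF x
    simp only [both, ind_sdiff (mem_gr.1 hF).1, pairIn]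
    rw [Finset.sum_mul_sum, Finset.sum_mul]
    exact Finset.sum_congr rfl fun u _ => by rw [Finset.sum_mul]
  have e2 : ∀ F x, lfun a b Y F * lfun b a Y F * x = ∑ u, ∑ v, pairOut a b u v Y F * x := by
    intro F x
    simp only [lfun, pairOut]
    rw [Finset.sum_mul_sum, Finset.sum_mul]
    exact Finset.sum_congr rfl fun u _ => by rw [Finset.sum_mul]
  rw [Finset.sum_congr rfl fun F hF => by rw [e1 F hF, e2 F],
    Finset.sum_congr rfl fun F hF => e1 F hF _]
  simp only [← Finset.sum_sub_distrib]
  rw [Finset.sum_comm, Finset.sum_comm (s := gr d Y), Finset.mul_sum]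
  refine le_trans (Finset.abs_sum_le_sum_abs _ _) (Finset.sum_le_sum fun u _ => ?_)
  rw [Finset.sum_comm, Finset.sum_comm (s := gr d Y), Finset.mul_sum]
  refine le_trans (Finset.abs_sum_le_sum_abs _ _) (Finset.sum_le_sum fun v _ => ?_)
  rw [Finset.sum_sub_distrib]
  exact pair_switch h hab hn hn' hlog φ

lemma both_nonneg : 0 ≤ both a b F := Finset.sum_nonneg fun _ _ => mul_nonneg ind_nonneg ind_nonneg

lemma both_le : both a b F ≤ n := by
  calc both a b F ≤ ∑ v : Fin n, (1:ℝ) := Finset.sum_le_sum fun v _ =>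
        mul_le_one₀ ind_le_one ind_nonneg ind_le_one
    _ = n := by simp

lemma forbidden_le (h : C0 T lam B Finset.univ d Y) (g : Fin n → ℝ) (hg : ∀ v, 0 ≤ g v)
    (hg' : ∀ v, g v ≤ 1) : 0 ≤ ∑ v, g v * (1 - ind Y s(b, v)) ∧
      ∑ v, g v * (1 - ind Y s(b, v)) ≤ B := by
  refine ⟨Finset.sum_nonneg fun v _ => mul_nonneg (hg v) (sub_nonneg.2 ind_le_one), ?_⟩
  calc _ ≤ ∑ v, (1 - ind Y s(b, v)) := Finset.sum_le_sum fun v _ =>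
        mul_le_of_le_one_left (sub_nonneg.2 ind_le_one) (hg' v)
    _ = n - dg Y b := by simp [dg, Finset.sum_sub_distrib]
    _ ≤ B := h.xd b (Finset.mem_univ _)

lemma drift (h : C0 T lam B Finset.univ d Y) (hF : F ∈ gr d Y) :
    |both a b F * both a b (Y \ F) - lfun a b Y F * lfun b a Y F
      + (n * lfun a b Y F - d b * (n - d a))| ≤ 4 * B * n := by
  have hFY := (mem_gr.1 hF).1
  have hB := h.hB
  have hi0 : ∀ {F : Finset (Sym2 (Fin n))} {e}, 0 ≤ ind F e := ind_nonneg
  have hi1 : ∀ {F : Finset (Sym2 (Fin n))} {e}, ind F e ≤ 1 := ind_le_one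
  obtain ⟨x1, y1⟩ := forbidden_le (b := a) h (fun v => ind F s(b, v)) (fun _ => hi0) fun _ => hi1
  obtain ⟨x2, y2⟩ := forbidden_le (b := b) h (fun v => ind F s(a, v)) (fun _ => hi0) fun _ => hi1
  obtain ⟨x3, y3⟩ := forbidden_le (b := b) h (fun v => ind (Y \ F) s(a, v)) (fun _ => hi0)
    fun _ => hi1
  set ξ₁ := ∑ v, ind F s(b, v) * (1 - ind Y s(a, v))
  set ξ₂ := ∑ v, ind F s(a, v) * (1 - ind Y s(b, v))
  set ξ₃ := ∑ v, ind (Y \ F) s(a, v) * (1 - ind Y s(b, v)) with hξ₃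
  have r1 : both a b F + lfun a b Y F + ξ₁ = d b := by
    rw [← dg_of_mem_gr hF b]
    simp only [both, lfun, ξ₁, ← Finset.sum_add_distrib]
    exact Finset.sum_congr rfl fun v _ => by ring
  have r2 : both a b F + lfun b a Y F + ξ₂ = d a := by
    rw [← dg_of_mem_gr hF a]
    simp only [both, lfun, ξ₂, ← Finset.sum_add_distrib]
    exact Finset.sum_congr rfl fun v _ => by ring
  have r3 : both a b (Y \ F) + lfun a b Y F + ξ₃ = dg Y a - d a := by
    rw [← dg_of_mem_gr hF a]
    simp only [both, lfun, ξ₃, dg, ind_sdiff hFY, ← Finset.sum_add_distrib,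
      ← Finset.sum_sub_distrib]
    exact Finset.sum_congr rfl fun v _ => by ring
  have hx := h.xd a (Finset.mem_univ _)
  have hx' := dg_le (F := Y) (v := a)
  have l0 := lfun_nonneg (a := a) (b := b) hFY
  have l1 := lfun_le (a := a) (b := b) (Y := Y) (F := F)
  have o0 := both_nonneg (a := a) (b := b) (F := Y \ F)
  have o1 := both_le (a := a) (b := b) (F := Y \ F)
  have h0 := both_nonneg (a := a) (b := b) (F := F)
  have dn : d b ≤ n := by
    rw [← (mem_gr.1 hF).2]; exact dg_le
  generalize both a b (Y \ F) = o at *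
  generalize both a b F = hh at *
  generalize lfun a b Y F = l at *
  generalize lfun b a Y F = k at *
  generalize dg Y a = D at *
  clear_value ξ₁ ξ₂ ξ₃
  have e1 : hh * o - l * k + (n * l - d b * (n - d a)) =
      -(ξ₁ * o) - (d b - l) * (n - D + ξ₃) - l * (ξ₁ - ξ₂) := by
    have q1 : hh = d b - l - ξ₁ := by linarith
    have q2 : k = d a - (d b - l - ξ₁) - ξ₂ := by linarith
    have q3 : o = D - d a - l - ξ₃ := by linarith
    rw [q1, q2, q3]; ring
  rw [e1]
  have b1 : |ξ₁ * o| ≤ B * n := by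
    rw [abs_of_nonneg (mul_nonneg x1 o0)]; gcongr
  have b2 : |(d b - l) * (n - D + ξ₃)| ≤ n * (2 * B) := by
    rw [abs_of_nonneg (mul_nonneg (by linarith) (by linarith))]
    exact mul_le_mul (by linarith) (by linarith) (by linarith) (by positivity)
  have b3 : |l * (ξ₁ - ξ₂)| ≤ n * B := by
    rw [abs_mul, abs_of_nonneg l0]
    exact mul_le_mul l1 (by rw [abs_le]; constructor <;> linarith) (abs_nonneg _) (by positivity)
  calc _ ≤ |ξ₁ * o| + |(d b - l) * (n - D + ξ₃)| + |l * (ξ₁ - ξ₂)| := by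
        refine (abs_sub _ _).trans (add_le_add_left ((abs_sub _ _).trans ?_) _)
        rw [abs_neg]
    _ ≤ _ := by linarith

lemma young_quartic {s x : ℝ} (hs : 1 ≤ s) :
    s * |x| ^ 3 + s ^ 2 * (3 * x ^ 2 + 3 * |x| + 1) ≤ x ^ 4 / 2 + 100 * s ^ 4 := by
  have hs0 : 0 < s := by linarith
  obtain ⟨y, hy⟩ : ∃ y, |x| = s * y := ⟨|x| / s, by field_simp⟩
  have hy0 : 0 ≤ y := by
    have := abs_nonneg x
    rw [hy] at this; exact nonneg_of_mul_nonneg_right this hs0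
  have h2 : x ^ 2 = s ^ 2 * y ^ 2 := by rw [← sq_abs, hy]; ring
  have h4 : x ^ 4 = s ^ 4 * y ^ 4 := by
    calc x ^ 4 = (x ^ 2) ^ 2 := by ring
      _ = _ := by rw [h2]; ring
  rw [h2, h4, hy]
  have q : y ^ 3 + 3 * y ^ 2 + 3 * y + 1 ≤ y ^ 4 / 2 + 100 := by
    nlinarith [sq_nonneg (y ^ 2 - y - 5), sq_nonneg (y - 8 / 3)]
  have s2 : s ^ 2 ≤ s ^ 4 := pow_le_pow_right₀ hs (by norm_num)
  have s3 : s ^ 3 ≤ s ^ 4 := pow_le_pow_right₀ hs (by norm_num)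
  calc s * (s * y) ^ 3 + s ^ 2 * (3 * (s ^ 2 * y ^ 2) + 3 * (s * y) + 1)
      = s ^ 4 * y ^ 3 + 3 * s ^ 4 * y ^ 2 + s ^ 3 * (3 * y) + s ^ 2 := by ring
    _ ≤ s ^ 4 * y ^ 3 + 3 * s ^ 4 * y ^ 2 + s ^ 4 * (3 * y) + s ^ 4 := by gcongr
    _ = s ^ 4 * (y ^ 3 + 3 * y ^ 2 + 3 * y + 1) := by ring
    _ ≤ s ^ 4 * (y ^ 4 / 2 + 100) := by gcongr
    _ = _ := by ring

/-- The fourth moment of the number of vertices joined to `b` but not to `a`. -/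
lemma fourth_moment (h : C0 T lam B Finset.univ d Y) (hab : a ≠ b) (hn : (B + 3) * T ^ 29 ≤ n)
    (hn' : T ^ 30 ≤ n) (hlog : Real.log n ≤ T) (hB2 : n ≤ B ^ 2) :
    ∑ F ∈ gr d Y, (lfun a b Y F - d b * (n - d a) / n) ^ 4 ≤ 200 * (T ^ 29 * B) ^ 4 * nn d Y := by
  have hT := h.hT
  have hB := h.hB
  have hT0 : 0 < T := by linarith
  have hn0 : (0:ℝ) < n := lt_of_lt_of_le (by positivity) hn'
  set μ := d b * (n - d a) / n with hμ
  have hμ' : n * μ = d b * (n - d a) := by rw [hμ]; field_simp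
  have key := cycle_switch h hab hn hn' hlog fun t => (t - μ) ^ 3
  set s := T ^ 29 * B with hs
  have hT28 : 1 ≤ T ^ 28 := one_le_pow₀ (by linarith)
  have hs1 : B ≤ s := by
    have : 1 ≤ T ^ 29 := one_le_pow₀ (by linarith)
    rw [hs]; nlinarith
  have hs2 : 4 * B + T ^ 28 * (B + 3) ≤ s := by
    have : s = T * (T ^ 28 * B) := by rw [hs]; ring
    rw [this]
    have : 0 ≤ (T - 100) * (T ^ 28 * B) := mul_nonneg (by linarith) (by positivity)
    nlinarith only [this, hT28, hB]
  have hs3 : (n:ℝ) ≤ s ^ 2 := hB2.trans (by gcongr)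
  have hsum : n * ∑ F ∈ gr d Y, (lfun a b Y F - μ) ^ 4 ≤ ∑ F ∈ gr d Y,
      (4 * B * n * |lfun a b Y F - μ| ^ 3 + n ^ 2 * (3 * (lfun a b Y F - μ) ^ 2
        + 3 * |lfun a b Y F - μ| + 1)) + T ^ 28 * (B + 3) / n * ∑ F ∈ gr d Y,
        both a b F * both a b (Y \ F) * |(lfun a b Y F - μ) ^ 3| := by
    have k1 := (abs_le.1 key).1
    have : n * ∑ F ∈ gr d Y, (lfun a b Y F - μ) ^ 4 ≤ ∑ F ∈ gr d Y,
      ((4 * B * n * |lfun a b Y F - μ| ^ 3 + n ^ 2 * (3 * (lfun a b Y F - μ) ^ 2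
        + 3 * |lfun a b Y F - μ| + 1)) - (both a b F * both a b (Y \ F) * (lfun a b Y F - μ) ^ 3
      - lfun a b Y F * lfun b a Y F * (lfun a b Y F - 1 - μ) ^ 3)) := by
      rw [Finset.mul_sum]
      refine Finset.sum_le_sum fun F hF => ?_
      have hd := drift (a := a) (b := b) h hF
      rw [← hμ', ← mul_sub] at hd
      have l0 := lfun_nonneg (a := a) (b := b) (mem_gr.1 hF).1
      have l1 := lfun_le (a := a) (b := b) (Y := Y) (F := F)
      have k0 := lfun_nonneg (a := b) (b := a) (mem_gr.1 hF).1
      have k1 := lfun_le (a := b) (b := a) (Y := Y) (F := F)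
      have lk : lfun a b Y F * lfun b a Y F ≤ n ^ 2 := by
        rw [sq]; exact mul_le_mul l1 k1 k0 (by positivity)
      have lk0 : 0 ≤ lfun a b Y F * lfun b a Y F := mul_nonneg l0 k0
      generalize lfun a b Y F * lfun b a Y F = lk' at *
      generalize both a b F * both a b (Y \ F) = ho at *
      rw [show lfun a b Y F - 1 - μ = lfun a b Y F - μ - 1 by ring]
      generalize lfun a b Y F - μ = x at *
      set E := ho - lk' + n * x with hE
      have e1 : n * x ^ 4 = E * x ^ 3 + lk' * (3 * x ^ 2 - 3 * x + 1)
          - (ho * x ^ 3 - lk' * (x - 1) ^ 3) := by rw [hE]; ring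
      have e2 : E * x ^ 3 ≤ 4 * B * n * |x| ^ 3 := by
        refine (le_abs_self _).trans ?_
        rw [abs_mul, abs_pow]; gcongr
      have e3 : lk' * (3 * x ^ 2 - 3 * x + 1) ≤ n ^ 2 * (3 * x ^ 2 + 3 * |x| + 1) := by
        have : 3 * x ^ 2 - 3 * x + 1 ≤ 3 * x ^ 2 + 3 * |x| + 1 := by
          have := neg_abs_le x; linarith
        calc _ ≤ lk' * (3 * x ^ 2 + 3 * |x| + 1) := by gcongr
          _ ≤ _ := by gcongr
      linarith only [e1, e2, e3]
    rw [Finset.sum_sub_distrib] at this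
    linarith only [this, k1]
  have hsum2 : T ^ 28 * (B + 3) / n * ∑ F ∈ gr d Y,
        both a b F * both a b (Y \ F) * |(lfun a b Y F - μ) ^ 3| ≤ ∑ F ∈ gr d Y,
        T ^ 28 * (B + 3) * n * |lfun a b Y F - μ| ^ 3 := by
    rw [Finset.mul_sum]
    refine Finset.sum_le_sum fun F hF => ?_
    have : both a b F * both a b (Y \ F) ≤ n * n :=
      mul_le_mul both_le both_le both_nonneg (by positivity)
    rw [abs_pow]
    calc _ ≤ T ^ 28 * (B + 3) / n * (n * n * |lfun a b Y F - μ| ^ 3) := by gcongr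
      _ = _ := by field_simp
  have hsum3 : n * ∑ F ∈ gr d Y, (lfun a b Y F - μ) ^ 4 ≤ n * ∑ F ∈ gr d Y,
      ((lfun a b Y F - μ) ^ 4 / 2 + 100 * s ^ 4) := by
    refine (hsum.trans (add_le_add_right hsum2 _)).trans ?_
    rw [← Finset.sum_add_distrib, Finset.mul_sum]
    refine Finset.sum_le_sum fun F _ => ?_
    generalize lfun a b Y F - μ = x
    have hy := young_quartic (s := s) (x := x) (by linarith)
    have hx := abs_nonneg x
    calc _ = n * ((4 * B + T ^ 28 * (B + 3)) * |x| ^ 3 + n * (3 * x ^ 2 + 3 * |x| + 1)) := by ring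
      _ ≤ n * (s * |x| ^ 3 + s ^ 2 * (3 * x ^ 2 + 3 * |x| + 1)) := by gcongr
      _ ≤ _ := by gcongr
  have hsum4 := le_of_mul_le_mul_left hsum3 hn0
  rw [Finset.sum_add_distrib, ← Finset.sum_div, Finset.sum_const, nsmul_eq_mul] at hsum4
  change _ ≤ _ + nn d Y * _ at hsum4
  linarith only [hsum4]

end moment

/-- The global parameters: `h = 1 / √n`, and `T` is a slack factor which is a tiny power of `n`. -/
structure Glob (n : ℕ) (T h lam : ℝ) : Prop where
  hT : 100 ≤ T
  h0 : 0 < h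
  nh : (n : ℝ) * h ^ 2 = 1
  small : T ^ 10000 * h ≤ 1
  log : Real.log n ≤ T
  lo : 1 ≤ lam * T
  hi : 1 ≤ (1 - lam) * T

/-- The bound `|x| ≤ T ^ c * h ^ k`. -/
def Bd (T h : ℝ) (c k : ℕ) (x : ℝ) : Prop := |x| ≤ T ^ c * h ^ k

section Glob

variable {n : ℕ} {T h lam : ℝ}

lemma Glob.T0 (G : Glob n T h lam) : 0 < T := by linarith [G.hT]

lemma Glob.T1 (G : Glob n T h lam) : 1 ≤ T := by linarith [G.hT]

lemma Glob.pow_mul_le (G : Glob n T h lam) {c : ℕ} (hc : c ≤ 10000) : T ^ c * h ≤ 1 :=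
  le_trans (mul_le_mul_of_nonneg_right (pow_le_pow_right₀ G.T1 hc) G.h0.le) G.small

lemma Glob.h1 (G : Glob n T h lam) : h ≤ 1 := by simpa using G.pow_mul_le (Nat.zero_le _)

lemma Glob.npos (G : Glob n T h lam) : (0:ℝ) < n := by
  rcases (Nat.cast_nonneg n : (0:ℝ) ≤ n).eq_or_lt with h0 | h0
  · have := G.nh; rw [← h0] at this; norm_num at this
  · exact h0

lemma Glob.inv_n (G : Glob n T h lam) : 1 / (n : ℝ) = h ^ 2 := by
  rw [div_eq_iff G.npos.ne', mul_comm]; exact G.nh.symm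

lemma Glob.n_eq (G : Glob n T h lam) : (n : ℝ) = 1 / h ^ 2 := by
  rw [eq_div_iff (pow_pos G.h0 2).ne']; exact G.nh

lemma Glob.div_n (G : Glob n T h lam) (x : ℝ) : x / n = x * h ^ 2 := by rw [← G.inv_n]; ring

lemma Glob.pow_le_inv (G : Glob n T h lam) {c : ℕ} (hc : c ≤ 10000) : T ^ c ≤ 1 / h := by
  rw [le_div_iff₀ G.h0]; exact G.pow_mul_le hc

lemma Glob.inv_le_n (G : Glob n T h lam) : 1 / h ≤ n := by
  rw [G.n_eq]
  exact one_div_le_one_div_of_le (pow_pos G.h0 2) (by nlinarith [G.h0, G.h1])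

lemma Glob.pow_le_n (G : Glob n T h lam) {c : ℕ} (hc : c ≤ 10000) : T ^ c ≤ n :=
  (G.pow_le_inv hc).trans G.inv_le_n

lemma Glob.lam0 (G : Glob n T h lam) : 0 < lam := by
  by_contra hc
  push Not at hc
  nlinarith [G.lo, G.T0]

lemma Glob.lam1 (G : Glob n T h lam) : lam < 1 := by
  by_contra hc
  push Not at hc
  nlinarith [G.hi, G.T0]

lemma Bd.mono (G : Glob n T h lam) {c k c' k' : ℕ} {x : ℝ}
    (H : Bd T h c k x) (hc : c ≤ c') (hk : k' ≤ k) :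
    Bd T h c' k' x :=
  le_trans H (mul_le_mul (pow_le_pow_right₀ G.T1 hc) (pow_le_pow_of_le_one G.h0.le G.h1 hk)
    (pow_nonneg G.h0.le _) (pow_nonneg G.T0.le _))

/-- A power of `h` absorbs a power of `T`. -/
lemma Bd.absorb (G : Glob n T h lam) {c k : ℕ} {x : ℝ} (H : Bd T h c (k + 1) x) (hc : c ≤ 10000) :
    Bd T h 0 k x := by
  refine le_trans H ?_
  have := mul_le_mul_of_nonneg_right (G.pow_mul_le hc) (pow_nonneg G.h0.le k)
  calc _ = T ^ c * h * h ^ k := by ring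
    _ ≤ _ := by simpa using this

lemma Bd.add (G : Glob n T h lam) {c k c' k' : ℕ} {x y : ℝ}
    (H : Bd T h c k x) (H' : Bd T h c' k' y) :
    Bd T h (max c c' + 1) (min k k') (x + y) := by
  have h1 := H.mono G (le_max_left c c') (min_le_left k k')
  have h2 := H'.mono G (le_max_right c c') (min_le_right k k')
  refine (abs_add_le x y).trans ((add_le_add h1 h2).trans ?_)
  have : 0 ≤ T ^ max c c' * h ^ min k k' := mul_nonneg (pow_nonneg G.T0.le _) (pow_nonneg G.h0.le _)
  rw [pow_succ]
  nlinarith [G.hT]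

lemma Bd.neg {c k : ℕ} {x : ℝ} (H : Bd T h c k x) : Bd T h c k (-x) := by
  unfold Bd at *; rwa [abs_neg]

lemma Bd.sub (G : Glob n T h lam) {c k c' k' : ℕ} {x y : ℝ}
    (H : Bd T h c k x) (H' : Bd T h c' k' y) :
    Bd T h (max c c' + 1) (min k k') (x - y) := by
  rw [sub_eq_add_neg]; exact H.add G H'.neg

lemma Bd.mul (G : Glob n T h lam) {c k c' k' : ℕ} {x y : ℝ}
    (H : Bd T h c k x) (H' : Bd T h c' k' y) :
    Bd T h (c + c') (k + k') (x * y) := by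
  unfold Bd at *
  rw [abs_mul]
  calc |x| * |y| ≤ (T ^ c * h ^ k) * (T ^ c' * h ^ k') :=
        mul_le_mul H H' (abs_nonneg _) (mul_nonneg (pow_nonneg G.T0.le _) (pow_nonneg G.h0.le _))
    _ = _ := by ring

lemma Glob.bd_hh (G : Glob n T h lam) : Bd T h 0 2 (h ^ 2) := by
  unfold Bd; rw [abs_of_pos (pow_pos G.h0 2)]; simp

lemma Glob.bd_const (G : Glob n T h lam) {x : ℝ} (hx : |x| ≤ 100) : Bd T h 1 0 x := by
  unfold Bd; simpa using hx.trans G.hT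

lemma Glob.bd_lam (G : Glob n T h lam) : Bd T h 0 0 lam := by
  unfold Bd; rw [abs_of_pos G.lam0]; simpa using G.lam1.le

lemma Glob.bd_one_sub_lam (G : Glob n T h lam) : Bd T h 0 0 (1 - lam) := by
  unfold Bd; rw [abs_of_pos (by linarith [G.lam1])]; simpa using G.lam0.le

lemma Bd.sum_div (G : Glob n T h lam) {c k : ℕ} {f : Fin n → ℝ} (H : ∀ v, Bd T h c k (f v)) :
    Bd T h c k ((∑ v, f v) / n) := by
  unfold Bd at *
  rw [abs_div, abs_of_pos G.npos, div_le_iff₀ G.npos]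
  refine (Finset.abs_sum_le_sum_abs _ _).trans ((Finset.sum_le_sum fun v _ => H v).trans ?_)
  simp [mul_comm]

/-- The variance parameter `lam (1 - lam)` is bounded below. -/
lemma Glob.q_pos (G : Glob n T h lam) : 0 < lam * (1 - lam) := mul_pos G.lam0 (by linarith [G.lam1])

lemma Glob.q_ge (G : Glob n T h lam) : 1 ≤ lam * (1 - lam) * T ^ 2 := by
  have := one_le_mul_of_one_le_of_one_le G.lo G.hi
  linarith

lemma Glob.bd_inv_q (G : Glob n T h lam) : Bd T h 2 0 (1 / (lam * (1 - lam))) := by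
  unfold Bd
  rw [abs_of_pos (by have := G.q_pos; positivity), div_le_iff₀ G.q_pos]
  linarith [G.q_ge]

end Glob

section average

variable {n : ℕ} {F G Y Z : Finset (Sym2 (Fin n))} {d : Fin n → ℝ} {a b u v w : Fin n}
  {e f : Sym2 (Fin n)} {φ ψ : Finset (Sym2 (Fin n)) → ℝ}

/-- The average of `φ` over the graphs inside `Y` with degree sequence `d`. -/
def av {n : ℕ} (d : Fin n → ℝ) (Y : Finset (Sym2 (Fin n))) (φ : Finset (Sym2 (Fin n)) → ℝ) : ℝ :=
  (∑ F ∈ gr d Y, φ F) / nn d Y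

/-- The probability of the edge `av` in a random graph inside `Y` with degree sequence `d`. -/
def pr {n : ℕ} (d : Fin n → ℝ) (Y : Finset (Sym2 (Fin n))) (a v : Fin n) : ℝ :=
  av d Y fun F => ind F s(a, v)

lemma av_add : av d Y (fun F => φ F + ψ F) = av d Y φ + av d Y ψ := by
  simp [av, Finset.sum_add_distrib, add_div]

lemma av_sub : av d Y (fun F => φ F - ψ F) = av d Y φ - av d Y ψ := by
  simp [av, Finset.sum_sub_distrib, sub_div]

lemma av_mul (c : ℝ) : av d Y (fun F => c * φ F) = c * av d Y φ := by
  simp [av, ← Finset.mul_sum, mul_div_assoc]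

lemma av_const (h : 0 < nn d Y) (c : ℝ) : av d Y (fun _ => c) = c := by
  have e : ((gr d Y).card : ℝ) = nn d Y := rfl
  simp only [av, Finset.sum_const, nsmul_eq_mul, e]
  field_simp

lemma av_congr (h : ∀ F ∈ gr d Y, φ F = ψ F) : av d Y φ = av d Y ψ := by
  unfold av; rw [Finset.sum_congr rfl h]

lemma av_mono (h : ∀ F ∈ gr d Y, φ F ≤ ψ F) : av d Y φ ≤ av d Y ψ :=
  div_le_div_of_nonneg_right (Finset.sum_le_sum h) nn_nonneg

lemma abs_av_le : |av d Y φ| ≤ av d Y fun F => |φ F| := by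
  unfold av
  rw [abs_div, abs_of_nonneg (nn_nonneg (d := d))]
  exact div_le_div_of_nonneg_right (Finset.abs_sum_le_sum_abs _ _) nn_nonneg

lemma av_nonneg (h : ∀ F ∈ gr d Y, 0 ≤ φ F) : 0 ≤ av d Y φ :=
  div_nonneg (Finset.sum_nonneg h) nn_nonneg

lemma av_sum {ι : Type*} (s : Finset ι) (φ : ι → Finset (Sym2 (Fin n)) → ℝ) :
    av d Y (fun F => ∑ i ∈ s, φ i F) = ∑ i ∈ s, av d Y (φ i) := by
  simp only [av]; rw [Finset.sum_comm, Finset.sum_div]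

lemma Bd.av {T h lam : ℝ} (G : Glob n T h lam) {c k : ℕ} (H : ∀ F ∈ gr d Y, Bd T h c k (φ F)) :
    Bd T h c k (av d Y φ) := by
  rcases (nn_nonneg (d := d) (Y := Y)).eq_or_lt with h0 | h0
  · unfold Bd _root_.av
    rw [← h0]; simp
    exact mul_nonneg (pow_nonneg G.T0.le _) (pow_nonneg G.h0.le _)
  · exact abs_av_le.trans ((av_mono H).trans (av_const h0 _).le)

lemma pr_nonneg : 0 ≤ pr d Y a v := av_nonneg fun _ _ => ind_nonneg

lemma pr_le_one : pr d Y a v ≤ 1 := by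
  rcases (nn_nonneg (d := d) (Y := Y)).eq_or_lt with h0 | h0
  · unfold pr av; rw [← h0]; simp
  · exact (av_mono fun F _ => ind_le_one).trans (av_const h0 1).le

lemma av_ind_mul (hab : a ≠ b) (he : s(a, b) ∈ Y) (φ : Finset (Sym2 (Fin n)) → ℝ)
    (h0 : 0 < nn (d - ev a - ev b) (Y.erase s(a, b))) :
    av d Y (fun F => ind F s(a, b) * φ F) =
      pr d Y a b * av (d - ev a - ev b) (Y.erase s(a, b)) (fun F => φ (insert s(a, b) F)) := by
  unfold pr av
  rw [sum_ind_mul hab he, sum_ind hab he]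
  field_simp

lemma av_one_sub_ind_mul (he : e ∈ Y) (φ : Finset (Sym2 (Fin n)) → ℝ)
    (h0 : 0 < nn d (Y.erase e)) :
    av d Y (fun F => (1 - ind F e) * φ F) =
      (av d Y fun F => 1 - ind F e) * av d (Y.erase e) φ := by
  unfold av
  rw [sum_one_sub_ind_mul he, sum_one_sub_ind he]
  field_simp

/-- The probability that `bv` is an edge and `av` is not. -/
def pw {n : ℕ} (a b : Fin n) (d : Fin n → ℝ) (Y : Finset (Sym2 (Fin n))) (v : Fin n) : ℝ :=
  pr d Y b v * (1 - pr (d - ev b - ev v) (Y.erase s(b, v)) a v)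

lemma av_ind_mul_one_sub (h0 : 0 < nn (d - ev b - ev v) (Y.erase s(b, v))) (hab : a ≠ b)
    (hbv : b ≠ v) (hb : s(b, v) ∈ Y) :
    av d Y (fun F => ind F s(b, v) * (1 - ind F s(a, v))) = pw a b d Y v := by
  rw [av_ind_mul hbv hb _ h0, pw]
  congr 1
  conv_rhs => rw [← av_const h0 1]
  rw [pr, ← av_sub]
  refine av_congr fun F _ => ?_
  rw [ind_insert_of_ne]
  intro h
  rw [Sym2.eq_swap, Sym2.eq_swap (a := b)] at h
  exact hab (Sym2.congr_right.1 h)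

end average

/-- The deviation of the degree of `v` from its expected value. -/
def gg {n : ℕ} (lam : ℝ) (d : Fin n → ℝ) (Y : Finset (Sym2 (Fin n))) (v : Fin n) : ℝ :=
  d v - lam * dg Y v

/-- The normalised deviation. -/
def uu {n : ℕ} (lam : ℝ) (d : Fin n → ℝ) (Y : Finset (Sym2 (Fin n))) (v : Fin n) : ℝ :=
  gg lam d Y v / n

/-- The normalised total deviation. -/
def ss {n : ℕ} (lam : ℝ) (d : Fin n → ℝ) (Y : Finset (Sym2 (Fin n))) : ℝ :=
  (∑ v, uu lam d Y v) / n

/-- Degree sequences and sets of allowed edges under consideration; `j` is an additive slack. -/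
structure Cls (n : ℕ) (T h lam : ℝ) (j : ℕ) (d : Fin n → ℝ) (Y : Finset (Sym2 (Fin n))) :
    Prop where
  loop : loopless Y
  g : ∀ v, |gg lam d Y v| ≤ (T + j) / h
  xd : ∀ v, n - dg Y v ≤ T + j
  s : |∑ v, gg lam d Y v| ≤ (T + j) * n

section Cls

variable {n : ℕ} {F G' Y Y' Z : Finset (Sym2 (Fin n))} {d d' : Fin n → ℝ} {a b u v w : Fin n}
  {e f : Sym2 (Fin n)} {φ ψ : Finset (Sym2 (Fin n)) → ℝ} {T h lam : ℝ} {j j' : ℕ}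

lemma gg_sub_ev : gg lam (d - ev b) Y v = gg lam d Y v - ev b v := by
  simp [gg]; ring

lemma gg_erase (hab : a ≠ b) (he : s(a, b) ∈ Y) :
    gg lam d (Y.erase s(a, b)) v = gg lam d Y v + lam * (ev a v + ev b v) := by
  simp only [gg, dg_erase hab he, Pi.sub_apply]; ring

lemma uu_sub_ev (G : Glob n T h lam) : uu lam (d - ev b) Y v = uu lam d Y v - ev b v * h ^ 2 := by
  rw [uu, gg_sub_ev, G.div_n, uu, G.div_n]; ring

lemma uu_erase (G : Glob n T h lam) (hab : a ≠ b) (he : s(a, b) ∈ Y) :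
    uu lam d (Y.erase s(a, b)) v = uu lam d Y v + lam * (ev a v + ev b v) * h ^ 2 := by
  rw [uu, gg_erase hab he, G.div_n, uu, G.div_n]; ring

lemma Cls.mono (H : Cls n T h lam j d Y) (G : Glob n T h lam) (hj : j ≤ j') :
    Cls n T h lam j' d Y := by
  have hj' : (j:ℝ) ≤ j' := by exact_mod_cast hj
  have hh := G.h0
  refine ⟨H.loop, fun v => (H.g v).trans ?_, fun v => (H.xd v).trans (by linarith),
    H.s.trans ?_⟩ <;> gcongr

lemma Cls.step (H : Cls n T h lam j d Y) (G : Glob n T h lam) (hY : Y' ⊆ Y)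
    (h1 : ∀ v, |gg lam d' Y' v - gg lam d Y v| ≤ 1) (h2 : ∀ v, dg Y v - dg Y' v ≤ 1) :
    Cls n T h lam (j + 1) d' Y' := by
  have hh := G.h0
  have hi : 1 ≤ 1 / h := by rw [le_div_iff₀ hh]; linarith [G.h1]
  refine ⟨H.loop.mono hY, fun v => ?_, fun v => ?_, ?_⟩
  · have := abs_add_le (gg lam d Y v) (gg lam d' Y' v - gg lam d Y v)
    rw [add_sub_cancel] at this
    have e : (T + ((j + 1 : ℕ) : ℝ)) / h = (T + j) / h + 1 / h := by push_cast; ring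
    linarith [H.g v, h1 v]
  · push_cast; linarith [H.xd v, h2 v]
  · have := abs_add_le (∑ v, gg lam d Y v) (∑ v, (gg lam d' Y' v - gg lam d Y v))
    have h3 : |∑ v, (gg lam d' Y' v - gg lam d Y v)| ≤ n := by
      refine (Finset.abs_sum_le_sum_abs _ _).trans ((Finset.sum_le_sum fun v _ => h1 v).trans ?_)
      simp
    rw [← Finset.sum_add_distrib] at this
    simp only [add_sub_cancel] at this
    push_cast
    linarith [H.s]

lemma ev_add_nonneg : 0 ≤ ev a v + ev b v := add_nonneg ev_nonneg ev_nonneg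

lemma Cls.sub_ev (H : Cls n T h lam j d Y) (G : Glob n T h lam) (b : Fin n) :
    Cls n T h lam (j + 1) (d - ev b) Y :=
  H.step G subset_rfl (fun v => by
    rw [gg_sub_ev, abs_le]
    constructor <;> linarith [ev_nonneg (a := b) (v := v), ev_le_one (a := b) (v := v)]) (by simp)

lemma Cls.erase (H : Cls n T h lam j d Y) (G : Glob n T h lam) (hab : a ≠ b)
    (he : s(a, b) ∈ Y) : Cls n T h lam (j + 1) d (Y.erase s(a, b)) := by
  refine H.step G (Finset.erase_subset _ _) (fun v => ?_) fun v => ?_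
  · rw [gg_erase hab he, add_sub_cancel_left, abs_of_nonneg (mul_nonneg G.lam0.le ev_add_nonneg)]
    exact mul_le_one₀ G.lam1.le ev_add_nonneg (ev_add_le hab)
  · rw [dg_erase hab he]
    simp only [Pi.sub_apply]
    linarith [ev_add_le (v := v) hab]

lemma Cls.take (H : Cls n T h lam j d Y) (G : Glob n T h lam) (hab : a ≠ b)
    (he : s(a, b) ∈ Y) : Cls n T h lam (j + 1) (d - ev a - ev b) (Y.erase s(a, b)) := by
  refine H.step G (Finset.erase_subset _ _) (fun v => ?_) fun v => ?_
  · rw [gg_erase hab he, gg_sub_ev, gg_sub_ev]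
    have : gg lam d Y v - ev a v - ev b v + lam * (ev a v + ev b v) - gg lam d Y v =
      -((1 - lam) * (ev a v + ev b v)) := by ring
    have h1 := G.lam1
    rw [this, abs_neg, abs_of_nonneg (mul_nonneg (by linarith) ev_add_nonneg)]
    exact mul_le_one₀ (by linarith [G.lam0]) ev_add_nonneg (ev_add_le hab)
  · rw [dg_erase hab he]
    simp only [Pi.sub_apply]
    linarith [ev_add_le (v := v) hab]

lemma slack_le (G : Glob n T h lam) (hj : j ≤ 50) : T + j ≤ T ^ 2 / 2 := by
  have hj' : (j:ℝ) ≤ 50 := by exact_mod_cast hj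
  nlinarith [G.hT]

lemma Cls.bd_u (H : Cls n T h lam j d Y) (G : Glob n T h lam) (hj : j ≤ 50) (v : Fin n) :
    Bd T h 2 1 (uu lam d Y v) := by
  unfold Bd uu
  rw [G.div_n, abs_mul, abs_of_pos (pow_pos G.h0 2)]
  have hh := G.h0
  calc _ ≤ (T ^ 2 / h) * h ^ 2 := by
        refine mul_le_mul_of_nonneg_right ((H.g v).trans ?_) (sq_nonneg _)
        have := slack_le G hj
        have hT2 := sq_nonneg T
        gcongr; linarith
    _ = _ := by field_simp

lemma Cls.bd_x (H : Cls n T h lam j d Y) (G : Glob n T h lam) (hj : j ≤ 50) (v : Fin n) :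
    Bd T h 2 2 ((n - dg Y v) / n) := by
  unfold Bd
  have h1 : (0:ℝ) ≤ n - dg Y v := sub_nonneg.2 dg_le
  rw [G.div_n, abs_of_nonneg (mul_nonneg h1 (sq_nonneg _))]
  have := slack_le G hj
  exact mul_le_mul_of_nonneg_right ((H.xd v).trans (by nlinarith [sq_nonneg T])) (sq_nonneg _)

lemma Cls.bd_s (H : Cls n T h lam j d Y) (G : Glob n T h lam) (hj : j ≤ 50) :
    Bd T h 2 2 (ss lam d Y) := by
  unfold Bd ss uu
  rw [← Finset.sum_div, abs_div, abs_div, abs_of_pos G.npos, G.div_n]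
  refine mul_le_mul_of_nonneg_right ?_ (sq_nonneg _)
  rw [div_le_iff₀ G.npos]
  refine H.s.trans (mul_le_mul_of_nonneg_right ?_ G.npos.le)
  have := slack_le G hj
  nlinarith [sq_nonneg T]

lemma deg_eq (G : Glob n T h lam) (v : Fin n) :
    d v / n = lam + uu lam d Y v - lam * ((n - dg Y v) / n) := by
  have := G.npos
  unfold uu gg
  field_simp
  ring

lemma Cls.bd_deg (H : Cls n T h lam j d Y) (G : Glob n T h lam) (hj : j ≤ 50) (v : Fin n) :
    Bd T h 3 1 (d v / n - lam) := by
  have h1 := (H.bd_u G hj v).sub G ((G.bd_lam).mul G (H.bd_x G hj v))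
  rw [deg_eq (Y := Y) G]
  have e : lam + uu lam d Y v - lam * ((n - dg Y v) / n) - lam =
    uu lam d Y v - lam * ((n - dg Y v) / n) := by ring
  rw [e]
  exact h1.mono G (by norm_num) (by norm_num)

lemma Cls.toC0 (H : Cls n T h lam j d Y) (G : Glob n T h lam) (hj : j ≤ 50) :
    C0 T lam (T ^ 2 / h) Finset.univ d Y := by
  have hh := G.h0
  have hT := G.hT
  have h1 := G.h1
  have hs := slack_le G hj
  have hi : T ^ 2 ≤ T ^ 2 / h := by
    rw [le_div_iff₀ hh]; nlinarith [sq_nonneg T]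
  refine ⟨H.loop, by simp, hT, by nlinarith, G.lo, G.hi, fun v _ => ?_, fun v _ => ?_⟩
  · have h2 := H.g v
    have h3 := H.xd v
    have h4 : (0:ℝ) ≤ n - dg Y v := sub_nonneg.2 dg_le
    have h5 : (T + j) / h ≤ T ^ 2 / h / 2 := by
      rw [div_div, mul_comm h, ← div_div]; gcongr
    unfold gg at h2
    rw [abs_le] at h2 ⊢
    have h6 : lam * (n - dg Y v) ≤ T ^ 2 / h / 2 := by nlinarith [G.lam0, G.lam1]
    have h7 : 0 ≤ lam * (n - dg Y v) := mul_nonneg G.lam0.le h4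
    constructor <;> linarith
  · linarith [H.xd v, sq_nonneg T]

lemma Glob.size (G : Glob n T h lam) {c : ℕ} (hc : c ≤ 40) : (T ^ 2 / h + 3) * T ^ c ≤ n := by
  have hh := G.h0
  have h0 : T ^ c ≤ T ^ 40 := pow_le_pow_right₀ G.T1 hc
  have h1 := G.pow_le_inv (c := 43) (by norm_num)
  have h2 : 1 ≤ 1 / h := by rw [le_div_iff₀ hh]; linarith [G.h1]
  have hT := G.hT
  have h3 : T ^ 2 / h + 3 ≤ T ^ 3 * (1 / h) := by
    have : T ^ 2 / h = T ^ 2 * (1 / h) := by ring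
    rw [this]
    have e : T ^ 2 + 3 ≤ T ^ 3 := by nlinarith [sq_nonneg T]
    calc _ ≤ (T ^ 2 + 3) * (1 / h) := by linarith
      _ ≤ _ := by gcongr
  have hT0 := G.T0
  calc _ ≤ (T ^ 3 * (1 / h)) * T ^ 40 := by gcongr
    _ = T ^ 43 * (1 / h) := by ring
    _ ≤ (1 / h) * (1 / h) := by gcongr
    _ = n := by rw [G.n_eq]; ring

lemma Glob.size' (G : Glob n T h lam) {c : ℕ} (hc : c ≤ 40) : (T ^ 2 / h) * T ^ c ≤ n :=
  le_trans (mul_le_mul_of_nonneg_right (by linarith) (pow_nonneg G.T0.le _)) (G.size hc)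

lemma Glob.two_size (G : Glob n T h lam) : 2 * (T ^ 2 / h) * T ^ 10 ≤ n := by
  refine le_trans ?_ (G.size' (c := 11) (by norm_num))
  have hh := G.h0
  have : 0 ≤ T ^ 2 / h * T ^ 10 := by have := G.T0; positivity
  have hT := G.hT
  calc _ = (T ^ 2 / h * T ^ 10) * 2 := by ring
    _ ≤ (T ^ 2 / h * T ^ 10) * T := by gcongr; linarith
    _ = _ := by ring

lemma Cls.pos_take (H : Cls n T h lam j d Y) (G : Glob n T h lam) (hj : j ≤ 50) (hab : a ≠ b)
    (he : s(a, b) ∈ Y) (hp : 0 < nn d Y) : 0 < nn (d - ev a - ev b) (Y.erase s(a, b)) := by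
  have := crude_lower (H.toC0 G hj) (G.size' (by norm_num)) (Finset.mem_univ a)
    (Finset.mem_univ b) he
  rw [sum_ind hab he] at this
  exact pos_of_mul_pos_right (hp.trans_le this) (pow_nonneg G.T0.le _)

lemma Cls.pos_erase (H : Cls n T h lam j d Y) (G : Glob n T h lam) (hj : j ≤ 50)
    (he : s(a, b) ∈ Y) (hp : 0 < nn d Y) : 0 < nn d (Y.erase s(a, b)) := by
  have := crude_upper (H.toC0 G hj) G.two_size (Finset.mem_univ a) (Finset.mem_univ b) he
  rw [sum_one_sub_ind he] at this
  exact pos_of_mul_pos_right (hp.trans_le this) (pow_nonneg G.T0.le _)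

/-- The ratio of the numbers of graphs whose degree sequences differ at `a` and `b`. -/
def rt {n : ℕ} (a b : Fin n) (d : Fin n → ℝ) (Y : Finset (Sym2 (Fin n))) : ℝ :=
  nn (d - ev a) Y / nn (d - ev b) Y

lemma Cls.ratio_le (H : Cls n T h lam j d Y) (G : Glob n T h lam) (hj : j ≤ 49) (hab : a ≠ b) :
    |nn (d - ev a) Y - nn (d - ev b) Y| ≤ T ^ 30 * h * nn (d - ev b) Y := by
  have := ratio_crude ((H.sub_ev G a).toC0 G (by omega)) hab (Finset.mem_univ a)
    (Finset.mem_univ b) (G.size' (by norm_num)) (G.pow_le_n (by norm_num)) G.log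
  refine this.trans (le_of_eq ?_)
  have hh := G.h0.ne'
  rw [G.div_n]
  field_simp

lemma Cls.pos_swap (H : Cls n T h lam j d Y) (G : Glob n T h lam) (hj : j ≤ 49) (hab : a ≠ b)
    (hp : 0 < nn (d - ev b) Y) : 0 < nn (d - ev a) Y := by
  have := H.ratio_le G hj hab.symm
  rcases (nn_nonneg (d := d - ev a) (Y := Y)).eq_or_lt with h0 | h0
  · rw [← h0] at this; simp at this
    linarith
  · exact h0

lemma Cls.bd_rt (H : Cls n T h lam j d Y) (G : Glob n T h lam) (hj : j ≤ 49) (hab : a ≠ b)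
    (hp : 0 < nn (d - ev b) Y) : Bd T h 30 1 (rt a b d Y - 1) := by
  have := H.ratio_le G hj hab
  unfold Bd rt
  rw [div_sub_one hp.ne', abs_div, abs_of_pos hp, div_le_iff₀ hp]
  simpa using this

end Cls

section inverse

variable {n : ℕ} {F Y : Finset (Sym2 (Fin n))} {d : Fin n → ℝ} {a b v : Fin n}
  {φ : Finset (Sym2 (Fin n)) → ℝ} {T h lam : ℝ} {j : ℕ} {m : ℝ}

/-- The normalised number of switchings from `b` to `a`, counting one extra. -/
def yy {n : ℕ} (a b : Fin n) (Y F : Finset (Sym2 (Fin n))) : ℝ := (lfun a b Y F + 1) / n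

lemma yy_ge (G : Glob n T h lam) (hF : F ∈ gr d Y) : h ^ 2 ≤ yy a b Y F := by
  have := lfun_nonneg (a := a) (b := b) (mem_gr.1 hF).1
  rw [yy, G.div_n]
  nlinarith [sq_nonneg h]

lemma yy_pos (G : Glob n T h lam) (hF : F ∈ gr d Y) : 0 < yy a b Y F :=
  (pow_pos G.h0 2).trans_le (yy_ge G hF)

lemma yy_le (G : Glob n T h lam) : yy a b Y F ≤ 2 := by
  have := lfun_le (a := a) (b := b) (Y := Y) (F := F)
  have h1 : (1:ℝ) ≤ n := by simpa using G.pow_le_n (c := 0) (by norm_num)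
  rw [yy, div_le_iff₀ G.npos]
  linarith

lemma Glob.inv_m (G : Glob n T h lam) (hm : Bd T h 40 1 (m - lam * (1 - lam))) :
    0 < m ∧ 1 / m ≤ T ^ 3 := by
  have hT := G.hT
  have hT0 := G.T0
  have h1 := hm.absorb G (c := 40) (k := 0) (by norm_num)
  have h2 : T ^ 3 * |m - lam * (1 - lam)| ≤ 1 := by
    calc _ ≤ T ^ 3 * (T ^ 40 * h ^ 1) := mul_le_mul_of_nonneg_left hm (by positivity)
      _ = T ^ 43 * h := by ring
      _ ≤ 1 := G.pow_mul_le (by norm_num)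
  have h3 : 1 ≤ T ^ 3 * m := by
    have h4 := G.q_ge
    have h5 := neg_abs_le (m - lam * (1 - lam))
    have h6 : T ^ 3 * (lam * (1 - lam) - |m - lam * (1 - lam)|) ≤ T ^ 3 * m :=
      mul_le_mul_of_nonneg_left (by linarith) (by positivity)
    have h7 : T ≤ T ^ 3 * (lam * (1 - lam)) := by
      calc T = T * 1 := by ring
        _ ≤ T * (lam * (1 - lam) * T ^ 2) := by gcongr
        _ = _ := by ring
    linarith
  have h4 : 0 < m := pos_of_mul_pos_right (by linarith) (pow_nonneg hT0.le 3)
  exact ⟨h4, by rwa [div_le_iff₀ h4]⟩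

lemma Glob.bd_inv_m (G : Glob n T h lam) (hm : Bd T h 40 1 (m - lam * (1 - lam))) :
    Bd T h 3 0 (1 / m) := by
  obtain ⟨h1, h2⟩ := G.inv_m hm
  unfold Bd
  rw [abs_of_pos (by positivity)]
  simpa using h2

lemma Cls.moment (H : Cls n T h lam j d Y) (G : Glob n T h lam) (hj : j ≤ 50) (hab : a ≠ b)
    (hp : 0 < nn d Y) (hm : Bd T h 40 1 (m - lam * (1 - lam))) :
    av d Y (fun F => (yy a b Y F - m) ^ 4) ≤ (T ^ 42 * h) ^ 4 := by
  have hT := G.hT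
  have hT0 := G.T0
  have hh := G.h0
  have h1 := fourth_moment (H.toC0 G hj) hab (G.size (by norm_num)) (G.pow_le_n (by norm_num))
    G.log (by
      rw [G.n_eq, div_pow]
      gcongr
      exact one_le_pow₀ (one_le_pow₀ G.T1))
  set μ := d b * (n - d a) / n with hμ
  have e1 : h ^ 2 * μ = d b / n * (1 - d a / n) := by
    rw [hμ, ← G.inv_n]; have := G.npos; field_simp
  have hz : |h ^ 2 + h ^ 2 * μ - m| ≤ T ^ 41 * h := by
    have hb := H.bd_deg G hj b
    have ha := H.bd_deg G hj a
    have key : Bd T h 41 1 (h ^ 2 + h ^ 2 * μ - m) := by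
      have := ((G.bd_hh.add G (((hb.mul G G.bd_one_sub_lam).sub G (G.bd_lam.mul G ha)).sub G
        (hb.mul G ha))).sub G hm)
      rw [e1]
      have e : h ^ 2 + d b / n * (1 - d a / n) - m = h ^ 2 + ((d b / n - lam) * (1 - lam)
          - lam * (d a / n - lam) - (d b / n - lam) * (d a / n - lam)) - (m - lam * (1 - lam)) := by
        ring
      rw [e]
      exact this.mono G (by norm_num) (by norm_num)
    simpa [Bd] using key
  set z := h ^ 2 + h ^ 2 * μ - m with hz'
  have h2 : ∀ F, (yy a b Y F - m) ^ 4 ≤ 8 * h ^ 8 * (lfun a b Y F - μ) ^ 4 + 8 * z ^ 4 := by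
    intro F
    have e : yy a b Y F - m = h ^ 2 * (lfun a b Y F - μ) + z := by
      rw [yy, G.div_n, hz']; ring
    rw [e]
    generalize lfun a b Y F - μ = x
    have : ∀ x y : ℝ, (x + y) ^ 4 ≤ 8 * x ^ 4 + 8 * y ^ 4 := fun x y => by
      nlinarith only [sq_nonneg (x ^ 2 - y ^ 2), sq_nonneg ((x - y) * (x + y)),
        sq_nonneg ((x - y) ^ 2), mul_nonneg (sq_nonneg (x - y)) (add_nonneg (sq_nonneg x)
          (sq_nonneg y)), mul_nonneg (sq_nonneg (x - y)) (sq_nonneg (x + y))]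
    calc _ ≤ 8 * (h ^ 2 * x) ^ 4 + 8 * z ^ 4 := this _ _
      _ = _ := by ring
  have h3 : av d Y (fun F => (yy a b Y F - m) ^ 4) ≤
      8 * h ^ 8 * (200 * (T ^ 29 * (T ^ 2 / h)) ^ 4) + 8 * z ^ 4 := by
    refine (av_mono fun F _ => h2 F).trans ?_
    rw [av_add, av_const hp, av_mul]
    have : av d Y (fun F => (lfun a b Y F - μ) ^ 4) ≤ 200 * (T ^ 29 * (T ^ 2 / h)) ^ 4 := by
      rw [av, div_le_iff₀ hp]; exact h1
    gcongr
  refine h3.trans ?_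
  have e2 : 8 * h ^ 8 * (200 * (T ^ 29 * (T ^ 2 / h)) ^ 4) = 1600 * T ^ 124 * h ^ 4 := by
    field_simp; norm_num
  have h4 : z ^ 4 ≤ (T ^ 41 * h) ^ 4 := by
    rw [← Even.pow_abs (by decide : Even 4)]
    exact pow_le_pow_left₀ (abs_nonneg _) hz 4
  rw [e2]
  have h5 : T ^ 124 ≤ T ^ 164 := pow_le_pow_right₀ G.T1 (by norm_num)
  have h6 : (1608:ℝ) ≤ T ^ 4 := le_trans (by norm_num) (pow_le_pow_left₀ (by norm_num) hT 4)
  calc _ ≤ 1600 * T ^ 164 * h ^ 4 + 8 * (T ^ 41 * h) ^ 4 := by gcongr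
    _ = 1608 * (T ^ 164 * h ^ 4) := by ring
    _ ≤ T ^ 4 * (T ^ 164 * h ^ 4) := by gcongr
    _ = _ := by ring

lemma pow_le_one_add_pow_four {t : ℝ} (ht : 0 ≤ t) {k : ℕ} (hk : k ≤ 4) : t ^ k ≤ 1 + t ^ 4 := by
  rcases le_total t 1 with h1 | h1
  · have := pow_le_one₀ ht h1 (n := k)
    have : 0 ≤ t ^ 4 := by positivity
    linarith
  · have := pow_le_pow_right₀ h1 hk
    linarith

lemma Cls.abs_moment (H : Cls n T h lam j d Y) (G : Glob n T h lam) (hj : j ≤ 50) (hab : a ≠ b)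
    (hp : 0 < nn d Y) (hm : Bd T h 40 1 (m - lam * (1 - lam))) {k : ℕ} (hk : k ≤ 4) :
    av d Y (fun F => |yy a b Y F - m| ^ k) ≤ 2 * (T ^ 42 * h) ^ k := by
  have hδ : 0 < T ^ 42 * h := mul_pos (pow_pos G.T0 _) G.h0
  have h1 := H.moment G hj hab hp hm
  set δ := T ^ 42 * h
  have h2 : ∀ F, |yy a b Y F - m| ^ k ≤ δ ^ k + δ ^ k / δ ^ 4 * (yy a b Y F - m) ^ 4 := by
    intro F
    have := pow_le_one_add_pow_four (t := |yy a b Y F - m| / δ) (by positivity) hk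
    rw [div_pow, div_pow, Even.pow_abs (by decide : Even 4), div_le_iff₀ (by positivity)] at this
    refine this.trans (le_of_eq ?_)
    ring
  refine (av_mono fun F _ => h2 F).trans ?_
  rw [av_add, av_const hp, av_mul]
  have : δ ^ k / δ ^ 4 * av d Y (fun F => (yy a b Y F - m) ^ 4) ≤ δ ^ k / δ ^ 4 * δ ^ 4 := by
    gcongr
  rw [div_mul_cancel₀ _ (by positivity)] at this
  linarith

lemma Cls.inv_moment (H : Cls n T h lam j d Y) (G : Glob n T h lam) (hj : j ≤ 50) (hab : a ≠ b)
    (hp : 0 < nn d Y) (hm : Bd T h 40 1 (m - lam * (1 - lam))) {k : ℕ} (hk : k ≤ 3) :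
    av d Y (fun F => |yy a b Y F - m| ^ k / yy a b Y F) ≤ T ^ 155 * h ^ k := by
  have hT := G.hT
  have hT0 := G.T0
  have hh := G.h0
  have hh1 := G.h1
  have h1 := H.abs_moment G hj hab hp hm (k := k) (by omega)
  have h2 := lower_tail (H.toC0 G hj) hab (Finset.mem_univ a) (Finset.mem_univ b)
    (G.size' (by norm_num)) (G.pow_le_n (by norm_num)) G.log
  have hm2 : |m| ≤ 2 := by
    have := hm.absorb G (k := 0) (by norm_num)
    have h3 := G.q_pos
    have h4 := G.lam0
    have h5 := G.lam1
    unfold Bd at this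
    simp only [pow_zero, one_mul] at this
    rw [abs_le] at this ⊢
    constructor <;> nlinarith
  have h3 : ∀ F ∈ gr d Y, |yy a b Y F - m| ^ k / yy a b Y F ≤ T ^ 27 * |yy a b Y F - m| ^ k +
      64 / h ^ 2 * (if lfun a b Y F < n / T ^ 27 then (1:ℝ) else 0) := by
    intro F hF
    have y0 := yy_pos (a := a) (b := b) G hF
    have y1 := yy_ge (a := a) (b := b) G hF
    have y2 := yy_le (a := a) (b := b) (Y := Y) (F := F) G
    split_ifs with hl
    · have h5 : |yy a b Y F - m| ^ k ≤ 64 := by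
        have h6 : |yy a b Y F - m| ≤ 4 := by
          rw [abs_le] at hm2 ⊢
          constructor <;> linarith
        calc _ ≤ (4:ℝ) ^ k := pow_le_pow_left₀ (abs_nonneg _) h6 k
          _ ≤ 4 ^ 3 := pow_le_pow_right₀ (by norm_num) hk
          _ = 64 := by norm_num
      have h7 : |yy a b Y F - m| ^ k / yy a b Y F ≤ 64 / h ^ 2 := by gcongr
      have h8 : 0 ≤ T ^ 27 * |yy a b Y F - m| ^ k := by positivity
      linarith
    · push Not at hl
      have h5 : 1 / T ^ 27 ≤ yy a b Y F := by
        rw [yy, le_div_iff₀ G.npos]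
        have : 1 / T ^ 27 * n = n / T ^ 27 := by ring
        linarith
      have h6 : 1 / yy a b Y F ≤ T ^ 27 := by
        rw [div_le_iff₀ y0]
        rw [div_le_iff₀ (by positivity)] at h5
        linarith
      have h7 : 0 ≤ |yy a b Y F - m| ^ k := by positivity
      calc _ = 1 / yy a b Y F * |yy a b Y F - m| ^ k := by ring
        _ ≤ T ^ 27 * |yy a b Y F - m| ^ k := by gcongr
        _ = _ := by ring
  refine (av_mono h3).trans ?_
  rw [av_add, av_mul, av_mul]
  have h4 : av d Y (fun F => if lfun a b Y F < n / T ^ 27 then (1:ℝ) else 0) ≤ h ^ 20 := by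
    rw [av, div_le_iff₀ hp]
    refine h2.trans (le_of_eq ?_)
    rw [G.n_eq]; field_simp
  have h5 : 64 / h ^ 2 * h ^ 20 ≤ 64 * h ^ k := by
    have e : 64 / h ^ 2 * h ^ 20 = 64 * h ^ 18 := by field_simp
    rw [e]
    have := pow_le_pow_of_le_one hh.le hh1 (show k ≤ 18 by omega)
    linarith
  have h6 : (T ^ 42) ^ k ≤ T ^ 126 := by
    rw [← pow_mul]; exact pow_le_pow_right₀ G.T1 (by omega)
  calc _ ≤ T ^ 27 * (2 * (T ^ 42 * h) ^ k) + 64 / h ^ 2 * h ^ 20 := by gcongr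
    _ ≤ T ^ 27 * (2 * (T ^ 42 * h) ^ k) + 64 * h ^ k := by gcongr
    _ = (2 * (T ^ 27 * (T ^ 42) ^ k) + 64) * h ^ k := by rw [mul_pow]; ring
    _ ≤ (2 * (T ^ 27 * T ^ 126) + 64) * h ^ k := by gcongr
    _ ≤ T ^ 155 * h ^ k := by
        gcongr
        have h8 : (1:ℝ) ≤ T ^ 153 := one_le_pow₀ G.T1
        have h9 : T ^ 155 = T ^ 153 * T ^ 2 := by ring
        have h10 : T ^ 27 * T ^ 126 = T ^ 153 := by ring
        have h11 : T ^ 153 * 100 ≤ T ^ 153 * T ^ 2 := by gcongr; nlinarith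
        linarith

lemma Cls.av_div (H : Cls n T h lam j d Y) (G : Glob n T h lam) (hj : j ≤ 50) (hab : a ≠ b)
    (hp : 0 < nn d Y) (hm : Bd T h 40 1 (m - lam * (1 - lam))) {c k : ℕ}
    (hφ : ∀ F ∈ gr d Y, Bd T h c k (φ F)) :
    Bd T h (c + 158) (k + 1) (av d Y (fun F => φ F / yy a b Y F) - av d Y φ / m) := by
  obtain ⟨m0, m1⟩ := G.inv_m hm
  have hT0 := G.T0
  have hh := G.h0
  have h1 := H.inv_moment G hj hab hp hm (k := 1) (by norm_num)
  have e1 : av d Y (fun F => φ F / yy a b Y F) - av d Y φ / m =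
      av d Y fun F => φ F / yy a b Y F - 1 / m * φ F := by
    rw [av_sub, av_mul]; ring
  have e2 : ∀ F ∈ gr d Y, |φ F / yy a b Y F - 1 / m * φ F| ≤
      T ^ c * h ^ k * T ^ 3 * (|yy a b Y F - m| ^ 1 / yy a b Y F) := by
    intro F hF
    have y0 := yy_pos (a := a) (b := b) G hF
    have e3 : φ F / yy a b Y F - 1 / m * φ F = -(φ F * (1 / m) * ((yy a b Y F - m)
        / yy a b Y F)) := by field_simp; ring
    rw [e3, abs_neg, abs_mul, abs_mul, abs_div (_ - _), abs_of_pos y0,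
      abs_of_pos (by positivity : 0 < 1 / m),
      pow_one]
    have := hφ F hF
    unfold Bd at this
    gcongr
  unfold Bd
  rw [e1]
  refine abs_av_le.trans ((av_mono e2).trans ?_)
  rw [av_mul]
  calc _ ≤ T ^ c * h ^ k * T ^ 3 * (T ^ 155 * h ^ 1) := by gcongr
    _ = _ := by ring

lemma Cls.av_inv (H : Cls n T h lam j d Y) (G : Glob n T h lam) (hj : j ≤ 50) (hab : a ≠ b)
    (hp : 0 < nn d Y) (hm : Bd T h 40 1 (m - lam * (1 - lam))) :
    Bd T h 161 2 (av d Y (fun F => 1 / yy a b Y F) - 1 / m + (av d Y (yy a b Y) - m) / m ^ 2) := by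
  obtain ⟨m0, m1⟩ := G.inv_m hm
  have hT0 := G.T0
  have hh := G.h0
  have h1 := H.inv_moment G hj hab hp hm (k := 2) (by norm_num)
  have e1 : av d Y (fun F => 1 / yy a b Y F) - 1 / m + (av d Y (yy a b Y) - m) / m ^ 2 =
      av d Y fun F => 1 / m ^ 2 * (|yy a b Y F - m| ^ 2 / yy a b Y F) := by
    have e2 : av d Y (fun F => 1 / m ^ 2 * (|yy a b Y F - m| ^ 2 / yy a b Y F)) =
        av d Y fun F => 1 / yy a b Y F - 1 / m + 1 / m ^ 2 * (yy a b Y F - m) := by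
      refine av_congr fun F hF => ?_
      have y0 := yy_pos (a := a) (b := b) G hF
      rw [sq_abs]
      field_simp; ring
    rw [e2, av_add, av_sub, av_mul, av_sub, av_const hp, av_const hp]
    ring
  rw [e1, av_mul]
  have h0 : 0 ≤ av d Y (fun F => |yy a b Y F - m| ^ 2 / yy a b Y F) :=
    av_nonneg fun F hF => div_nonneg (by positivity) (yy_pos G hF).le
  unfold Bd
  rw [abs_of_nonneg (by positivity)]
  have e3 : 1 / m ^ 2 = (1 / m) ^ 2 := by ring
  have h4 : 0 < 1 / m := by positivity
  rw [e3]
  calc _ ≤ (T ^ 3) ^ 2 * (T ^ 155 * h ^ 2) := by gcongr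
    _ = _ := by ring

lemma Cls.av_inv_mean (H : Cls n T h lam j d Y) (G : Glob n T h lam) (hj : j ≤ 50) (hab : a ≠ b)
    (hp : 0 < nn d Y) (hm : Bd T h 40 1 (m - lam * (1 - lam))) (hmm : m = av d Y (yy a b Y)) :
    Bd T h 164 3 (av d Y (fun F => 1 / yy a b Y F) - 1 / m
      - av d Y (fun F => (yy a b Y F - m) ^ 2) / m ^ 3) := by
  obtain ⟨m0, m1⟩ := G.inv_m hm
  have hT0 := G.T0
  have hh := G.h0
  have h1 := H.inv_moment G hj hab hp hm (k := 3) (by norm_num)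
  have e1 : av d Y (fun F => 1 / yy a b Y F) - 1 / m
      - av d Y (fun F => (yy a b Y F - m) ^ 2) / m ^ 3 =
      av d Y fun F => -(1 / m ^ 3) * ((yy a b Y F - m) ^ 3 / yy a b Y F) := by
    have e2 : av d Y (fun F => -(1 / m ^ 3) * ((yy a b Y F - m) ^ 3 / yy a b Y F)) =
        av d Y fun F => 1 / yy a b Y F - 1 / m + 1 / m ^ 2 * (yy a b Y F - m)
          - 1 / m ^ 3 * (yy a b Y F - m) ^ 2 := by
      refine av_congr fun F hF => ?_
      have y0 := yy_pos (a := a) (b := b) G hF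
      field_simp; ring
    rw [e2, av_sub, av_add, av_sub, av_mul, av_mul, av_sub, av_const hp, av_const hp, ← hmm]
    ring
  rw [e1, av_mul]
  unfold Bd
  rw [abs_mul, abs_neg, abs_of_pos (by positivity : 0 < 1 / m ^ 3)]
  have e3 : 1 / m ^ 3 = (1 / m) ^ 3 := by ring
  have h4 : 0 < 1 / m := by positivity
  have h5 : |av d Y (fun F => (yy a b Y F - m) ^ 3 / yy a b Y F)| ≤ T ^ 155 * h ^ 3 := by
    refine abs_av_le.trans (le_trans (le_of_eq (av_congr fun F hF => ?_)) h1)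
    rw [abs_div, abs_of_pos (yy_pos G hF), abs_pow]
  rw [e3]
  calc _ ≤ (T ^ 3) ^ 3 * (T ^ 155 * h ^ 3) := by gcongr
    _ = _ := by ring

end inverse

section ladder

variable {n : ℕ} {F Y : Finset (Sym2 (Fin n))} {d : Fin n → ℝ} {a b v : Fin n}
  {φ : Finset (Sym2 (Fin n)) → ℝ} {T h lam : ℝ} {j : ℕ} {m : ℝ}

lemma Bd.congr (G : Glob n T h lam) {c k c' k' : ℕ} {x y : ℝ} (H : Bd T h c k x) (e : y = x)
    (hc : c ≤ c') (hk : k' ≤ k) : Bd T h c' k' y := e ▸ H.mono G hc hk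

lemma bd_zero (G : Glob n T h lam) (k : ℕ) : Bd T h 0 k 0 := by
  unfold Bd; simp; exact pow_nonneg G.h0.le _

lemma pr_eq_zero (he : s(a, v) ∉ Y) : pr d Y a v = 0 := by
  unfold pr av
  rw [Finset.sum_eq_zero fun F hF => ind_eq_zero_of_mem_gr hF he, zero_div]

lemma sum_pr (hp : 0 < nn d Y) : ∑ b, pr d Y b v = d v := by
  unfold pr
  rw [← av_sum, ← av_const hp (d v)]
  refine av_congr fun F hF => ?_
  rw [← dg_of_mem_gr hF v]
  exact Finset.sum_congr rfl fun u _ => ind_comm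

lemma edge_ne (hab : a ≠ b) : s(a, v) ≠ s(b, v) := by
  intro h
  rw [Sym2.eq_swap, Sym2.eq_swap (a := b)] at h
  exact hab (Sym2.congr_right.1 h)

lemma Cls.pw_eq (H : Cls n T h lam j d Y) (G : Glob n T h lam) (hj : j ≤ 45) (hp : 0 < nn d Y)
    (hab : a ≠ b) (ha : s(a, v) ∈ Y) (hb : s(b, v) ∈ Y) : pw a b d Y v =
      nn (d - ev v - ev b) ((Y.erase s(b, v)).erase s(a, v)) / nn d Y := by
  have hbv := H.loop.ne hb
  rw [← av_ind_mul_one_sub (H.pos_take G (by omega) hbv hb hp) hab hbv hb, av,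
    sum_ind_mul hbv hb, sub_right_comm]
  congr 1
  rw [← sum_one_sub_ind (Finset.mem_erase.2 ⟨edge_ne hab, ha⟩)]
  exact Finset.sum_congr rfl fun F _ => by rw [ind_insert_of_ne (edge_ne hab)]

lemma Cls.pr_sub (H : Cls n T h lam j d Y) (G : Glob n T h lam) (hj : j ≤ 45) (hp : 0 < nn d Y)
    (hab : a ≠ b) (ha : s(a, v) ∈ Y) (hb : s(b, v) ∈ Y) : pr d Y a v - pr d Y b v =
      (rt a b (d - ev v) ((Y.erase s(b, v)).erase s(a, v)) - 1) * pw a b d Y v := by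
  have hbv := H.loop.ne hb
  have hav := H.loop.ne ha
  have hbe : s(a, v) ∈ Y.erase s(b, v) := Finset.mem_erase.2 ⟨edge_ne hab, ha⟩
  have e1 : pr d Y a v - pr d Y b v = pw b a d Y v - pw a b d Y v := by
    rw [← av_ind_mul_one_sub (H.pos_take G (by omega) hbv hb hp) hab hbv hb,
      ← av_ind_mul_one_sub (H.pos_take G (by omega) hav ha hp) hab.symm hav ha, ← av_sub, pr, pr,
      ← av_sub]
    exact av_congr fun F _ => by ring
  have h0 : 0 < nn (d - ev v - ev b) ((Y.erase s(b, v)).erase s(a, v)) := by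
    rw [sub_right_comm]
    exact (H.take G hbv hb).pos_erase G (by omega) hbe (H.pos_take G (by omega) hbv hb hp)
  rw [e1, H.pw_eq G hj hp hab ha hb, H.pw_eq G hj hp hab.symm hb ha, rt, Finset.erase_right_comm]
  field_simp [h0.ne']

/-- Probability estimates follow from estimates of differences. -/
lemma Cls.ladder (H : Cls n T h lam j d Y) (G : Glob n T h lam) (hj : j ≤ 45) (hp : 0 < nn d Y)
    {c k : ℕ} {f : Fin n → ℝ} (hf : ∀ b, Bd T h 8 1 (f b))
    (hW : ∀ b, s(b, v) ∈ Y → Bd T h c k (pr d Y a v - pr d Y b v - f b)) :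
    Bd T h (max c 10 + 1) (min k 3) (pr d Y a v - (lam + uu lam d Y v
      + (n - dg Y v) / n * (pr d Y a v - lam) + (∑ b, f b) / n)) := by
  have e1 : ∑ b, ind Y s(b, v) = dg Y v := Finset.sum_congr rfl fun b _ => ind_comm
  have e2 : ∑ b, ind Y s(b, v) * pr d Y b v = d v := by
    rw [← sum_pr hp]
    refine Finset.sum_congr rfl fun b _ => ?_
    by_cases hb : s(b, v) ∈ Y
    · rw [ind_of_mem hb, one_mul]
    · rw [pr_eq_zero hb, mul_zero]
  have e3 : ∑ b, ind Y s(b, v) * (pr d Y a v - pr d Y b v - f b)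
      + ∑ b, (1 - ind Y s(b, v)) * (-f b) = dg Y v * pr d Y a v - d v - ∑ b, f b := by
    rw [← Finset.sum_add_distrib, ← e1, Finset.sum_mul, ← e2, ← Finset.sum_sub_distrib,
      ← Finset.sum_sub_distrib]
    exact Finset.sum_congr rfl fun b _ => by ring
  have b1 : Bd T h c k ((∑ b, ind Y s(b, v) * (pr d Y a v - pr d Y b v - f b)) / n) := by
    refine Bd.sum_div G fun b => ?_
    by_cases hb : s(b, v) ∈ Y
    · rw [ind_of_mem hb, one_mul]; exact hW b hb
    · rw [ind_of_notMem hb, zero_mul]; exact (bd_zero G k).mono G (Nat.zero_le _) le_rfl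
  have b2 : Bd T h 10 3 ((∑ b, (1 - ind Y s(b, v)) * (-f b)) / n) := by
    have hx := H.bd_x G (by omega) v
    unfold Bd at hx ⊢
    have h1 : (0:ℝ) ≤ n - dg Y v := sub_nonneg.2 dg_le
    rw [abs_of_nonneg (div_nonneg h1 G.npos.le)] at hx
    rw [abs_div, abs_of_pos G.npos]
    have h2 : |∑ b, (1 - ind Y s(b, v)) * (-f b)| ≤ (n - dg Y v) * (T ^ 8 * h ^ 1) := by
      refine (Finset.abs_sum_le_sum_abs _ _).trans ?_
      calc _ ≤ ∑ b, (1 - ind Y s(b, v)) * (T ^ 8 * h ^ 1) := by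
            refine Finset.sum_le_sum fun b _ => ?_
            have h3 : 0 ≤ 1 - ind Y s(b, v) := sub_nonneg.2 ind_le_one
            rw [abs_mul, abs_neg, abs_of_nonneg h3]
            exact mul_le_mul_of_nonneg_left (hf b) h3
        _ = _ := by rw [← Finset.sum_mul, Finset.sum_sub_distrib, e1]; simp
    have hT0 := G.T0
    have hh := G.h0
    calc _ ≤ (n - dg Y v) * (T ^ 8 * h ^ 1) / n := div_le_div_of_nonneg_right h2 G.npos.le
      _ = (n - dg Y v) / n * (T ^ 8 * h ^ 1) := by ring
      _ ≤ (T ^ 2 * h ^ 2) * (T ^ 8 * h ^ 1) := by gcongr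
      _ = _ := by ring
  refine (b1.add G b2).congr G ?_ le_rfl le_rfl
  rw [← add_div, e3]
  have := G.npos
  rw [uu, gg]
  field_simp
  ring

lemma pw_abs_le : |pw a b d Y v| ≤ 1 := by
  have h1 := pr_nonneg (d := d) (Y := Y) (a := b) (v := v)
  have h2 := pr_le_one (d := d) (Y := Y) (a := b) (v := v)
  have h3 := pr_nonneg (d := d - ev b - ev v) (Y := Y.erase s(b, v)) (a := a) (v := v)
  have h4 := pr_le_one (d := d - ev b - ev v) (Y := Y.erase s(b, v)) (a := a) (v := v)
  rw [pw, abs_of_nonneg (mul_nonneg h1 (by linarith))]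
  exact mul_le_one₀ h2 (by linarith) (by linarith)

lemma bd_pw : Bd T h 0 0 (pw a b d Y v) := by unfold Bd; simpa using pw_abs_le

lemma Cls.shift3 (H : Cls n T h lam j d Y) (G : Glob n T h lam) (hab : a ≠ b)
    (ha : s(a, v) ∈ Y) (hb : s(b, v) ∈ Y) :
    Cls n T h lam (j + 3) (d - ev v) ((Y.erase s(b, v)).erase s(a, v)) :=
  ((H.sub_ev G v).erase G (H.loop.ne hb) hb).erase G (H.loop.ne ha)
    (Finset.mem_erase.2 ⟨edge_ne hab, ha⟩)

lemma Cls.pos3 (H : Cls n T h lam j d Y) (G : Glob n T h lam) (hj : j ≤ 45) (hp : 0 < nn d Y)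
    (hab : a ≠ b) (ha : s(a, v) ∈ Y) (hb : s(b, v) ∈ Y) :
    0 < nn (d - ev v - ev b) ((Y.erase s(b, v)).erase s(a, v)) := by
  rw [sub_right_comm]
  exact (H.take G (H.loop.ne hb) hb).pos_erase G (by omega)
    (Finset.mem_erase.2 ⟨edge_ne hab, ha⟩) (H.pos_take G (by omega) (H.loop.ne hb) hb hp)

lemma uu_shift3 (H : Cls n T h lam j d Y) (G : Glob n T h lam) (hab : a ≠ b)
    (ha : s(a, v) ∈ Y) (hb : s(b, v) ∈ Y) :
    uu lam (d - ev v) ((Y.erase s(b, v)).erase s(a, v)) a = uu lam d Y a + lam * h ^ 2 ∧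
    uu lam (d - ev v) ((Y.erase s(b, v)).erase s(a, v)) b = uu lam d Y b + lam * h ^ 2 := by
  have hav := H.loop.ne ha
  have hbv := H.loop.ne hb
  rw [uu_erase G hav (Finset.mem_erase.2 ⟨edge_ne hab, ha⟩),
    uu_erase G hav (Finset.mem_erase.2 ⟨edge_ne hab, ha⟩), uu_erase G hbv hb,
    uu_erase G hbv hb, uu_sub_ev G, uu_sub_ev G]
  simp only [ev_self, ev_of_ne hab, ev_of_ne hab.symm, ev_of_ne hav, ev_of_ne hbv]
  constructor <;> ring

lemma Cls.pr_one (H : Cls n T h lam j d Y) (G : Glob n T h lam) (hj : j ≤ 45) (hp : 0 < nn d Y)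
    (ha : s(a, v) ∈ Y) : Bd T h 33 1 (pr d Y a v - lam) := by
  have h1 := H.ladder G hj hp (a := a) (v := v) (f := fun _ => 0) (c := 30) (k := 1)
    (fun b => (bd_zero G 1).mono G (by norm_num) le_rfl) (fun b hb => by
      rcases eq_or_ne a b with rfl | hab
      · simpa using (bd_zero G 1).mono G (Nat.zero_le 30) le_rfl
      rw [sub_zero, H.pr_sub G hj hp hab ha hb]
      exact (((H.shift3 G hab ha hb).bd_rt G (by omega) hab (H.pos3 G hj hp hab ha hb)).mul G
        bd_pw).mono G (by norm_num) (by norm_num))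
  have hpr : Bd T h 0 0 (pr d Y a v) := by
    unfold Bd; rw [abs_of_nonneg pr_nonneg]; simpa using pr_le_one
  have hpl := hpr.sub G G.bd_lam
  refine ((h1.add G (H.bd_u G (by omega) v)).add G ((H.bd_x G (by omega) v).mul G hpl)).congr G
    ?_ (by norm_num) (by norm_num)
  simp only [Finset.sum_const_zero, zero_div]
  ring

lemma Cls.bd_pw_one (H : Cls n T h lam j d Y) (G : Glob n T h lam) (hj : j ≤ 44)
    (hp : 0 < nn d Y) (hab : a ≠ b) (ha : s(a, v) ∈ Y) (hb : s(b, v) ∈ Y) :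
    Bd T h 36 1 (pw a b d Y v - lam * (1 - lam)) := by
  have hbv := H.loop.ne hb
  have h1 := H.pr_one G (by omega) hp hb
  have h2 := (H.take G hbv hb).pr_one G (by omega) (H.pos_take G (by omega) hbv hb hp)
    (a := a) (v := v) (Finset.mem_erase.2 ⟨edge_ne hab, ha⟩)
  have hpr : Bd T h 0 0 (1 - pr (d - ev b - ev v) (Y.erase s(b, v)) a v) := by
    have h3 := pr_le_one (d := d - ev b - ev v) (Y := Y.erase s(b, v)) (a := a) (v := v)
    unfold Bd; rw [abs_of_nonneg (by linarith)]
    simpa using pr_nonneg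
  exact ((h1.mul G hpr).sub G (G.bd_lam.mul G h2)).congr G (by unfold pw; ring) (by norm_num)
    (by norm_num)

lemma Cls.bd_rt_av (H : Cls n T h lam j d Y) (G : Glob n T h lam) (hj : j ≤ 45) (hab : a ≠ b)
    (hp : 0 < nn (d - ev b) Y) : Bd T h 1 20 (rt a b d Y - 1 -
      av (d - ev b) Y fun F => ((d a - d b) / n - xi a b Y F / n) / yy a b Y F) := by
  have h1 := switch_identity ((H.sub_ev G a).toC0 G (by omega)) hab (Finset.mem_univ a)
    (Finset.mem_univ b) (G.size' (by norm_num)) (G.pow_le_n (by norm_num)) G.log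
  have h2 := (H.bd_rt G (by omega) hab hp).absorb G (by norm_num)
  unfold Bd at h2
  simp only [pow_zero, one_mul] at h2
  have h3 : rt a b d Y ≤ 2 := by linarith [le_abs_self (rt a b d Y - 1)]
  have hn := G.npos
  have e1 : rt a b d Y - 1 -
      (av (d - ev b) Y fun F => ((d a - d b) / n - xi a b Y F / n) / yy a b Y F) =
      (nn (d - ev a) Y - nn (d - ev b) Y - ∑ F ∈ gr (d - ev b) Y,
        (d a - d b - xi a b Y F) / (lfun a b Y F + 1)) / nn (d - ev b) Y := by
    have hs : ∑ F ∈ gr (d - ev b) Y, ((d a - d b) / n - xi a b Y F / n) / yy a b Y F =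
        ∑ F ∈ gr (d - ev b) Y, (d a - d b - xi a b Y F) / (lfun a b Y F + 1) := by
      refine Finset.sum_congr rfl fun F hF => ?_
      rw [yy, ← sub_div, div_div_div_cancel_right₀ hn.ne']
    rw [av, rt, hs]
    field_simp
  unfold Bd
  rw [e1, abs_div, abs_of_pos hp, div_le_iff₀ hp]
  refine h1.trans ?_
  have e2 : nn (d - ev a) Y = rt a b d Y * nn (d - ev b) Y := by
    rw [rt]; field_simp
  have hh := G.h0
  rw [e2, G.n_eq]
  have hT := G.hT
  calc _ = rt a b d Y * h ^ 20 * nn (d - ev b) Y := by field_simp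
    _ ≤ T ^ 1 * h ^ 20 * nn (d - ev b) Y := by gcongr; linarith

lemma Cls.bd_xi (H : Cls n T h lam j d Y) (G : Glob n T h lam) (hj : j ≤ 45) (hF : F ⊆ Y) :
    Bd T h 2 2 (xi a b Y F / n) := by
  have key : ∀ a b : Fin n, 0 ≤ ∑ v, ind F s(a, v) * (1 - ind Y s(b, v)) ∧
      ∑ v, ind F s(a, v) * (1 - ind Y s(b, v)) ≤ T ^ 2 := fun a b => by
    refine ⟨Finset.sum_nonneg fun v _ => mul_nonneg ind_nonneg (sub_nonneg.2 ind_le_one), ?_⟩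
    calc _ ≤ ∑ v, (1 - ind Y s(b, v)) := Finset.sum_le_sum fun _ _ =>
          mul_le_of_le_one_left (sub_nonneg.2 ind_le_one) ind_le_one
      _ = n - dg Y b := by simp [dg, Finset.sum_sub_distrib]
      _ ≤ T ^ 2 := by
        have := slack_le (j := j) G (by omega)
        nlinarith [H.xd b, sq_nonneg T]
  unfold Bd
  rw [G.div_n, abs_mul, abs_of_pos (pow_pos G.h0 2)]
  refine mul_le_mul_of_nonneg_right ?_ (sq_nonneg _)
  rw [xi, Finset.sum_sub_distrib, abs_le]
  constructor <;> linarith [key a b, key b a]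

lemma Cls.rt_two (H : Cls n T h lam j d Y) (G : Glob n T h lam) (hj : j ≤ 45) (hab : a ≠ b)
    (hp : 0 < nn (d - ev b) Y) : Bd T h 170 2 (rt a b d Y - 1 -
      (uu lam d Y a - uu lam d Y b) / (lam * (1 - lam))) := by
  have h1 := H.bd_rt_av G hj hab hp
  have hda := H.bd_deg G (by omega) a
  have hdb := H.bd_deg G (by omega) b
  have hxa := H.bd_x G (by omega) a
  have hxb := H.bd_x G (by omega) b
  have hm : Bd T h 40 1 (lam * (1 - lam) - lam * (1 - lam)) := by
    rw [sub_self]; exact (bd_zero G 1).mono G (by norm_num) le_rfl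
  have hφ : ∀ F ∈ gr (d - ev b) Y, Bd T h 5 1 ((d a - d b) / n - xi a b Y F / n) := fun F hF =>
    ((hda.sub G hdb).sub G (H.bd_xi G hj (mem_gr.1 hF).1)).congr G (by ring) (by norm_num)
      (by norm_num)
  have h2 := (H.sub_ev G b).av_div G (by omega) hab hp hm hφ
  have h3 : Bd T h 2 2 (av (d - ev b) Y fun F => xi a b Y F / n) :=
    Bd.av G fun F hF => H.bd_xi G hj (mem_gr.1 hF).1
  have h4 := ((h1.add G h2).sub G (h3.mul G G.bd_inv_q)).sub G
    ((G.bd_lam.mul G (hxa.sub G hxb)).mul G G.bd_inv_q)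
  refine h4.congr G ?_ (by norm_num) (by norm_num)
  rw [av_sub, av_const hp]
  have e1 : (d a - d b) / n = uu lam d Y a - uu lam d Y b
      - lam * ((n - dg Y a) / n - (n - dg Y b) / n) := by
    rw [sub_div, deg_eq (Y := Y) G a, deg_eq (Y := Y) G b]; ring
  rw [e1]
  ring

lemma Cls.pr_two (H : Cls n T h lam j d Y) (G : Glob n T h lam) (hj : j ≤ 40) (hp : 0 < nn d Y)
    (ha : s(a, v) ∈ Y) :
    Bd T h 180 2 (pr d Y a v - (lam + uu lam d Y a + uu lam d Y v)) := by
  have hu := H.bd_u G (show j ≤ 50 by omega)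
  have hf : ∀ b, Bd T h 3 1 (uu lam d Y a - uu lam d Y b) := fun b =>
    ((hu a).sub G (hu b)).mono G (by norm_num) (by norm_num)
  have h1 := H.ladder G (by omega) hp (a := a) (v := v)
    (f := fun b => uu lam d Y a - uu lam d Y b) (c := 171) (k := 2)
    (fun b => (hf b).mono G (by norm_num) le_rfl) (fun b hb => by
      rcases eq_or_ne a b with rfl | hab
      · simpa using (bd_zero G 2).mono G (Nat.zero_le 171) le_rfl
      rw [H.pr_sub G (by omega) hp hab ha hb]
      have h2 := (H.shift3 G hab ha hb).rt_two G (by omega) hab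
        (H.pos3 G (by omega) hp hab ha hb)
      have h3 := H.bd_pw_one G (by omega) hp hab ha hb
      rw [(uu_shift3 H G hab ha hb).1, (uu_shift3 H G hab ha hb).2] at h2
      have h4 := (h2.mul G (bd_pw (a := a) (b := b) (d := d) (Y := Y) (v := v))).add G
        (((hf b).mul G G.bd_inv_q).mul G h3)
      refine h4.congr G ?_ (by norm_num) (by norm_num)
      have := G.q_pos.ne'
      generalize lam * (1 - lam) = q at *
      generalize rt a b (d - ev v) ((Y.erase s(b, v)).erase s(a, v)) = r
      field_simp
      ring)
  have h5 := (H.bd_x G (by omega) v).mul G (H.pr_one G (by omega) hp ha)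
  refine ((h1.add G h5).sub G (H.bd_s G (by omega))).congr G ?_ (by norm_num) (by norm_num)
  have hn := G.npos
  rw [Finset.sum_sub_distrib, ss, sub_div]
  simp only [Finset.sum_const, Finset.card_univ, Fintype.card_fin, nsmul_eq_mul]
  field_simp
  ring

end ladder

section third

variable {n : ℕ} {F Y : Finset (Sym2 (Fin n))} {d : Fin n → ℝ} {a b v : Fin n}
  {φ : Finset (Sym2 (Fin n)) → ℝ} {T h lam : ℝ} {j : ℕ} {m : ℝ}

lemma lfun_eq_sum (hF : F ∈ gr d Y) : lfun a b Y F =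
    ∑ v, ind Y s(a, v) * ind Y s(b, v) * (ind F s(b, v) * (1 - ind F s(a, v))) := by
  refine Finset.sum_congr rfl fun v _ => ?_
  by_cases ha : s(a, v) ∈ Y
  · by_cases hb : s(b, v) ∈ Y
    · rw [ind_of_mem ha, ind_of_mem hb]; ring
    · rw [ind_eq_zero_of_mem_gr hF hb]; ring
  · rw [ind_eq_zero_of_mem_gr hF ha, ind_of_notMem ha]; ring

lemma Cls.av_yy (H : Cls n T h lam j d Y) (G : Glob n T h lam) (hj : j ≤ 50) (hp : 0 < nn d Y)
    (hab : a ≠ b) : av d Y (yy a b Y) =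
      (∑ v, ind Y s(a, v) * ind Y s(b, v) * pw a b d Y v) / n + h ^ 2 := by
  have e1 : av d Y (yy a b Y) = av d Y fun F => h ^ 2 + 1 / n *
      ∑ v, ind Y s(a, v) * ind Y s(b, v) * (ind F s(b, v) * (1 - ind F s(a, v))) :=
    av_congr fun F hF => by rw [yy, lfun_eq_sum hF, ← G.inv_n]; ring
  rw [e1, av_add, av_const hp, av_mul, av_sum, add_comm, one_div_mul_eq_div]
  congr 2
  refine Finset.sum_congr rfl fun v _ => ?_
  rw [av_mul]
  by_cases hb : s(b, v) ∈ Y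
  · rw [av_ind_mul_one_sub (H.pos_take G hj (H.loop.ne hb) hb hp) hab (H.loop.ne hb) hb]
  · rw [ind_of_notMem hb]; ring

lemma Cls.sum_pair_div (H : Cls n T h lam j d Y) (G : Glob n T h lam) (hj : j ≤ 50)
    {f g : Fin n → ℝ} {c k c' k' : ℕ}
    (hf : ∀ v, s(a, v) ∈ Y → s(b, v) ∈ Y → Bd T h c k (f v - g v))
    (hg : ∀ v, Bd T h c' k' (g v)) :
    Bd T h (max c (c' + 3) + 1) (min k (k' + 2))
      ((∑ v, ind Y s(a, v) * ind Y s(b, v) * f v) / n - (∑ v, g v) / n) := by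
  have b1 : Bd T h c k ((∑ v, ind Y s(a, v) * ind Y s(b, v) * (f v - g v)) / n) := by
    refine Bd.sum_div G fun v => ?_
    by_cases ha : s(a, v) ∈ Y
    · by_cases hb : s(b, v) ∈ Y
      · rw [ind_of_mem ha, ind_of_mem hb, one_mul, one_mul]; exact hf v ha hb
      · rw [ind_of_notMem hb, mul_zero, zero_mul]; exact (bd_zero G k).mono G (Nat.zero_le _) le_rfl
    · rw [ind_of_notMem ha, zero_mul, zero_mul]; exact (bd_zero G k).mono G (Nat.zero_le _) le_rfl
  have b2 : Bd T h (c' + 3) (k' + 2) ((∑ v, (1 - ind Y s(a, v) * ind Y s(b, v)) * (-g v)) / n) := by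
    have hx : Bd T h 3 2 ((n - dg Y a) / n + (n - dg Y b) / n) :=
      ((H.bd_x G hj a).add G (H.bd_x G hj b)).mono G (by norm_num) (by norm_num)
    have h1 : ∀ v, 0 ≤ 1 - ind Y s(a, v) * ind Y s(b, v) := fun v =>
      sub_nonneg.2 (mul_le_one₀ ind_le_one ind_nonneg ind_le_one)
    have h2 : |∑ v, (1 - ind Y s(a, v) * ind Y s(b, v)) * (-g v)| ≤
        ((n - dg Y a) + (n - dg Y b)) * (T ^ c' * h ^ k') := by
      refine (Finset.abs_sum_le_sum_abs _ _).trans ?_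
      calc _ ≤ ∑ v, ((1 - ind Y s(a, v)) + (1 - ind Y s(b, v))) * (T ^ c' * h ^ k') := by
            refine Finset.sum_le_sum fun v _ => ?_
            rw [abs_mul, abs_neg, abs_of_nonneg (h1 v)]
            have h3 : 1 - ind Y s(a, v) * ind Y s(b, v) ≤
                (1 - ind Y s(a, v)) + (1 - ind Y s(b, v)) := by
              rcases ind_eq_zero_or_one (F := Y) (e := s(a, v)) with h | h <;>
              rcases ind_eq_zero_or_one (F := Y) (e := s(b, v)) with h' | h' <;>
              rw [h, h'] <;> norm_num
            exact mul_le_mul h3 (hg v) (abs_nonneg _) ((h1 v).trans h3)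
        _ = _ := by
          rw [← Finset.sum_mul, Finset.sum_add_distrib, Finset.sum_sub_distrib,
            Finset.sum_sub_distrib]
          simp [dg]
    have hT0 := G.T0
    have hh := G.h0
    unfold Bd at hx ⊢
    rw [abs_div, abs_of_pos G.npos]
    calc _ ≤ ((n - dg Y a) + (n - dg Y b)) * (T ^ c' * h ^ k') / n :=
          div_le_div_of_nonneg_right h2 G.npos.le
      _ = ((n - dg Y a) / n + (n - dg Y b) / n) * (T ^ c' * h ^ k') := by ring
      _ ≤ (T ^ 3 * h ^ 2) * (T ^ c' * h ^ k') := by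
        gcongr; exact (le_abs_self _).trans hx
      _ = _ := by ring
  refine (b1.add G b2).congr G ?_ le_rfl le_rfl
  rw [← sub_div, ← add_div, ← Finset.sum_add_distrib, ← Finset.sum_sub_distrib]
  congr 1
  exact Finset.sum_congr rfl fun v _ => by ring

lemma Cls.pw_two (H : Cls n T h lam j d Y) (G : Glob n T h lam) (hj : j ≤ 39)
    (hp : 0 < nn d Y) (hab : a ≠ b) (ha : s(a, v) ∈ Y) (hb : s(b, v) ∈ Y) :
    Bd T h 190 2 (pw a b d Y v - (lam * (1 - lam) + (1 - lam) * uu lam d Y b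
      - lam * uu lam d Y a + (1 - 2 * lam) * uu lam d Y v)) := by
  have hbv := H.loop.ne hb
  have hav := H.loop.ne ha
  have hu := H.bd_u G (show j ≤ 50 by omega)
  have h1 := H.pr_two G (by omega) hp hb
  have h2 := (H.take G hbv hb).pr_two G (by omega) (H.pos_take G (by omega) hbv hb hp)
    (a := a) (v := v) (Finset.mem_erase.2 ⟨edge_ne hab, ha⟩)
  rw [uu_erase G hbv hb, uu_erase G hbv hb, uu_sub_ev G, uu_sub_ev G, uu_sub_ev G,
    uu_sub_ev G] at h2
  simp only [ev_self, ev_of_ne hab, ev_of_ne hav, ev_of_ne hbv.symm] at h2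
  have h3 := pr_le_one (d := d - ev b - ev v) (Y := Y.erase s(b, v)) (a := a) (v := v)
  have hpr : Bd T h 0 0 (1 - pr (d - ev b - ev v) (Y.erase s(b, v)) a v) := by
    unfold Bd; rw [abs_of_nonneg (by linarith)]
    simpa using pr_nonneg
  have hA := (hu b).add G (hu v)
  have hB := (hu a).add G (hu v)
  have h4 := (G.bd_lam.add G hA).mul G (h2.sub G (G.bd_one_sub_lam.mul G G.bd_hh))
  refine (((h1.mul G hpr).sub G h4).sub G (hA.mul G hB)).congr G ?_ (by norm_num) (by norm_num)
  unfold pw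
  ring

lemma Cls.yy_mean (H : Cls n T h lam j d Y) (G : Glob n T h lam) (hj : j ≤ 39)
    (hp : 0 < nn d Y) (hab : a ≠ b) :
    Bd T h 196 2 (av d Y (yy a b Y) - (lam * (1 - lam) + (1 - lam) * uu lam d Y b
      - lam * uu lam d Y a)) := by
  have hu := H.bd_u G (show j ≤ 50 by omega)
  have hl : Bd T h 1 0 (1 - 2 * lam) := G.bd_const (by
    have := G.lam0; have := G.lam1; rw [abs_le]; constructor <;> linarith)
  have h1 := H.sum_pair_div G (by omega) (fun v ha hb => H.pw_two G hj hp hab ha hb)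
    (c' := 7) (k' := 0) (fun v =>
    ((((G.bd_lam.mul G G.bd_one_sub_lam).add G (G.bd_one_sub_lam.mul G (hu b))).sub G
      (G.bd_lam.mul G (hu a))).add G (hl.mul G (hu v))).mono G (by norm_num) (by norm_num))
  refine ((h1.add G G.bd_hh).add G (hl.mul G (H.bd_s G (by omega)))).congr G ?_ (by norm_num)
    (by norm_num)
  have hn := G.npos
  rw [H.av_yy G (by omega) hp hab, Finset.sum_add_distrib, ← Finset.mul_sum, ss]
  simp only [Finset.sum_const, Finset.card_univ, Fintype.card_fin, nsmul_eq_mul]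
  field_simp
  ring

lemma Cls.xi_mean (H : Cls n T h lam j d Y) (G : Glob n T h lam) (hj : j ≤ 40)
    (hp : 0 < nn d Y) :
    Bd T h 38 3 (av d Y (fun F => xi a b Y F / n) -
      lam * ((n - dg Y b) / n - (n - dg Y a) / n)) := by
  have key : ∀ a b : Fin n, Bd T h 36 3
      ((∑ v, (pr d Y a v - lam * ind Y s(a, v)) * (1 - ind Y s(b, v))) / n) := fun a b => by
    have hx := H.bd_x G (by omega) b
    have hT0 := G.T0
    have hh := G.h0
    have h1 : ∀ v, |pr d Y a v - lam * ind Y s(a, v)| ≤ T ^ 33 * h ^ 1 := fun v => by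
      by_cases ha : s(a, v) ∈ Y
      · rw [ind_of_mem ha, mul_one]; exact H.pr_one G (by omega) hp ha
      · rw [ind_of_notMem ha, pr_eq_zero ha]; simp; positivity
    unfold Bd at hx ⊢
    have h0 : (0:ℝ) ≤ n - dg Y b := sub_nonneg.2 dg_le
    rw [abs_of_nonneg (div_nonneg h0 G.npos.le)] at hx
    rw [abs_div, abs_of_pos G.npos]
    have h2 : |∑ v, (pr d Y a v - lam * ind Y s(a, v)) * (1 - ind Y s(b, v))| ≤
        (n - dg Y b) * (T ^ 33 * h ^ 1) := by
      refine (Finset.abs_sum_le_sum_abs _ _).trans ?_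
      calc _ ≤ ∑ v, (1 - ind Y s(b, v)) * (T ^ 33 * h ^ 1) := by
            refine Finset.sum_le_sum fun v _ => ?_
            have h3 : 0 ≤ 1 - ind Y s(b, v) := sub_nonneg.2 ind_le_one
            rw [abs_mul, abs_of_nonneg h3, mul_comm]
            exact mul_le_mul_of_nonneg_left (h1 v) h3
        _ = _ := by rw [← Finset.sum_mul, Finset.sum_sub_distrib]; simp [dg]
    calc _ ≤ (n - dg Y b) * (T ^ 33 * h ^ 1) / n := div_le_div_of_nonneg_right h2 G.npos.le
      _ = (n - dg Y b) / n * (T ^ 33 * h ^ 1) := by ring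
      _ ≤ (T ^ 2 * h ^ 2) * (T ^ 33 * h ^ 1) := by gcongr
      _ = T ^ 35 * h ^ 3 := by ring
      _ ≤ _ := by gcongr; exacts [G.T1, by norm_num]
  refine ((key a b).sub G (key b a)).congr G ?_ (by norm_num) (by norm_num)
  have e1 : av d Y (fun F => xi a b Y F / n) = (∑ v, (pr d Y a v * (1 - ind Y s(b, v))
      - pr d Y b v * (1 - ind Y s(a, v)))) / n := by
    have : av d Y (fun F => xi a b Y F / n) = av d Y fun F => 1 / n * ∑ v,
        ((1 - ind Y s(b, v)) * ind F s(a, v) - (1 - ind Y s(a, v)) * ind F s(b, v)) :=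
      av_congr fun F _ => by
        rw [xi, div_eq_inv_mul, one_div]; congr 1; exact Finset.sum_congr rfl fun v _ => by ring
    rw [this, av_mul, av_sum, one_div_mul_eq_div]
    congr 1
    refine Finset.sum_congr rfl fun v _ => ?_
    rw [av_sub, av_mul, av_mul, pr, pr]
    ring
  have e2 : lam * ((n - dg Y b) / n - (n - dg Y a) / n) =
      (∑ v, (lam * ind Y s(a, v) - lam * ind Y s(b, v))) / n := by
    rw [Finset.sum_sub_distrib, ← Finset.mul_sum, ← Finset.mul_sum]
    simp only [dg]
    ring
  rw [e1, e2, ← sub_div, ← sub_div, ← Finset.sum_sub_distrib, ← Finset.sum_sub_distrib]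
  congr 1
  exact Finset.sum_congr rfl fun v _ => by ring

lemma Cls.rt_three (H : Cls n T h lam j d Y) (G : Glob n T h lam) (hj : j ≤ 38) (hab : a ≠ b)
    (hp : 0 < nn (d - ev b) Y) : Bd T h 210 3 (rt a b d Y - 1 -
      ((uu lam d Y a - uu lam d Y b) * (1 / (lam * (1 - lam))) -
      (uu lam d Y a - uu lam d Y b) * ((1 - lam) * uu lam d Y b - lam * uu lam d Y a) *
        (1 / (lam * (1 - lam))) ^ 2)) := by
  have h1 := H.bd_rt_av G (by omega) hab hp
  have hu := H.bd_u G (show j ≤ 50 by omega)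
  have hda := H.bd_deg G (by omega) a
  have hdb := H.bd_deg G (by omega) b
  have hxa := H.bd_x G (by omega) a
  have hxb := H.bd_x G (by omega) b
  have hm : Bd T h 40 1 (lam * (1 - lam) - lam * (1 - lam)) := by
    rw [sub_self]; exact (bd_zero G 1).mono G (by norm_num) le_rfl
  have hb' := H.sub_ev G b
  have h2 := hb'.av_div G (by omega) hab hp hm (φ := fun F => xi a b Y F / n) (c := 2) (k := 2)
    fun F hF => H.bd_xi G (by omega) (mem_gr.1 hF).1
  have h3 := (hb'.xi_mean G (by omega) hp (a := a) (b := b)).mul G G.bd_inv_q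
  have h4 := hb'.av_inv G (by omega) hab hp hm
  have h5 := hb'.yy_mean G (by omega) hp hab
  rw [uu_sub_ev G, uu_sub_ev G] at h5
  simp only [ev_self, ev_of_ne hab] at h5
  have hD : Bd T h 4 1 ((d a - d b) / n) := (hda.sub G hdb).congr G (by ring) (by norm_num)
    (by norm_num)
  have e1 : (d a - d b) / n = uu lam d Y a - uu lam d Y b
      - lam * ((n - dg Y a) / n - (n - dg Y b) / n) := by
    rw [sub_div, deg_eq (Y := Y) G a, deg_eq (Y := Y) G b]; ring
  have e2 : av (d - ev b) Y (fun F => ((d a - d b) / n - xi a b Y F / n) / yy a b Y F) =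
      (d a - d b) / n * av (d - ev b) Y (fun F => 1 / yy a b Y F) -
      av (d - ev b) Y (fun F => xi a b Y F / n / yy a b Y F) := by
    rw [← av_mul, ← av_sub]; exact av_congr fun F _ => by ring
  rw [e2] at h1
  have hw : Bd T h 4 1 ((1 - lam) * uu lam d Y b - lam * uu lam d Y a) :=
    ((G.bd_one_sub_lam.mul G (hu b)).sub G (G.bd_lam.mul G (hu a))).mono G (by norm_num)
      (by norm_num)
  have hx : Bd T h 4 2 (lam * ((n - dg Y a) / n - (n - dg Y b) / n)) :=
    (G.bd_lam.mul G (hxa.sub G hxb)).mono G (by norm_num) (by norm_num)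
  have h6 := hD.mul G h4
  have h7 := (hD.mul G (h5.sub G (G.bd_one_sub_lam.mul G G.bd_hh))).mul G
    (G.bd_inv_q.mul G G.bd_inv_q)
  have h8 := (hx.mul G hw).mul G (G.bd_inv_q.mul G G.bd_inv_q)
  refine (((((h1.sub G h2).sub G h3).add G h6).sub G h7).add G h8).congr G ?_ (by norm_num)
    (by norm_num)
  generalize hI : (1 / (lam * (1 - lam))) = I at *
  have e3 : ∀ x, x / (lam * (1 - lam)) = x * I := fun x => by rw [← hI]; ring
  have e4 : ∀ x, x / (lam * (1 - lam)) ^ 2 = x * I ^ 2 := fun x => by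
    rw [← hI, one_div, inv_pow, div_eq_mul_inv]
  simp only [e3, e4, e1] at *
  generalize av (d - ev b) Y (yy a b Y) = M at *
  ring

end third

section edge

variable {n : ℕ} {F Y : Finset (Sym2 (Fin n))} {d : Fin n → ℝ} {a b v : Fin n}
  {T h lam : ℝ} {j : ℕ}

lemma Glob.bd_one_sub_two_lam (G : Glob n T h lam) : Bd T h 1 0 (1 - 2 * lam) :=
  G.bd_const (by have := G.lam0; have := G.lam1; rw [abs_le]; constructor <;> linarith)

lemma Cls.pr_three (H : Cls n T h lam j d Y) (G : Glob n T h lam) (hj : j ≤ 35) (hp : 0 < nn d Y)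
    (ha : s(a, v) ∈ Y) :
    Bd T h 230 3 (pr d Y a v - (lam + uu lam d Y a + uu lam d Y v - ss lam d Y +
      (1 - 2 * lam) * (1 / (lam * (1 - lam))) * (uu lam d Y a * uu lam d Y v))) := by
  have hu := H.bd_u G (show j ≤ 50 by omega)
  have hk : Bd T h 3 0 ((1 - 2 * lam) * (1 / (lam * (1 - lam)))) :=
    G.bd_one_sub_two_lam.mul G G.bd_inv_q
  have hdu : ∀ b, Bd T h 3 1 (uu lam d Y a - uu lam d Y b) := fun b => (hu a).sub G (hu b)
  have hku : Bd T h 0 0 ((1 - 2 * lam) * (1 / (lam * (1 - lam))) * uu lam d Y v) :=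
    Bd.absorb G (hk.mul G (hu v)) (by norm_num)
  have h1 := H.ladder G (by omega) hp (a := a) (v := v)
    (f := fun b => (uu lam d Y a - uu lam d Y b) *
      (1 + (1 - 2 * lam) * (1 / (lam * (1 - lam))) * uu lam d Y v)) (c := 225) (k := 3)
    (fun b => ((hdu b).mul G ((G.bd_const (x := 1) (by norm_num)).add G hku)).mono G
      (by norm_num) (by norm_num))
    (fun b hb => by
      rcases eq_or_ne a b with rfl | hab
      · simpa using (bd_zero G 3).mono G (Nat.zero_le 225) le_rfl
      rw [H.pr_sub G (by omega) hp hab ha hb]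
      have h2 := (H.shift3 G hab ha hb).rt_three G (by omega) hab
        (H.pos3 G (by omega) hp hab ha hb)
      have h3 := H.pw_two G (by omega) hp hab ha hb
      rw [(uu_shift3 H G hab ha hb).1, (uu_shift3 H G hab ha hb).2] at h2
      have hw : Bd T h 4 1 ((1 - lam) * uu lam d Y b - lam * uu lam d Y a) :=
        ((G.bd_one_sub_lam.mul G (hu b)).sub G (G.bd_lam.mul G (hu a))).mono G (by norm_num)
          (by norm_num)
      have hw' := hw.add G ((G.bd_one_sub_two_lam.mul G G.bd_lam).mul G G.bd_hh)
      have hpw := bd_pw (T := T) (h := h) (a := a) (b := b) (d := d) (Y := Y) (v := v)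
      have hI := G.bd_inv_q
      have hv := hw.add G (G.bd_one_sub_two_lam.mul G (hu v))
      -- the four error terms of the product
      have t1 := h2.mul G hpw
      have t2 := ((hdu b).mul G hI).mul G h3
      have t3 := (((hdu b).mul G (hI.mul G hI)).mul G hw').mul G (h3.add G hv)
      have t4 := ((hdu b).mul G hI).mul G ((G.bd_one_sub_two_lam.mul G G.bd_lam).mul G G.bd_hh)
      refine ((((t1.add G t2).sub G t3).sub G t4)).congr G ?_ (by norm_num) (by norm_num)
      have e5 : lam * (1 - lam) * (1 / (lam * (1 - lam))) = 1 :=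
        mul_one_div_cancel G.q_pos.ne'
      generalize 1 / (lam * (1 - lam)) = I at *
      generalize rt a b (d - ev v) ((Y.erase s(b, v)).erase s(a, v)) = r at *
      generalize pw a b d Y v = p at *
      generalize uu lam d Y a = ua at *
      generalize uu lam d Y b = ub at *
      generalize uu lam d Y v = uv at *
      linear_combination ((ua - ub) - (ua - ub) * I *
        ((1 - lam) * ub - lam * ua + (1 - 2 * lam) * lam * h ^ 2)) * e5)
  have h5 := (H.bd_x G (by omega) v).mul G (H.pr_one G (by omega) hp ha)
  have h6 := (H.bd_s G (by omega)).mul G (hk.mul G (hu v))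
  refine ((h1.add G h5).sub G h6).congr G ?_ (by norm_num) (by norm_num)
  have hn := G.npos
  rw [← Finset.sum_mul, Finset.sum_sub_distrib, ss]
  simp only [Finset.sum_const, Finset.card_univ, Fintype.card_fin, nsmul_eq_mul]
  field_simp
  ring

end edge

section variance

variable {n : ℕ} {F Y : Finset (Sym2 (Fin n))} {d : Fin n → ℝ} {a b v w : Fin n}
  {T h lam : ℝ} {j : ℕ}

lemma sum_ev : ∑ v, ev a v = 1 := by simp [ev]

lemma ss_sub_ev (G : Glob n T h lam) : ss lam (d - ev b) Y = ss lam d Y - h ^ 4 := by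
  unfold ss
  simp only [uu_sub_ev G, Finset.sum_sub_distrib, ← Finset.sum_mul, sum_ev]
  rw [G.div_n, G.div_n]; ring

lemma ss_erase (G : Glob n T h lam) (hab : a ≠ b) (he : s(a, b) ∈ Y) :
    ss lam d (Y.erase s(a, b)) = ss lam d Y + 2 * lam * h ^ 4 := by
  unfold ss
  simp only [uu_erase G hab he, Finset.sum_add_distrib, ← Finset.sum_mul, ← Finset.mul_sum, sum_ev]
  rw [G.div_n, G.div_n]; ring

lemma Cls.pw_three (H : Cls n T h lam j d Y) (G : Glob n T h lam) (hj : j ≤ 34)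
    (hp : 0 < nn d Y) (hab : a ≠ b) (ha : s(a, v) ∈ Y) (hb : s(b, v) ∈ Y) :
    Bd T h 248 3 (pw a b d Y v - (lam * (1 - lam) + (1 - lam) * (uu lam d Y b + uu lam d Y v)
      - lam * (uu lam d Y a + uu lam d Y v)
      - (uu lam d Y b + uu lam d Y v) * (uu lam d Y a + uu lam d Y v)
      + lam * (1 - lam) * h ^ 2 - (1 - 2 * lam) * ss lam d Y
      + (1 - 2 * lam) * (1 / (lam * (1 - lam))) *
        (uu lam d Y v * ((1 - lam) * uu lam d Y b - lam * uu lam d Y a)))) := by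
  have hbv := H.loop.ne hb
  have hav := H.loop.ne ha
  have hu := H.bd_u G (show j ≤ 50 by omega)
  have hs := H.bd_s G (show j ≤ 50 by omega)
  have h1 := H.pr_three G (by omega) hp hb
  have h2 := (H.take G hbv hb).pr_three G (by omega) (H.pos_take G (by omega) hbv hb hp)
    (a := a) (v := v) (Finset.mem_erase.2 ⟨edge_ne hab, ha⟩)
  rw [uu_erase G hbv hb, uu_erase G hbv hb, uu_sub_ev G, uu_sub_ev G, uu_sub_ev G,
    uu_sub_ev G, ss_erase G hbv hb, ss_sub_ev G, ss_sub_ev G] at h2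
  simp only [ev_self, ev_of_ne hab, ev_of_ne hav, ev_of_ne hbv.symm] at h2
  have h3 := pr_le_one (d := d - ev b - ev v) (Y := Y.erase s(b, v)) (a := a) (v := v)
  have hpr : Bd T h 0 0 (1 - pr (d - ev b - ev v) (Y.erase s(b, v)) a v) := by
    unfold Bd; rw [abs_of_nonneg (by linarith)]
    simpa using pr_nonneg
  have hk : Bd T h 3 0 ((1 - 2 * lam) * (1 / (lam * (1 - lam)))) :=
    G.bd_one_sub_two_lam.mul G G.bd_inv_q
  have hx : Bd T h 3 1 (uu lam d Y b + uu lam d Y v) := (hu b).add G (hu v)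
  have hy : Bd T h 3 1 (uu lam d Y a + uu lam d Y v) := (hu a).add G (hu v)
  have hs1 : Bd T h 8 2 ((1 - 2 * lam) * (1 / (lam * (1 - lam))) * (uu lam d Y b * uu lam d Y v)
      - ss lam d Y) := ((hk.mul G ((hu b).mul G (hu v))).sub G hs).mono G (by norm_num)
      (by norm_num)
  have hs2 : Bd T h 9 2 ((1 - lam) * h ^ 2 + ss lam d Y - (1 - 2 * lam) *
      (1 / (lam * (1 - lam))) * (uu lam d Y a * uu lam d Y v)) :=
    (((G.bd_one_sub_lam.mul G G.bd_hh).add G hs).sub G (hk.mul G ((hu a).mul G (hu v)))).mono G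
      (by norm_num) (by norm_num)
  have hβ := (((G.bd_const (x := 2) (by norm_num)).mul G G.bd_one_sub_lam).mul G
    (G.bd_hh.mul G G.bd_hh)).sub G ((hk.mul G ((hu a).mul G G.bd_hh)).mul G G.bd_one_sub_lam)
  have hA0 : Bd T h 10 0 (lam + (uu lam d Y b + uu lam d Y v) + ((1 - 2 * lam) *
      (1 / (lam * (1 - lam))) * (uu lam d Y b * uu lam d Y v) - ss lam d Y)) :=
    ((G.bd_lam.add G hx).add G hs1).mono G (by norm_num) (by norm_num)
  refine ((((((h1.mul G hpr).sub G (hA0.mul G h2)).sub G (hA0.mul G hβ)).add G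
    (hx.mul G hs2)).sub G (hy.mul G hs1)).add G (hs1.mul G hs2)).congr G ?_ (by norm_num)
    (by norm_num)
  unfold pw
  generalize 1 / (lam * (1 - lam)) = I at *
  ring

/-- The indicator that `bv` is an edge and `av` is not. -/
def swt {n : ℕ} (a b v : Fin n) (F : Finset (Sym2 (Fin n))) : ℝ :=
  ind F s(b, v) * (1 - ind F s(a, v))

lemma Cls.av_swt (H : Cls n T h lam j d Y) (G : Glob n T h lam) (hj : j ≤ 44)
    (hp : 0 < nn d Y) (hab : a ≠ b) (hb : s(b, v) ∈ Y) : av d Y (swt a b v) = pw a b d Y v :=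
  av_ind_mul_one_sub (H.pos_take G (by omega) (H.loop.ne hb) hb hp) hab (H.loop.ne hb) hb

lemma swt_sq : swt a b v F * swt a b v F = swt a b v F := by
  unfold swt
  rcases ind_eq_zero_or_one (F := F) (e := s(b, v)) with h | h <;>
  rcases ind_eq_zero_or_one (F := F) (e := s(a, v)) with h' | h' <;> rw [h, h'] <;> norm_num

lemma Cls.av_swt_mul (H : Cls n T h lam j d Y) (G : Glob n T h lam) (hj : j ≤ 42)
    (hp : 0 < nn d Y) (hab : a ≠ b) (ha : s(a, v) ∈ Y) (hb : s(b, v) ∈ Y)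
    (hbw : s(b, w) ∈ Y) (hvw : w ≠ v) :
    av d Y (fun F => swt a b v F * swt a b w F) =
      pw a b d Y v * pw a b (d - ev b - ev v) ((Y.erase s(b, v)).erase s(a, v)) w := by
  have hbv := H.loop.ne hb
  have hav := H.loop.ne ha
  have hae : s(a, v) ∈ Y.erase s(b, v) := Finset.mem_erase.2 ⟨edge_ne hab, ha⟩
  have h0 := H.pos_take G (by omega) hbv hb hp
  have H1 := H.take G hbv hb
  have h1 := H1.pos_erase G (by omega) hae h0
  have n1 : s(b, w) ≠ s(b, v) := fun h => hvw (Sym2.congr_right.1 h)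
  have n2 : s(a, w) ≠ s(b, v) := fun h => by
    rcases Sym2.eq_iff.1 h with ⟨h, _⟩ | ⟨h, _⟩
    exacts [hab h, hav h]
  have n3 : s(b, w) ≠ s(a, v) := fun h => by
    rcases Sym2.eq_iff.1 h with ⟨h, _⟩ | ⟨h, _⟩
    exacts [hab h.symm, hbv h]
  have e1 : av d Y (fun F => swt a b v F * swt a b w F) =
      av d Y (fun F => ind F s(b, v) * ((1 - ind F s(a, v)) * swt a b w F)) :=
    av_congr fun F _ => by unfold swt; ring
  have e2 : av (d - ev b - ev v) (Y.erase s(b, v)) (fun F => (1 - ind (insert s(b, v) F) s(a, v)) *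
      swt a b w (insert s(b, v) F)) = av (d - ev b - ev v) (Y.erase s(b, v)) (fun F =>
      (1 - ind F s(a, v)) * swt a b w F) := by
    refine av_congr fun F _ => ?_
    unfold swt
    rw [ind_insert_of_ne (edge_ne hab), ind_insert_of_ne n1, ind_insert_of_ne n2]
  rw [e1, av_ind_mul hbv hb _ h0, e2, av_one_sub_ind_mul hae _ h1,
    ((H1.erase G hav hae).av_swt G (by omega) h1 hab (Finset.mem_erase.2
      ⟨n3, Finset.mem_erase.2 ⟨n1, hbw⟩⟩)), av_sub, av_const h0, ← pr, ← mul_assoc]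
  rfl

lemma Cls.cov_ne (H : Cls n T h lam j d Y) (G : Glob n T h lam) (hj : j ≤ 32)
    (hp : 0 < nn d Y) (hab : a ≠ b) (ha : s(a, v) ∈ Y) (hb : s(b, v) ∈ Y)
    (haw : s(a, w) ∈ Y) (hbw : s(b, w) ∈ Y) (hvw : w ≠ v) :
    Bd T h 262 3 (av d Y (fun F => swt a b v F * swt a b w F) - pw a b d Y v * pw a b d Y w +
      lam * (1 - lam) * (1 - 2 * (lam * (1 - lam))) * h ^ 2) := by
  have hbv := H.loop.ne hb
  have hav := H.loop.ne ha
  have hwa := (H.loop.ne haw).symm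
  have hwb := (H.loop.ne hbw).symm
  have hae : s(a, v) ∈ Y.erase s(b, v) := Finset.mem_erase.2 ⟨edge_ne hab, ha⟩
  have h0 := H.pos_take G (by omega) hbv hb hp
  have H1 := H.take G hbv hb
  have h1 := H1.pos_erase G (by omega) hae h0
  have n1 : s(b, w) ≠ s(b, v) := fun h => hvw (Sym2.congr_right.1 h)
  have n2 : s(a, w) ≠ s(b, v) := fun h => by
    rcases Sym2.eq_iff.1 h with ⟨h, _⟩ | ⟨h, _⟩
    exacts [hab h, hav h]
  have n3 : s(b, w) ≠ s(a, v) := fun h => by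
    rcases Sym2.eq_iff.1 h with ⟨h, _⟩ | ⟨h, _⟩
    exacts [hab h.symm, hbv h]
  have n4 : s(a, w) ≠ s(a, v) := fun h => hvw (Sym2.congr_right.1 h)
  have hu := H.bd_u G (show j ≤ 50 by omega)
  have p1 := H.pw_three G (by omega) hp hab haw hbw
  have p2 := (H1.erase G hav hae).pw_three G (by omega) h1 hab
    (Finset.mem_erase.2 ⟨n4, Finset.mem_erase.2 ⟨n2, haw⟩⟩)
    (Finset.mem_erase.2 ⟨n3, Finset.mem_erase.2 ⟨n1, hbw⟩⟩)
  simp only [uu_erase G hav hae, uu_erase G hbv hb, uu_sub_ev G, ss_erase G hav hae,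
    ss_erase G hbv hb, ss_sub_ev G, ev_self, ev_of_ne hab, ev_of_ne hab.symm, ev_of_ne hav,
    ev_of_ne hbv, ev_of_ne hwa, ev_of_ne hwb, ev_of_ne hvw] at p2
  have p3 := H.bd_pw_one G (by omega) hp hab ha hb
  have hpw := bd_pw (T := T) (h := h) (a := a) (b := b) (d := d) (Y := Y) (v := v)
  have hk : Bd T h 3 0 ((1 - 2 * lam) * (1 / (lam * (1 - lam)))) :=
    G.bd_one_sub_two_lam.mul G G.bd_inv_q
  have hx : Bd T h 3 1 (uu lam d Y b + uu lam d Y w) := (hu b).add G (hu w)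
  have hy : Bd T h 3 1 (uu lam d Y a + uu lam d Y w) := (hu a).add G (hu w)
  have hq : Bd T h 5 0 (1 - 2 * (lam * (1 - lam))) :=
    ((G.bd_const (x := 1) (by norm_num)).sub G ((G.bd_const (x := 2) (by norm_num)).mul G
      (G.bd_lam.mul G G.bd_one_sub_lam))).mono G (by norm_num) (by norm_num)
  have ha' : Bd T h 0 2 (lam * h ^ 2) := (G.bd_lam.mul G G.bd_hh).mono G (by norm_num) (by norm_num)
  have hb' : Bd T h 0 2 ((1 - lam) * h ^ 2) :=
    (G.bd_one_sub_lam.mul G G.bd_hh).mono G (by norm_num) (by norm_num)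
  have t1 := hx.mul G ha'
  have t2 := hy.mul G hb'
  have t3 := ha'.mul G hb'
  have t4 := hq.mul G (hk.mul G ((hu w).mul G G.bd_hh))
  have t5 := ((G.bd_const (x := 2) (by norm_num)).mul G
    (G.bd_one_sub_two_lam.mul G G.bd_one_sub_two_lam)).mul G (G.bd_hh.mul G G.bd_hh)
  have t6 := (p3.mul G hq).mul G G.bd_hh
  rw [H.av_swt_mul G (by omega) hp hab ha hb hbw hvw]
  refine ((hpw.mul G ((((((p2.sub G p1).sub G t1).add G t2).add G t3).sub G t4).add G t5)).sub G
    t6).congr G ?_ (by norm_num) (by norm_num)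
  generalize 1 / (lam * (1 - lam)) = I at *
  ring

lemma Cls.variance (H : Cls n T h lam j d Y) (G : Glob n T h lam) (hj : j ≤ 32)
    (hp : 0 < nn d Y) (hab : a ≠ b) :
    Bd T h 280 3 (av d Y (fun F => (yy a b Y F - av d Y (yy a b Y)) ^ 2) -
      (lam * (1 - lam)) ^ 2 * h ^ 2) := by
  set q := lam * (1 - lam) with hq
  set cov : Fin n → Fin n → ℝ := fun v w =>
    av d Y (fun F => swt a b v F * swt a b w F) - pw a b d Y v * pw a b d Y w with hcov
  have hqb : Bd T h 0 0 q := (G.bd_lam.mul G G.bd_one_sub_lam).mono G le_rfl le_rfl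
  have hq2 : Bd T h 5 0 (1 - 2 * q) :=
    ((G.bd_const (x := 1) (by norm_num)).sub G ((G.bd_const (x := 2) (by norm_num)).mul G
      hqb)).mono G (by norm_num) (by norm_num)
  have hg : Bd T h 5 2 (-(q * (1 - 2 * q) * h ^ 2)) := (((hqb.mul G hq2).mul G G.bd_hh).neg).mono G
    (by norm_num) (by norm_num)
  have e0 : av d Y (fun F => (yy a b Y F - av d Y (yy a b Y)) ^ 2) =
      (∑ v, ind Y s(a, v) * ind Y s(b, v) *
        ((∑ w, ind Y s(a, w) * ind Y s(b, w) * cov v w) / n)) / n := by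
    have e1 : av d Y (fun F => (yy a b Y F - av d Y (yy a b Y)) ^ 2) = av d Y fun F =>
        1 / n ^ 2 * ∑ v, ∑ w, ind Y s(a, v) * ind Y s(b, v) * (ind Y s(a, w) * ind Y s(b, w)) *
          (swt a b v F * swt a b w F - pw a b d Y v * swt a b w F - pw a b d Y w * swt a b v F
            + pw a b d Y v * pw a b d Y w) := by
      refine av_congr fun F hF => ?_
      have : yy a b Y F - av d Y (yy a b Y) = (∑ v, ind Y s(a, v) * ind Y s(b, v) *
          (swt a b v F - pw a b d Y v)) / n := by
        rw [yy, lfun_eq_sum hF, H.av_yy G (by omega) hp hab, ← G.inv_n]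
        simp only [mul_sub, Finset.sum_sub_distrib, swt]
        ring
      rw [this, div_pow, sq, Finset.sum_mul_sum, div_eq_inv_mul, one_div]
      congr 1
      exact Finset.sum_congr rfl fun v _ => Finset.sum_congr rfl fun w _ => by ring
    rw [e1, av_mul, av_sum, Finset.sum_div, Finset.mul_sum]
    refine Finset.sum_congr rfl fun v _ => ?_
    rw [av_sum, Finset.sum_div, Finset.mul_sum, Finset.mul_sum, Finset.sum_div]
    refine Finset.sum_congr rfl fun w _ => ?_
    rw [av_mul, av_add, av_sub, av_sub, av_mul, av_mul, av_const hp]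
    by_cases hb : s(b, v) ∈ Y
    · by_cases hb' : s(b, w) ∈ Y
      · rw [H.av_swt G (by omega) hp hab hb, H.av_swt G (by omega) hp hab hb']
        ring
      · rw [ind_of_notMem hb']; ring
    · rw [ind_of_notMem hb]; ring
  have hin : ∀ v, s(a, v) ∈ Y → s(b, v) ∈ Y → Bd T h 270 3
      ((∑ w, ind Y s(a, w) * ind Y s(b, w) * cov v w) / n - q ^ 2 * h ^ 2) := fun v ha hb => by
    have hpw := bd_pw (T := T) (h := h) (a := a) (b := b) (d := d) (Y := Y) (v := v)
    have h1 := H.sum_pair_div G (by omega) (a := a) (b := b)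
      (f := fun w => if w = v then -(q * (1 - 2 * q) * h ^ 2) else cov v w)
      (g := fun _ => -(q * (1 - 2 * q) * h ^ 2)) (c := 262) (k := 3) (c' := 5) (k' := 2)
      (fun w haw hbw => by
        split_ifs with hw
        · rw [sub_self]; exact (bd_zero G 3).mono G (Nat.zero_le _) le_rfl
        · rw [sub_neg_eq_add]
          exact H.cov_ne G hj hp hab ha hb haw hbw hw) (fun _ => hg)
    have h2 : cov v v = pw a b d Y v * (1 - pw a b d Y v) := by
      have : av d Y (fun F => swt a b v F * swt a b v F) = av d Y (swt a b v) :=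
        av_congr fun F _ => swt_sq
      rw [hcov]; simp only [this]; rw [H.av_swt G (by omega) hp hab hb]; ring
    have h3 := H.bd_pw_one G (by omega) hp hab ha hb
    have e2 : ∑ w, ind Y s(a, w) * ind Y s(b, w) * cov v w = (∑ w, ind Y s(a, w) * ind Y s(b, w) *
        (if w = v then -(q * (1 - 2 * q) * h ^ 2) else cov v w)) +
        (cov v v + q * (1 - 2 * q) * h ^ 2) := by
      rw [← sub_eq_iff_eq_add', ← Finset.sum_sub_distrib, Finset.sum_eq_single v]
      · rw [if_pos rfl, ind_of_mem ha, ind_of_mem hb]; ring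
      · intro w _ hw; rw [if_neg hw, sub_self]
      · intro h; exact absurd (Finset.mem_univ v) h
    rw [e2, h2]
    have t1 := (h3.mul G (((G.bd_const (x := 1) (by norm_num)).sub G hpw).sub G hqb)).mul G G.bd_hh
    have t2 := (hqb.mul G hq2).mul G (G.bd_hh.mul G G.bd_hh)
    refine ((h1.add G t1).add G t2).congr G ?_ (by norm_num) (by norm_num)
    have hn := G.npos.ne'
    rw [add_div, G.div_n (pw a b d Y v * (1 - pw a b d Y v) + _)]
    simp only [Finset.sum_const, Finset.card_univ, Fintype.card_fin, nsmul_eq_mul]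
    rw [mul_div_cancel_left₀ _ hn]
    ring
  have h4 := H.sum_pair_div G (by omega) (a := a) (b := b) (g := fun _ => q ^ 2 * h ^ 2)
    (c' := 0) (k' := 2) hin
    (fun _ => by
      rw [sq]
      exact ((hqb.mul G hqb).mul G G.bd_hh).mono G (by norm_num) (by norm_num))
  rw [e0]
  refine h4.congr G ?_ (by norm_num) (by norm_num)
  simp only [Finset.sum_const, Finset.card_univ, Fintype.card_fin, nsmul_eq_mul]
  rw [mul_div_cancel_left₀ _ G.npos.ne']

end variance

/-- The edges of the complete graph. -/
def full (n : ℕ) : Finset (Sym2 (Fin n)) := Finset.univ.filter fun e => ¬ e.IsDiag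

section complete

variable {n : ℕ} {F Y : Finset (Sym2 (Fin n))} {d : Fin n → ℝ} {a b v w : Fin n}
  {T h lam : ℝ} {j : ℕ}

lemma mem_full : s(a, b) ∈ full n ↔ a ≠ b := by simp [full]

lemma ind_full : ind (full n) s(a, b) = 1 - ev a b := by
  unfold ind ev
  rcases eq_or_ne b a with rfl | h
  · rw [if_neg (by simp [mem_full]), if_pos rfl, sub_self]
  · rw [if_pos (mem_full.2 h.symm), if_neg h, sub_zero]

lemma dg_full : dg (full n) v = n - 1 := by
  simp [dg, ind_full, Finset.sum_sub_distrib, sum_ev]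

lemma loopless_full : loopless (full n) := fun v hv => mem_full.1 hv rfl

lemma sum_ev_mul (f : Fin n → ℝ) : ∑ v, ev b v * f v = f b := by
  simp [ev]

lemma xi_full : xi a b (full n) F = 0 := by
  unfold xi
  simp only [ind_full, sub_sub_cancel, Finset.sum_sub_distrib]
  have : ∀ a b : Fin n, ∑ v, ind F s(a, v) * ev b v = ind F s(a, b) := fun a b => by
    simp only [mul_comm _ (ev b _), sum_ev_mul]
  rw [this, this, ind_comm, sub_self]

lemma sum_pair_full (hab : a ≠ b) (f : Fin n → ℝ) :
    ∑ v, ind (full n) s(a, v) * ind (full n) s(b, v) * f v = (∑ v, f v) - f a - f b := by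
  have : ∀ v, ind (full n) s(a, v) * ind (full n) s(b, v) * f v =
      f v - ev a v * f v - ev b v * f v := fun v => by
    rw [ind_full, ind_full]
    have h0 : ev a v * ev b v = 0 := by
      rcases eq_or_ne v a with rfl | h
      · rw [ev_of_ne hab, mul_zero]
      · rw [ev_of_ne h, zero_mul]
    linear_combination f v * h0
  simp only [this, Finset.sum_sub_distrib]
  rw [sum_ev_mul, sum_ev_mul]

lemma Cls.yy_mean_full (H : Cls n T h lam j d (full n)) (G : Glob n T h lam) (hj : j ≤ 34)
    (hp : 0 < nn d (full n)) (hab : a ≠ b) (hs : ∑ v, uu lam d (full n) v = 0) :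
    Bd T h 260 3 (av d (full n) (yy a b (full n)) - (lam * (1 - lam)
      + (1 - lam) * uu lam d (full n) b - lam * uu lam d (full n) a
      - uu lam d (full n) a * uu lam d (full n) b - (∑ v, uu lam d (full n) v ^ 2) / n
      + (1 - lam * (1 - lam)) * h ^ 2)) := by
  have hu := H.bd_u G (show j ≤ 50 by omega)
  have hss : ss lam d (full n) = 0 := by rw [ss, hs, zero_div]
  have hk : Bd T h 3 0 ((1 - 2 * lam) * (1 / (lam * (1 - lam)))) :=
    G.bd_one_sub_two_lam.mul G G.bd_inv_q
  have hq : Bd T h 0 0 (lam * (1 - lam)) := G.bd_lam.mul G G.bd_one_sub_lam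
  rw [H.av_yy G (by omega) hp hab]
  set U := uu lam d (full n) with hU
  set P : Fin n → ℝ := fun v => lam * (1 - lam) + (1 - lam) * (U b + U v) - lam * (U a + U v)
    - (U b + U v) * (U a + U v) + lam * (1 - lam) * h ^ 2 + (1 - 2 * lam) *
      (1 / (lam * (1 - lam))) * (U v * ((1 - lam) * U b - lam * U a)) with hP
  have h1 := H.sum_pair_div G (by omega) (a := a) (b := b) (f := fun v => pw a b d (full n) v - P v)
    (g := fun _ => 0) (c := 248) (k := 3) (c' := 0) (k' := 3) (fun v ha hb => by
      have := H.pw_three G hj hp hab ha hb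
      rw [hss, mul_zero, sub_zero] at this
      rw [sub_zero]; exact this) (fun _ => bd_zero G 3)
  have hPb : ∀ v, Bd T h 20 1 (P v - lam * (1 - lam)) := fun v =>
    ((((G.bd_one_sub_lam.mul G ((hu b).add G (hu v))).sub G (G.bd_lam.mul G
      ((hu a).add G (hu v)))).sub G (((hu b).add G (hu v)).mul G ((hu a).add G (hu v)))).add G
      ((hq.mul G G.bd_hh).add G (hk.mul G ((hu v).mul G ((G.bd_one_sub_lam.mul G (hu b)).sub G
        (G.bd_lam.mul G (hu a))))))).congr G (by rw [hP]; ring) (by norm_num) (by norm_num)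
  have h2 := ((hPb a).add G (hPb b)).mul G G.bd_hh
  refine (h1.sub G h2).congr G ?_ (by norm_num) (by norm_num)
  have hn := G.npos.ne'
  have e1 : ∑ v, ind (full n) s(a, v) * ind (full n) s(b, v) * (pw a b d (full n) v - P v) =
      (∑ v, ind (full n) s(a, v) * ind (full n) s(b, v) * pw a b d (full n) v) -
        ((∑ v, P v) - P a - P b) := by
    rw [← sum_pair_full hab, ← Finset.sum_sub_distrib]
    exact Finset.sum_congr rfl fun v _ => by ring
  have e2 : ∑ v, P v = n * (lam * (1 - lam) + (1 - lam) * U b - lam * U a - U a * U b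
      + lam * (1 - lam) * h ^ 2) - ∑ v, U v ^ 2 := by
    have : ∀ v, P v = (lam * (1 - lam) + (1 - lam) * U b - lam * U a - U a * U b
      + lam * (1 - lam) * h ^ 2) + ((1 - lam) - lam - U a - U b + (1 - 2 * lam) *
      (1 / (lam * (1 - lam))) * ((1 - lam) * U b - lam * U a)) * U v - U v ^ 2 := fun v => by
      rw [hP]; ring
    simp only [this, Finset.sum_sub_distrib, Finset.sum_add_distrib, ← Finset.mul_sum, hs]
    simp
    ring
  rw [e1, e2, Finset.sum_const_zero, zero_div, sub_div, sub_div, sub_div, sub_div,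
    mul_div_cancel_left₀ _ hn, G.div_n (P a), G.div_n (P b)]
  ring

/-- The ratio of numbers of graphs with nearby degree sequences. -/
lemma Cls.rt_full (H : Cls n T h lam j d (full n)) (G : Glob n T h lam) (hj : j ≤ 30)
    (hp : 0 < nn (d - ev b) (full n)) (hab : a ≠ b) (hs : ∑ v, gg lam d (full n) v = 1) :
    Bd T h 400 4 (rt a b d (full n) - (d a * (n - d b)) / (d b * (n - d a)) -
      (d a - d b) / n * (h ^ 4 * (∑ v, gg lam d (full n) v ^ 2) * h ^ 2 *
        (1 / (lam * (1 - lam))) ^ 2)) := by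
  have hu := H.bd_u G (show j ≤ 50 by omega)
  have hn := G.npos
  have hI := G.bd_inv_q
  have hq : Bd T h 0 0 (lam * (1 - lam)) := G.bd_lam.mul G G.bd_one_sub_lam
  have H' := H.sub_ev G b
  have h1 := H.bd_rt_av G (by omega) hab hp
  have hda := H.bd_deg G (by omega) a
  have hdb := H.bd_deg G (by omega) b
  have hD : Bd T h 4 1 ((d a - d b) / n) := (hda.sub G hdb).congr G (by ring) (by norm_num)
    (by norm_num)
  have hs' : ∑ v, uu lam (d - ev b) (full n) v = 0 := by
    simp only [uu, gg_sub_ev]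
    rw [← Finset.sum_div, Finset.sum_sub_distrib, hs, sum_ev, sub_self, zero_div]
  have hM' := H'.yy_mean_full G (by omega) hp hab hs'
  set M := av (d - ev b) (full n) (yy a b (full n)) with hMdef
  set V := av (d - ev b) (full n) (fun F => (yy a b (full n) F - M) ^ 2) with hVdef
  have hM : Bd T h 40 1 (M - lam * (1 - lam)) := by
    have h2 := Bd.absorb G (c := 196) (k := 1) (H'.yy_mean G (by omega) hp hab) (by norm_num)
    have hu' := H'.bd_u G (show j + 1 ≤ 50 by omega)
    exact (h2.add G ((G.bd_one_sub_lam.mul G (hu' b)).sub G (G.bd_lam.mul G (hu' a)))).congr G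
      (by rw [hMdef]; ring) (by norm_num) (by norm_num)
  have hV : Bd T h 280 3 (V - (lam * (1 - lam)) ^ 2 * h ^ 2) :=
    H'.variance G (by omega) hp hab
  have h2 := H'.av_inv_mean G (by omega) hab hp hM rfl
  have hJ := G.bd_inv_m hM
  have hM0 := (G.inv_m hM).1
  set M0 := d b / n * (1 - d a / n) with hM0def
  have hN : Bd T h 40 1 (M0 - lam * (1 - lam)) := by
    refine ((hdb.mul G ((G.bd_const (x := 1) (by norm_num)).sub G
      (G.bd_const (x := lam) (by have := G.lam0; have := G.lam1; rw [abs_le]; constructor <;> linarith)))).sub G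
      ((hda.mul G G.bd_lam).add G (hda.mul G hdb))).congr G ?_ (by norm_num) (by norm_num)
    rw [hM0def]; ring
  have hJ0 := G.bd_inv_m hN
  have hN0 := (G.inv_m hN).1
  set U := uu lam d (full n) with hU
  set r := (∑ v, U v ^ 2) / n with hr
  have hrb : Bd T h 4 2 r := Bd.sum_div G fun v => ((hu v).mul G (hu v)).congr G (by ring)
    (by norm_num) (by norm_num)
  have hMM : Bd T h 262 3 (M - M0 - (lam * (1 - lam) * h ^ 2 - r)) := by
    have e1 : ∑ v, uu lam (d - ev b) (full n) v ^ 2 = ∑ v, U v ^ 2 - 2 * U b * h ^ 2 + h ^ 4 := by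
      have : ∀ v, uu lam (d - ev b) (full n) v ^ 2 = U v ^ 2 - ev b v * (2 * U v * h ^ 2 - h ^ 4) :=
        fun v => by
          rw [uu_sub_ev G]
          have h3 : ev b v * ev b v = ev b v := by unfold ev; split_ifs <;> norm_num
          linear_combination h ^ 4 * h3
      simp only [this, Finset.sum_sub_distrib]
      rw [sum_ev_mul]
      ring
    rw [e1, uu_sub_ev G, uu_sub_ev G, ev_self, ev_of_ne hab, zero_mul, sub_zero, ← hU, add_div,
      sub_div, ← hr, G.div_n (2 * U b * h ^ 2), G.div_n (h ^ 4)] at hM'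
    have ea : d a / n = lam + U a - lam * h ^ 2 := by
      rw [deg_eq (Y := full n) G, dg_full, sub_sub_cancel, G.inv_n]
    have eb : d b / n = lam + U b - lam * h ^ 2 := by
      rw [deg_eq (Y := full n) G, dg_full, sub_sub_cancel, G.inv_n]
    refine (hM'.add G ((((hu a).mul G G.bd_hh).add G ((((G.bd_lam.mul G (hu a)).add G
      (G.bd_lam.mul G (hu b))).mul G G.bd_hh).neg)).add G ((((hu b).mul G (G.bd_const (x := 2)
      (by norm_num))).mul G (G.bd_hh.mul G G.bd_hh)).add G (((G.bd_lam.mul G G.bd_lam).sub G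
      (G.bd_hh)).mul G (G.bd_hh.mul G G.bd_hh))))).congr G ?_ (by norm_num) (by norm_num)
    rw [hM0def, ea, eb]
    ring
  set J := 1 / M with hJd
  set J0 := 1 / M0 with hJ0d
  set I := 1 / (lam * (1 - lam)) with hId
  have hqI : lam * (1 - lam) * I = 1 := mul_one_div_cancel G.q_pos.ne'
  clear_value I
  have hMJ : M * J = 1 := mul_one_div_cancel hM0.ne'
  have hMJ0 : M0 * J0 = 1 := mul_one_div_cancel hN0.ne'
  have hd1 : Bd T h 45 1 (J - I) := ((hM.mul G hJ).mul G hI).neg.congr G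
    (by linear_combination (-J) * hqI + I * hMJ) (by norm_num) (by norm_num)
  have hd2 : Bd T h 45 1 (J0 - I) := ((hN.mul G hJ0).mul G hI).neg.congr G
    (by linear_combination (-J0) * hqI + I * hMJ0) (by norm_num) (by norm_num)
  have hd3 : Bd T h 49 1 (J * J0 - I ^ 2) := ((hd1.mul G hJ0).add G (hI.mul G hd2)).congr G
    (by ring) (by norm_num) (by norm_num)
  have hd4 : Bd T h 60 1 (J ^ 3 - I ^ 3) :=
    (hd1.mul G (((hJ.mul G hJ).add G (hJ.mul G hI)).add G (hI.mul G hI))).congr G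
    (by ring) (by norm_num) (by norm_num)
  have hd5 : Bd T h 300 3 (J - J0 + V * J ^ 3 - r * I ^ 2) := by
    refine (((((hMM.mul G hJ).mul G hJ0).neg).sub G (((hq.mul G G.bd_hh).sub G hrb).mul G hd3)).add G
      ((hV.mul G ((hJ.mul G hJ).mul G hJ)).add G ((hq.mul G hq).mul G (G.bd_hh.mul G hd4)))).congr G
      ?_ (by norm_num) (by norm_num)
    linear_combination J0 * hMJ - J * hMJ0 + (lam * (1 - lam) * h ^ 2 * I ^ 2) * hqI
  have e1 : (av (d - ev b) (full n) fun F =>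
      ((d a - d b) / n - xi a b (full n) F / n) / yy a b (full n) F) =
      (d a - d b) / n * av (d - ev b) (full n) (fun F => 1 / yy a b (full n) F) := by
    rw [← av_mul]
    refine av_congr fun F _ => ?_
    rw [xi_full]; ring
  rw [e1] at h1
  have e2 : d a * (n - d b) / (d b * (n - d a)) = 1 + (d a - d b) / n * J0 := by
    have h3 : M0 = d b * (n - d a) / n ^ 2 := by rw [hM0def]; field_simp
    have h4 : d b * (n - d a) ≠ 0 := by
      intro h4; rw [h3, h4, zero_div] at hN0; exact hN0.ne rfl
    have h5 := (mul_ne_zero_iff.1 h4).1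
    have h6 := (mul_ne_zero_iff.1 h4).2
    rw [hJ0d, h3]
    field_simp
    ring
  have e3 : h ^ 4 * (∑ v, gg lam d (full n) v ^ 2) * h ^ 2 = r := by
    rw [hr, hU, G.div_n]
    simp only [uu, div_pow]
    have h3 : (n:ℝ) ^ 2 * h ^ 4 = 1 := by
      rw [show (n:ℝ) ^ 2 * h ^ 4 = (n * h ^ 2) ^ 2 by ring, G.nh, one_pow]
    rw [← Finset.sum_div]
    field_simp
    linear_combination h ^ 2 * (∑ v, gg lam d (full n) v ^ 2) * h3
  rw [e2, e3]
  refine ((h1.add G (hD.mul G h2)).add G (hD.mul G hd5)).congr G ?_ (by norm_num) (by norm_num)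
  have e4 : V / M ^ 3 = V * J ^ 3 := by rw [hJd]; field_simp
  rw [← hVdef, e4]
  ring

end complete

/-- The sum of the squared deviations of the degrees. -/
def sqd {n : ℕ} (lam : ℝ) (d : Fin n → ℝ) : ℝ := ∑ v, gg lam d (full n) v ^ 2

section step

variable {n : ℕ} {d : Fin n → ℝ} {a b v : Fin n} {T h lam : ℝ} {j : ℕ}

lemma sqd_sub_ev : sqd lam (d - ev b) = sqd lam d - 2 * gg lam d (full n) b + 1 := by
  unfold sqd
  have : ∀ v, gg lam (d - ev b) (full n) v ^ 2 =
      gg lam d (full n) v ^ 2 - ev b v * (2 * gg lam d (full n) v - 1) := fun v => by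
    rw [gg_sub_ev]
    have h3 : ev b v * ev b v = ev b v := by unfold ev; split_ifs <;> norm_num
    linear_combination h3
  simp only [this, Finset.sum_sub_distrib]
  rw [sum_ev_mul]
  ring

lemma Cls.rt_full_le (H : Cls n T h lam j d (full n)) (G : Glob n T h lam) (hj : j ≤ 30)
    (hp : 0 < nn (d - ev b) (full n)) (hab : a ≠ b) (hs : ∑ v, gg lam d (full n) v = 1) :
    0 < d a ∧ 0 < d b ∧ 0 < n - d a ∧ 0 < n - d b ∧
    rt a b d (full n) ≤ (d a * (n - d b)) / (d b * (n - d a)) *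
      Real.exp ((1 / (lam * (1 - lam))) ^ 2 / 4 * h ^ 8 *
        (sqd lam (d - ev b) ^ 2 - sqd lam (d - ev a) ^ 2)) * Real.exp (T ^ 420 * h ^ 4) := by
  have hn := G.npos
  have hu := H.bd_u G (show j ≤ 50 by omega)
  have h1 := H.rt_full G hj hp hab hs
  have h0 := H.bd_rt G (by omega) hab hp
  have hda := H.bd_deg G (by omega) a
  have hdb := H.bd_deg G (by omega) b
  have hD : Bd T h 4 1 ((d a - d b) / n) := (hda.sub G hdb).congr G (by ring) (by norm_num)
    (by norm_num)
  have hI := G.bd_inv_q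
  have hpos : ∀ v, 0 < d v ∧ 0 < n - d v := fun v => by
    have h2 := (H.bd_deg G (by omega) v).absorb G (c := 3) (k := 0) (by norm_num)
    have h3 : T ^ 2 * |d v / n - lam| ≤ T ^ 5 * h := by
      calc _ ≤ T ^ 2 * (T ^ 3 * h ^ 1) := mul_le_mul_of_nonneg_left
            (H.bd_deg G (by omega) v) (by have := G.T0; positivity)
        _ = _ := by ring
    have h4 := h3.trans (G.pow_mul_le (c := 5) (by norm_num))
    have hT := G.hT
    have h5 : |d v / n - lam| * T < 1 := by
      have := abs_nonneg (d v / n - lam)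
      nlinarith [mul_nonneg this G.T0.le]
    have h6 : |d v / n - lam| < lam := by
      by_contra hc
      push Not at hc
      nlinarith [G.lo, G.T0]
    have h7 : |d v / n - lam| < 1 - lam := by
      by_contra hc
      push Not at hc
      nlinarith [G.hi, G.T0]
    rw [abs_lt] at h6 h7
    constructor
    · have : 0 < d v / n := by linarith
      by_contra hc
      push Not at hc
      exact absurd this (not_lt.2 (div_nonpos_of_nonpos_of_nonneg hc hn.le))
    · have : d v / n < 1 := by linarith
      rw [div_lt_one hn] at this
      linarith
  refine ⟨(hpos a).1, (hpos b).1, (hpos a).2, (hpos b).2, ?_⟩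
  set X := (d a * (n - d b)) / (d b * (n - d a)) with hX
  set I := 1 / (lam * (1 - lam)) with hId
  set U := uu lam d (full n) with hU
  set r := h ^ 4 * (∑ v, gg lam d (full n) v ^ 2) * h ^ 2 with hr
  have hrr : r = (∑ v, U v ^ 2) / n := by
    have h3 : (n:ℝ) ^ 2 * h ^ 4 = 1 := by
      rw [show (n:ℝ) ^ 2 * h ^ 4 = (n * h ^ 2) ^ 2 by ring, G.nh, one_pow]
    have : ∀ v, U v ^ 2 = h ^ 4 * gg lam d (full n) v ^ 2 := fun v => by
      rw [hU, uu, G.div_n]; ring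
    simp only [this]
    rw [← Finset.mul_sum, G.div_n, hr]
  have hrb : Bd T h 4 2 r := by
    rw [hrr]
    exact Bd.sum_div G fun v => ((hu v).mul G (hu v)).congr G (by ring) (by norm_num) (by norm_num)
  set y := I ^ 2 / 4 * h ^ 8 * (sqd lam (d - ev b) ^ 2 - sqd lam (d - ev a) ^ 2) with hy
  have hgU : ∀ v, gg lam d (full n) v * h ^ 2 = U v := fun v => by rw [hU, uu, G.div_n]
  have hyy : y = (d a - d b) / n * (I ^ 2 * (r - h ^ 4 * U a - h ^ 4 * U b + h ^ 6)) := by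
    have e : d a - d b = gg lam d (full n) a - gg lam d (full n) b := by
      unfold gg; rw [dg_full, dg_full]; ring
    rw [hy, sqd_sub_ev, sqd_sub_ev, ← hgU, ← hgU, hr, sqd, G.div_n, e]
    ring
  have hw0 : Bd T h 5 4 (h ^ 4 * U a + h ^ 4 * U b - h ^ 6) :=
    (((G.bd_hh.mul G (G.bd_hh.mul G (hu a))).add G (G.bd_hh.mul G (G.bd_hh.mul G (hu b)))).sub G
      (G.bd_hh.mul G (G.bd_hh.mul G G.bd_hh))).congr G (by ring) (by norm_num) (by norm_num)
  have hy1 : Bd T h 14 3 y := ((hD.mul G (hI.mul G hI)).mul G (hrb.sub G hw0)).congr G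
    (by rw [hyy]; ring) (by norm_num) (by norm_num)
  have hX1 : Bd T h 402 1 (X - 1) := ((h0.sub G h1).sub G (hD.mul G (hrb.mul G (hI.mul G hI)))).congr
    G (by ring) (by norm_num) (by norm_num)
  have hZ : Bd T h 417 4 (rt a b d (full n) - X - y - (X - 1) * y) :=
    ((h1.add G (hD.mul G ((hI.mul G hI).mul G hw0))).sub G (hX1.mul G hy1)).congr G
      (by rw [hyy]; ring) (by norm_num) (by norm_num)
  have hT := G.hT
  have hX2 : 1 / 2 ≤ X := by
    have h2 : |X - 1| * T ≤ 1 := by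
      have := mul_le_mul_of_nonneg_right hX1 G.T0.le
      have h3 := G.pow_mul_le (c := 403) (by norm_num)
      calc _ ≤ _ := this
        _ = T ^ 403 * h := by ring
        _ ≤ 1 := h3
    have := neg_abs_le (X - 1)
    nlinarith [abs_nonneg (X - 1)]
  have hy2 : -(1 / 2) ≤ y := by
    have h2 : |y| ≤ h := by
      have := (hy1.absorb G (by norm_num)).mono G le_rfl (k' := 1) (by norm_num)
      unfold Bd at this
      simpa using this
    have h3 := G.pow_mul_le (c := 1) (by norm_num)
    have := neg_abs_le y
    nlinarith [G.h0]
  have hZ' := (le_abs_self _).trans hZ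
  have hpw : 4 * (T ^ 417 * h ^ 4) ≤ T ^ 420 * h ^ 4 := by
    have h2 : 0 ≤ T ^ 417 * h ^ 4 := by have := G.T0; have := G.h0; positivity
    have h3 : (4:ℝ) ≤ T ^ 3 := by nlinarith [sq_nonneg T]
    calc _ ≤ T ^ 3 * (T ^ 417 * h ^ 4) := mul_le_mul_of_nonneg_right h3 h2
      _ = _ := by ring
  have h5 := Real.add_one_le_exp y
  have h6 := Real.add_one_le_exp (T ^ 420 * h ^ 4)
  have h7 : 0 ≤ T ^ 420 * h ^ 4 := by have := G.T0; have := G.h0; positivity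
  set δ := T ^ 420 * h ^ 4
  set ρ := rt a b d (full n)
  clear_value ρ δ X y
  calc ρ ≤ X * (1 + y) + δ / 4 := by linarith
    _ ≤ X * (1 + y) * (1 + δ) := by
      have : 1 / 4 ≤ X * (1 + y) := by nlinarith only [hX2, hy2]
      nlinarith only [this, h7]
    _ ≤ X * Real.exp y * Real.exp δ := by
      have h8 : 0 ≤ X := by linarith
      have h9 : 0 ≤ X * (1 + y) := mul_nonneg h8 (by linarith)
      gcongr <;> linarith

end step

/-- A sequence of natural numbers as a real vector. -/
def cst {n : ℕ} (k : Fin n → ℕ) : Fin n → ℝ := fun v => k v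

/-- The number of choices of independent neighbourhoods of sizes `k`. -/
def chs {n : ℕ} (k : Fin n → ℕ) : ℝ := ∏ v, ((n - 1).choose (k v) : ℝ)

/-- The approximation to the number of graphs with degrees `k`, up to a constant. -/
def wt {n : ℕ} (lam h : ℝ) (k : Fin n → ℕ) : ℝ :=
  chs k * Real.exp (-((1 / (lam * (1 - lam))) ^ 2 / 4 * h ^ 8 * sqd lam (cst k) ^ 2))

section path

variable {n : ℕ} {k k' : Fin n → ℕ} {a b v : Fin n} {T h lam : ℝ}

/-- Moving one unit from `a` to `b`. -/
def move {n : ℕ} (a b : Fin n) (k : Fin n → ℕ) : Fin n → ℕ :=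
  fun v => if v = a then k a - 1 else if v = b then k b + 1 else k v

lemma cst_move (hab : a ≠ b) (ha : 0 < k a) : cst k + ev b - ev a = cst (move a b k) := by
  funext v
  simp only [cst, move, Pi.sub_apply, Pi.add_apply, ev]
  by_cases h1 : v = a
  · subst h1; simp [hab, Nat.cast_sub (show 1 ≤ k v from ha)]
  · by_cases h2 : v = b
    · subst h2; simp [h1]
    · simp [h1, h2]

lemma chs_move (hab : a ≠ b) (ha : 0 < k a) (ha' : k a ≤ n - 1) (hb' : k b ≤ n - 1) :
    chs (move a b k) * (((n - 1 : ℕ) - k a + 1 : ℝ) * (k b + 1)) =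
      chs k * ((k a : ℝ) * ((n - 1 : ℕ) - k b)) := by
  have h1 : ∏ v, (if v = a then ((n - 1 : ℕ) - k a + 1 : ℝ) else if v = b then (k b + 1 : ℝ) else 1) =
      ((n - 1 : ℕ) - k a + 1 : ℝ) * (k b + 1) := by
    rw [Finset.prod_eq_mul a b hab] <;> simp +contextual [hab.symm]
  have h2 : ∏ v, (if v = a then (k a : ℝ) else if v = b then ((n - 1 : ℕ) - k b : ℝ) else 1) =
      (k a : ℝ) * ((n - 1 : ℕ) - k b) := by
    rw [Finset.prod_eq_mul a b hab] <;> simp +contextual [hab.symm]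
  rw [← h1, ← h2, chs, chs, ← Finset.prod_mul_distrib, ← Finset.prod_mul_distrib]
  refine Finset.prod_congr rfl fun v _ => ?_
  unfold move
  by_cases hv : v = a
  · subst hv
    simp only [if_true]
    have := Nat.choose_succ_right_eq (n - 1) (k v - 1)
    rw [Nat.sub_add_cancel ha] at this
    have h3 : (((n - 1).choose (k v) * k v : ℕ) : ℝ) = _ := congrArg Nat.cast this
    rw [Nat.cast_mul, Nat.cast_mul, Nat.cast_sub (by omega), Nat.cast_sub ha] at h3
    rw [h3]; push_cast; ring
  · by_cases hw : v = b
    · subst hw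
      simp only [if_true, if_neg hv]
      have := Nat.choose_succ_right_eq (n - 1) (k v)
      have h3 : (((n - 1).choose (k v + 1) * (k v + 1) : ℕ) : ℝ) = _ := congrArg Nat.cast this
      rw [Nat.cast_mul, Nat.cast_mul, Nat.cast_sub hb'] at h3
      rw [← h3]; push_cast; ring
    · simp [hv, hw]

lemma step_le (G : Glob n T h lam) (hk : ∀ v, |(k v : ℝ) - lam * (n - 1)| ≤ T / h)
    (hs : ∑ v, (k v : ℝ) = lam * (n * (n - 1))) (hab : a ≠ b) (ha : 0 < k a)
    (hp : 0 < nn (cst k) (full n)) :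
    0 < nn (cst (move a b k)) (full n) ∧ nn (cst (move a b k)) (full n) * wt lam h k ≤
      nn (cst k) (full n) * wt lam h (move a b k) * Real.exp (T ^ 420 * h ^ 4) := by
  have hn := G.npos
  have hn1 : 1 ≤ n := Nat.cast_pos.1 hn
  have hh := G.h0
  set d : Fin n → ℝ := cst k + ev b with hd
  have e1 : d - ev b = cst k := by rw [hd]; simp
  have e2 : d - ev a = cst (move a b k) := cst_move hab ha
  have hsg : ∑ v, gg lam d (full n) v = 1 := by
    simp only [gg, hd, dg_full, cst, Pi.add_apply, Finset.sum_sub_distrib, Finset.sum_add_distrib, hs,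
      sum_ev]
    simp; ring
  have H : Cls n T h lam 1 d (full n) := by
    refine ⟨loopless_full, fun v => ?_, fun v => ?_, ?_⟩
    · have h1 : gg lam d (full n) v = ((k v : ℝ) - lam * (n - 1)) + ev b v := by
        simp [gg, hd, dg_full, cst]; ring
      rw [h1]
      refine (abs_add_le _ _).trans ?_
      rw [abs_of_nonneg (ev_nonneg (a := b) (v := v)), add_div]
      refine add_le_add (hk v) (ev_le_one.trans ?_)
      rw [Nat.cast_one, le_div_iff₀ hh]; linarith [G.h1]
    · rw [dg_full]; push_cast; linarith [G.T0]
    · rw [hsg, abs_one]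
      have : (1:ℝ) ≤ n := by exact_mod_cast hn1
      push_cast
      nlinarith [G.T0]
  rw [← e1] at hp
  obtain ⟨p1, p2, p3, p4, h1⟩ := H.rt_full_le G (by norm_num) hp hab hsg
  refine ⟨e2 ▸ H.pos_swap G (by norm_num) hab hp, ?_⟩
  rw [rt, div_le_iff₀ hp, e1, e2] at h1
  have da : d a = k a := by simp [hd, cst, ev_of_ne hab]
  have db : d b = k b + 1 := by simp [hd, cst, ev_self]
  rw [da, db] at h1
  rw [da] at p3
  rw [db] at p4
  have ha' : k a ≤ n - 1 := by
    have : k a < n := by exact_mod_cast (sub_pos.1 p3)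
    omega
  have hb' : k b ≤ n - 1 := by
    have : k b + 1 < n := by exact_mod_cast (sub_pos.1 p4)
    omega
  have h2 := chs_move hab ha ha' hb'
  rw [Nat.cast_sub hn1, Nat.cast_one] at h2
  have h3 : chs (move a b k) = chs k * ((k a : ℝ) * (n - (k b + 1)) / ((k b + 1) * (n - k a))) := by
    have h4 : (n - k a : ℝ) ≠ 0 := p3.ne'
    have h5 : (k b + 1 : ℝ) ≠ 0 := by positivity
    rw [mul_div_assoc', eq_div_iff (mul_ne_zero h5 h4)]
    linear_combination h2
  rw [wt, wt, h3]
  set c := (1 / (lam * (1 - lam))) ^ 2 / 4 * h ^ 8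
  rw [mul_sub c, sub_eq_add_neg (c * _), Real.exp_add] at h1
  have hE : Real.exp (-(c * sqd lam (cst k) ^ 2)) * Real.exp (c * sqd lam (cst k) ^ 2) = 1 := by
    rw [← Real.exp_add]; simp
  have hc : 0 ≤ chs k * Real.exp (-(c * sqd lam (cst k) ^ 2)) :=
    mul_nonneg (Finset.prod_nonneg fun _ _ => Nat.cast_nonneg _) (Real.exp_pos _).le
  refine (mul_le_mul_of_nonneg_right h1 hc).trans (le_of_eq ?_)
  linear_combination (nn (cst k) (full n) * chs k * ((k a : ℝ) * (n - (k b + 1)) /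
    ((k b + 1) * (n - k a))) * Real.exp (-(c * sqd lam (cst (move a b k)) ^ 2)) *
    Real.exp (T ^ 420 * h ^ 4)) * hE

lemma le_of_box (G : Glob n T h lam) (hk : |(k v : ℝ) - lam * (n - 1)| ≤ T / h) :
    k v ≤ n - 1 := by
  have hn1 : 1 ≤ n := Nat.cast_pos.1 G.npos
  have h1 := (abs_le.1 hk).2
  have h2 := G.hi
  have h3 := G.T0
  have h4 := G.h0
  have h5 := G.pow_mul_le (c := 3) (by norm_num)
  have h6 : T / h ≤ (1 - lam) * (n - 1) := by
    rw [div_le_iff₀ h4, G.n_eq]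
    have e : (1 - lam) * (1 / h ^ 2 - 1) * h = (1 - lam) * (1 - h ^ 2) / h := by
      field_simp
    rw [e, le_div_iff₀ h4]
    have h7 := G.h1
    have h8 : T * (T * h) ≤ (1 - h ^ 2) := by
      have h8 : 100 * (T ^ 2 * h) ≤ 1 := le_trans (by
        nlinarith only [mul_le_mul_of_nonneg_right G.hT (mul_pos (pow_pos h3 2) h4).le]) h5
      nlinarith only [h8, h7, h4, mul_le_mul_of_nonneg_right (one_le_pow₀ G.T1 : 1 ≤ T ^ 2) h4.le]
    have h9 : (0:ℝ) ≤ 1 - h ^ 2 := by nlinarith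
    nlinarith
  have h7 : (k v : ℝ) ≤ (n - 1 : ℕ) := by
    rw [Nat.cast_sub hn1, Nat.cast_one]; linarith
  exact_mod_cast h7

lemma wt_pos (G : Glob n T h lam) (hk : ∀ v, |(k v : ℝ) - lam * (n - 1)| ≤ T / h) :
    0 < wt lam h k :=
  mul_pos (Finset.prod_pos fun v _ => by exact_mod_cast Nat.choose_pos (le_of_box G (hk v)))
    (Real.exp_pos _)

lemma path_le (G : Glob n T h lam) (hk' : ∀ v, |(k' v : ℝ) - lam * (n - 1)| ≤ T / h)
    (hs' : ∑ v, (k' v : ℝ) = lam * (n * (n - 1))) :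
    ∀ (D : ℕ) (k : Fin n → ℕ), (∀ v, |(k v : ℝ) - lam * (n - 1)| ≤ T / h) →
    ∑ v, (k v : ℝ) = lam * (n * (n - 1)) → 0 < nn (cst k) (full n) →
    ∑ v, ((k v : ℤ) - k' v).natAbs ≤ D →
    0 < nn (cst k') (full n) ∧ nn (cst k') (full n) * wt lam h k ≤
      nn (cst k) (full n) * wt lam h k' * Real.exp (T ^ 420 * h ^ 4 * D) := by
  intro D
  have hδ : 0 ≤ T ^ 420 * h ^ 4 := by have := G.T0; have := G.h0; positivity
  have hw : ∀ k : Fin n → ℕ, 0 ≤ wt lam h k := fun k =>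
    mul_nonneg (Finset.prod_nonneg fun _ _ => Nat.cast_nonneg _) (Real.exp_pos _).le
  induction D with
  | zero =>
    intro k _ _ hp hD
    have : k = k' := by
      funext v
      have := Finset.sum_eq_zero_iff.1 (Nat.le_zero.1 hD) v (Finset.mem_univ v)
      omega
    subst this
    exact ⟨hp, by simp⟩
  | succ D ih =>
    intro k hk hs hp hD
    by_cases heq : k = k'
    · subst heq
      refine ⟨hp, ?_⟩
      have := Real.one_le_exp (mul_nonneg hδ (Nat.cast_nonneg (D + 1)))
      have h2 := mul_nonneg hp.le (hw k)
      nlinarith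
    have hsum : ∑ v, k v = ∑ v, k' v := by exact_mod_cast hs.trans hs'.symm
    obtain ⟨a, ha⟩ : ∃ a, k' a < k a := by
      by_contra hc
      push Not at hc
      exact heq (funext fun v => (Finset.sum_eq_sum_iff_of_le fun v _ => hc v).1 hsum v
        (Finset.mem_univ v))
    obtain ⟨b, hb⟩ : ∃ b, k b < k' b := by
      by_contra hc
      push Not at hc
      exact heq (funext fun v => ((Finset.sum_eq_sum_iff_of_le fun v _ => hc v).1 hsum.symm v
        (Finset.mem_univ v)).symm)
    have hab : a ≠ b := by rintro rfl; omega
    obtain ⟨q1, q2⟩ := step_le G hk hs hab (by omega) hp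
    have hm : ∀ v, |((move a b k) v : ℝ) - lam * (n - 1)| ≤ T / h := fun v => by
      have h1 := abs_le.1 (hk v)
      have h2 := abs_le.1 (hk' v)
      have : ((move a b k) v ≤ k v ∧ k' v ≤ (move a b k) v) ∨
          (k v ≤ (move a b k) v ∧ (move a b k) v ≤ k' v) := by
        unfold move; split_ifs with h3 h4
        · subst h3; left; omega
        · subst h4; right; omega
        · rcases le_total (k v) (k' v) with h5 | h5
          · right; omega
          · left; omega
      rw [abs_le]
      rcases this with ⟨h3, h4⟩ | ⟨h3, h4⟩
      · have h5 : ((move a b k) v : ℝ) ≤ k v := by exact_mod_cast h3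
        have h6 : (k' v : ℝ) ≤ (move a b k) v := by exact_mod_cast h4
        constructor <;> linarith
      · have h5 : (k v : ℝ) ≤ (move a b k) v := by exact_mod_cast h3
        have h6 : ((move a b k) v : ℝ) ≤ k' v := by exact_mod_cast h4
        constructor <;> linarith
    have hms : ∑ v, ((move a b k) v : ℝ) = lam * (n * (n - 1)) := by
      have : ∑ v, cst (move a b k) v = ∑ v, cst k v := by
        rw [← cst_move hab (by omega)]
        simp [Finset.sum_add_distrib, Finset.sum_sub_distrib, sum_ev]
      exact this.trans hs
    have hmD : ∑ v, (((move a b k) v : ℤ) - k' v).natAbs ≤ D := by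
      have : ∑ v, (((move a b k) v : ℤ) - k' v).natAbs < ∑ v, ((k v : ℤ) - k' v).natAbs := by
        refine Finset.sum_lt_sum (fun v _ => ?_) ⟨a, Finset.mem_univ a, ?_⟩
        · unfold move; split_ifs with h3 h4
          · subst h3; omega
          · subst h4; omega
          · rfl
        · simp only [move, if_true]; omega
      omega
    obtain ⟨r1, r2⟩ := ih _ hm hms q1 hmD
    refine ⟨r1, ?_⟩
    set k1 := move a b k
    have e : Real.exp (T ^ 420 * h ^ 4 * (D + 1 : ℕ)) =
        Real.exp (T ^ 420 * h ^ 4 * D) * Real.exp (T ^ 420 * h ^ 4) := by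
      rw [← Real.exp_add]; push_cast; ring_nf
    rw [e]
    have h1 := mul_le_mul_of_nonneg_right r2 (hw k)
    have h2 := mul_le_mul_of_nonneg_right q2 (mul_nonneg (hw k')
      (Real.exp_pos (T ^ 420 * h ^ 4 * D)).le)
    refine le_of_mul_le_mul_right ?_ (wt_pos G hm)
    calc _ = nn (cst k') (full n) * wt lam h k1 * wt lam h k := by ring
      _ ≤ _ := h1
      _ = nn (cst k1) (full n) * wt lam h k * (wt lam h k' * Real.exp (T ^ 420 * h ^ 4 * D)) := by
        ring
      _ ≤ _ := h2
      _ = _ := by ring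

end path

/-- The expectation of `φ` under the binomial distribution. -/
def bex (m : ℕ) (p : ℝ) (φ : ℕ → ℝ) : ℝ :=
  ∑ i ∈ Finset.range (m + 1), ((m.choose i : ℝ) * p ^ i * (1 - p) ^ (m - i)) * φ i

section binomial

variable {m : ℕ} {p s T h : ℝ} {φ ψ : ℕ → ℝ}

lemma bex_one : bex m p (fun _ => 1) = 1 := by
  have := add_pow p (1 - p) m
  rw [add_sub_cancel, one_pow] at this
  rw [bex]
  refine Eq.trans (Finset.sum_congr rfl fun i _ => ?_) this.symm
  ring

lemma bex_mono (h0 : 0 ≤ p) (h1 : p ≤ 1) (h : ∀ i ≤ m, φ i ≤ ψ i) : bex m p φ ≤ bex m p ψ := by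
  refine Finset.sum_le_sum fun i hi => mul_le_mul_of_nonneg_left (h i ?_) ?_
  · have := Finset.mem_range.1 hi; omega
  · have : 0 ≤ 1 - p := by linarith
    positivity

lemma bex_add : bex m p (fun i => φ i + ψ i) = bex m p φ + bex m p ψ := by
  simp only [bex, mul_add, Finset.sum_add_distrib]

lemma bex_const_mul (c : ℝ) : bex m p (fun i => c * φ i) = c * bex m p φ := by
  simp only [bex, Finset.mul_sum]
  exact Finset.sum_congr rfl fun i _ => by ring

lemma bex_const (c : ℝ) : bex m p (fun _ => c) = c := by
  have := bex_const_mul (m := m) (p := p) (φ := fun _ => 1) c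
  simpa [bex_one] using this

lemma bex_exp : bex m p (fun i => Real.exp (s * i)) = (1 - p + p * Real.exp s) ^ m := by
  rw [add_comm, add_pow, bex]
  refine Finset.sum_congr rfl fun i _ => ?_
  rw [mul_pow, mul_comm s, Real.exp_nat_mul]
  ring

lemma one_sub_add_mul_exp_le (h0 : 0 ≤ p) (hs : |s| ≤ 1) :
    1 - p + p * Real.exp s ≤ Real.exp (p * s + p * s ^ 2) := by
  have h1 := Real.abs_exp_sub_one_sub_id_le hs
  have h2 := Real.add_one_le_exp (p * s + p * s ^ 2)
  nlinarith [(abs_le.1 h1).2]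

lemma bex_exp_centered_le (h0 : 0 ≤ p) (h1 : p ≤ 1) (hs : |s| ≤ 1) :
    bex m p (fun i => Real.exp (s * (i - p * m))) ≤ Real.exp (s ^ 2 * m) := by
  have e : bex m p (fun i => Real.exp (s * (i - p * m))) =
      Real.exp (-(s * (p * m))) * (1 - p + p * Real.exp s) ^ m := by
    rw [← bex_exp, ← bex_const_mul]
    refine Finset.sum_congr rfl fun i _ => ?_
    beta_reduce
    rw [← Real.exp_add]; ring_nf
  rw [e]
  have h2 : (0:ℝ) ≤ 1 - p + p * Real.exp s :=
    add_nonneg (by linarith) (mul_nonneg h0 (Real.exp_pos _).le)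
  refine (mul_le_mul_of_nonneg_left (pow_le_pow_left₀ h2 (one_sub_add_mul_exp_le h0 hs) m)
    (Real.exp_pos _).le).trans ?_
  rw [← Real.exp_nat_mul, ← Real.exp_add, Real.exp_le_exp]
  have : (0:ℝ) ≤ m := Nat.cast_nonneg m
  nlinarith [mul_nonneg this (sq_nonneg s)]

lemma bex_variance : bex m p (fun i => (i - p * m) ^ 2) = m * (p * (1 - p)) := by
  have := congrArg (Polynomial.eval p) (bernsteinPolynomial.variance ℝ m)
  simp only [Polynomial.eval_finsetSum, bernsteinPolynomial, Polynomial.eval_mul,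
    Polynomial.eval_pow, Polynomial.eval_sub, Polynomial.eval_X,
    Polynomial.eval_natCast, Polynomial.eval_one, nsmul_eq_mul] at this
  rw [← mul_assoc, ← this, bex]
  exact Finset.sum_congr rfl fun i _ => by ring

lemma ite_lt_abs_le {y : ℝ} (hh : 0 < h) : (if T / h < |y| then (1:ℝ) else 0) ≤
    Real.exp (-(20 * T)) * (Real.exp (20 * h * y) + Real.exp (-(20 * h) * y)) := by
  split_ifs with hy
  · rw [mul_add, ← Real.exp_add, ← Real.exp_add]
    rw [div_lt_iff₀ hh] at hy
    rcases abs_cases y with ⟨h1, -⟩ | ⟨h1, -⟩ <;> rw [h1] at hy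
    · refine le_trans (Real.one_le_exp ?_) (le_add_of_nonneg_right (Real.exp_pos _).le)
      linarith
    · refine le_trans (Real.one_le_exp ?_) (le_add_of_nonneg_left (Real.exp_pos _).le)
      linarith
  · positivity

lemma bex_tail_le (h0 : 0 ≤ p) (h1 : p ≤ 1) (hh : 0 < h) (hh' : 20 * h ≤ 1)
    (hm : m * h ^ 2 ≤ 1) (hT : 100 ≤ T) :
    bex m p (fun i => if T / h < |(i : ℝ) - p * m| then 1 else 0) ≤ 2 * Real.exp (-(16 * T)) := by
  refine (bex_mono h0 h1 fun i _ => ite_lt_abs_le hh).trans ?_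
  rw [bex_const_mul, bex_add]
  have e1 := bex_exp_centered_le (m := m) (s := 20 * h) h0 h1 (by rw [abs_of_pos] <;> linarith)
  have e2 := bex_exp_centered_le (m := m) (s := -(20 * h)) h0 h1
    (by rw [abs_neg, abs_of_pos] <;> linarith)
  have e3 : Real.exp ((20 * h) ^ 2 * m) ≤ Real.exp 400 := Real.exp_le_exp.2 (by nlinarith)
  have e4 : Real.exp ((-(20 * h)) ^ 2 * m) ≤ Real.exp 400 := Real.exp_le_exp.2 (by nlinarith)
  have e5 : Real.exp (-(20 * T)) * (2 * Real.exp 400) ≤ 2 * Real.exp (-(16 * T)) := by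
    rw [mul_left_comm, ← Real.exp_add]
    exact mul_le_mul_of_nonneg_left (Real.exp_le_exp.2 (by linarith)) (by norm_num)
  refine le_trans (mul_le_mul_of_nonneg_left ?_ (Real.exp_pos _).le) e5
  linarith

end binomial

/-- The expectation of `Ψ` for `n` independent binomial variables. -/
def pex (n m : ℕ) (p : ℝ) (Ψ : (Fin n → ℕ) → ℝ) : ℝ :=
  ∑ k ∈ Fintype.piFinset (fun _ : Fin n => Finset.range (m + 1)),
    (∏ v, ((m.choose (k v) : ℝ) * p ^ k v * (1 - p) ^ (m - k v))) * Ψ k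

/-- Sequences of length `n` in `{0, …, m}` with sum `M`. -/
def seqs (n m M : ℕ) : Finset (Fin n → ℕ) :=
  (Fintype.piFinset (fun _ : Fin n => Finset.range (m + 1))).filter fun k => ∑ v, k v = M

section product

variable {n m M : ℕ} {p s T h : ℝ} {Ψ Φ : (Fin n → ℕ) → ℝ} {k : Fin n → ℕ}

lemma mem_seqs : k ∈ seqs n m M ↔ (∀ v, k v ≤ m) ∧ ∑ v, k v = M := by
  simp [seqs, Fintype.mem_piFinset]

lemma pex_prod (φ : Fin n → ℕ → ℝ) : pex n m p (fun k => ∏ v, φ v (k v)) = ∏ v, bex m p (φ v) := by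
  unfold pex bex
  rw [Finset.prod_univ_sum]
  exact Finset.sum_congr rfl fun k _ => by rw [← Finset.prod_mul_distrib]

lemma pex_mono (h0 : 0 ≤ p) (h1 : p ≤ 1) (h : ∀ k, Ψ k ≤ Φ k) : pex n m p Ψ ≤ pex n m p Φ := by
  refine Finset.sum_le_sum fun k _ => mul_le_mul_of_nonneg_left (h k)
    (Finset.prod_nonneg fun v _ => ?_)
  have : 0 ≤ 1 - p := by linarith
  positivity

lemma pex_add : pex n m p (fun k => Ψ k + Φ k) = pex n m p Ψ + pex n m p Φ := by
  simp only [pex, mul_add, Finset.sum_add_distrib]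

lemma pex_const_mul (c : ℝ) : pex n m p (fun k => c * Ψ k) = c * pex n m p Ψ := by
  simp only [pex, Finset.mul_sum]
  exact Finset.sum_congr rfl fun i _ => by ring

lemma pex_sum {ι : Type*} (t : Finset ι) (f : ι → (Fin n → ℕ) → ℝ) :
    pex n m p (fun k => ∑ i ∈ t, f i k) = ∑ i ∈ t, pex n m p (f i) := by
  simp only [pex, Finset.mul_sum]
  exact Finset.sum_comm

lemma pex_single (v : Fin n) (φ : ℕ → ℝ) : pex n m p (fun k => φ (k v)) = bex m p φ := by
  have := pex_prod (m := m) (p := p) (fun w i => if w = v then φ i else 1)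
  have e : ∀ k : Fin n → ℕ, ∏ w, (if w = v then φ (k w) else 1) = φ (k v) := fun k => by
    rw [Finset.prod_ite_eq' Finset.univ v (fun w => φ (k w)), if_pos (Finset.mem_univ v)]
  simp only [e] at this
  rw [this, Finset.prod_eq_single v]
  · simp
  · intro w _ hw; simp [hw, bex_one]
  · simp

lemma sum_seqs_le_pex (h0 : 0 ≤ p) (h1 : p ≤ 1) (hΨ : ∀ k, 0 ≤ Ψ k) :
    p ^ M * (1 - p) ^ (n * m - M) * ∑ k ∈ seqs n m M, (∏ v, (m.choose (k v) : ℝ)) * Ψ k ≤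
      pex n m p Ψ := by
  have hq : 0 ≤ 1 - p := by linarith
  unfold pex
  rw [Finset.mul_sum]
  refine le_trans (le_of_eq (Finset.sum_congr rfl fun k hk => ?_))
    (Finset.sum_le_sum_of_subset_of_nonneg (Finset.filter_subset _ _) fun k _ _ =>
      mul_nonneg (Finset.prod_nonneg fun v _ => by positivity) (hΨ k))
  obtain ⟨h2, h3⟩ := mem_seqs.1 hk
  rw [Finset.prod_mul_distrib, Finset.prod_mul_distrib, Finset.prod_pow_eq_pow_sum,
    Finset.prod_pow_eq_pow_sum, h3]
  have : ∑ v, (m - k v) = n * m - M := by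
    have : ∑ v, (m - k v) + ∑ v, k v = n * m := by
      rw [← Finset.sum_add_distrib]
      simp [Nat.sub_add_cancel (h2 _)]
    omega
  rw [this]; ring

lemma sum_seqs_choose : ∑ k ∈ seqs n m M, ∏ v, m.choose (k v) = (n * m).choose M := by
  have h1 : (∏ _v : Fin n, ∑ i ∈ Finset.range (m + 1),
      (Polynomial.C (m.choose i) * Polynomial.X ^ i : Polynomial ℕ)) = (1 + Polynomial.X) ^ (n * m) := by
    have : ∑ i ∈ Finset.range (m + 1), (Polynomial.C (m.choose i) * Polynomial.X ^ i : Polynomial ℕ) =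
        (1 + Polynomial.X) ^ m := by
      rw [add_comm (1 : Polynomial ℕ), add_pow]
      refine Finset.sum_congr rfl fun i _ => ?_
      rw [one_pow, mul_one, mul_comm]; simp
    rw [this]
    simp [← pow_mul, mul_comm]
  have h2 := congrArg (fun P => Polynomial.coeff P M) h1
  simp only [Polynomial.coeff_one_add_X_pow, Finset.prod_univ_sum, Polynomial.finsetSum_coeff,
    Finset.prod_mul_distrib, Finset.prod_pow_eq_pow_sum] at h2
  rw [Nat.cast_id] at h2
  rw [← h2, seqs, Finset.sum_filter]
  refine Finset.sum_congr rfl fun k _ => ?_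
  rw [← map_prod, Polynomial.coeff_C_mul, Polynomial.coeff_X_pow]
  simp [eq_comm]

/-- The truncated squared deviation, scaled by `h ^ 2`. -/
def omg (m : ℕ) (p T h : ℝ) (i : ℕ) : ℝ :=
  if T / h < |(i : ℝ) - p * m| then 0 else ((i - p * m) * h) ^ 2

lemma omg_nonneg {i : ℕ} : 0 ≤ omg m p T h i := by unfold omg; split_ifs <;> positivity

lemma omg_le (hh : 0 < h) {i : ℕ} : omg m p T h i ≤ T ^ 2 := by
  unfold omg; split_ifs with h1
  · positivity
  · push Not at h1
    rw [le_div_iff₀ hh] at h1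
    rw [← sq_abs, abs_mul, abs_of_pos hh]
    exact pow_le_pow_left₀ (by positivity) h1 2

lemma bex_exp_omg_le (h0 : 0 ≤ p) (h1 : p ≤ 1) (hh : 0 < h) (hs : |s| * T ^ 2 ≤ 1) :
    bex m p (fun i => Real.exp (s * (omg m p T h i - bex m p (omg m p T h)))) ≤
      Real.exp (s ^ 2 * T ^ 4) := by
  set μ := bex m p (omg m p T h) with hμ
  have m0 : 0 ≤ μ := by
    have := bex_mono (m := m) (φ := fun _ => (0:ℝ)) (ψ := omg m p T h) h0 h1 fun i _ => omg_nonneg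
    rwa [bex_const] at this
  have m1 : μ ≤ T ^ 2 := by
    have := bex_mono (m := m) (φ := omg m p T h) (ψ := fun _ => T ^ 2) h0 h1 fun i _ => omg_le hh
    rwa [bex_const] at this
  have hb : ∀ i, |omg m p T h i - μ| ≤ T ^ 2 := fun i => by
    have h2 := omg_nonneg (m := m) (p := p) (T := T) (h := h) (i := i)
    have h3 := omg_le (m := m) (p := p) (T := T) hh (i := i)
    rw [abs_le]; constructor <;> linarith
  have h2 : ∀ i ≤ m, Real.exp (s * (omg m p T h i - μ)) ≤
      1 + s ^ 2 * T ^ 4 + -(s * μ) + s * omg m p T h i := fun i _ => by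
    have h3 : |s * (omg m p T h i - μ)| ≤ 1 := by
      rw [abs_mul]
      exact (mul_le_mul_of_nonneg_left (hb i) (abs_nonneg s)).trans hs
    have h4 := (abs_le.1 (Real.abs_exp_sub_one_sub_id_le h3)).2
    have h5 : (s * (omg m p T h i - μ)) ^ 2 ≤ s ^ 2 * T ^ 4 := by
      rw [mul_pow, ← sq_abs (omg m p T h i - μ)]
      refine mul_le_mul_of_nonneg_left ?_ (sq_nonneg s)
      calc _ ≤ (T ^ 2) ^ 2 := pow_le_pow_left₀ (abs_nonneg _) (hb i) 2
        _ = _ := by ring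
    linarith
  refine (bex_mono h0 h1 h2).trans ?_
  have h3 : bex m p (fun i => 1 + s ^ 2 * T ^ 4 + -(s * μ) + s * omg m p T h i) =
      1 + s ^ 2 * T ^ 4 := by
    rw [bex_add, bex_const, bex_const_mul, ← hμ]; ring
  rw [h3]
  linarith [Real.add_one_le_exp (s ^ 2 * T ^ 4)]

lemma pex_omg_le (h0 : 0 ≤ p) (h1 : p ≤ 1) (hh : 0 < h) (hT : 1 ≤ T) (hh' : h ≤ 1)
    (hn : n * h ^ 2 ≤ 1) :
    pex n m p (fun k => if 20 * T ^ 3 / h < |∑ v, (omg m p T h (k v) - bex m p (omg m p T h))|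
      then 1 else 0) ≤ 2 * Real.exp (1 - 20 * T) := by
  set μ := bex m p (omg m p T h) with hμ
  have hT0 : 0 < T := by linarith
  have key : ∀ s : ℝ, |s| = h / T ^ 2 →
      pex n m p (fun k => Real.exp (s * ∑ v, (omg m p T h (k v) - μ))) ≤ Real.exp 1 := fun s hs => by
    simp only [Finset.mul_sum, Real.exp_sum]
    rw [pex_prod (fun _ i => Real.exp (s * (omg m p T h i - μ)))]
    have h2 := bex_exp_omg_le (m := m) (p := p) (s := s) (T := T) h0 h1 hh
      (by rw [hs, div_mul_cancel₀ _ (by positivity)]; exact hh')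
    have h3 : (0:ℝ) ≤ bex m p (fun i => Real.exp (s * (omg m p T h i - μ))) := by
      have := bex_mono (m := m) (φ := fun _ => (0:ℝ)) h0 h1
        (ψ := fun i => Real.exp (s * (omg m p T h i - μ))) fun i _ => (Real.exp_pos _).le
      rwa [bex_const] at this
    rw [Finset.prod_const, Finset.card_univ, Fintype.card_fin]
    refine (pow_le_pow_left₀ h3 h2 n).trans ?_
    rw [← Real.exp_nat_mul, Real.exp_le_exp, ← sq_abs s, hs]
    calc (n : ℝ) * ((h / T ^ 2) ^ 2 * T ^ 4) = n * h ^ 2 := by field_simp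
      _ ≤ 1 := hn
  have hs : |h / T ^ 2| = h / T ^ 2 := abs_of_pos (by positivity)
  have e1 := key (h / T ^ 2) hs
  have e2 := key (-(h / T ^ 2)) (by rw [abs_neg, hs])
  have h2 : ∀ y : ℝ, (if 20 * T ^ 3 / h < |y| then (1:ℝ) else 0) ≤
      Real.exp (-(20 * T)) * (Real.exp (h / T ^ 2 * y) + Real.exp (-(h / T ^ 2) * y)) := fun y => by
    split_ifs with hy
    · rw [mul_add, ← Real.exp_add, ← Real.exp_add]
      have h4 : 20 * T < h / T ^ 2 * |y| := by
        calc 20 * T = h / T ^ 2 * (20 * T ^ 3 / h) := by field_simp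
          _ < _ := mul_lt_mul_of_pos_left hy (by positivity)
      rcases abs_cases y with ⟨h5, -⟩ | ⟨h5, -⟩ <;> rw [h5] at h4
      · refine le_trans (Real.one_le_exp ?_) (le_add_of_nonneg_right (Real.exp_pos _).le)
        linarith
      · refine le_trans (Real.one_le_exp ?_) (le_add_of_nonneg_left (Real.exp_pos _).le)
        linarith
    · positivity
  refine (pex_mono h0 h1 fun k => h2 _).trans ?_
  rw [pex_const_mul, pex_add, sub_eq_add_neg, Real.exp_add]
  have := Real.exp_pos (-(20 * T))
  nlinarith

lemma pex_box_le (h0 : 0 ≤ p) (h1 : p ≤ 1) (hh : 0 < h) (hh' : 20 * h ≤ 1)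
    (hm : m * h ^ 2 ≤ 1) (hT : 100 ≤ T) :
    pex n m p (fun k => if ∃ v, T / h < |(k v : ℝ) - p * m| then 1 else 0) ≤
      n * (2 * Real.exp (-(16 * T))) := by
  have h2 : ∀ k : Fin n → ℕ, (if ∃ v, T / h < |(k v : ℝ) - p * m| then (1:ℝ) else 0) ≤
      ∑ v, if T / h < |(k v : ℝ) - p * m| then 1 else 0 := fun k => by
    split_ifs with hk
    · obtain ⟨v, hv⟩ := hk
      refine le_trans (le_of_eq (if_pos hv).symm) (Finset.single_le_sum
        (f := fun v => if T / h < |(k v : ℝ) - p * m| then (1:ℝ) else 0) (fun i _ => ?_)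
        (Finset.mem_univ v))
      positivity
    · exact Finset.sum_nonneg fun i _ => by positivity
  refine (pex_mono h0 h1 h2).trans ?_
  rw [pex_sum]
  refine (Finset.sum_le_card_nsmul _ _ (2 * Real.exp (-(16 * T))) fun v _ => ?_).trans
    (le_of_eq ?_)
  · rw [pex_single v (fun i => if T / h < |(i : ℝ) - p * m| then (1:ℝ) else 0)]
    exact bex_tail_le h0 h1 hh hh' hm hT
  · simp

lemma bex_omg (h0 : 0 ≤ p) (h1 : p ≤ 1) (hh : 0 < h) (hh' : 20 * h ≤ 1)
    (hm : m * h ^ 2 ≤ 1) (hT : 100 ≤ T) :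
    |bex m p (omg m p T h) - m * (p * (1 - p)) * h ^ 2| ≤ m * (2 * Real.exp (-(16 * T))) := by
  have e : (m : ℝ) * (p * (1 - p)) * h ^ 2 = bex m p (omg m p T h) +
      bex m p (fun i => if T / h < |(i : ℝ) - p * m| then ((i - p * m) * h) ^ 2 else 0) := by
    rw [← bex_variance, mul_comm, ← bex_const_mul, ← bex_add]
    refine Finset.sum_congr rfl fun i _ => ?_
    simp only [omg]
    split_ifs <;> ring
  have h2 := bex_mono (m := m) (p := p)
    (φ := fun i => if T / h < |(i : ℝ) - p * m| then ((i - p * m) * h) ^ 2 else 0)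
    (ψ := fun i => m * if T / h < |(i : ℝ) - p * m| then 1 else 0) h0 h1 fun i hi => by
      split_ifs
      · rw [mul_one, mul_pow]
        have h3 : |(i : ℝ) - p * m| ≤ m := by
          have h4 : (i : ℝ) ≤ m := by exact_mod_cast hi
          have h5 : (0 : ℝ) ≤ i := Nat.cast_nonneg i
          rw [abs_le]; constructor <;> nlinarith
        have h6 : ((i : ℝ) - p * m) ^ 2 ≤ m ^ 2 := by
          rw [← sq_abs]; exact pow_le_pow_left₀ (abs_nonneg _) h3 2
        calc _ ≤ (m : ℝ) ^ 2 * h ^ 2 := mul_le_mul_of_nonneg_right h6 (sq_nonneg h)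
          _ = m * (m * h ^ 2) := by ring
          _ ≤ m * 1 := mul_le_mul_of_nonneg_left hm (Nat.cast_nonneg m)
          _ = m := mul_one _
      · simp
  have h3 := bex_mono (m := m) (p := p) (φ := fun _ => (0:ℝ))
    (ψ := fun i => if T / h < |(i : ℝ) - p * m| then ((i - p * m) * h) ^ 2 else 0) h0 h1
    fun i _ => by positivity
  rw [bex_const] at h3
  rw [bex_const_mul] at h2
  have h4 := h2.trans (mul_le_mul_of_nonneg_left (bex_tail_le h0 h1 hh hh' hm hT) (Nat.cast_nonneg m))
  rw [e, sub_add_cancel_left, abs_neg, abs_of_nonneg h3]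
  exact h4

end product

/-- The degree of `v` in the edge set `F`, as a natural number. -/
def ndg {n : ℕ} (F : Finset (Sym2 (Fin n))) (v : Fin n) : ℕ := (F.filter fun e => v ∈ e).card

section graphs

variable {n E : ℕ} {p s T h : ℝ} {v : Fin n} {F : Finset (Sym2 (Fin n))}

lemma dg_eq_ndg (v : Fin n) : dg F v = ndg F v := by
  have h1 : F.filter (fun e => v ∈ e) = (Finset.univ.filter fun u => s(v, u) ∈ F).image
      fun u => s(v, u) := by
    ext e
    simp only [Finset.mem_filter, Finset.mem_image, Finset.mem_univ, true_and]
    constructor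
    · rintro ⟨he, hv⟩
      obtain ⟨u, rfl⟩ := Sym2.mem_iff_exists.1 hv
      exact ⟨u, he, rfl⟩
    · rintro ⟨u, hu, rfl⟩
      exact ⟨hu, Sym2.mem_mk_left _ _⟩
  rw [ndg, h1, Finset.card_image_of_injective _ fun u w hu => Sym2.congr_right.1 hu]
  simp [dg, ind]

lemma dg_eq_cst_ndg : dg F = cst (ndg F) := funext fun v => dg_eq_ndg v

lemma ndg_full : ndg (full n) v = n - 1 := by
  have h1 := (dg_eq_ndg (F := full n) v).symm.trans dg_full
  have hn : 1 ≤ n := Nat.one_le_of_lt v.2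
  have : (ndg (full n) v : ℝ) = ((n - 1 : ℕ) : ℝ) := by rw [h1, Nat.cast_sub hn, Nat.cast_one]
  exact_mod_cast this

lemma ndg_le (hF : F ⊆ full n) : ndg F v ≤ n - 1 :=
  (Finset.card_le_card (Finset.filter_subset_filter _ hF)).trans ndg_full.le

lemma sum_ndg (hF : F ⊆ full n) : ∑ v, ndg F v = 2 * F.card := by
  simp only [ndg, Finset.card_filter]
  rw [Finset.sum_comm]
  have : ∀ e ∈ F, ∑ v, (if v ∈ e then 1 else 0) = 2 := fun e he => by
    have h1 : ¬ e.IsDiag := by simpa [full] using hF he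
    rw [← Sym2.card_toFinset_of_not_isDiag e h1, ← Finset.card_filter]
    congr 1
    ext v; simp
  rw [Finset.sum_congr rfl this]
  simp [mul_comm]

lemma card_full : (full n).card = n.choose 2 := by
  have h1 := sum_ndg (Finset.Subset.refl (full n))
  simp only [ndg_full, Finset.sum_const, Finset.card_univ, Fintype.card_fin, smul_eq_mul] at h1
  rw [Nat.choose_two_right]; omega

lemma sum_seqs_nn (Φ : (Fin n → ℕ) → ℝ) :
    ∑ k ∈ seqs n (n - 1) (2 * E), nn (cst k) (full n) * Φ k =
      ∑ F ∈ (full n).powersetCard E, Φ (ndg F) := by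
  have h1 : ∀ k, nn (cst k) (full n) * Φ k =
      ∑ F ∈ (full n).powerset, if ndg F = k then Φ (ndg F) else 0 := fun k => by
    rw [nn, gr, ← Finset.sum_filter, ← nsmul_eq_mul, ← Finset.sum_const]
    have : ∀ F : Finset (Sym2 (Fin n)), dg F = cst k ↔ ndg F = k := fun F => by
      rw [dg_eq_cst_ndg]
      refine ⟨fun h => funext fun v => ?_, fun h => by rw [h]⟩
      have := congrFun h v
      simpa [cst] using this
    simp only [this]
    exact Finset.sum_congr rfl fun F hF => by rw [(Finset.mem_filter.1 hF).2]
  simp only [h1]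
  rw [Finset.sum_comm]
  have h2 : ∀ F ∈ (full n).powerset, (∑ k ∈ seqs n (n - 1) (2 * E),
      if ndg F = k then Φ (ndg F) else 0) = if F.card = E then Φ (ndg F) else 0 := fun F hF => by
    have hF' := Finset.mem_powerset.1 hF
    rw [Finset.sum_ite_eq]
    have : ndg F ∈ seqs n (n - 1) (2 * E) ↔ F.card = E := by
      rw [mem_seqs, sum_ndg hF']
      exact ⟨fun h => by omega, fun h => ⟨fun v => ndg_le hF', by omega⟩⟩
    simp only [this]
  rw [Finset.sum_congr rfl h2, ← Finset.sum_filter]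
  congr 1
  ext F; simp [Finset.mem_powersetCard]

lemma sum_seqs_nn_one : ∑ k ∈ seqs n (n - 1) (2 * E), nn (cst k) (full n) = (n.choose 2).choose E := by
  have := sum_seqs_nn (n := n) (E := E) (fun _ => 1)
  simpa [card_full] using this

/-- The weight of an edge set when the edges are independent with probability `p`. -/
def ewt (n : ℕ) (p : ℝ) (F : Finset (Sym2 (Fin n))) : ℝ :=
  p ^ F.card * (1 - p) ^ (n.choose 2 - F.card)

lemma sum_ewt_exp :
    ∑ F ∈ (full n).powerset, ewt n p F * Real.exp (s * ndg F v) =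
      (1 - p + p * Real.exp s) ^ (n - 1) := by
  have h1 := Finset.prod_add (fun e : Sym2 (Fin n) => p * if v ∈ e then Real.exp s else 1)
    (fun _ => 1 - p) (full n)
  have h2 : ∀ e : Sym2 (Fin n), (p * if v ∈ e then Real.exp s else 1) + (1 - p) =
      if v ∈ e then 1 - p + p * Real.exp s else 1 := fun e => by split_ifs <;> ring
  simp only [h2] at h1
  rw [← Finset.prod_filter, Finset.prod_const] at h1
  change _ ^ ndg (full n) v = _ at h1
  rw [ndg_full] at h1
  rw [h1]
  refine Finset.sum_congr rfl fun F hF => ?_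
  have hF' := Finset.mem_powerset.1 hF
  rw [Finset.prod_const, Finset.prod_mul_distrib, Finset.prod_const, ← Finset.prod_filter,
    Finset.prod_const, Finset.card_sdiff_of_subset hF', card_full]
  change _ = p ^ F.card * Real.exp s ^ ndg F v * _
  rw [mul_comm s, Real.exp_nat_mul, ewt]; ring

lemma sum_ewt_centered_le (h0 : 0 ≤ p) (h1 : p ≤ 1) (hs : |s| ≤ 1) :
    ∑ F ∈ (full n).powerset, ewt n p F * Real.exp (s * (ndg F v - p * (n - 1 : ℕ))) ≤
      Real.exp (s ^ 2 * (n - 1 : ℕ)) := by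
  refine le_trans (le_of_eq ?_) (bex_exp_centered_le (m := n - 1) h0 h1 hs)
  have e : ∀ i : ℝ, Real.exp (s * (i - p * (n - 1 : ℕ))) =
      Real.exp (-(s * (p * (n - 1 : ℕ)))) * Real.exp (s * i) := fun i => by
    rw [← Real.exp_add]; ring_nf
  simp only [e]
  rw [bex_const_mul, bex_exp, ← sum_ewt_exp (v := v), Finset.mul_sum]
  exact Finset.sum_congr rfl fun F _ => by ring

lemma sum_nn_box_le (h0 : 0 ≤ p) (h1 : p ≤ 1) (hh : 0 < h) (hh' : 20 * h ≤ 1)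
    (hm : (n - 1 : ℕ) * h ^ 2 ≤ 1) (hT : 100 ≤ T) :
    p ^ E * (1 - p) ^ (n.choose 2 - E) * ∑ k ∈ seqs n (n - 1) (2 * E), nn (cst k) (full n) *
      (if ∃ v, T / h < |(k v : ℝ) - p * (n - 1 : ℕ)| then 1 else 0) ≤
      n * (2 * Real.exp (-(16 * T))) := by
  rw [sum_seqs_nn fun k => if ∃ v, T / h < |(k v : ℝ) - p * (n - 1 : ℕ)| then (1:ℝ) else 0,
    Finset.mul_sum]
  have hq : 0 ≤ 1 - p := by linarith
  have hw : ∀ F : Finset (Sym2 (Fin n)), 0 ≤ ewt n p F := fun F => by unfold ewt; positivity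
  have h2 : ∀ F : Finset (Sym2 (Fin n)),
      (if ∃ v, T / h < |(ndg F v : ℝ) - p * (n - 1 : ℕ)| then (1:ℝ) else 0) ≤
      ∑ v, Real.exp (-(20 * T)) * (Real.exp (20 * h * (ndg F v - p * (n - 1 : ℕ))) +
        Real.exp (-(20 * h) * (ndg F v - p * (n - 1 : ℕ)))) := fun F => by
    split_ifs with hk
    · obtain ⟨v, hv⟩ := hk
      refine le_trans (le_of_eq (if_pos hv).symm) ((ite_lt_abs_le hh).trans
        (Finset.single_le_sum (f := fun v => Real.exp (-(20 * T)) * (Real.exp (20 * h *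
          (ndg F v - p * (n - 1 : ℕ))) + Real.exp (-(20 * h) * (ndg F v - p * (n - 1 : ℕ)))))
          (fun i _ => ?_) (Finset.mem_univ v)))
      positivity
    · exact Finset.sum_nonneg fun i _ => by positivity
  have h3 : ∀ F ∈ (full n).powersetCard E, p ^ E * (1 - p) ^ (n.choose 2 - E) *
      (if ∃ v, T / h < |(ndg F v : ℝ) - p * (n - 1 : ℕ)| then (1:ℝ) else 0) ≤
      ewt n p F * ∑ v, Real.exp (-(20 * T)) * (Real.exp (20 * h * (ndg F v - p * (n - 1 : ℕ))) +
        Real.exp (-(20 * h) * (ndg F v - p * (n - 1 : ℕ)))) := fun F hF => by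
    rw [ewt, (Finset.mem_powersetCard.1 hF).2]
    exact mul_le_mul_of_nonneg_left (h2 F) (by positivity)
  refine (Finset.sum_le_sum h3).trans ((Finset.sum_le_sum_of_subset_of_nonneg (t := (full n).powerset)
    (fun F hF => Finset.mem_powerset.2 (Finset.mem_powersetCard.1 hF).1) fun F _ _ =>
    mul_nonneg (hw F) (Finset.sum_nonneg fun i _ => by positivity)).trans ?_)
  simp only [Finset.mul_sum]
  rw [Finset.sum_comm]
  refine (Finset.sum_le_card_nsmul _ _ (2 * Real.exp (-(16 * T))) fun v _ => ?_).trans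
    (le_of_eq ?_)
  · have e1 := sum_ewt_centered_le (n := n) (v := v) (s := 20 * h) h0 h1
      (by rw [abs_of_pos] <;> linarith)
    have e2 := sum_ewt_centered_le (n := n) (v := v) (s := -(20 * h)) h0 h1
      (by rw [abs_neg, abs_of_pos] <;> linarith)
    have e3 : Real.exp ((20 * h) ^ 2 * (n - 1 : ℕ)) ≤ Real.exp 400 :=
      Real.exp_le_exp.2 (by nlinarith)
    have e4 : Real.exp ((-(20 * h)) ^ 2 * (n - 1 : ℕ)) ≤ Real.exp 400 :=
      Real.exp_le_exp.2 (by nlinarith)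
    have e5 : Real.exp (-(20 * T)) * (2 * Real.exp 400) ≤ 2 * Real.exp (-(16 * T)) := by
      rw [mul_left_comm, ← Real.exp_add]
      exact mul_le_mul_of_nonneg_left (Real.exp_le_exp.2 (by linarith)) (by norm_num)
    have e6 : ∀ F : Finset (Sym2 (Fin n)), ewt n p F * (Real.exp (-(20 * T)) *
        (Real.exp (20 * h * (ndg F v - p * (n - 1 : ℕ))) +
          Real.exp (-(20 * h) * (ndg F v - p * (n - 1 : ℕ))))) =
        Real.exp (-(20 * T)) * (ewt n p F * Real.exp (20 * h * (ndg F v - p * (n - 1 : ℕ)))) +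
        Real.exp (-(20 * T)) * (ewt n p F * Real.exp (-(20 * h) * (ndg F v - p * (n - 1 : ℕ)))) :=
      fun F => by ring
    simp only [e6, Finset.sum_add_distrib]
    rw [← Finset.mul_sum, ← Finset.mul_sum, ← mul_add]
    refine le_trans (mul_le_mul_of_nonneg_left ?_ (Real.exp_pos _).le) e5
    linarith
  · simp

end graphs

section stirling

variable {N M : ℕ}

/-- The relative error in Stirling's formula. -/
def ste (N : ℕ) : ℝ := Real.log (Stirling.stirlingSeq N) - Real.log √Real.pi

lemma ste_nonneg (hN : N ≠ 0) : 0 ≤ ste N :=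
  sub_nonneg.2 (Real.log_le_log (by positivity) (Stirling.sqrt_pi_le_stirlingSeq hN))

lemma ste_le (hN : N ≠ 0) : ste N ≤ 1 / (12 * N) := by
  set f : ℕ → ℝ := fun k => Real.log (Stirling.stirlingSeq (k + 1)) - 1 / (12 * ((k + 1 : ℕ) : ℝ))
    with hf
  have h1 : Monotone f := monotone_nat_of_le_succ fun k => by
    have h2 := Stirling.log_stirlingSeq_sdiff_le (k + 1)
    have h3 : 1 / (12 * ((k + 1 : ℕ) : ℝ) * ((k + 1 : ℕ) + 1)) =
        1 / (12 * ((k + 1 : ℕ) : ℝ)) - 1 / (12 * ((k + 1 + 1 : ℕ) : ℝ)) := by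
      push_cast
      field_simp
      ring
    simp only [hf]
    linarith
  have h2 : Tendsto f atTop (𝓝 (Real.log √Real.pi - 0)) := by
    have h3 := (Real.continuousAt_log (x := √Real.pi) (by positivity)).tendsto.comp
      (Stirling.tendsto_stirlingSeq_sqrt_pi.comp (tendsto_add_atTop_nat 1))
    have h4 : Tendsto (fun k : ℕ => 1 / (12 * ((k + 1 : ℕ) : ℝ))) atTop (𝓝 0) := by
      refine Filter.Tendsto.comp (g := fun k : ℕ => 1 / (12 * (k : ℝ))) ?_ (tendsto_add_atTop_nat 1)
      refine tendsto_const_nhds.div_atTop ?_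
      exact tendsto_natCast_atTop_atTop.const_mul_atTop (by norm_num)
    exact h3.sub h4
  have h3 := h1.ge_of_tendsto h2 (N - 1)
  simp only [hf, Nat.sub_add_cancel (Nat.one_le_iff_ne_zero.2 hN)] at h3
  rw [ste]
  linarith

lemma log_factorial_eq (hN : N ≠ 0) : Real.log (N.factorial : ℝ) =
    ste N + Real.log Real.pi / 2 + (Real.log 2 + Real.log N) / 2 + N * (Real.log N - 1) := by
  have h1 := Stirling.log_stirlingSeq_formula N
  have hN' : (N : ℝ) ≠ 0 := Nat.cast_ne_zero.2 hN
  rw [Real.log_mul two_ne_zero hN', Real.log_div hN' (Real.exp_ne_zero _), Real.log_exp] at h1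
  rw [ste, h1, Real.log_sqrt Real.pi_pos.le]
  ring

lemma log_choose_eq (h0 : 0 < M) (h1 : M < N) : Real.log (N.choose M : ℝ) =
    ste N - ste M - ste (N - M) - Real.log Real.pi / 2 +
      (Real.log N - Real.log 2 - Real.log M - Real.log (N - M : ℕ)) / 2 -
      (M * Real.log (M / N) + (N - M : ℕ) * Real.log ((N - M : ℕ) / N)) := by
  have hN : (N : ℝ) ≠ 0 := by have : N ≠ 0 := by omega
                              exact_mod_cast this
  have hM : (M : ℝ) ≠ 0 := by have : M ≠ 0 := by omega
                              exact_mod_cast this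
  have hM' : ((N - M : ℕ) : ℝ) ≠ 0 := by have : N - M ≠ 0 := by omega
                                         exact_mod_cast this
  rw [Nat.cast_choose ℝ h1.le, Real.log_div (by positivity) (by positivity),
    Real.log_mul (by positivity) (by positivity), log_factorial_eq (by omega),
    log_factorial_eq (by omega), log_factorial_eq (by omega), Real.log_div hM hN,
    Real.log_div hM' hN, Nat.cast_sub h1.le]
  ring

lemma inv_le_binomial (h0 : 0 < M) (h1 : M < N) (hN : 10 ≤ N) :
    1 / (N : ℝ) ≤ N.choose M * ((M / N : ℝ) ^ M * (1 - M / N : ℝ) ^ (N - M)) := by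
  have hN0 : (0 : ℝ) < N := by exact_mod_cast (by omega : 0 < N)
  have hM0 : (0 : ℝ) < M := by exact_mod_cast h0
  have hM1 : (0 : ℝ) < (N - M : ℕ) := by exact_mod_cast (by omega : 0 < N - M)
  have e : (1 - M / N : ℝ) = (N - M : ℕ) / N := by
    rw [Nat.cast_sub h1.le]; field_simp
  have hc : (0 : ℝ) < N.choose M := by exact_mod_cast Nat.choose_pos h1.le
  rw [e, ← Real.log_le_log_iff (by positivity) (by positivity), Real.log_mul hc.ne' (by positivity),
    Real.log_mul (by positivity) (by positivity), Real.log_pow, Real.log_pow, log_choose_eq h0 h1,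
    one_div, Real.log_inv]
  have s1 := ste_nonneg (N := N) (by omega)
  have s2 := ste_le (N := M) (by omega)
  have s3 := ste_le (N := N - M) (by omega)
  have t2 : 1 / (12 * (M : ℝ)) ≤ 1 / 12 :=
    one_div_le_one_div_of_le (by norm_num) (by have : (1:ℝ) ≤ M := by exact_mod_cast h0
                                               linarith)
  have t3 : 1 / (12 * ((N - M : ℕ) : ℝ)) ≤ 1 / 12 :=
    one_div_le_one_div_of_le (by norm_num)
      (by have : (1:ℝ) ≤ (N - M : ℕ) := by exact_mod_cast (by omega : 1 ≤ N - M)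
          linarith)
  have h2 : Real.log M + Real.log (N - M : ℕ) ≤ 2 * Real.log N - 2 * Real.log 2 := by
    rw [← Real.log_mul hM0.ne' hM1.ne', ← Real.log_rpow hN0, ← Real.log_rpow two_pos,
      ← Real.log_div (by positivity) (by positivity)]
    refine Real.log_le_log (by positivity) ?_
    rw [Nat.cast_sub h1.le, Real.rpow_two, Real.rpow_two]
    nlinarith [sq_nonneg ((N : ℝ) - 2 * M)]
  have h3 : Real.log Real.pi ≤ 2 * Real.log 2 := by
    rw [← Real.log_rpow two_pos, Real.rpow_two]
    exact Real.log_le_log Real.pi_pos (by linarith [Real.pi_le_four])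
  have h4 : 2 * Real.log 2 + 1 / 3 ≤ Real.log N + Real.log 2 := by
    have h5 : Real.log N - Real.log 2 = Real.log (N / 2) := (Real.log_div hN0.ne' two_ne_zero).symm
    have h6 := Real.one_sub_inv_le_log_of_pos (show (0:ℝ) < N / 2 by positivity)
    have h7 : ((N : ℝ) / 2)⁻¹ ≤ 1 / 2 := by
      rw [inv_le_comm₀ (by positivity) (by norm_num)]
      have : (10 : ℝ) ≤ N := by exact_mod_cast hN
      linarith
    linarith
  linarith

lemma choose_div_choose (h0 : 0 < M) (h1 : M < N) {p : ℝ} (hp : p = M / N) :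
    ∃ e : ℝ, |e| ≤ 1 / M + 1 / (N - M) ∧ (N.choose M : ℝ) = √2 * (p ^ p * (1 - p) ^ (1 - p)) ^ N *
      ((2 * N).choose (2 * M)) * Real.exp e := by
  have hN0 : (0 : ℝ) < N := by exact_mod_cast (by omega : 0 < N)
  have hM0 : (0 : ℝ) < M := by exact_mod_cast h0
  have hM1 : (0 : ℝ) < N - M := sub_pos.2 (by exact_mod_cast h1)
  have hc : (0 : ℝ) < N.choose M := by exact_mod_cast Nat.choose_pos h1.le
  have hc' : (0 : ℝ) < (2 * N).choose (2 * M) := by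
    exact_mod_cast Nat.choose_pos (by omega)
  have hp0 : 0 < p := by rw [hp]; positivity
  have hp1 : 1 - p = (N - M) / N := by rw [hp]; field_simp
  have hq0 : 0 < 1 - p := by rw [hp1]; positivity
  refine ⟨ste N - ste M - ste (N - M) - (ste (2 * N) - ste (2 * M) - ste (2 * N - 2 * M)), ?_, ?_⟩
  · have bd : ∀ K : ℕ, 0 < K → 0 ≤ ste K ∧ ste K ≤ 1 / (12 * K) := fun K hK =>
      ⟨ste_nonneg hK.ne', ste_le hK.ne'⟩
    have b1 := bd N (by omega)
    have b2 := bd M (by omega)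
    have b3 := bd (N - M) (by omega)
    have b4 := bd (2 * N) (by omega)
    have b5 := bd (2 * M) (by omega)
    have b6 := bd (2 * N - 2 * M) (by omega)
    rw [Nat.cast_sub h1.le] at b3
    rw [Nat.cast_sub (by omega : 2 * M ≤ 2 * N)] at b6
    push_cast at b4 b5 b6
    rw [← mul_sub] at b6
    have m1 : 1 / (12 * (N : ℝ)) ≤ 1 / 12 * (1 / M) := by
      rw [← one_div_mul_one_div]
      exact mul_le_mul_of_nonneg_left (one_div_le_one_div_of_le hM0 (by linarith)) (by norm_num)
    have m2 : ∀ z : ℝ, 1 / (12 * z) = 1 / 12 * (1 / z) := fun z => by rw [← one_div_mul_one_div]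
    have m3 : ∀ z : ℝ, 1 / (12 * (2 * z)) = 1 / 24 * (1 / z) := fun z => by
      rw [← one_div_mul_one_div, ← one_div_mul_one_div]; ring
    rw [m3] at b4 b5 b6
    rw [m2] at b1 b2 b3 m1
    have p1 : 0 ≤ 1 / (M : ℝ) := by positivity
    have p2 : 0 ≤ 1 / ((N : ℝ) - M) := by positivity
    rw [abs_le]; constructor <;> linarith
  · have h2 : (0:ℝ) < p ^ p * (1 - p) ^ (1 - p) :=
      mul_pos (Real.rpow_pos_of_pos hp0 _) (Real.rpow_pos_of_pos hq0 _)
    rw [← Real.exp_log hc, ← Real.exp_log (show 0 < √2 * (p ^ p * (1 - p) ^ (1 - p)) ^ N *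
      ((2 * N).choose (2 * M) : ℝ) by positivity), ← Real.exp_add]
    congr 1
    rw [Real.log_mul (by positivity) hc'.ne', Real.log_mul (by positivity) (by positivity),
      Real.log_pow, Real.log_mul (Real.rpow_pos_of_pos hp0 _).ne' (Real.rpow_pos_of_pos hq0 _).ne',
      Real.log_rpow hp0, Real.log_rpow hq0, log_choose_eq h0 h1,
      log_choose_eq (show 0 < 2 * M by omega) (by omega), Real.log_sqrt (by norm_num)]
    have e1 : ((2 * N - 2 * M : ℕ) : ℝ) = 2 * (N - M : ℕ) := by
      rw [← Nat.mul_sub]; push_cast; rfl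
    have e2 : ((2 * N : ℕ) : ℝ) = 2 * N := by push_cast; rfl
    have e3 : ((2 * M : ℕ) : ℝ) = 2 * M := by push_cast; rfl
    have hM2 : ((N - M : ℕ) : ℝ) = N - M := Nat.cast_sub h1.le
    rw [e1, e2, e3, hM2, mul_div_mul_left _ _ two_ne_zero, mul_div_mul_left _ _ two_ne_zero, ← hp1,
      ← hp, Real.log_mul two_ne_zero hN0.ne', Real.log_mul two_ne_zero hM0.ne',
      Real.log_mul two_ne_zero hM1.ne']
    have e4 : (M : ℝ) = p * N := by rw [hp]; field_simp
    have e5 : (N : ℝ) - M = (1 - p) * N := by rw [hp1]; field_simp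
    linear_combination (Real.log p) * e4 + (Real.log (1 - p)) * e5

end stirling

section normalization

variable {n E : ℕ} {k : Fin n → ℕ} {T h lam : ℝ}

lemma Glob.exp_neg_le (G : Glob n T h lam) : Real.exp (-T) ≤ h ^ 2 := by
  rw [← G.inv_n, one_div, ← Real.exp_log G.npos, ← Real.exp_neg]
  exact Real.exp_le_exp.2 (neg_le_neg G.log)

lemma Glob.h_le (G : Glob n T h lam) : 100 * h ≤ 1 := by
  have h1 := G.pow_mul_le (c := 1) (by norm_num)
  nlinarith [G.hT, G.h0]

lemma Glob.n_ge (G : Glob n T h lam) : 10 ≤ n := by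
  have h1 := G.pow_le_n (c := 1) (by norm_num)
  have : (10 : ℝ) ≤ n := by linarith [G.hT]
  exact_mod_cast this

lemma Glob.exp_le (G : Glob n T h lam) : Real.exp (-(16 * T)) ≤ h ^ 32 := by
  have : Real.exp (-(16 * T)) = Real.exp (-T) ^ 16 := by
    rw [← Real.exp_nat_mul]; congr 1; push_cast; ring
  rw [this]
  calc _ ≤ (h ^ 2) ^ 16 := pow_le_pow_left₀ (Real.exp_pos _).le G.exp_neg_le 16
    _ = _ := by ring

lemma Glob.tail_le (G : Glob n T h lam) :
    (n : ℝ) * n * (n * (2 * Real.exp (-(16 * T))) + 2 * Real.exp (1 - 20 * T)) ≤ h := by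
  have h1 := G.exp_le
  have h2 : Real.exp (1 - 20 * T) ≤ Real.exp (-(16 * T)) :=
    Real.exp_le_exp.2 (by linarith [G.hT])
  have hh := G.h0
  have hn := G.npos
  have h3 : (1 : ℝ) ≤ n := by exact_mod_cast (by have := G.n_ge; omega : 1 ≤ n)
  calc _ ≤ (n : ℝ) * n * (n * (2 * h ^ 32) + n * (2 * h ^ 32)) := by
        refine mul_le_mul_of_nonneg_left ?_ (by positivity)
        have : 2 * Real.exp (1 - 20 * T) ≤ 1 * (2 * h ^ 32) := by linarith
        have h4 := mul_le_mul_of_nonneg_right h3 (show 0 ≤ 2 * h ^ 32 by positivity)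
        have h5 := mul_le_mul_of_nonneg_left h1 hn.le
        linarith
    _ = h * (4 * h ^ 25) := by rw [G.n_eq]; field_simp; ring
    _ ≤ h * 1 := by
        refine mul_le_mul_of_nonneg_left ?_ hh.le
        have : h ^ 25 ≤ h ^ 1 := pow_le_pow_of_le_one hh.le G.h1 (by norm_num)
        linarith [G.h_le, pow_one h]
    _ = h := mul_one h

lemma Glob.cast_pred (G : Glob n T h lam) : ((n - 1 : ℕ) : ℝ) = n - 1 := by
  rw [Nat.cast_sub (by have := G.n_ge; omega), Nat.cast_one]

lemma Glob.pred_mul_le (G : Glob n T h lam) : ((n - 1 : ℕ) : ℝ) * h ^ 2 ≤ 1 := by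
  have : ((n - 1 : ℕ) : ℝ) ≤ n := by exact_mod_cast Nat.sub_le _ _
  exact (mul_le_mul_of_nonneg_right this (sq_nonneg h)).trans G.nh.le

lemma sqd_concentrated (G : Glob n T h lam) (hk : ∀ v, |(k v : ℝ) - lam * (n - 1)| ≤ T / h)
    (hω : |∑ v, (omg (n - 1) lam T h (k v) - bex (n - 1) lam (omg (n - 1) lam T h))| ≤
      20 * T ^ 3 / h) :
    |(1 / (lam * (1 - lam))) ^ 2 / 4 * h ^ 8 * sqd lam (cst k) ^ 2 - 1 / 4| ≤ T ^ 11 * h := by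
  have hh := G.h0
  have hn := G.npos
  have hT := G.T0
  have hm := G.cast_pred
  set μ := bex (n - 1) lam (omg (n - 1) lam T h) with hμ
  have hμ' := bex_omg (m := n - 1) (p := lam) (T := T) G.lam0.le G.lam1.le hh
    (by linarith [G.h_le]) G.pred_mul_le G.hT
  rw [← hμ, hm] at hμ'
  set q := lam * (1 - lam) with hq
  have hq0 : 0 < q := G.q_pos
  have hq1 : q ≤ 1 := by nlinarith [G.lam0, G.lam1]
  have hR : sqd lam (cst k) = n * ∑ v, omg (n - 1) lam T h (k v) := by
    rw [sqd, Finset.mul_sum]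
    refine Finset.sum_congr rfl fun v _ => ?_
    have h1 := hk v
    rw [omg, if_neg (not_lt.2 (by rwa [hm])), gg, dg_full, cst, hm]
    linear_combination -((k v : ℝ) - lam * (n - 1)) ^ 2 * G.nh
  have hS : |(∑ v, omg (n - 1) lam T h (k v)) - n * μ| ≤ 20 * T ^ 3 / h := by
    refine le_of_eq_of_le ?_ hω
    rw [Finset.sum_sub_distrib]; simp
  set S := ∑ v, omg (n - 1) lam T h (k v) with hSd
  -- scaled by `h ^ 2`, the mean is within `22 T ^ 3 h` of `q`
  have hbig : |S * h ^ 2 - q| ≤ 22 * T ^ 3 * h := by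
    have e1 : S * h ^ 2 - q = (S - n * μ) * h ^ 2 + (μ - (n - 1) * q * h ^ 2) - q * h ^ 2 := by
      linear_combination (μ + q) * G.nh
    have e2 : |(S - n * μ) * h ^ 2| ≤ 20 * T ^ 3 * h := by
      rw [abs_mul, abs_of_pos (pow_pos hh 2)]
      calc _ ≤ 20 * T ^ 3 / h * h ^ 2 := mul_le_mul_of_nonneg_right hS (sq_nonneg h)
        _ = _ := by field_simp
    have e3 : |μ - (n - 1) * q * h ^ 2| ≤ h := by
      refine hμ'.trans ?_
      have := G.exp_le
      calc (n - 1 : ℝ) * (2 * Real.exp (-(16 * T))) ≤ n * (2 * h ^ 32) := by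
            refine mul_le_mul (by linarith) (by linarith) (by positivity) hn.le
        _ = h * (2 * h ^ 29) := by rw [G.n_eq]; field_simp
        _ ≤ h * 1 := by
            refine mul_le_mul_of_nonneg_left ?_ hh.le
            have : h ^ 29 ≤ h ^ 1 := pow_le_pow_of_le_one hh.le G.h1 (by norm_num)
            linarith [G.h_le, pow_one h]
        _ = h := mul_one h
    have e4 : |q * h ^ 2| ≤ h := by
      rw [abs_of_pos (by positivity)]
      nlinarith [G.h1, mul_le_mul_of_nonneg_right hq1 (sq_nonneg h)]
    rw [e1]
    have e5 : h ≤ T ^ 3 * h := le_mul_of_one_le_left hh.le (one_le_pow₀ G.T1)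
    refine (abs_sub _ _).trans ?_
    refine (add_le_add (abs_add_le _ _) le_rfl).trans ?_
    linarith
  have hS0 : 0 ≤ S := Finset.sum_nonneg fun v _ => omg_nonneg
  have hI := G.q_ge
  rw [← hq] at hI
  have hIT : 1 / q ≤ T ^ 2 := by
    rw [div_le_iff₀ hq0]; linarith
  have hsmall : 22 * T ^ 3 * h ≤ 1 := by
    have := G.pow_mul_le (c := 4) (by norm_num)
    nlinarith [G.hT, mul_pos (pow_pos hT 3) hh]
  have e6 : (1 / q) ^ 2 / 4 * h ^ 8 * sqd lam (cst k) ^ 2 - 1 / 4 =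
      (1 / 4) * (1 / q) ^ 2 * ((S * h ^ 2 - q) * (S * h ^ 2 + q)) := by
    rw [hR]
    have : (n : ℝ) ^ 2 * h ^ 8 = h ^ 4 := by
      calc (n : ℝ) ^ 2 * h ^ 8 = (n * h ^ 2) ^ 2 * h ^ 4 := by ring
        _ = h ^ 4 := by rw [G.nh]; ring
    have h8 : (1 / q) ^ 2 * q ^ 2 = 1 := by field_simp
    clear_value q S
    linear_combination (1 / q) ^ 2 / 4 * S ^ 2 * this + (1 / 4) * h8
  rw [e6, abs_mul (1 / 4 * (1 / q) ^ 2), abs_of_pos (show (0:ℝ) < 1 / 4 * (1 / q) ^ 2 by positivity),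
    abs_mul, abs_of_nonneg (show 0 ≤ S * h ^ 2 + q by positivity)]
  have h9 : S * h ^ 2 + q ≤ 3 := by linarith [(abs_le.1 hbig).2]
  have h10 : (1 / q) ^ 2 ≤ (T ^ 2) ^ 2 := pow_le_pow_left₀ (by positivity) hIT 2
  have h11 : |S * h ^ 2 - q| * (S * h ^ 2 + q) ≤ 22 * T ^ 3 * h * 3 :=
    mul_le_mul hbig h9 (by positivity) (by positivity)
  calc _ ≤ 1 / 4 * (T ^ 2) ^ 2 * (22 * T ^ 3 * h * 3) :=
        mul_le_mul (mul_le_mul_of_nonneg_left h10 (by norm_num)) h11 (by positivity) (by positivity)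
    _ = (33 / 2) * (T ^ 7 * h) := by ring
    _ ≤ T ^ 4 * (T ^ 7 * h) := by
        refine mul_le_mul_of_nonneg_right ?_ (by positivity)
        have := pow_le_pow_right₀ G.T1 (show 1 ≤ 4 by norm_num)
        linarith [G.hT, pow_one T]
    _ = _ := by ring

/-- The sequences with sum `2 * E` within `T / h` of the mean. -/
def boxes (n E : ℕ) (T h lam : ℝ) : Finset (Fin n → ℕ) :=
  (seqs n (n - 1) (2 * E)).filter fun k => ∀ v, |(k v : ℝ) - lam * (n - 1)| ≤ T / h

lemma mem_boxes (G : Glob n T h lam) : k ∈ boxes n E T h lam ↔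
    (∀ v, |(k v : ℝ) - lam * (n - 1)| ≤ T / h) ∧ ∑ v, k v = 2 * E := by
  rw [boxes, Finset.mem_filter, mem_seqs]
  exact ⟨fun h => ⟨h.2, h.1.2⟩, fun h => ⟨⟨fun v => le_of_box G (h.1 v), h.2⟩, h.1⟩⟩

lemma two_mul_choose_two : 2 * n.choose 2 = n * (n - 1) := by
  rw [Nat.choose_two_right, Nat.mul_div_cancel' (Nat.even_mul_pred_self n).two_dvd]

lemma edges_pos (G : Glob n T h lam) (hE : lam = E / n.choose 2) : 0 < E ∧ E < n.choose 2 := by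
  have h0 := G.lam0
  have h1 := G.lam1
  have hN : (0:ℝ) < n.choose 2 := by
    exact_mod_cast Nat.choose_pos (by have := G.n_ge; omega)
  rw [hE] at h0 h1
  rw [div_lt_one hN] at h1
  constructor
  · have := (div_pos_iff_of_pos_right hN).1 h0
    exact_mod_cast this
  · exact_mod_cast h1

lemma sum_boxes_nn (G : Glob n T h lam) (hE : lam = E / n.choose 2) :
    (1 - h) * (n.choose 2).choose E ≤ ∑ k ∈ boxes n E T h lam, nn (cst k) (full n) ∧
    ∑ k ∈ boxes n E T h lam, nn (cst k) (full n) ≤ (n.choose 2).choose E := by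
  obtain ⟨hE0, hE1⟩ := edges_pos G hE
  rw [← sum_seqs_nn_one]
  refine ⟨?_, Finset.sum_le_sum_of_subset_of_nonneg (Finset.filter_subset _ _)
    fun _ _ _ => nn_nonneg⟩
  have h1 := sum_nn_box_le (n := n) (E := E) (T := T) G.lam0.le G.lam1.le G.h0
    (by linarith [G.h_le]) G.pred_mul_le G.hT
  have h2 : 10 ≤ n.choose 2 := by
    have := G.n_ge
    have h3 := two_mul_choose_two (n := n)
    have : 10 * 9 ≤ n * (n - 1) := Nat.mul_le_mul this (by omega)
    omega
  have h3 := inv_le_binomial hE0 hE1 h2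
  rw [← hE] at h3
  have h4 : ∑ k ∈ seqs n (n - 1) (2 * E), nn (cst k) (full n) =
      ∑ k ∈ boxes n E T h lam, nn (cst k) (full n) +
      ∑ k ∈ seqs n (n - 1) (2 * E), nn (cst k) (full n) *
      (if ∃ v, T / h < |(k v : ℝ) - lam * (n - 1 : ℕ)| then 1 else 0) := by
    rw [boxes, Finset.sum_filter, ← Finset.sum_add_distrib]
    refine Finset.sum_congr rfl fun k _ => ?_
    rw [G.cast_pred]
    by_cases hk : ∀ v, |(k v : ℝ) - lam * (n - 1)| ≤ T / h
    · rw [if_pos hk, if_neg (by push Not; exact hk)]; simp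
    · rw [if_neg hk, if_pos (by push Not at hk; exact hk)]; simp
  set S := ∑ k ∈ seqs n (n - 1) (2 * E), nn (cst k) (full n) *
      (if ∃ v, T / h < |(k v : ℝ) - lam * (n - 1 : ℕ)| then (1:ℝ) else 0)
  have hS : S ≤ h * (n.choose 2).choose E := by
    have hN0 : (0:ℝ) < n.choose 2 := by exact_mod_cast (by omega : 0 < n.choose 2)
    have hS0 : 0 ≤ S := Finset.sum_nonneg fun k _ => mul_nonneg nn_nonneg (by positivity)
    have hC : (0:ℝ) < (n.choose 2).choose E := by exact_mod_cast Nat.choose_pos hE1.le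
    have hNn : ((n.choose 2 : ℕ) : ℝ) ≤ n * n := by
      have : n.choose 2 ≤ n * n := by
        have h3 := two_mul_choose_two (n := n)
        have := Nat.mul_le_mul_left n (Nat.sub_le n 1)
        omega
      exact_mod_cast this
    have hp := mul_le_mul_of_nonneg_right h3 hS0
    have h5 := mul_le_mul_of_nonneg_left h1 hC.le
    have h6 : S ≤ (n.choose 2 : ℕ) * (((n.choose 2).choose E : ℕ) * (n * (2 * Real.exp (-(16 * T))))) := by
      rw [← div_le_iff₀' hN0]
      refine le_trans (le_of_eq (by ring)) (hp.trans ((le_of_eq (by ring)).trans h5))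
    refine h6.trans ?_
    have h7 := G.tail_le
    have h8 := (Real.exp_pos (1 - 20 * T)).le
    have h9 := G.npos
    have h10 : (n.choose 2 : ℕ) * (n * (2 * Real.exp (-(16 * T)))) ≤ h := by
      refine le_trans ?_ h7
      exact mul_le_mul hNn (by linarith) (by positivity) (by positivity)
    nlinarith [mul_le_mul_of_nonneg_right h10 hC.le]
  rw [sum_seqs_nn_one] at h4 ⊢
  linarith

lemma sum_boxes_wt (G : Glob n T h lam) (hE : lam = E / n.choose 2) :
    ∃ e : ℝ, |e| ≤ T ^ 12 * h ∧ ∑ k ∈ boxes n E T h lam, wt lam h k =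
      (2 * n.choose 2).choose (2 * E) * Real.exp (-(1 / 4) + e) := by
  obtain ⟨hE0, hE1⟩ := edges_pos G hE
  have hh := G.h0
  have hTh : 0 ≤ T ^ 11 * h := by have := G.T0; positivity
  set N := 2 * n.choose 2 with hN
  have hNn : N = n * (n - 1) := two_mul_choose_two
  have hC : (0:ℝ) < N.choose (2 * E) := by exact_mod_cast Nat.choose_pos (by omega)
  have hlam : lam = ((2 * E : ℕ) : ℝ) / N := by
    rw [hE, hN]; push_cast; rw [mul_div_mul_left _ _ two_ne_zero]
  have hN10 : 10 ≤ N := by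
    have := G.n_ge
    have : 10 * 9 ≤ n * (n - 1) := Nat.mul_le_mul this (by omega)
    omega
  have h3 := inv_le_binomial (show 0 < 2 * E by omega) (show 2 * E < N by omega) hN10
  rw [← hlam] at h3
  set bad : (Fin n → ℕ) → ℝ := fun k =>
    (if ∃ v, T / h < |(k v : ℝ) - lam * (n - 1 : ℕ)| then 1 else 0) +
    (if 20 * T ^ 3 / h < |∑ v, (omg (n - 1) lam T h (k v) - bex (n - 1) lam (omg (n - 1) lam T h))|
      then 1 else 0) with hbad
  have hb0 : ∀ k, 0 ≤ bad k := fun k => by simp only [hbad]; positivity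
  have h1 := sum_seqs_le_pex (n := n) (m := n - 1) (M := 2 * E) (Ψ := bad) G.lam0.le G.lam1.le hb0
  have hpb : pex n (n - 1) lam bad ≤ n * (2 * Real.exp (-(16 * T))) + 2 * Real.exp (1 - 20 * T) := by
    rw [hbad, pex_add]
    exact add_le_add (pex_box_le G.lam0.le G.lam1.le hh (by linarith [G.h_le]) G.pred_mul_le G.hT)
      (pex_omg_le G.lam0.le G.lam1.le hh G.T1 G.h1 G.nh.le)
  have htot : ∑ k ∈ seqs n (n - 1) (2 * E), chs k = N.choose (2 * E) := by
    rw [hNn, ← sum_seqs_choose, Nat.cast_sum]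
    exact Finset.sum_congr rfl fun k _ => by rw [chs, Nat.cast_prod]
  have hc0 : ∀ k : Fin n → ℕ, 0 ≤ chs k := fun k => Finset.prod_nonneg fun _ _ => Nat.cast_nonneg _
  set B := ∑ k ∈ seqs n (n - 1) (2 * E), chs k * bad k with hB
  have hBh : B ≤ h * N.choose (2 * E) := by
    have hN0 : (0:ℝ) < N := by exact_mod_cast (by omega : 0 < N)
    have hB0 : 0 ≤ B := Finset.sum_nonneg fun k _ => mul_nonneg (hc0 k) (hb0 k)
    have hNn' : (N : ℝ) ≤ n * n := by
      have : N ≤ n * n := by rw [hNn]; exact Nat.mul_le_mul_left n (Nat.sub_le n 1)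
      exact_mod_cast this
    have hp := mul_le_mul_of_nonneg_right h3 hB0
    have h5 := mul_le_mul_of_nonneg_left (h1.trans hpb) hC.le
    have h6 : B ≤ N * (N.choose (2 * E) * (n * (2 * Real.exp (-(16 * T))) +
        2 * Real.exp (1 - 20 * T))) := by
      rw [← div_le_iff₀' hN0]
      refine le_trans (le_of_eq (by ring)) (hp.trans ((le_of_eq ?_).trans h5))
      rw [hNn, hB]; simp only [chs]; ring
    refine h6.trans ?_
    have h10 : N * (n * (2 * Real.exp (-(16 * T))) + 2 * Real.exp (1 - 20 * T)) ≤ h := by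
      refine le_trans ?_ G.tail_le
      exact mul_le_mul_of_nonneg_right hNn' (by positivity)
    nlinarith [mul_le_mul_of_nonneg_right h10 hC.le]
  have hgood : ∀ k ∈ seqs n (n - 1) (2 * E), bad k < 1 →
      (∀ v, |(k v : ℝ) - lam * (n - 1)| ≤ T / h) ∧
      chs k * Real.exp (-(1 / 4) - T ^ 11 * h) ≤ wt lam h k ∧
      wt lam h k ≤ chs k * Real.exp (-(1 / 4) + T ^ 11 * h) := fun k _ hk => by
    simp only [hbad] at hk
    have g1 : ¬ ∃ v, T / h < |(k v : ℝ) - lam * (n - 1 : ℕ)| := fun hc => by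
      rw [if_pos hc] at hk
      have : (0:ℝ) ≤ if 20 * T ^ 3 / h < |∑ v, (omg (n - 1) lam T h (k v) -
        bex (n - 1) lam (omg (n - 1) lam T h))| then 1 else 0 := by positivity
      linarith
    have g2 : ¬ 20 * T ^ 3 / h < |∑ v, (omg (n - 1) lam T h (k v) -
        bex (n - 1) lam (omg (n - 1) lam T h))| := fun hc => by
      rw [if_pos hc] at hk
      have : (0:ℝ) ≤ if ∃ v, T / h < |(k v : ℝ) - lam * (n - 1 : ℕ)| then 1 else 0 := by positivity
      linarith
    push Not at g1 g2
    rw [G.cast_pred] at g1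
    have g3 := abs_le.1 (sqd_concentrated G g1 g2)
    refine ⟨g1, ?_, ?_⟩ <;>
    · rw [wt]
      exact mul_le_mul_of_nonneg_left (Real.exp_le_exp.2 (by linarith)) (hc0 k)
  have hw0 : ∀ k : Fin n → ℕ, 0 ≤ wt lam h k ∧ wt lam h k ≤ chs k := fun k => by
    refine ⟨mul_nonneg (hc0 k) (Real.exp_pos _).le, mul_le_of_le_one_right (hc0 k) ?_⟩
    rw [Real.exp_le_one_iff]
    have : 0 ≤ (1 / (lam * (1 - lam))) ^ 2 / 4 * h ^ 8 * sqd lam (cst k) ^ 2 := by positivity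
    linarith
  have hup : ∑ k ∈ boxes n E T h lam, wt lam h k ≤
      N.choose (2 * E) * Real.exp (-(1 / 4) + T ^ 11 * h) + B := by
    rw [← htot, Finset.sum_mul, hB, ← Finset.sum_add_distrib]
    refine le_trans (Finset.sum_le_sum_of_subset_of_nonneg (Finset.filter_subset _ _)
      fun k _ _ => (hw0 k).1) (Finset.sum_le_sum fun k hk => ?_)
    by_cases hb : bad k < 1
    · have := (hgood k hk hb).2.2
      have := mul_nonneg (hc0 k) (hb0 k)
      linarith
    · have := mul_nonneg (hc0 k) (Real.exp_pos (-(1 / 4) + T ^ 11 * h)).le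
      have := mul_le_mul_of_nonneg_left (not_lt.1 hb) (hc0 k)
      linarith [(hw0 k).2]
  have hlow : (N.choose (2 * E) - B) * Real.exp (-(1 / 4) - T ^ 11 * h) ≤
      ∑ k ∈ boxes n E T h lam, wt lam h k := by
    rw [← htot, hB, ← Finset.sum_sub_distrib, Finset.sum_mul, boxes, Finset.sum_filter]
    refine Finset.sum_le_sum fun k hk => ?_
    have hx := Real.exp_pos (-(1 / 4) - T ^ 11 * h)
    by_cases hb : bad k < 1
    · obtain ⟨g1, g2, -⟩ := hgood k hk hb
      rw [if_pos g1]
      have := mul_nonneg (mul_nonneg (hc0 k) (hb0 k)) hx.le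
      nlinarith
    · have h5 := mul_le_mul_of_nonneg_left (not_lt.1 hb) (hc0 k)
      have h6 : (chs k - chs k * bad k) * Real.exp (-(1 / 4) - T ^ 11 * h) ≤ 0 :=
        mul_nonpos_of_nonpos_of_nonneg (by linarith) hx.le
      refine h6.trans ?_
      split_ifs
      · exact (hw0 k).1
      · exact le_rfl
  have hh1 := G.h_le
  have hT12 : T ^ 11 * h + 2 * h ≤ T ^ 12 * h := by
    have : T ^ 11 * h + 2 * h ≤ 100 * (T ^ 11 * h) := by
      have := le_mul_of_one_le_left hh.le (one_le_pow₀ G.T1 : 1 ≤ T ^ 11)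
      linarith
    refine this.trans ?_
    calc _ ≤ T * (T ^ 11 * h) := mul_le_mul_of_nonneg_right G.hT hTh
      _ = _ := by ring
  set W := ∑ k ∈ boxes n E T h lam, wt lam h k with hW
  have hW1 : W ≤ N.choose (2 * E) * Real.exp (-(1 / 4) + T ^ 12 * h) := by
    have g1 : Real.exp (-(1 / 4) + T ^ 12 * h) ≥ Real.exp (-(1 / 4) + T ^ 11 * h) *
        Real.exp (2 * h) := by
      rw [← Real.exp_add]; exact Real.exp_le_exp.2 (by linarith)
    have g2 := Real.add_one_le_exp (2 * h)
    have g3 : 1 / 2 ≤ Real.exp (-(1 / 4) + T ^ 11 * h) := by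
      have := Real.add_one_le_exp (-(1 / 4) + T ^ 11 * h); linarith
    have g4 : Real.exp (-(1 / 4) + T ^ 11 * h) + h ≤ Real.exp (-(1 / 4) + T ^ 12 * h) := by
      nlinarith
    nlinarith
  have hW2 : N.choose (2 * E) * Real.exp (-(1 / 4) - T ^ 12 * h) ≤ W := by
    refine le_trans ?_ hlow
    have g1 : Real.exp (-(1 / 4) - T ^ 12 * h) ≤ Real.exp (-(2 * h)) *
        Real.exp (-(1 / 4) - T ^ 11 * h) := by
      rw [← Real.exp_add]; exact Real.exp_le_exp.2 (by linarith)
    have g2 : Real.exp (-(2 * h)) ≤ 1 - h := by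
      have g3 := Real.add_one_le_exp (2 * h)
      rw [Real.exp_neg, inv_le_comm₀ (Real.exp_pos _) (by linarith)]
      refine le_trans ?_ g3
      rw [inv_le_iff_one_le_mul₀ (by linarith)]
      nlinarith
    have g4 := Real.exp_pos (-(1 / 4) - T ^ 11 * h)
    have g5 : (1 - h) * N.choose (2 * E) ≤ N.choose (2 * E) - B := by linarith
    have g6 := mul_le_mul_of_nonneg_right g2 g4.le
    calc _ ≤ N.choose (2 * E) * ((1 - h) * Real.exp (-(1 / 4) - T ^ 11 * h)) :=
          mul_le_mul_of_nonneg_left (g1.trans g6) hC.le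
      _ = (1 - h) * N.choose (2 * E) * Real.exp (-(1 / 4) - T ^ 11 * h) := by ring
      _ ≤ _ := mul_le_mul_of_nonneg_right g5 g4.le
  have hWC : 0 < W / N.choose (2 * E) :=
    div_pos (lt_of_lt_of_le (mul_pos hC (Real.exp_pos _)) hW2) hC
  refine ⟨Real.log (W / N.choose (2 * E)) + 1 / 4, ?_, ?_⟩
  · have g1 : Real.log (W / N.choose (2 * E)) ≤ -(1 / 4) + T ^ 12 * h := by
      rw [Real.log_le_iff_le_exp hWC, div_le_iff₀' hC]; exact hW1
    have g2 : -(1 / 4) - T ^ 12 * h ≤ Real.log (W / N.choose (2 * E)) := by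
      rw [Real.le_log_iff_exp_le hWC, le_div_iff₀' hC]; exact hW2
    rw [abs_le]; constructor <;> linarith
  · rw [neg_add_cancel_comm_assoc, Real.exp_log hWC, mul_div_cancel₀ _ hC.ne']

end normalization

section enumeration

variable {n E : ℕ} {k k' : Fin n → ℕ} {T h lam : ℝ}

lemma Glob.exp_neg_two_mul_le (G : Glob n T h lam) : Real.exp (-(2 * h)) ≤ 1 - h := by
  have h0 := G.h0
  have h1 := G.h_le
  have g3 := Real.add_one_le_exp (2 * h)
  rw [Real.exp_neg, inv_le_comm₀ (Real.exp_pos _) (by linarith)]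
  refine le_trans ?_ g3
  rw [inv_le_iff_one_le_mul₀ (by linarith)]
  nlinarith

lemma sum_natAbs_le (hk : ∀ v, |(k v : ℝ) - lam * (n - 1)| ≤ T / h)
    (hk' : ∀ v, |(k' v : ℝ) - lam * (n - 1)| ≤ T / h) :
    ((∑ v, ((k v : ℤ) - k' v).natAbs : ℕ) : ℝ) ≤ n * (2 * (T / h)) := by
  rw [Nat.cast_sum]
  refine (Finset.sum_le_card_nsmul _ _ (2 * (T / h)) fun v _ => ?_).trans (by simp)
  rw [Nat.cast_natAbs, Int.cast_abs]
  push_cast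
  have h1 := abs_le.1 (hk v)
  have h2 := abs_le.1 (hk' v)
  rw [abs_le]; constructor <;> linarith

lemma nn_mul_wt_le (G : Glob n T h lam)
    (hk : ∀ v, |(k v : ℝ) - lam * (n - 1)| ≤ T / h) (hs : ∑ v, (k v : ℝ) = lam * (n * (n - 1)))
    (hk' : ∀ v, |(k' v : ℝ) - lam * (n - 1)| ≤ T / h)
    (hs' : ∑ v, (k' v : ℝ) = lam * (n * (n - 1))) (hp : 0 < nn (cst k) (full n)) :
    0 < nn (cst k') (full n) ∧ nn (cst k') (full n) * wt lam h k ≤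
      nn (cst k) (full n) * wt lam h k' * Real.exp (2 * T ^ 421 * h) := by
  obtain ⟨h1, h2⟩ := path_le G hk' hs' _ k hk hs hp le_rfl
  refine ⟨h1, h2.trans (mul_le_mul_of_nonneg_left (Real.exp_le_exp.2 ?_)
    (mul_nonneg hp.le (wt_pos G hk').le))⟩
  have hh := G.h0
  have hT := G.T0
  calc _ ≤ T ^ 420 * h ^ 4 * (n * (2 * (T / h))) :=
        mul_le_mul_of_nonneg_left (sum_natAbs_le hk hk') (by positivity)
    _ = _ := by rw [G.n_eq]; field_simp

lemma sum_cast_eq (G : Glob n T h lam) (hE : lam = E / n.choose 2) (hs : ∑ v, k v = 2 * E) :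
    ∑ v, (k v : ℝ) = lam * (n * (n - 1)) := by
  obtain ⟨h0, h1⟩ := edges_pos G hE
  have hN : (0:ℝ) < n.choose 2 := by exact_mod_cast h0.trans h1
  have h2 : (2:ℝ) * n.choose 2 = n * (n - 1) := by
    rw [← G.cast_pred]; exact_mod_cast two_mul_choose_two
  rw [← h2, hE, ← Nat.cast_sum, hs]
  push_cast
  field_simp

lemma inv_edges_le (G : Glob n T h lam) (hE : lam = E / n.choose 2) :
    1 / (E : ℝ) + 1 / ((n.choose 2 : ℕ) - E) ≤ h := by
  obtain ⟨h0, h1⟩ := edges_pos G hE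
  have hN : (0:ℝ) < n.choose 2 := by exact_mod_cast h0.trans h1
  have h2 : (2:ℝ) * n.choose 2 = n * (n - 1) := by
    rw [← G.cast_pred]; exact_mod_cast two_mul_choose_two
  have hE' : (E:ℝ) = lam * n.choose 2 := by rw [hE]; field_simp
  have hn : (10:ℝ) ≤ n := by exact_mod_cast G.n_ge
  have hNn : (n:ℝ) ≤ n.choose 2 := by nlinarith
  have hT := G.T0
  have hh := G.h0
  have hl := G.lam0
  have hl' := G.lam1
  have key : ∀ p : ℝ, 0 < p → 1 ≤ p * T → 1 / (p * n.choose 2) ≤ T * h ^ 2 := fun p hp h3 => by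
    rw [div_le_iff₀ (by positivity)]
    calc (1:ℝ) = 1 * 1 := by norm_num
      _ ≤ (p * T) * (n.choose 2 * h ^ 2) := by
          refine mul_le_mul h3 ?_ (by norm_num) (by positivity)
          rw [← G.nh]
          exact mul_le_mul_of_nonneg_right hNn (by positivity)
      _ = _ := by ring
  have e1 := key lam hl G.lo
  have e2 := key (1 - lam) (by linarith) G.hi
  have e3 : ((n.choose 2 : ℕ) : ℝ) - E = (1 - lam) * n.choose 2 := by rw [hE']; ring
  rw [e3, hE']
  refine (add_le_add e1 e2).trans ?_
  have := G.pow_mul_le (c := 2) (by norm_num)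
  nlinarith [G.hT, mul_pos hT hh]

/-- Enumeration of graphs by degrees, for dense nearly regular degree sequences. -/
lemma nn_full (G : Glob n T h lam) (hE : lam = E / n.choose 2)
    (hk : ∀ v, |(k v : ℝ) - lam * (n - 1)| ≤ T / h) (hs : ∑ v, k v = 2 * E) :
    ∃ e : ℝ, |e| ≤ T ^ 422 * h ∧ nn (cst k) (full n) =
      √2 * (lam ^ lam * (1 - lam) ^ (1 - lam)) ^ n.choose 2 * chs k *
        Real.exp (1 / 4 - (1 / (lam * (1 - lam))) ^ 2 / 4 * h ^ 8 * sqd lam (cst k) ^ 2 + e) := by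
  obtain ⟨hE0, hE1⟩ := edges_pos G hE
  obtain ⟨hS1, hS2⟩ := sum_boxes_nn G hE
  obtain ⟨e₁, he₁, hW⟩ := sum_boxes_wt G hE
  obtain ⟨e₂, he₂, hC⟩ := choose_div_choose hE0 hE1 hE
  have hh := G.h0
  have hh1 := G.h_le
  have hT := G.T0
  have hCp : (0:ℝ) < (n.choose 2).choose E := by exact_mod_cast Nat.choose_pos hE1.le
  have hC2 : (0:ℝ) < (2 * n.choose 2).choose (2 * E) := by
    exact_mod_cast Nat.choose_pos (by omega)
  have hl := G.lam0
  have hl1 : 0 < 1 - lam := by linarith [G.lam1]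
  have hsum : ∀ k ∈ boxes n E T h lam, (∀ v, |(k v : ℝ) - lam * (n - 1)| ≤ T / h) ∧
      ∑ v, (k v : ℝ) = lam * (n * (n - 1)) := fun k hk => by
    rw [mem_boxes G] at hk
    exact ⟨hk.1, sum_cast_eq G hE hk.2⟩
  have hs' := sum_cast_eq G hE hs
  set S := ∑ k ∈ boxes n E T h lam, nn (cst k) (full n) with hSdef
  have hSp : 0 < S := lt_of_lt_of_le (mul_pos (by linarith) hCp) hS1
  obtain ⟨k₁, hk₁, hp₁⟩ : ∃ k ∈ boxes n E T h lam, 0 < nn (cst k) (full n) := by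
    by_contra! hc
    exact hSp.not_ge (Finset.sum_nonpos hc)
  have hp := (nn_mul_wt_le G (hsum k₁ hk₁).1 (hsum k₁ hk₁).2 hk hs' hp₁).1
  set η := 2 * T ^ 421 * h with hη
  set W := ∑ k ∈ boxes n E T h lam, wt lam h k with hWdef
  have h1 : nn (cst k) (full n) * W ≤ S * wt lam h k * Real.exp η := by
    rw [hSdef, hWdef, Finset.mul_sum, Finset.sum_mul, Finset.sum_mul]
    refine Finset.sum_le_sum fun k' hk' => ?_
    have := (nn_mul_wt_le G hk hs' (hsum k' hk').1 (hsum k' hk').2 hp).1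
    exact (nn_mul_wt_le G (hsum k' hk').1 (hsum k' hk').2 hk hs' this).2
  have h2 : S * wt lam h k ≤ nn (cst k) (full n) * W * Real.exp η := by
    rw [hSdef, hWdef, Finset.mul_sum, Finset.sum_mul, Finset.sum_mul]
    refine Finset.sum_le_sum fun k' hk' => ?_
    exact (nn_mul_wt_le G hk hs' (hsum k' hk').1 (hsum k' hk').2 hp).2
  have hw := wt_pos G hk
  set P := (lam ^ lam * (1 - lam) ^ (1 - lam)) ^ n.choose 2 with hP
  have hPp : 0 < P := pow_pos (mul_pos (Real.rpow_pos_of_pos hl _) (Real.rpow_pos_of_pos hl1 _)) _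
  have hV : 0 < √2 * P * wt lam h k * Real.exp (1 / 4) := by positivity
  set C2 : ℝ := (((2 * n.choose 2).choose (2 * E) : ℕ) : ℝ)
  set M := nn (cst k) (full n) with hM
  have hup : M ≤ √2 * P * wt lam h k * Real.exp (1 / 4) * Real.exp (η - e₁ + e₂) := by
    have h3 : M * W ≤ √2 * P * C2 * Real.exp e₂ * wt lam h k * Real.exp η := by
      refine h1.trans (mul_le_mul_of_nonneg_right (mul_le_mul_of_nonneg_right ?_ hw.le)
        (Real.exp_pos _).le)
      rw [← hC]; exact hS2
    rw [hW, ← mul_assoc] at h3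
    have h4 : M * C2 * Real.exp (-(1 / 4) + e₁) ≤ (√2 * P * wt lam h k * Real.exp (1 / 4) *
        Real.exp (η - e₁ + e₂)) * C2 * Real.exp (-(1 / 4) + e₁) := by
      refine h3.trans (le_of_eq ?_)
      have : Real.exp (1 / 4) * Real.exp (η - e₁ + e₂) * Real.exp (-(1 / 4) + e₁) =
          Real.exp e₂ * Real.exp η := by
        rw [← Real.exp_add, ← Real.exp_add, ← Real.exp_add]; congr 1; ring
      linear_combination -(√2 * P * wt lam h k * C2) * this
    exact le_of_mul_le_mul_right (le_of_mul_le_mul_right h4 (Real.exp_pos _)) hC2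
  have hlo : √2 * P * wt lam h k * Real.exp (1 / 4) * Real.exp (-η - e₁ + e₂ - 2 * h) ≤ M := by
    have h3 : Real.exp (-(2 * h)) * (√2 * P * C2 * Real.exp e₂) * wt lam h k ≤
        M * W * Real.exp η := by
      refine le_trans (mul_le_mul_of_nonneg_right ?_ hw.le) h2
      rw [← hC]
      exact (mul_le_mul_of_nonneg_right G.exp_neg_two_mul_le hCp.le).trans hS1
    rw [hW] at h3
    have h4 : (√2 * P * wt lam h k * Real.exp (1 / 4) * Real.exp (-η - e₁ + e₂ - 2 * h)) * C2 *
        Real.exp (-(1 / 4) + e₁) * Real.exp η ≤ M * C2 * Real.exp (-(1 / 4) + e₁) * Real.exp η := by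
      refine le_trans (le_of_eq ?_) (h3.trans_eq (by ring))
      have : Real.exp (1 / 4) * Real.exp (-η - e₁ + e₂ - 2 * h) * Real.exp (-(1 / 4) + e₁) *
          Real.exp η = Real.exp (-(2 * h)) * Real.exp e₂ := by
        rw [← Real.exp_add, ← Real.exp_add, ← Real.exp_add, ← Real.exp_add]; congr 1; ring
      linear_combination (√2 * P * wt lam h k * C2) * this
    exact le_of_mul_le_mul_right (le_of_mul_le_mul_right (le_of_mul_le_mul_right h4
      (Real.exp_pos _)) (Real.exp_pos _)) hC2
  set V := √2 * P * wt lam h k * Real.exp (1 / 4) with hVd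
  have hMV : 0 < M / V := div_pos hp hV
  refine ⟨Real.log (M / V), ?_, ?_⟩
  · have g1 : Real.log (M / V) ≤ η - e₁ + e₂ := by
      rw [Real.log_le_iff_le_exp hMV, div_le_iff₀' hV]; exact hup
    have g2 : -η - e₁ + e₂ - 2 * h ≤ Real.log (M / V) := by
      rw [Real.le_log_iff_exp_le hMV, le_div_iff₀' hV]; exact hlo
    have g3 := abs_le.1 he₁
    have g4 := abs_le.1 (he₂.trans (inv_edges_le G hE))
    have g5 : T ^ 12 * h ≤ T ^ 421 * h :=
      mul_le_mul_of_nonneg_right (pow_le_pow_right₀ G.T1 (by norm_num)) hh.le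
    have g6 : h ≤ T ^ 421 * h := le_mul_of_one_le_left hh.le (one_le_pow₀ G.T1)
    have g7 : 100 * (T ^ 421 * h) ≤ T ^ 422 * h := by
      calc _ ≤ T * (T ^ 421 * h) := mul_le_mul_of_nonneg_right G.hT (by positivity)
        _ = _ := by ring
    rw [abs_le]; constructor <;> linarith
  · rw [Real.exp_add, Real.exp_log hMV, sub_eq_add_neg, Real.exp_add]
    have : √2 * P * chs k * (Real.exp (1 / 4) * Real.exp (-((1 / (lam * (1 - lam))) ^ 2 / 4 *
        h ^ 8 * sqd lam (cst k) ^ 2))) = V := by rw [hVd, wt]; ring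
    rw [← mul_assoc, this, mul_div_cancel₀ _ hV.ne']

end enumeration

/-- The sum of `f u * f v` over the edges `uv` of `Z`. -/
def edgeSum {n : ℕ} (f : Fin n → ℝ) (Z : Finset (Sym2 (Fin n))) : ℝ :=
  (∑ u, ∑ v, ind Z s(u, v) * (f u * f v)) / 2

/-- The logarithm of the probability of avoiding `Z`, relative to independent edges; `w` is
the normalised deviation of the degrees. -/
def avoid {n : ℕ} (lam h : ℝ) (w : Fin n → ℝ) (Z : Finset (Sym2 (Fin n))) : ℝ :=
  -(1 / (1 - lam)) * ((∑ v, w v * dg Z v) + lam * h ^ 2 / 2 * (∑ v, dg Z v * (dg Z v - 1)) -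
    lam * h ^ 4 * ((Z.card : ℝ) ^ 2 - Z.card) +
    (1 - 2 * lam) * (1 / (lam * (1 - lam))) * edgeSum w Z) -
  (1 / (1 - lam)) ^ 2 / 2 * ((∑ v, w v ^ 2 * dg Z v) + 2 * edgeSum w Z)

section missing

variable {n : ℕ} {Z : Finset (Sym2 (Fin n))} {d w : Fin n → ℝ} {a b v : Fin n} {T h lam : ℝ}

lemma sum_ev_add_mul (f : Fin n → ℝ) : ∑ v, (ev a v + ev b v) * f v = f a + f b := by
  simp only [add_mul, Finset.sum_add_distrib, sum_ev_mul]

lemma sum_mul_dg_insert (hab : a ≠ b) (hZ : s(a, b) ∉ Z) (f : Fin n → ℝ) :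
    ∑ v, f v * dg (insert s(a, b) Z) v = (∑ v, f v * dg Z v) + (f a + f b) := by
  rw [← sum_ev_add_mul, ← Finset.sum_add_distrib, dg_insert hab hZ]
  exact Finset.sum_congr rfl fun v _ => by simp only [Pi.add_apply]; ring

lemma sum_dg_sq_insert (hab : a ≠ b) (hZ : s(a, b) ∉ Z) :
    ∑ v, dg (insert s(a, b) Z) v * (dg (insert s(a, b) Z) v - 1) =
      (∑ v, dg Z v * (dg Z v - 1)) + 2 * (dg Z a + dg Z b) := by
  have : 2 * (dg Z a + dg Z b) = ∑ v, (ev a v + ev b v) * (2 * dg Z v) := by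
    rw [sum_ev_add_mul]; ring
  rw [this, ← Finset.sum_add_distrib, dg_insert hab hZ]
  refine Finset.sum_congr rfl fun v _ => ?_
  have h1 : (ev a v + ev b v) * (ev a v + ev b v) = ev a v + ev b v := by
    unfold ev
    rcases eq_or_ne v a with rfl | hv
    · simp [hab]
    · simp [hv]
  simp only [Pi.add_apply]
  linear_combination h1

lemma edgeSum_insert (hab : a ≠ b) (hZ : s(a, b) ∉ Z) :
    edgeSum w (insert s(a, b) Z) = edgeSum w Z + w a * w b := by
  have h1 : ∀ u v, ind (insert s(a, b) Z) s(u, v) * (w u * w v) = ind Z s(u, v) * (w u * w v) +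
      (ev a u * (ev b v * (w u * w v)) + ev b u * (ev a v * (w u * w v))) := fun u v => by
    have : ind (insert s(a, b) Z) s(u, v) = ind Z s(u, v) + ev a u * ev b v + ev b u * ev a v := by
      by_cases he : s(u, v) = s(a, b)
      · rw [he, ind_insert_self, ind_of_notMem hZ]
        rcases Sym2.eq_iff.1 he with ⟨rfl, rfl⟩ | ⟨rfl, rfl⟩ <;> simp [ev, hab, hab.symm]
      · rw [ind_insert_of_ne he]
        simp only [ev]
        by_cases h1 : u = a <;> by_cases h2 : v = b <;> by_cases h3 : u = b <;>
          by_cases h4 : v = a <;> simp_all [Sym2.eq_swap]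
    rw [this]; ring
  unfold edgeSum
  simp only [h1, Finset.sum_add_distrib, ← Finset.mul_sum, sum_ev_mul]
  ring

lemma avoid_insert (hab : a ≠ b) (hZ : s(a, b) ∉ Z) :
    avoid lam h w (insert s(a, b) Z) = avoid lam h w Z -
      (1 / (1 - lam)) * (w a + w b + lam * h ^ 2 * (dg Z a + dg Z b) -
        2 * lam * h ^ 4 * Z.card + (1 - 2 * lam) * (1 / (lam * (1 - lam))) * (w a * w b)) -
      (1 / (1 - lam)) ^ 2 / 2 * (w a + w b) ^ 2 := by
  unfold avoid
  rw [sum_mul_dg_insert hab hZ, sum_dg_sq_insert hab hZ, edgeSum_insert hab hZ,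
    sum_mul_dg_insert hab hZ (fun v => w v ^ 2), Finset.card_insert_of_notMem hZ]
  push_cast
  ring

lemma avoid_empty : avoid lam h w ∅ = 0 := by
  have : ∀ v : Fin n, dg ∅ v = 0 := fun v => by simp [dg, ind]
  simp [avoid, edgeSum, this, ind]

lemma Bd.one_sub_eq_exp (G : Glob n T h lam) {c : ℕ} {y : ℝ} (hy : Bd T h c 1 y) (hc : c ≤ 9999) :
    ∃ r, Bd T h (3 * c + 1) 3 r ∧ 1 - y = Real.exp (-y - y ^ 2 / 2 + r) := by
  have hT := G.T0
  have hh := G.h0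
  have h1 : |y| ≤ 1 / 2 := by
    have h2 := G.pow_mul_le (c := c + 1) (by omega)
    have h3 : |y| ≤ T ^ c * h := by simpa [Bd] using hy
    have h4 : 0 ≤ T ^ c * h := by positivity
    have h5 : T * (T ^ c * h) ≤ 1 := by rw [← mul_assoc, ← pow_succ']; exact h2
    nlinarith [G.hT]
  refine ⟨Real.log (1 - y) + y + y ^ 2 / 2, ?_, ?_⟩
  · have h2 := Real.abs_log_sub_add_sum_range_le (show |y| < 1 by linarith) 2
    simp only [Finset.sum_range_succ, Finset.sum_range_zero] at h2
    norm_num at h2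
    have h3 : Bd T h (c + c + c) (1 + 1 + 1) (y * y * y) := (hy.mul G hy).mul G hy
    unfold Bd at h3 ⊢
    have h4 : |y| ^ 3 = |y * y * y| := by rw [← abs_pow]; congr 1; ring
    rw [h4] at h2
    rw [show Real.log (1 - y) + y + y ^ 2 / 2 = y + y ^ 2 / 2 + Real.log (1 - y) by ring]
    have h5 : |y * y * y| / (1 - |y|) ≤ 2 * |y * y * y| := by
      rw [div_le_iff₀ (by linarith)]
      nlinarith [abs_nonneg (y * y * y)]
    calc _ ≤ 2 * |y * y * y| := h2.trans h5
      _ ≤ T * (T ^ (c + c + c) * h ^ (1 + 1 + 1)) :=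
          mul_le_mul (by linarith [G.hT]) h3 (abs_nonneg _) hT.le
      _ = _ := by ring
  · rw [show -y - y ^ 2 / 2 + (Real.log (1 - y) + y + y ^ 2 / 2) = Real.log (1 - y) by ring,
      Real.exp_log (by linarith [(abs_le.1 h1).2])]

lemma sum_dg (hZ : Z ⊆ full n) : ∑ v, dg Z v = 2 * Z.card := by
  simp only [dg_eq_ndg]
  exact_mod_cast sum_ndg hZ

/-- The complement of a sparse set of edges, with the deviations of the degrees. -/
lemma dg_full_sdiff (hZ : Z ⊆ full n) : dg (full n \ Z) v = n - 1 - dg Z v := by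
  rw [dg_sdiff hZ, Pi.sub_apply, dg_full]

lemma gg_full_sdiff (hZ : Z ⊆ full n) :
    gg lam d (full n \ Z) v = gg lam d (full n) v + lam * dg Z v := by
  rw [gg, gg, dg_full_sdiff hZ, dg_full]; ring

lemma uu_full_sdiff (G : Glob n T h lam) (hZ : Z ⊆ full n) :
    uu lam d (full n \ Z) v = uu lam d (full n) v + lam * h ^ 2 * dg Z v := by
  rw [uu, uu, gg_full_sdiff hZ, G.div_n, G.div_n]; ring

lemma sum_gg_full_sdiff (hZ : Z ⊆ full n) (hs : ∑ v, gg lam d (full n) v = 0) :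
    ∑ v, gg lam d (full n \ Z) v = 2 * lam * Z.card := by
  simp only [gg_full_sdiff hZ, Finset.sum_add_distrib, ← Finset.mul_sum, hs, sum_dg hZ]
  ring

lemma ss_full_sdiff (G : Glob n T h lam) (hZ : Z ⊆ full n) (hs : ∑ v, gg lam d (full n) v = 0) :
    ss lam d (full n \ Z) = 2 * lam * h ^ 4 * Z.card := by
  simp only [ss, uu, ← Finset.sum_div]
  rw [sum_gg_full_sdiff hZ hs, G.div_n, G.div_n]; ring

lemma two_card_le (hZ : Z ⊆ full n) (hT : ∀ v, dg Z v ≤ T) : 2 * (Z.card : ℝ) ≤ n * T := by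
  rw [← sum_dg hZ]
  exact (Finset.sum_le_card_nsmul _ _ T fun v _ => hT v).trans (by simp)

lemma cls_full_sdiff (G : Glob n T h lam) (hZ : Z ⊆ full n) (hT : ∀ v, dg Z v ≤ T)
    (hg : ∀ v, |gg lam d (full n) v| ≤ T / h) (hs : ∑ v, gg lam d (full n) v = 0) :
    Cls n T h lam 1 d (full n \ Z) where
  loop := loopless_full.mono Finset.sdiff_subset
  g v := by
    have h1 : T ≤ 1 / h := by simpa using G.pow_le_inv (c := 1) (by norm_num)
    have h2 : 0 ≤ dg Z v := dg_nonneg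
    have h3 : |lam * dg Z v| ≤ 1 / h := by
      rw [abs_of_nonneg (mul_nonneg G.lam0.le h2)]
      nlinarith [G.lam1, hT v]
    rw [gg_full_sdiff hZ, Nat.cast_one, add_div]
    exact (abs_add_le _ _).trans (add_le_add (hg v) h3)
  xd v := by rw [dg_full_sdiff hZ, Nat.cast_one]; linarith [hT v]
  s := by
    have h1 := two_card_le hZ hT
    have h2 := G.lam0
    have h3 := G.lam1
    have h4 := G.npos
    have h5 : (0:ℝ) ≤ Z.card := Nat.cast_nonneg _
    rw [sum_gg_full_sdiff hZ hs, abs_of_nonneg (by positivity), Nat.cast_one]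
    nlinarith

lemma nn_erase (he : s(a, v) ∈ Z) (hp : 0 < nn d Z) :
    nn d (Z.erase s(a, v)) = nn d Z * (1 - pr d Z a v) := by
  rw [← sum_one_sub_ind he, Finset.sum_sub_distrib, ← nn_eq_sum, pr, av, mul_sub, mul_one,
    mul_div_cancel₀ _ hp.ne']

lemma avoid_step (G : Glob n T h lam) (hZ : Z ⊆ full n) (hT : ∀ v, dg Z v ≤ T)
    (hg : ∀ v, |gg lam d (full n) v| ≤ T / h) (hs : ∑ v, gg lam d (full n) v = 0)
    (hab : a ≠ b) (he : s(a, b) ∉ Z) (hp : 0 < nn d (full n \ Z)) :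
    ∃ r, Bd T h 1000 3 r ∧ nn d (full n \ insert s(a, b) Z) = nn d (full n \ Z) * ((1 - lam) *
      Real.exp (avoid lam h (uu lam d (full n)) (insert s(a, b) Z) -
        avoid lam h (uu lam d (full n)) Z + r)) := by
  have H := cls_full_sdiff G hZ hT hg hs
  have hmem : s(a, b) ∈ full n \ Z := Finset.mem_sdiff.2 ⟨mem_full.2 hab, he⟩
  have h3 := H.pr_three G (by norm_num) hp hmem
  have hh := G.h0
  have hT0 := G.T0
  have hl : 0 < 1 - lam := by linarith [G.lam1]
  have hu : ∀ v, Bd T h 2 1 (uu lam d (full n \ Z) v) := H.bd_u G (by norm_num)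
  have hs2 := H.bd_s G (by norm_num)
  have hI : Bd T h 1 0 (1 / (1 - lam)) := by
    unfold Bd
    rw [abs_of_pos (by positivity), pow_one, pow_zero, mul_one, div_le_iff₀ hl]
    linarith [G.hi]
  have hκ : Bd T h 3 0 ((1 - 2 * lam) * (1 / (lam * (1 - lam)))) :=
    G.bd_one_sub_two_lam.mul G G.bd_inv_q
  have hz : ∀ v, Bd T h 1 2 (lam * h ^ 2 * dg Z v) := fun v => by
    unfold Bd
    have h2 : 0 ≤ dg Z v := dg_nonneg
    rw [abs_of_nonneg (by have := G.lam0; positivity), pow_one]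
    calc lam * h ^ 2 * dg Z v ≤ 1 * h ^ 2 * T := by
          refine mul_le_mul (mul_le_mul_of_nonneg_right G.lam1.le (by positivity)) (hT v) h2
            (by positivity)
      _ = _ := by ring
  have hw' : ∀ v, uu lam d (full n) v = uu lam d (full n \ Z) v - lam * h ^ 2 * dg Z v :=
    fun v => by rw [uu_full_sdiff G hZ]; ring
  have hw : ∀ v, Bd T h 3 1 (uu lam d (full n) v) := fun v => by
    rw [hw']; exact ((hu v).sub G (hz v)).mono G (by norm_num) (by norm_num)
  rw [ss_full_sdiff G hZ hs] at h3 hs2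
  rw [avoid_insert hab he]
  have he1 : full n \ insert s(a, b) Z = (full n \ Z).erase s(a, b) := by
    rw [Finset.sdiff_insert]
  rw [he1, nn_erase hmem hp]
  set P := pr d (full n \ Z) a b
  have hua := hu a
  have hub := hu b
  have hwa := hw a
  have hwb := hw b
  have hza := hz a
  have hzb := hz b
  have e1 := hw' a
  have e2 := hw' b
  generalize uu lam d (full n \ Z) a = ua at *
  generalize uu lam d (full n \ Z) b = ub at *
  generalize uu lam d (full n) a = wa at *
  generalize uu lam d (full n) b = wb at *
  set za := dg Z a
  set zb := dg Z b
  set m : ℝ := (Z.card : ℝ)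
  set κ := (1 - 2 * lam) * (1 / (lam * (1 - lam)))
  set I := 1 / (1 - lam) with hId
  clear_value P za zb m κ
  set r₀ := P - (lam + ua + ub - 2 * lam * h ^ 4 * m + κ * (ua * ub)) with hr0
  have hq : Bd T h 9 2 (κ * (ua * ub)) := (hκ.mul G (hua.mul G hub)).mono G (by norm_num) le_rfl
  -- the first two orders of the edge probability
  have hP1 : Bd T h 240 2 (P - lam - wa - wb) := by
    refine ((((h3.add G hq).sub G hs2).add G hza).add G hzb).congr G ?_ (by norm_num) (by norm_num)
    rw [e1, e2]; ring
  have hP2 : Bd T h 242 1 (P - lam + wa + wb) := by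
    refine ((hP1.add G (hwa.add G hwb)).add G (hwa.add G hwb)).congr G ?_ (by norm_num)
      (by norm_num)
    ring
  have hP0 : Bd T h 242 1 (P - lam) := by
    refine (hP1.add G (hwa.add G hwb)).congr G ?_ (by norm_num) (by norm_num)
    ring
  have hy : Bd T h 243 1 (I * (P - lam)) := (hI.mul G hP0).mono G (by norm_num) (by norm_num)
  obtain ⟨r, hr, hexp⟩ := hy.one_sub_eq_exp G (by norm_num)
  have hd1 : Bd T h 9 3 (κ * (ua * (lam * h ^ 2 * zb) + (lam * h ^ 2 * za) * wb)) :=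
    (hκ.mul G ((hua.mul G hzb).add G (hza.mul G hwb))).mono G (by norm_num) (by norm_num)
  have hd2 : Bd T h 500 3 (I ^ 2 * (1 / 2) * ((P - lam - wa - wb) * (P - lam + wa + wb))) := by
    refine (((hI.mul G hI).mul G (G.bd_const (x := 1 / 2) (by norm_num [abs_of_pos]))).mul G
      (hP1.mul G hP2)).congr G ?_ (by norm_num) (by norm_num)
    ring
  refine ⟨r - I * r₀ - I * (κ * (ua * (lam * h ^ 2 * zb) + (lam * h ^ 2 * za) * wb)) -
    I ^ 2 * (1 / 2) * ((P - lam - wa - wb) * (P - lam + wa + wb)), ?_, ?_⟩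
  · exact (((hr.sub G (hI.mul G h3)).sub G (hI.mul G hd1)).sub G hd2).mono G (by norm_num)
      (by norm_num)
  · have e3 : 1 - P = (1 - lam) * (1 - I * (P - lam)) := by rw [hId]; field_simp; ring
    rw [e3, hexp]
    congr 3
    rw [hr0]
    clear_value I
    rw [show ua = wa + lam * h ^ 2 * za by rw [e1]; ring,
      show ub = wb + lam * h ^ 2 * zb by rw [e2]; ring]
    ring

/-- The number of graphs avoiding a sparse set of edges. -/
lemma nn_full_sdiff (G : Glob n T h lam) (hg : ∀ v, |gg lam d (full n) v| ≤ T / h)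
    (hs : ∑ v, gg lam d (full n) v = 0) (hp : 0 < nn d (full n)) (hZ : Z ⊆ full n)
    (hT : ∀ v, dg Z v ≤ T) :
    ∃ r, |r| ≤ Z.card * (T ^ 1000 * h ^ 3) ∧ nn d (full n \ Z) = nn d (full n) *
      ((1 - lam) ^ Z.card * Real.exp (avoid lam h (uu lam d (full n)) Z + r)) := by
  induction Z using Finset.induction_on with
  | empty => exact ⟨0, by simp, by simp [avoid_empty]⟩
  | insert e Z he ih =>
    induction e with
    | _ a b =>
    obtain ⟨r, hr, h1⟩ := ih ((Finset.subset_insert _ _).trans hZ) fun v => by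
      refine le_trans ?_ (hT v)
      exact Finset.sum_le_sum fun u _ => ind_le_of_subset (Finset.subset_insert _ _)
    have hZ' := (Finset.subset_insert _ _).trans hZ
    have hab : a ≠ b := mem_full.1 (hZ (Finset.mem_insert_self _ _))
    have hl : 0 < 1 - lam := by linarith [G.lam1]
    have hp' : 0 < nn d (full n \ Z) := by rw [h1]; positivity
    obtain ⟨r', hr', h2⟩ := avoid_step G hZ' (fun v => le_trans
      (Finset.sum_le_sum fun u _ => ind_le_of_subset (Finset.subset_insert _ _)) (hT v))
      hg hs hab he hp'
    refine ⟨r + r', ?_, ?_⟩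
    · rw [Finset.card_insert_of_notMem he]
      push_cast
      rw [add_mul, one_mul]
      exact (abs_add_le _ _).trans (add_le_add hr hr')
    · rw [h2, h1, Finset.card_insert_of_notMem he, pow_succ]
      have : Real.exp (avoid lam h (uu lam d (full n)) (insert s(a, b) Z) + (r + r')) =
        Real.exp (avoid lam h (uu lam d (full n)) Z + r) *
        Real.exp (avoid lam h (uu lam d (full n)) (insert s(a, b) Z) -
        avoid lam h (uu lam d (full n)) Z + r') := by rw [← Real.exp_add]; congr 1; ring
      rw [this]; ring

end missing

section regular

variable {n x : ℕ} {Z : Finset (Sym2 (Fin n))} {d : Fin n → ℝ} {k : Fin n → ℕ} {T h lam : ℝ}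

/-- The exponent for avoiding an `x`-regular graph. -/
def missExp {n : ℕ} (lam : ℝ) (d : Fin n → ℝ) (Z : Finset (Sym2 (Fin n))) (x : ℕ) : ℝ :=
  -lam * x * (x - 2) / (4 * (1 - lam)) - x * sqd lam d / (2 * (1 - lam) ^ 2 * (n : ℝ) ^ 2) -
    edgeSum (gg lam d (full n)) Z / (lam * (1 - lam) * (n : ℝ) ^ 2)

lemma Glob.inv_one_sub_le (G : Glob n T h lam) : 0 < 1 - lam ∧ 1 / (1 - lam) ≤ T := by
  have hl : 0 < 1 - lam := by linarith [G.lam1]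
  refine ⟨hl, ?_⟩
  rw [div_le_iff₀ hl]
  linarith [G.hi]

lemma edgeSum_smul (c : ℝ) (f : Fin n → ℝ) :
    edgeSum (fun v => f v * c) Z = c ^ 2 * edgeSum f Z := by
  unfold edgeSum
  rw [mul_div_assoc', Finset.mul_sum]
  congr 1
  refine Finset.sum_congr rfl fun u _ => ?_
  rw [Finset.mul_sum]
  exact Finset.sum_congr rfl fun v _ => by ring

lemma avoid_regular (G : Glob n T h lam) (hs : ∑ v, gg lam d (full n) v = 0) (hZ : Z ⊆ full n)
    (hx : ∀ v, dg Z v = x) : avoid lam h (uu lam d (full n)) Z =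
      missExp lam d Z x - 1 / (1 - lam) * (lam * h ^ 2 * x / 2) := by
  have hc := sum_dg hZ
  simp only [hx, Finset.sum_const, Finset.card_univ, Fintype.card_fin, nsmul_eq_mul] at hc
  have hm : (Z.card : ℝ) = n * x / 2 := by linarith
  have hl := G.inv_one_sub_le.1
  have hl0 := G.lam0
  have hn := G.npos
  have hw : uu lam d (full n) = fun v => gg lam d (full n) v * h ^ 2 := by
    funext v; rw [uu, G.div_n]
  have hR : ∑ v, (gg lam d (full n) v * h ^ 2) ^ 2 = h ^ 4 * sqd lam d := by
    rw [sqd, Finset.mul_sum]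
    exact Finset.sum_congr rfl fun v _ => by ring
  unfold avoid missExp
  rw [hw, edgeSum_smul]
  simp only [hx, ← Finset.sum_mul, hs, hR, hm, Finset.sum_const, Finset.card_univ,
    Fintype.card_fin, nsmul_eq_mul]
  rw [show h ^ 4 = (h ^ 2) ^ 2 by ring, ← G.inv_n]
  field_simp
  ring

/-- The number of graphs avoiding a sparse regular graph. -/
lemma nn_full_sdiff_regular (G : Glob n T h lam) (hg : ∀ v, |gg lam d (full n) v| ≤ T / h)
    (hs : ∑ v, gg lam d (full n) v = 0) (hp : 0 < nn d (full n)) (hZ : Z ⊆ full n)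
    (hx : ∀ v, dg Z v = x) (hxT : (x : ℝ) ≤ T) :
    ∃ r, |r| ≤ T ^ 1002 * h ∧ nn d (full n \ Z) = nn d (full n) *
      ((1 - lam) ^ Z.card * Real.exp (missExp lam d Z x + r)) := by
  obtain ⟨r, hr, h1⟩ := nn_full_sdiff G hg hs hp hZ fun v => (hx v).trans_le hxT
  obtain ⟨hl, hI⟩ := G.inv_one_sub_le
  have hT := G.T0
  have hh := G.h0
  refine ⟨r - 1 / (1 - lam) * (lam * h ^ 2 * x / 2), ?_, ?_⟩
  · have h2 := two_card_le hZ fun v => (hx v).trans_le hxT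
    have h3 : |r| ≤ T ^ 1001 * h := by
      refine hr.trans ?_
      calc _ ≤ n * T * (T ^ 1000 * h ^ 3) := mul_le_mul_of_nonneg_right
            (by linarith [(Nat.cast_nonneg Z.card : (0:ℝ) ≤ Z.card)]) (by positivity)
        _ = _ := by rw [G.n_eq]; field_simp
    have h4 : |1 / (1 - lam) * (lam * h ^ 2 * x / 2)| ≤ T ^ 1001 * h := by
      have hl0 := G.lam0
      rw [abs_of_nonneg (by positivity)]
      calc _ ≤ T * (1 * h * T) := by
            refine mul_le_mul hI ?_ (by positivity) hT.le
            have : lam * h ^ 2 ≤ 1 * h := by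
              have := G.lam1; have := G.h1
              nlinarith [mul_pos hl0 hh]
            have := mul_le_mul this hxT (Nat.cast_nonneg _) (by positivity)
            have h5 : (0:ℝ) ≤ lam * h ^ 2 * x := by positivity
            linarith
        _ = T ^ 2 * h := by ring
        _ ≤ _ := mul_le_mul_of_nonneg_right (pow_le_pow_right₀ G.T1 (by norm_num)) hh.le
    have h5 : 100 * (T ^ 1001 * h) ≤ T ^ 1002 * h := by
      calc _ ≤ T * (T ^ 1001 * h) := mul_le_mul_of_nonneg_right G.hT (by positivity)
        _ = _ := by ring
    refine (abs_sub _ _).trans ?_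
    have : 0 ≤ T ^ 1001 * h := by positivity
    linarith
  · rw [h1, avoid_regular G hs hZ hx]
    congr 3
    ring

lemma Glob.symm (G : Glob n T h lam) : Glob n T h (1 - lam) where
  hT := G.hT
  h0 := G.h0
  nh := G.nh
  small := G.small
  log := G.log
  lo := G.hi
  hi := by linarith [G.lo]

lemma gg_compl (v : Fin n) :
    gg (1 - lam) (dg (full n) - d) (full n) v = -gg lam d (full n) v := by
  simp only [gg, Pi.sub_apply]; ring

lemma missExp_compl : missExp (1 - lam) (dg (full n) - d) Z x =
    -(1 - lam) * x * (x - 2) / (4 * lam) - x * sqd lam d / (2 * lam ^ 2 * (n : ℝ) ^ 2) -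
      edgeSum (gg lam d (full n)) Z / (lam * (1 - lam) * (n : ℝ) ^ 2) := by
  have h1 : sqd (1 - lam) (dg (full n) - d) = sqd lam d := by
    simp only [sqd, gg_compl, neg_sq]
  have h2 : edgeSum (gg (1 - lam) (dg (full n) - d) (full n)) Z =
      edgeSum (gg lam d (full n)) Z := by
    simp only [edgeSum, gg_compl, neg_mul_neg]
  rw [missExp, h1, h2, sub_sub_cancel, mul_comm (1 - lam) lam]

/-- The number of graphs containing a sparse regular graph. -/
lemma nn_sub_regular (G : Glob n T h lam) (hg : ∀ v, |gg lam d (full n) v| ≤ T / h)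
    (hs : ∑ v, gg lam d (full n) v = 0) (hp : 0 < nn d (full n)) (hZ : Z ⊆ full n)
    (hx : ∀ v, dg Z v = x) (hxT : (x : ℝ) ≤ T) :
    ∃ r, |r| ≤ T ^ 1002 * h ∧ nn (d - dg Z) (full n \ Z) = nn d (full n) *
      (lam ^ Z.card * Real.exp (missExp (1 - lam) (dg (full n) - d) Z x + r)) := by
  rw [nn_compl (d := d)] at hp
  obtain ⟨r, hr, h1⟩ := nn_full_sdiff_regular G.symm (d := dg (full n) - d)
    (fun v => by rw [gg_compl, abs_neg]; exact hg v)
    (by simp only [gg_compl, Finset.sum_neg_distrib, hs, neg_zero]) hp hZ hx hxT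
  refine ⟨r, hr, ?_⟩
  rw [nn_compl, nn_compl (d := d), dg_sdiff hZ, sub_sub_sub_cancel_right, h1, sub_sub_cancel]

lemma choose_step (G : Glob n T h lam) {i m : ℕ} (hi : (i : ℝ) ≤ T) (hin : i + m < n - 1 + 1)
    (hm : |(m : ℝ) - lam * (n - 1)| ≤ T / h) (hii : i < n - 1) :
    ∃ r, Bd T h 1000 3 r ∧ (1 - lam) * (n - 1 - i).choose m = (n - 1 - (i + 1)).choose m *
      Real.exp (1 / (1 - lam) * h ^ 2 * ((m - lam * (n - 1)) + lam * i) +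
        (1 / (1 - lam)) ^ 2 * h ^ 4 * (m - lam * (n - 1)) ^ 2 / 2 + r) := by
  obtain ⟨hl, hI⟩ := G.inv_one_sub_le
  have hT := G.T0
  have hh := G.h0
  have hn := G.npos
  set γ := (m : ℝ) - lam * (n - 1) with hγ
  have hI' : Bd T h 1 0 (1 / (1 - lam)) := by
    unfold Bd; rw [abs_of_pos (by positivity)]; simpa using hI
  have hγ' : Bd T h 1 1 (γ * h ^ 2) := by
    unfold Bd
    rw [abs_mul, abs_of_pos (pow_pos hh 2)]
    calc _ ≤ T / h * h ^ 2 := mul_le_mul_of_nonneg_right hm (by positivity)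
      _ = _ := by field_simp
  have hi' : Bd T h 1 2 (i * h ^ 2) := by
    unfold Bd
    rw [abs_of_nonneg (by positivity), pow_one]
    exact mul_le_mul_of_nonneg_right hi (by positivity)
  have hcast : ((n - 1 - i : ℕ) : ℝ) = n - 1 - i := by
    rw [Nat.cast_sub hii.le, G.cast_pred]
  have hN : 1 / 2 ≤ (n - 1 - i) * h ^ 2 := by
    have h1 := G.pow_mul_le (c := 1) (by norm_num)
    have h2 := G.h_le
    have h3 : (n - 1 - i) * h ^ 2 = 1 - h ^ 2 - i * h ^ 2 := by linear_combination G.nh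
    rw [h3]
    have h4 : i * h ^ 2 ≤ T * h * h := by
      calc _ ≤ T * h ^ 2 := mul_le_mul_of_nonneg_right hi (by positivity)
        _ = _ := by ring
    nlinarith [mul_pos hT hh]
  have hN0 : (0:ℝ) < n - 1 - i := by
    by_contra hc
    push Not at hc
    nlinarith [mul_nonneg (neg_nonneg.2 hc) (sq_nonneg h)]
  set J := 1 / ((n - 1 - i) * h ^ 2) with hJ
  have hJ1 : Bd T h 1 0 J := by
    unfold Bd
    rw [abs_of_pos (by positivity), pow_one, pow_zero, mul_one, hJ, div_le_iff₀ (by positivity)]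
    nlinarith [G.hT]
  have hJ2 : Bd T h 5 2 (J - 1) := by
    have : J - 1 = J * (h ^ 2 + i * h ^ 2) := by
      have : J * ((n - 1 - i) * h ^ 2) = 1 := by rw [hJ]; field_simp
      clear_value J
      linear_combination this - J * G.nh
    rw [this]
    exact (hJ1.mul G (G.bd_hh.add G hi')).mono G (by norm_num) le_rfl
  set y := (γ + lam * i) / ((1 - lam) * (n - 1 - i)) with hy
  have hyJ : y = 1 / (1 - lam) * (γ * h ^ 2 + lam * (i * h ^ 2)) * J := by
    rw [hy, hJ]; field_simp
  have hyl : Bd T h 9 3 (y - 1 / (1 - lam) * (γ * h ^ 2 + lam * (i * h ^ 2))) := by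
    refine ((hI'.mul G (hγ'.add G (G.bd_lam.mul G hi'))).mul G hJ2).congr G ?_ (by norm_num)
      (by norm_num)
    rw [hyJ]; ring
  have hyb : Bd T h 9 1 y := by
    rw [hyJ]
    exact ((hI'.mul G (hγ'.add G (G.bd_lam.mul G hi'))).mul G hJ1).mono G (by norm_num)
      (by norm_num)
  have hy2 : Bd T h 50 3 (y ^ 2 - (1 / (1 - lam)) ^ 2 * (γ * h ^ 2) ^ 2) := by
    have h1 : Bd T h 15 2 (y - 1 / (1 - lam) * (γ * h ^ 2)) := by
      refine (hyl.add G (hI'.mul G (G.bd_lam.mul G hi'))).congr G ?_ (by norm_num) (by norm_num)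
      ring
    have h2 : Bd T h 15 1 (y + 1 / (1 - lam) * (γ * h ^ 2)) :=
      (hyb.add G (hI'.mul G hγ')).mono G (by norm_num) (by norm_num)
    exact (h1.mul G h2).congr G (by ring) (by norm_num) (by norm_num)
  obtain ⟨r, hr, hexp⟩ := hyb.one_sub_eq_exp G (by norm_num)
  have hpas := Nat.choose_mul_succ_eq (n - 1 - (i + 1)) m
  rw [show n - 1 - (i + 1) + 1 = n - 1 - i by omega] at hpas
  have hpas' : ((n - 1 - (i + 1)).choose m : ℝ) * (n - 1 - i) =
      (n - 1 - i).choose m * (n - 1 - i - m) := by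
    have h1 : ((n - 1 - i - m : ℕ) : ℝ) = n - 1 - i - m := by
      rw [Nat.cast_sub (by omega), hcast]
    rw [← h1, ← hcast]
    exact_mod_cast hpas
  have hsplit : (n - 1 - i - m : ℝ) = (1 - lam) * (n - 1 - i) * (1 - y) := by
    rw [hy]; field_simp; rw [hγ]; ring
  rw [hsplit, hexp] at hpas'
  refine ⟨(y - 1 / (1 - lam) * (γ * h ^ 2 + lam * (i * h ^ 2))) +
    (y ^ 2 - (1 / (1 - lam)) ^ 2 * (γ * h ^ 2) ^ 2) * (1 / 2) - r, ?_, ?_⟩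
  · exact ((hyl.add G (hy2.mul G (G.bd_const (x := 1 / 2) (by norm_num [abs_of_pos])))).sub G
      hr).mono G (by norm_num) (by norm_num)
  · have e1 : 1 / (1 - lam) * h ^ 2 * (γ + lam * i) + (1 / (1 - lam)) ^ 2 * h ^ 4 * γ ^ 2 / 2 +
        ((y - 1 / (1 - lam) * (γ * h ^ 2 + lam * (i * h ^ 2))) +
        (y ^ 2 - (1 / (1 - lam)) ^ 2 * (γ * h ^ 2) ^ 2) * (1 / 2) - r) =
        -(-y - y ^ 2 / 2 + r) := by ring
    rw [e1, Real.exp_neg, ← div_eq_mul_inv, eq_div_iff (Real.exp_pos _).ne']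
    have h1 : (n - 1 - i : ℝ) ≠ 0 := hN0.ne'
    apply mul_right_cancel₀ h1
    linear_combination -hpas'

lemma choose_ratio (G : Glob n T h lam) {m : ℕ} (hm : |(m : ℝ) - lam * (n - 1)| ≤ T / h) :
    ∀ x : ℕ, (x : ℝ) ≤ T → x + m ≤ n - 1 → x ≤ n - 1 →
    ∃ r, |r| ≤ x * (T ^ 1000 * h ^ 3) ∧ (1 - lam) ^ x * (n - 1).choose m =
      (n - 1 - x).choose m * Real.exp (1 / (1 - lam) * h ^ 2 * (x * (m - lam * (n - 1)) +
        lam * (x * (x - 1) / 2)) +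
        x * ((1 / (1 - lam)) ^ 2 * h ^ 4 * (m - lam * (n - 1)) ^ 2 / 2) + r) := by
  intro x
  induction x with
  | zero => intro _ _ _; exact ⟨0, by simp, by simp⟩
  | succ x ih =>
    intro h1 h2 h3
    have h1' : (x : ℝ) ≤ T := by push_cast at h1; linarith
    obtain ⟨r, hr, e1⟩ := ih h1' (by omega) (by omega)
    obtain ⟨r', hr', e2⟩ := choose_step G h1' (m := m) (by omega) hm (by omega)
    refine ⟨r + r', ?_, ?_⟩
    · push_cast
      rw [add_mul, one_mul]
      exact (abs_add_le _ _).trans (add_le_add hr hr')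
    · rw [pow_succ, mul_right_comm, e1, mul_right_comm, mul_comm _ (1 - lam), e2, mul_assoc,
        ← Real.exp_add]
      congr 2
      push_cast
      ring

lemma prod_choose_ratio (G : Glob n T h lam) (hk : ∀ v, |(k v : ℝ) - lam * (n - 1)| ≤ T / h)
    (hs : ∑ v, gg lam (cst k) (full n) v = 0) (hxT : (x : ℝ) ≤ T) (hkx : ∀ v, x + k v ≤ n - 1)
    (hx : x ≤ n - 1) :
    ∃ r, |r| ≤ T ^ 1001 * h ∧ (1 - lam) ^ (n * x) * chs k =
      (∏ v, ((n - 1 - x).choose (k v) : ℝ)) * Real.exp (lam * x * (x - 1) / (2 * (1 - lam)) +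
        x * sqd lam (cst k) / (2 * (1 - lam) ^ 2 * (n : ℝ) ^ 2) + r) := by
  have hl := G.inv_one_sub_le.1
  have hn := G.npos
  have hT := G.T0
  have hh := G.h0
  choose r hr e using fun v => choose_ratio G (hk v) x hxT (hkx v) hx
  have hgg : ∀ v, gg lam (cst k) (full n) v = k v - lam * (n - 1) := fun v => by
    rw [gg, dg_full, cst]
  refine ⟨∑ v, r v, ?_, ?_⟩
  · refine (Finset.abs_sum_le_sum_abs _ _).trans ((Finset.sum_le_card_nsmul _ _
      (T * (T ^ 1000 * h ^ 3)) fun v _ => (hr v).trans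
        (mul_le_mul_of_nonneg_right hxT (by positivity))).trans (le_of_eq ?_))
    rw [Finset.card_univ, Fintype.card_fin, nsmul_eq_mul, G.n_eq]
    field_simp
  · have h1 : (1 - lam) ^ (n * x) * chs k = ∏ v, ((1 - lam) ^ x * ((n - 1).choose (k v) : ℝ)) := by
      rw [Finset.prod_mul_distrib, chs, Finset.prod_const, Finset.card_univ, Fintype.card_fin,
        ← pow_mul, mul_comm x]
    rw [h1, Finset.prod_congr rfl fun v _ => e v, Finset.prod_mul_distrib, ← Real.exp_sum]
    congr 2
    simp only [Finset.sum_add_distrib, ← Finset.mul_sum, ← hgg, hs, ← Finset.sum_div]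
    rw [← sqd, Finset.sum_const, Finset.card_univ, Fintype.card_fin, nsmul_eq_mul,
      show h ^ 4 = (h ^ 2) ^ 2 by ring, ← G.inv_n]
    field_simp
    ring

end regular

section translation

variable {n : ℕ} {d : Fin n → ℕ} {X H : SimpleGraph (Fin n)}

lemma dg_edgeFinset [Fintype H.edgeSet] (v : Fin n) :
    dg H.edgeFinset v = Nat.card (H.neighborSet v) := by
  rw [Nat.card_eq_fintype_card, ← Set.toFinset_card, dg]
  simp only [ind, SimpleGraph.mem_edgeFinset, SimpleGraph.mem_edgeSet]
  rw [Finset.sum_boole]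
  congr 2
  ext u; simp

lemma dg_edgeFinset_eq_xDeg (v : Fin n) : dg X.edgeFinset v = xDeg X v := dg_edgeFinset v

lemma edgeFinset_subset_full : H.edgeFinset ⊆ full n := by
  intro e he
  induction e with
  | h u v =>
    rw [SimpleGraph.mem_edgeFinset, SimpleGraph.mem_edgeSet] at he
    exact mem_full.2 he.ne

lemma xEdges_eq : xEdges X = X.edgeFinset.card := by
  rw [xEdges, Nat.card_eq_fintype_card, SimpleGraph.edgeFinset_card]

lemma edgeFinset_fromEdgeSet {F : Finset (Sym2 (Fin n))} (hF : F ⊆ full n) :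
    (SimpleGraph.fromEdgeSet (F : Set (Sym2 (Fin n)))).edgeFinset = F := by
  ext e
  rw [SimpleGraph.mem_edgeFinset, SimpleGraph.edgeSet_fromEdgeSet]
  refine ⟨fun h => h.1, fun h => ⟨h, ?_⟩⟩
  induction e with
  | h u v => exact mem_full.1 (hF h)

lemma gCount_eq_nn : (gCount d X : ℝ) = nn (cst d) (full n \ X.edgeFinset) := by
  rw [gCount, nn, Nat.card_eq_fintype_card, Fintype.card_subtype]
  congr 1
  refine Finset.card_bij' (fun H _ => H.edgeFinset)
    (fun F _ => SimpleGraph.fromEdgeSet (F : Set (Sym2 (Fin n)))) ?_ ?_ ?_ ?_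
  · intro H hH
    rw [Finset.mem_filter] at hH
    rw [mem_gr, Finset.subset_sdiff]
    refine ⟨⟨edgeFinset_subset_full, SimpleGraph.disjoint_edgeFinset.2
      (SimpleGraph.disjoint_edgeSet.1 hH.2.2)⟩, ?_⟩
    funext v
    rw [dg_edgeFinset, hH.2.1, cst]
  · intro F hF
    rw [mem_gr, Finset.subset_sdiff] at hF
    obtain ⟨⟨h1, h2⟩, h3⟩ := hF
    rw [Finset.mem_filter]
    refine ⟨Finset.mem_univ _, fun v => ?_, ?_⟩
    · have h5 := dg_edgeFinset (H := SimpleGraph.fromEdgeSet (F : Set (Sym2 (Fin n)))) v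
      rw [edgeFinset_fromEdgeSet h1, h3, cst] at h5
      exact_mod_cast h5.symm
    · rw [SimpleGraph.disjoint_edgeSet, ← SimpleGraph.disjoint_edgeFinset, edgeFinset_fromEdgeSet h1]
      exact h2
  · intro H _
    simp
  · intro F hF
    rw [mem_gr, Finset.subset_sdiff] at hF
    convert edgeFinset_fromEdgeSet hF.1.1

lemma gCount_bot : (gCount d ⊥ : ℝ) = nn (cst d) (full n) := by
  rw [gCount_eq_nn]
  congr 1
  ext e; simp

lemma pairSum_eq (f : Fin n → ℝ) : pairSum X f = edgeSum f X.edgeFinset := by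
  unfold pairSum edgeSum
  congr 1
  refine Finset.sum_congr rfl fun u _ => Finset.sum_congr rfl fun v _ => ?_
  simp [ind]

lemma gg_full_eq (hn : 2 ≤ n) (v : Fin n) : gg (lamb d) (cst d) (full n) v = d v - dBar d := by
  have h1 : (2:ℝ) ≤ n := by exact_mod_cast hn
  have h2 : (n - 1 : ℝ) ≠ 0 := by linarith
  rw [gg, dg_full, cst, lamb, div_mul_cancel₀ _ h2]

lemma sqd_eq_rPar (hn : 2 ≤ n) : sqd (lamb d) (cst d) = rPar d := by
  simp only [sqd, gg_full_eq hn, rPar]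

lemma sum_sub_dBar (hn : 0 < n) : ∑ v, ((d v : ℝ) - dBar d) = 0 := by
  have : (n : ℝ) ≠ 0 := by positivity
  rw [Finset.sum_sub_distrib, Finset.sum_const, Finset.card_univ, Fintype.card_fin, nsmul_eq_mul,
    dBar, mul_div_cancel₀ _ this, sub_self]

lemma lamb_eq (hn : 2 ≤ n) {E : ℕ} (hE : ∑ j, d j = 2 * E) : lamb d = E / n.choose 2 := by
  have h1 : (2:ℝ) ≤ n := by exact_mod_cast hn
  have h2 : (2:ℝ) * n.choose 2 = n * (n - 1) := by
    have h3 : (2:ℝ) * n.choose 2 = n * (n - 1 : ℕ) := by exact_mod_cast two_mul_choose_two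
    rw [h3, Nat.cast_pred (by omega)]
  have h4 : (n - 1 : ℝ) ≠ 0 := by linarith
  have h5 : (n.choose 2 : ℝ) ≠ 0 := by
    intro h5
    rw [h5, mul_zero] at h2
    rcases mul_eq_zero.1 h2.symm with h6 | h6
    · linarith
    · exact h4 h6
  rw [lamb, dBar, ← Nat.cast_sum, hE, div_div, ← h2]
  push_cast
  field_simp

end translation

section combination

variable {n x : ℕ} {d : Fin n → ℕ} {X : SimpleGraph (Fin n)} {T h lam : ℝ}

lemma Glob.add_le_pred (G : Glob n T h lam) {m : ℕ} (hm : |(m : ℝ) - lam * (n - 1)| ≤ T / h)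
    (hx : (x : ℝ) ≤ T) : x + m ≤ n - 1 := by
  have hT := G.T0
  have hh := G.h0
  have hl := G.inv_one_sub_le.1
  have h1 := (abs_le.1 hm).2
  have h2 := G.pow_le_inv (c := 5) (by norm_num)
  have h3 : T ^ 4 / h ≤ (1 - lam) * n := by
    have h4 : (1 - lam) * n = (1 - lam) * T * (1 / h) * (1 / T / h) := by
      rw [G.n_eq]; field_simp
    have h5 : T ^ 4 / h = 1 * T ^ 5 * (1 / T / h) := by field_simp
    rw [h4, h5]
    have := G.hi
    gcongr
  have h6 : (1:ℝ) ≤ 1 / h := by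
    rw [le_div_iff₀ hh]; linarith [G.h_le]
  have h7 : T ≤ T / h := by
    rw [div_eq_mul_one_div]; nlinarith
  have h8 : 4 * (T / h) ≤ T ^ 4 / h := by
    rw [← mul_div_assoc]
    refine div_le_div_of_nonneg_right ?_ hh.le
    calc 4 * T ≤ T * T := mul_le_mul_of_nonneg_right (by linarith [G.hT]) hT.le
      _ = T ^ 2 := by ring
      _ ≤ T ^ 4 := pow_le_pow_right₀ G.T1 (by norm_num)
  have h9 : (x + m : ℝ) ≤ n - 1 := by
    have := G.lam0
    have := G.hT
    linarith
  rw [← G.cast_pred] at h9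
  exact_mod_cast h9

lemma Glob.le_deg (G : Glob n T h lam) {m : ℕ} (hm : |(m : ℝ) - lam * (n - 1)| ≤ T / h)
    (hx : (x : ℝ) ≤ T) : x ≤ m := by
  have h1 : m ≤ n - 1 := by
    have := G.add_le_pred hm (x := 0) (by simpa using G.T0.le); omega
  have h2 := G.symm.add_le_pred (m := n - 1 - m) (x := x) (by
    rw [Nat.cast_sub h1, G.cast_pred, ← abs_neg]
    convert hm using 2; ring) hx
  omega

lemma ratio_eq_exp {s P p q α β γ : ℝ} (hs : 0 < s) (hP : 0 < P) (hp : 0 < p) (hq : 0 < q) :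
    s * P * (p * Real.exp α / (q * q)) * Real.exp β * (q * Real.exp γ) / (s * (q⁻¹ * P * p)) =
      Real.exp (α + β + γ) := by
  rw [Real.exp_add, Real.exp_add]
  generalize Real.exp α = A
  generalize Real.exp β = B
  generalize Real.exp γ = C
  field_simp

/-- The three estimates for a regular graph, with explicit error terms. -/
lemma regular_counts (G : Glob n T h (lamb d)) (hd : Even (∑ j, d j))
    (hdev : ∀ v, |(d v : ℝ) - dBar d| ≤ T / h) (hx : ∀ j, xDeg X j = x) (hxT : (x : ℝ) ≤ T) :
    ∃ e₁ e₂ e₃ : ℝ, |e₁| ≤ T ^ 1003 * h ∧ |e₂| ≤ T ^ 1003 * h ∧ |e₃| ≤ T ^ 1003 * h ∧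
      numPar d X = Real.exp (1 / 4 + lamb d * (x : ℝ) ^ 2 / (4 * (1 - lamb d)) -
        pairSum X (fun j => (d j : ℝ) - dBar d) / (2 * aPar d * (n : ℝ) ^ 2) -
        rPar d ^ 2 / (16 * aPar d ^ 2 * (n : ℝ) ^ 4) + e₁) ∧
      missPar d X = Real.exp (-lamb d * (x : ℝ) * ((x : ℝ) - 2) / (4 * (1 - lamb d)) -
        (x : ℝ) * rPar d / (2 * (1 - lamb d) ^ 2 * (n : ℝ) ^ 2) -
        pairSum X (fun j => (d j : ℝ) - dBar d) / (2 * aPar d * (n : ℝ) ^ 2) + e₂) ∧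
      hitPar d X = Real.exp (-(1 - lamb d) * (x : ℝ) * ((x : ℝ) - 2) / (4 * lamb d) -
        (x : ℝ) * rPar d / (2 * lamb d ^ 2 * (n : ℝ) ^ 2) -
        pairSum X (fun j => (d j : ℝ) - dBar d) / (2 * aPar d * (n : ℝ) ^ 2) + e₃) := by
  have hn2 : 2 ≤ n := by linarith [G.n_ge]
  obtain ⟨E, hE⟩ := hd
  rw [← two_mul] at hE
  have hlE := lamb_eq hn2 hE
  have hn := G.npos
  have hT := G.T0
  have hh := G.h0
  have hl0 := G.lam0
  have hl1 := G.inv_one_sub_le.1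
  have hsub : X.edgeFinset ⊆ full n := edgeFinset_subset_full
  have hxZ : ∀ v, dg X.edgeFinset v = x := fun v => by rw [dg_edgeFinset_eq_xDeg, hx]
  have hk : ∀ v, |(d v : ℝ) - lamb d * (n - 1)| ≤ T / h := fun v => by
    have h1 := hdev v
    rw [← gg_full_eq hn2, gg, dg_full, cst] at h1
    exact h1
  have hg : ∀ v, |gg (lamb d) (cst d) (full n) v| ≤ T / h := fun v => by
    rw [gg_full_eq hn2]; exact hdev v
  have hs : ∑ v, gg (lamb d) (cst d) (full n) v = 0 := by
    simp only [gg_full_eq hn2]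
    exact sum_sub_dBar (by omega)
  have hxm : ∀ v, x + d v ≤ n - 1 := fun v => G.add_le_pred (hk v) hxT
  have hxd : ∀ v, x ≤ d v := fun v => G.le_deg (hk v) hxT
  have hchs : 0 < chs d := Finset.prod_pos fun v _ => by
    exact_mod_cast Nat.choose_pos (by have := hxm v; omega)
  have hP : 0 < (lamb d ^ lamb d * (1 - lamb d) ^ (1 - lamb d)) ^ n.choose 2 :=
    pow_pos (mul_pos (Real.rpow_pos_of_pos hl0 _) (Real.rpow_pos_of_pos hl1 _)) _
  obtain ⟨e, he, h1⟩ := nn_full G hlE hk hE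
  have hp : 0 < nn (cst d) (full n) := by rw [h1]; positivity
  obtain ⟨r, hr, h2⟩ := nn_full_sdiff_regular G hg hs hp hsub hxZ hxT
  obtain ⟨r₂, hr₂, h3⟩ := nn_sub_regular G hg hs hp hsub hxZ hxT
  obtain ⟨r₃, hr₃, h4⟩ := prod_choose_ratio G hk hs hxT hxm (by
    have := hxm ⟨0, by omega⟩; omega)
  have hK : edgeSum (gg (lamb d) (cst d) (full n)) X.edgeFinset =
      pairSum X fun j => (d j : ℝ) - dBar d := by
    rw [pairSum_eq]; congr 1; funext v; exact gg_full_eq hn2 v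
  have hle : T ^ 1002 * h ≤ T ^ 1003 * h :=
    mul_le_mul_of_nonneg_right (pow_le_pow_right₀ G.T1 (by norm_num)) hh.le
  refine ⟨e + r + r₃, r, r₂, ?_, hr.trans hle, hr₂.trans hle, ?_, ?_, ?_⟩
  · have h5 : |e| ≤ T ^ 1002 * h := he.trans
      (mul_le_mul_of_nonneg_right (pow_le_pow_right₀ G.T1 (by norm_num)) hh.le)
    have h6 : |r₃| ≤ T ^ 1002 * h := hr₃.trans
      (mul_le_mul_of_nonneg_right (pow_le_pow_right₀ G.T1 (by norm_num)) hh.le)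
    have h7 : 100 * (T ^ 1002 * h) ≤ T ^ 1003 * h := by
      rw [pow_succ' T 1002, mul_assoc]
      exact mul_le_mul_of_nonneg_right G.hT (by positivity)
    have h8 : 0 ≤ T ^ 1002 * h := by positivity
    have h9 := abs_add_le (e + r) r₃
    have h10 := abs_add_le e r
    linarith
  · have hcard : n * x = X.edgeFinset.card + X.edgeFinset.card := by
      have := sum_dg hsub
      simp only [hxZ, Finset.sum_const, Finset.card_univ, Fintype.card_fin, nsmul_eq_mul] at this
      rw [← two_mul]
      exact_mod_cast this
    have hprod : 0 < ∏ v, ((n - 1 - x).choose (d v) : ℝ) := Finset.prod_pos fun v _ => by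
      exact_mod_cast Nat.choose_pos (by have := hxm v; omega)
    have hpow : 0 < (1 - lamb d) ^ X.edgeFinset.card := pow_pos hl1 _
    rw [numPar, gHat, gCount_eq_nn, h2, h1]
    simp only [hx, xEdges_eq]
    rw [Real.rpow_neg hl1.le, Real.rpow_natCast]
    rw [hcard, pow_add] at h4
    have hchs' : chs d = (∏ v, ((n - 1 - x).choose (d v) : ℝ)) *
        Real.exp (lamb d * x * (x - 1) / (2 * (1 - lamb d)) +
          x * sqd (lamb d) (cst d) / (2 * (1 - lamb d) ^ 2 * (n : ℝ) ^ 2) + r₃) /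
        ((1 - lamb d) ^ X.edgeFinset.card * (1 - lamb d) ^ X.edgeFinset.card) := by
      rw [← h4]; field_simp
    rw [hchs']
    have hexp : 1 / 4 + lamb d * (x : ℝ) ^ 2 / (4 * (1 - lamb d)) -
        pairSum X (fun j => (d j : ℝ) - dBar d) / (2 * aPar d * (n : ℝ) ^ 2) -
        rPar d ^ 2 / (16 * aPar d ^ 2 * (n : ℝ) ^ 4) + (e + r + r₃) =
        (lamb d * x * (x - 1) / (2 * (1 - lamb d)) +
          x * sqd (lamb d) (cst d) / (2 * (1 - lamb d) ^ 2 * (n : ℝ) ^ 2) + r₃) +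
        (1 / 4 - (1 / (lamb d * (1 - lamb d))) ^ 2 / 4 * h ^ 8 * sqd (lamb d) (cst d) ^ 2 + e) +
        (missExp (lamb d) (cst d) X.edgeFinset x + r) := by
      rw [missExp, hK, sqd_eq_rPar hn2, aPar, show h ^ 8 = (h ^ 2) ^ 4 by ring, ← G.inv_n]
      generalize pairSum X (fun j => (d j : ℝ) - dBar d) = K
      field_simp
      ring
    rw [hexp]
    exact ratio_eq_exp (by positivity) hP hprod hpow
  · have hpow : 0 < (1 - lamb d) ^ X.edgeFinset.card := pow_pos hl1 _
    rw [missPar, gCount_eq_nn, gCount_bot, h2, xEdges_eq, missExp, hK, sqd_eq_rPar hn2]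
    rw [show 2 * aPar d = lamb d * (1 - lamb d) by rw [aPar]; ring]
    field_simp
  · have hpow : 0 < lamb d ^ X.edgeFinset.card := pow_pos hl0 _
    have hcst : cst (fun j => d j - xDeg X j) = cst d - dg X.edgeFinset := by
      funext v
      rw [Pi.sub_apply, hxZ, cst, cst, hx, Nat.cast_sub (hxd v)]
    rw [hitPar, gCount_eq_nn, hcst, gCount_bot, h3, xEdges_eq, missExp_compl, hK,
      sqd_eq_rPar hn2, show 2 * aPar d = lamb d * (1 - lamb d) by rw [aPar]; ring]
    field_simp

end combination

section asymptotics

variable {n x : ℕ} {d : Fin n → ℕ} {X : SimpleGraph (Fin n)}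

lemma eventually_le_natCast_rpow (C : ℝ) {η : ℝ} (hη : 0 < η) :
    ∀ᶠ n : ℕ in atTop, C ≤ (n : ℝ) ^ η :=
  ((tendsto_rpow_atTop hη).comp tendsto_natCast_atTop_atTop).eventually_ge_atTop C

lemma eventually_mul_log_le_rpow (C : ℝ) {η : ℝ} (hη : 0 < η) :
    ∀ᶠ n : ℕ in atTop, C * Real.log n ≤ (n : ℝ) ^ η := by
  have h1 := ((isLittleO_log_rpow_atTop hη).comp_tendsto
    tendsto_natCast_atTop_atTop).const_mul_left C
  filter_upwards [h1.bound one_pos] with n hn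
  rw [one_mul] at hn
  refine (le_abs_self _).trans (hn.trans_eq ?_)
  rw [Function.comp_apply, Real.norm_of_nonneg (Real.rpow_nonneg (Nat.cast_nonneg n) _)]

lemma xEdges_of_regular (hx : ∀ j, xDeg X j = x) : (n : ℝ) * x = 2 * xEdges X := by
  have := sum_dg (edgeFinset_subset_full (H := X))
  simpa only [dg_edgeFinset_eq_xDeg, hx, Finset.sum_const, Finset.card_univ, Fintype.card_fin,
    nsmul_eq_mul, ← xEdges_eq] using this

lemma one_le_density_mul {N D c T : ℝ} (hN : 1 < N) (hc : 0 < c) (hcT : c ≤ T) (hD : N / c ≤ D) :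
    1 ≤ D / (N - 1) * T := by
  have h1 : 0 < N - 1 := by linarith
  rw [div_le_iff₀ hc] at hD
  have h2 : 0 < D := by
    by_contra h2
    push Not at h2
    nlinarith
  rw [div_mul_eq_mul_div, le_div_iff₀ h1]
  nlinarith

lemma glob_of_large {a η : ℝ} (ha : 0 < a) (h2 : 10000 * η ≤ 1 / 2) (hn : 1 < (n : ℝ))
    (hT : 100 ≤ (n : ℝ) ^ η) (hlog : 1 * Real.log n ≤ (n : ℝ) ^ η)
    (hlog' : 3 * a * Real.log n ≤ (n : ℝ) ^ η)
    (hd : (n : ℝ) / (3 * a * Real.log n) ≤ min (dBar d) ((n : ℝ) - dBar d - 1)) :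
    Glob n ((n : ℝ) ^ η) ((n : ℝ) ^ (-(1 / 2) : ℝ)) (lamb d) := by
  have hn0 : (0:ℝ) < n := by linarith
  have hl : 0 < 3 * a * Real.log n := by
    have := Real.log_pos hn
    positivity
  refine ⟨hT, Real.rpow_pos_of_pos hn0 _, ?_, ?_, by linarith, ?_, ?_⟩
  · rw [← Real.rpow_natCast, ← Real.rpow_mul hn0.le, Nat.cast_two,
      show (-(1 / 2) : ℝ) * 2 = -1 by norm_num, Real.rpow_neg_one, mul_inv_cancel₀ hn0.ne']
  · rw [← Real.rpow_natCast, ← Real.rpow_mul hn0.le, ← Real.rpow_add hn0]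
    refine Real.rpow_le_one_of_one_le_of_nonpos hn.le ?_
    push_cast
    linarith
  · exact one_le_density_mul hn hl hlog' (hd.trans (min_le_left _ _))
  · have h3 : 1 - lamb d = (n - dBar d - 1) / (n - 1) := by
      have : (n - 1 : ℝ) ≠ 0 := by linarith
      rw [lamb]; field_simp; ring
    rw [h3]
    exact one_le_density_mul hn hl hlog' (hd.trans (min_le_right _ _))

end asymptotics

/-- Corollary 2.3: the case where `X` is regular, `x_1 = ⋯ = x_n = x`.
Here `R = Σ_j (d_j-d̄)²` and `K = Σ_{jk∈X} (d_j-d̄)(d_k-d̄)`. -/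
theorem stmt6 (a b : ℝ) (ha : 0 < a) (hb : 0 < b) (hab : a + b < 1/2) :
    ∃ ε : ℝ, 0 < ε ∧
      ∀ (d : (n : ℕ) → Fin n → ℕ) (X : (n : ℕ) → SimpleGraph (Fin n)) (x : ℕ → ℕ),
        (∀ n, Even (∑ j, d n j)) →
        (∃ C : ℝ, ∀ (n : ℕ) (j : Fin n),
            |(d n j : ℝ) - dBar (d n)| ≤ C * (n : ℝ) ^ ((1:ℝ)/2 + ε)) →
        (∃ C : ℝ, ∀ (n : ℕ) (j : Fin n),
            (xDeg (X n) j : ℝ) ≤ C * (n : ℝ) ^ ((1:ℝ)/2 + ε)) →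
        (∃ C : ℝ, ∀ n : ℕ, (xEdges (X n) : ℝ) ≤ C * (n : ℝ) ^ ((1:ℝ) + 2*ε)) →
        (∀ᶠ n : ℕ in atTop,
            (n : ℝ) / (3 * a * Real.log n) ≤ min (dBar (d n)) ((n : ℝ) - dBar (d n) - 1)) →
        (∀ (n : ℕ) (j : Fin n), xDeg (X n) j = x n) →
        ∃ C : ℝ, ∀ᶠ n : ℕ in atTop, ∃ e₁ e₂ e₃ : ℝ,
          |e₁| ≤ C * (n : ℝ) ^ (-b) ∧ |e₂| ≤ C * (n : ℝ) ^ (-b) ∧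
          |e₃| ≤ C * (n : ℝ) ^ (-b) ∧
          numPar (d n) (X n) = Real.exp (1/4
              + lamb (d n) * (x n : ℝ)^2 / (4 * (1 - lamb (d n)))
              - pairSum (X n) (fun j => (d n j : ℝ) - dBar (d n))
                  / (2 * aPar (d n) * (n : ℝ)^2)
              - rPar (d n)^2 / (16 * aPar (d n)^2 * (n : ℝ)^4)
              + e₁) ∧
          missPar (d n) (X n) = Real.exp (
              - lamb (d n) * (x n : ℝ) * ((x n : ℝ) - 2) / (4 * (1 - lamb (d n)))
              - (x n : ℝ) * rPar (d n) / (2 * (1 - lamb (d n))^2 * (n : ℝ)^2)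
              - pairSum (X n) (fun j => (d n j : ℝ) - dBar (d n))
                  / (2 * aPar (d n) * (n : ℝ)^2)
              + e₂) ∧
          hitPar (d n) (X n) = Real.exp (
              - (1 - lamb (d n)) * (x n : ℝ) * ((x n : ℝ) - 2) / (4 * lamb (d n))
              - (x n : ℝ) * rPar (d n) / (2 * lamb (d n)^2 * (n : ℝ)^2)
              - pairSum (X n) (fun j => (d n j : ℝ) - dBar (d n))
                  / (2 * aPar (d n) * (n : ℝ)^2)
              + e₃) := by
  set η : ℝ := (1 / 2 - b) / 10000 with hη
  have hη0 : 0 < η := by rw [hη]; apply div_pos <;> linarith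
  have hη1 : 10000 * η = 1 / 2 - b := by rw [hη]; ring
  clear_value η
  refine ⟨η / 4, by positivity, fun d X x heven ⟨C₁, hC₁⟩ _ ⟨C₂, hC₂⟩ hdens hreg => ⟨1, ?_⟩⟩
  filter_upwards [hdens, eventually_gt_atTop 1, eventually_le_natCast_rpow 100 hη0,
    eventually_mul_log_le_rpow 1 hη0, eventually_mul_log_le_rpow (3 * a) hη0,
    eventually_le_natCast_rpow C₁ (by linarith : 0 < 3 * η / 4),
    eventually_le_natCast_rpow (2 * C₂) (by linarith : 0 < η / 2)]
    with n hd hn hT hlog hlog' h₁ h₂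
  have hn1 : (1:ℝ) < n := by exact_mod_cast hn
  have hn0 : (0:ℝ) < n := by linarith
  have G : Glob n ((n : ℝ) ^ η) ((n : ℝ) ^ (-(1 / 2) : ℝ)) (lamb (d n)) :=
    glob_of_large ha (by linarith) hn1 hT hlog hlog' hd
  have hdev : ∀ v, |(d n v : ℝ) - dBar (d n)| ≤ (n : ℝ) ^ η / (n : ℝ) ^ (-(1 / 2) : ℝ) := fun v => by
    refine (hC₁ n v).trans ?_
    rw [← Real.rpow_sub hn0, show η - -(1 / 2) = 3 * η / 4 + (1 / 2 + η / 4) by ring,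
      Real.rpow_add hn0 (3 * η / 4)]
    exact mul_le_mul_of_nonneg_right h₁ (Real.rpow_nonneg hn0.le _)
  have hx : (x n : ℝ) ≤ (n : ℝ) ^ η := by
    have h3 := xEdges_of_regular (hreg n)
    have h4 := hC₂ n
    have h5 : (n : ℝ) * x n ≤ n * (n : ℝ) ^ η := by
      calc (n : ℝ) * x n ≤ 2 * C₂ * (n : ℝ) ^ (1 + 2 * (η / 4)) := by linarith
        _ ≤ (n : ℝ) ^ (η / 2) * (n : ℝ) ^ (1 + 2 * (η / 4)) :=
          mul_le_mul_of_nonneg_right h₂ (Real.rpow_nonneg hn0.le _)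
        _ = n * (n : ℝ) ^ η := by
          rw [← Real.rpow_add hn0, show η / 2 + (1 + 2 * (η / 4)) = 1 + η by ring,
            Real.rpow_add hn0, Real.rpow_one]
    exact le_of_mul_le_mul_left h5 hn0
  have herr : ((n : ℝ) ^ η) ^ 1003 * (n : ℝ) ^ (-(1 / 2) : ℝ) ≤ 1 * (n : ℝ) ^ (-b) := by
    rw [one_mul, ← Real.rpow_natCast, ← Real.rpow_mul hn0.le, ← Real.rpow_add hn0]
    refine Real.rpow_le_rpow_of_exponent_le hn1.le ?_
    push_cast
    linarith
  obtain ⟨e₁, e₂, e₃, he₁, he₂, he₃, h⟩ := regular_counts G (heven n) hdev (hreg n) hx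
  exact ⟨e₁, e₂, e₃, he₁.trans herr, he₂.trans herr, he₃.trans herr, h⟩
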